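/- Case (A1): suppose p, q ∉ I and p is not a root of unity. Then for every ν ∈ ᶿNI the VV algebra 𝔚_ν is affine cellular with respect to the k-involution of 𝔚_ν that fixes each generator x_k, each σ_k, π, and each idempotent e(i) (and reverses products). -/

import Mathlib

open scoped TensorProduct
open CategoryTheory

noncomputable section

namespace VVPaper

variable {k : Type} [Field k]

/-! ## Quiver combinatorics -/

/-- There is an arrow `a → b` in the quiver `Γ` iff `a = p² b` (arrows `p² i → i`). -/
def Arrow (p a b : kˣ) : Prop := a = p ^ 2 * b

/-- The orbit of `lam` under the `ℤ ⋊ ℤ/2`-action `(n, ε) · λ = p^(2n) λ^ε` on `kˣ`. -/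
def orbit (p lam : kˣ) : Set kˣ :=
  {x | ∃ n : ℤ, x = p ^ (2 * n) * lam ∨ x = p ^ (2 * n) * lam⁻¹}

/-- The half-orbit `I⁺ = {p^(2n) λ : n ∈ ℤ}`. -/
def halfOrbit (p lam : kˣ) : Set kˣ := {x | ∃ n : ℤ, x = p ^ (2 * n) * lam}

/-- `ν ∈ ᶿℕI`: a finitely supported dimension vector, supported on `I` and `θ`-invariant
(`θ i = i⁻¹`). -/
def IsDimVec (I : Set kˣ) (ν : kˣ →₀ ℕ) : Prop :=
  (∀ a : kˣ, ν a ≠ 0 → a ∈ I) ∧ (∀ a : kˣ, ν a⁻¹ = ν a)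

/-- The height `|ν|` of a dimension vector. -/
def height (ν : kˣ →₀ ℕ) : ℕ := ν.sum fun _ n => n

/-- `i = (i₁, …, i_m) ∈ ᶿI^ν`, i.e. `Σ i_k + Σ i_k⁻¹ = ν`. -/
def IsThetaSeq (ν : kˣ →₀ ℕ) {m : ℕ} (i : Fin m → kˣ) : Prop :=
  (∑ j : Fin m, (Finsupp.single (i j) 1 + Finsupp.single (i j)⁻¹ 1)) = ν

/-- `i = (i₁, …, i_m) ∈ I^ν̃`, i.e. `Σ i_k = ν̃` (for KLR algebras). -/
def IsSeq (ν : kˣ →₀ ℕ) {m : ℕ} (i : Fin m → kˣ) : Prop :=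
  (∑ j : Fin m, Finsupp.single (i j) 1) = ν

open Classical in
/-- The (finite) set of all sequences in `ᶿI^ν`. -/
def thetaSeqs (ν : kˣ →₀ ℕ) (m : ℕ) : Finset (Fin m → kˣ) :=
  (Fintype.piFinset fun _ : Fin m => ν.support).filter fun i => IsThetaSeq ν i

open Classical in
/-- The (finite) set of all sequences in `I^ν̃`. -/
def seqs (ν : kˣ →₀ ℕ) (m : ℕ) : Finset (Fin m → kˣ) :=
  (Fintype.piFinset fun _ : Fin m => ν.support).filter fun i => IsSeq ν i

/-! ## Generators and relations for VV and KLR algebras -/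

/-- Generators of a VV algebra (or of a KLR algebra, discarding `pi`):
polynomial generators `x`, intertwiners `sig`, idempotents `idem` and the extra generator `pi`. -/
inductive Gen (V : Type) (m : ℕ) : Type
  | x : Fin m → Gen V m
  | sig : Fin (m - 1) → Gen V m
  | idem : (Fin m → V) → Gen V m
  | pi : Gen V m

/-- The free algebra on the generators. -/
abbrev FA (k : Type) [Field k] (m : ℕ) : Type := FreeAlgebra k (Gen kˣ m)

def X {m : ℕ} (j : Fin m) : FA k m := FreeAlgebra.ι k (Gen.x j)
def Sg {m : ℕ} (s : Fin (m - 1)) : FA k m := FreeAlgebra.ι k (Gen.sig s)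
def E {m : ℕ} (i : Fin m → kˣ) : FA k m := FreeAlgebra.ι k (Gen.idem i)
def Pg {m : ℕ} : FA k m := FreeAlgebra.ι k (Gen.pi : Gen kˣ m)

/-- `σ_k` exchanges positions `k` and `k+1`: the lower position. -/
def lo {m : ℕ} (s : Fin (m - 1)) : Fin m := ⟨s.1, by have := s.2; omega⟩

/-- The upper position `k+1`. -/
def hi {m : ℕ} (s : Fin (m - 1)) : Fin m := ⟨s.1 + 1, by have := s.2; omega⟩

/-- The action of the simple transposition `s_k` on sequences. -/
def swapAt {V : Type} {m : ℕ} (s : Fin (m - 1)) (i : Fin m → V) : Fin m → V :=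
  i ∘ Equiv.swap (lo s) (hi s)

/-- The defining relations of the VV algebra (when `withPi = true`) and of the KLR algebra
(when `withPi = false`), for the quiver with arrows `p² i → i`, parameter `q`, sequences
satisfying `P` (whose collection is the finite set `T`). -/
inductive Rel (p q : kˣ) {m : ℕ} (P : (Fin m → kˣ) → Prop) (T : Finset (Fin m → kˣ))
    (withPi : Bool) : FA k m → FA k m → Prop
  -- the e(i) are orthogonal idempotents summing to 1
  | idem_mul (i : Fin m → kˣ) : Rel p q P T withPi (E i * E i) (E i)
  | idem_orth (i j : Fin m → kˣ) (h : i ≠ j) : Rel p q P T withPi (E i * E j) 0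
  | idem_zero (i : Fin m → kˣ) (h : ¬ P i) : Rel p q P T withPi (E i) 0
  | idem_sum : Rel p q P T withPi (∑ i ∈ T, E i) 1
  -- the x's commute with each other and with the idempotents
  | x_mul_comm (a b : Fin m) : Rel p q P T withPi (X a * X b) (X b * X a)
  | x_idem (a : Fin m) (i : Fin m → kˣ) : Rel p q P T withPi (X a * E i) (E i * X a)
  -- σ_k e(i) = e(s_k i) σ_k
  | sig_idem (s : Fin (m - 1)) (i : Fin m → kˣ) :
      Rel p q P T withPi (Sg s * E i) (E (swapAt s i) * Sg s)
  -- quadratic relations for σ_k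
  | sig_sq_eq (s : Fin (m - 1)) (i : Fin m → kˣ) (h : i (lo s) = i (hi s)) :
      Rel p q P T withPi (Sg s * Sg s * E i) 0
  | sig_sq_none (s : Fin (m - 1)) (i : Fin m → kˣ) (hne : i (lo s) ≠ i (hi s))
      (h1 : ¬ Arrow p (i (lo s)) (i (hi s))) (h2 : ¬ Arrow p (i (hi s)) (i (lo s))) :
      Rel p q P T withPi (Sg s * Sg s * E i) (E i)
  | sig_sq_from (s : Fin (m - 1)) (i : Fin m → kˣ)
      (h1 : Arrow p (i (hi s)) (i (lo s))) (h2 : ¬ Arrow p (i (lo s)) (i (hi s))) :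
      Rel p q P T withPi (Sg s * Sg s * E i) ((X (hi s) - X (lo s)) * E i)
  | sig_sq_to (s : Fin (m - 1)) (i : Fin m → kˣ)
      (h1 : Arrow p (i (lo s)) (i (hi s))) (h2 : ¬ Arrow p (i (hi s)) (i (lo s))) :
      Rel p q P T withPi (Sg s * Sg s * E i) ((X (lo s) - X (hi s)) * E i)
  | sig_sq_both (s : Fin (m - 1)) (i : Fin m → kˣ)
      (h1 : Arrow p (i (lo s)) (i (hi s))) (h2 : Arrow p (i (hi s)) (i (lo s))) :
      Rel p q P T withPi (Sg s * Sg s * E i) ((X (hi s) - X (lo s)) * (X (lo s) - X (hi s)) * E i)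
  -- far-apart σ's commute
  | sig_comm (s t : Fin (m - 1)) (h : s.1 + 1 < t.1) :
      Rel p q P T withPi (Sg s * Sg t) (Sg t * Sg s)
  -- braid relations
  | braid_triv (s : Fin (m - 1)) (hs : s.1 + 1 < m - 1) (i : Fin m → kˣ)
      (h : i (lo s) ≠ i ⟨s.1 + 2, by omega⟩ ∨
        (¬ Arrow p (i (lo s)) (i (hi s)) ∧ ¬ Arrow p (i (hi s)) (i (lo s)))) :
      Rel p q P T withPi (Sg ⟨s.1 + 1, hs⟩ * Sg s * Sg ⟨s.1 + 1, hs⟩ * E i)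
        (Sg s * Sg ⟨s.1 + 1, hs⟩ * Sg s * E i)
  | braid_to (s : Fin (m - 1)) (hs : s.1 + 1 < m - 1) (i : Fin m → kˣ)
      (he : i (lo s) = i ⟨s.1 + 2, by omega⟩)
      (h1 : Arrow p (i (lo s)) (i (hi s))) (h2 : ¬ Arrow p (i (hi s)) (i (lo s))) :
      Rel p q P T withPi (Sg ⟨s.1 + 1, hs⟩ * Sg s * Sg ⟨s.1 + 1, hs⟩ * E i)
        (Sg s * Sg ⟨s.1 + 1, hs⟩ * Sg s * E i + E i)
  | braid_from (s : Fin (m - 1)) (hs : s.1 + 1 < m - 1) (i : Fin m → kˣ)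
      (he : i (lo s) = i ⟨s.1 + 2, by omega⟩)
      (h1 : Arrow p (i (hi s)) (i (lo s))) (h2 : ¬ Arrow p (i (lo s)) (i (hi s))) :
      Rel p q P T withPi (Sg ⟨s.1 + 1, hs⟩ * Sg s * Sg ⟨s.1 + 1, hs⟩ * E i)
        (Sg s * Sg ⟨s.1 + 1, hs⟩ * Sg s * E i - E i)
  | braid_both (s : Fin (m - 1)) (hs : s.1 + 1 < m - 1) (i : Fin m → kˣ)
      (he : i (lo s) = i ⟨s.1 + 2, by omega⟩)
      (h1 : Arrow p (i (lo s)) (i (hi s))) (h2 : Arrow p (i (hi s)) (i (lo s))) :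
      Rel p q P T withPi (Sg ⟨s.1 + 1, hs⟩ * Sg s * Sg ⟨s.1 + 1, hs⟩ * E i)
        (Sg s * Sg ⟨s.1 + 1, hs⟩ * Sg s * E i +
          ((2 : FA k m) * X (hi s) - X ⟨s.1 + 2, by omega⟩ - X (lo s)) * E i)
  -- mixed relations for σ and x
  | sig_x_lo (s : Fin (m - 1)) (i : Fin m → kˣ) (h : i (lo s) = i (hi s)) :
      Rel p q P T withPi (Sg s * X (lo s) * E i) (X (hi s) * Sg s * E i - E i)
  | sig_x_hi (s : Fin (m - 1)) (i : Fin m → kˣ) (h : i (lo s) = i (hi s)) :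
      Rel p q P T withPi (Sg s * X (hi s) * E i) (X (lo s) * Sg s * E i + E i)
  | sig_x (s : Fin (m - 1)) (l : Fin m) (i : Fin m → kˣ)
      (h : i (lo s) ≠ i (hi s) ∨ (l ≠ lo s ∧ l ≠ hi s)) :
      Rel p q P T withPi (Sg s * X l * E i) (X (Equiv.swap (lo s) (hi s) l) * Sg s * E i)
  -- relations involving π (only for the VV algebra)
  | pi_idem (hw : withPi = true) (h0 : 0 < m) (i : Fin m → kˣ) :
      Rel p q P T withPi (Pg * E i) (E (Function.update i ⟨0, h0⟩ (i ⟨0, h0⟩)⁻¹) * Pg)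
  | pi_sq_q (hw : withPi = true) (h0 : 0 < m) (i : Fin m → kˣ) (h : i ⟨0, h0⟩ = q) :
      Rel p q P T withPi (Pg * Pg * E i) (X ⟨0, h0⟩ * E i)
  | pi_sq_qinv (hw : withPi = true) (h0 : 0 < m) (i : Fin m → kˣ) (h : i ⟨0, h0⟩ = q⁻¹) :
      Rel p q P T withPi (Pg * Pg * E i) (-(X ⟨0, h0⟩ * E i))
  | pi_sq_one (hw : withPi = true) (h0 : 0 < m) (i : Fin m → kˣ)
      (h1 : i ⟨0, h0⟩ ≠ q) (h2 : i ⟨0, h0⟩ ≠ q⁻¹) :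
      Rel p q P T withPi (Pg * Pg * E i) (E i)
  | pi_x_zero (hw : withPi = true) (h0 : 0 < m) :
      Rel p q P T withPi (Pg * X ⟨0, h0⟩) (-(X ⟨0, h0⟩ * Pg))
  | pi_x (hw : withPi = true) (l : Fin m) (h : 0 < l.1) :
      Rel p q P T withPi (Pg * X l) (X l * Pg)
  | pi_sig (hw : withPi = true) (s : Fin (m - 1)) (h : 0 < s.1) :
      Rel p q P T withPi (Pg * Sg s) (Sg s * Pg)
  | sig_pi_plus (hw : withPi = true) (h1 : 0 < m - 1) (i : Fin m → kˣ)
      (ha : i ⟨0, by omega⟩ = q) (hb : i ⟨1, by omega⟩ = q⁻¹) :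
      Rel p q P T withPi (Sg ⟨0, h1⟩ * Pg * (Sg ⟨0, h1⟩ * Pg) * E i)
        (Pg * Sg ⟨0, h1⟩ * (Pg * Sg ⟨0, h1⟩) * E i + Sg ⟨0, h1⟩ * E i)
  | sig_pi_minus (hw : withPi = true) (h1 : 0 < m - 1) (i : Fin m → kˣ)
      (ha : i ⟨0, by omega⟩ = q⁻¹) (hb : i ⟨1, by omega⟩ = q) :
      Rel p q P T withPi (Sg ⟨0, h1⟩ * Pg * (Sg ⟨0, h1⟩ * Pg) * E i)
        (Pg * Sg ⟨0, h1⟩ * (Pg * Sg ⟨0, h1⟩) * E i - Sg ⟨0, h1⟩ * E i)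
  | sig_pi_zero (hw : withPi = true) (h1 : 0 < m - 1) (i : Fin m → kˣ)
      (hc : ¬ (i ⟨0, by omega⟩ = q ∧ i ⟨1, by omega⟩ = q⁻¹))
      (hc' : ¬ (i ⟨0, by omega⟩ = q⁻¹ ∧ i ⟨1, by omega⟩ = q)) :
      Rel p q P T withPi (Sg ⟨0, h1⟩ * Pg * (Sg ⟨0, h1⟩ * Pg) * E i)
        (Pg * Sg ⟨0, h1⟩ * (Pg * Sg ⟨0, h1⟩) * E i)
  -- for the KLR algebra, there is no generator π
  | pi_zero (hw : withPi = false) : Rel p q P T withPi Pg 0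

/-- The VV algebra `𝔚_ν` attached to `p`, `q` and a dimension vector `ν` of height `2m`. -/
@[reducible] def VV (k : Type) [Field k] (p q : kˣ) (ν : kˣ →₀ ℕ) (m : ℕ) : Type :=
  RingQuot (Rel p q (IsThetaSeq ν) (thetaSeqs ν m) true)

/-- The KLR algebra `R_ν̃` attached to `p` and a dimension vector `ν̃` of height `m`. -/
@[reducible] def KLR (k : Type) [Field k] (p : kˣ) (ν : kˣ →₀ ℕ) (m : ℕ) : Type :=
  RingQuot (Rel p 1 (IsSeq ν) (seqs ν m) false)

/-- The canonical map from the free algebra onto the VV algebra. -/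
def vmk (p q : kˣ) (ν : kˣ →₀ ℕ) (m : ℕ) : FA k m →ₐ[k] VV k p q ν m :=
  RingQuot.mkAlgHom k _

/-- The canonical map from the free algebra onto the KLR algebra. -/
def kmk (p : kˣ) (ν : kˣ →₀ ℕ) (m : ℕ) : FA k m →ₐ[k] KLR k p ν m :=
  RingQuot.mkAlgHom k _

/-- Two `k`-algebras are Morita equivalent if there is a `k`-linear equivalence between their
categories of (left) modules. -/
def MoritaEquiv (k : Type) [Field k] (A B : Type) [Ring A] [Ring B]
    [Algebra k A] [Algebra k B] : Prop :=
  ∃ (e : ModuleCat.{0} A ≌ ModuleCat.{0} B) (_ : e.functor.Additive), e.functor.Linear k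

end VVPaper

set_option synthInstance.maxHeartbeats 1000000
set_option maxHeartbeats 1600000

namespace VVPaper

/-! ## Affine cellularity (after Koenig–Xi) -/

/-- A `k`-involution of a `k`-algebra: a `k`-linear anti-automorphism of order two. -/
structure IsKInvolution {k A : Type} [Field k] [Ring A] [Algebra k A] (ω : A →ₗ[k] A) :
    Prop where
  map_mul : ∀ a b : A, ω (a * b) = ω b * ω a
  map_one : ω 1 = 1
  involutive : ∀ a : A, ω (ω a) = a

/-- An affine cell ideal of `(H, ω)`: a two-sided ideal `J` with `ω(J) = J` such that for some
finite-rank free `k`-module `V = k^{nV}` and some affine commutative `k`-algebra `B`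
(a quotient of a polynomial ring in finitely many variables) with involution `iB`, the
free module `Δ := V ⊗_k B ≅ (Fin nV → B)` carries a left `H`-action commuting with the
`B`-action (an `H`-`B`-bimodule), and there is an isomorphism `α : J ≅ Δ ⊗_B Δ'`
(`Δ' = B ⊗_k V ≅ Δ`) of `H`-`H`-bimodules, where the right `H`-action on `Δ'` is induced by
the left action via `ω`, intertwining `ω` with the switch map
`v ⊗ b ⊗ b' ⊗ w ↦ w ⊗ iB(b') ⊗ iB(b) ⊗ v`. -/
def IsAffineCellIdeal (k : Type) [Field k] (H : Type) [Ring H] [Algebra k H]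
    (ω : H →ₗ[k] H) (J : TwoSidedIdeal H) : Prop :=
  (∀ x : H, x ∈ J ↔ ω x ∈ J) ∧
  ∃ (nV N : ℕ) (Id : Ideal (MvPolynomial (Fin N) k))
    (iB : (MvPolynomial (Fin N) k ⧸ Id) ≃ₐ[k] (MvPolynomial (Fin N) k ⧸ Id)),
    (∀ b, iB (iB b) = b) ∧
    ∃ (act : H →ₐ[k] Module.End (MvPolynomial (Fin N) k ⧸ Id)
        (Fin nV → MvPolynomial (Fin N) k ⧸ Id))
      (α : (Submodule.restrictScalars k
          (TwoSidedIdeal.asIdeal J : Ideal H)) ≃ₗ[k]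
        TensorProduct (MvPolynomial (Fin N) k ⧸ Id)
          (Fin nV → MvPolynomial (Fin N) k ⧸ Id) (Fin nV → MvPolynomial (Fin N) k ⧸ Id)),
      (∀ (h : H) (x y : (Submodule.restrictScalars k (TwoSidedIdeal.asIdeal J : Ideal H))),
        (y : H) = h * (x : H) →
          α y = LinearMap.rTensor (Fin nV → MvPolynomial (Fin N) k ⧸ Id) (act h) (α x)) ∧
      (∀ (h : H) (x y : (Submodule.restrictScalars k (TwoSidedIdeal.asIdeal J : Ideal H))),
        (y : H) = (x : H) * h →
          α y = LinearMap.lTensor (Fin nV → MvPolynomial (Fin N) k ⧸ Id) (act (ω h)) (α x)) ∧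
      ∃ sw : TensorProduct (MvPolynomial (Fin N) k ⧸ Id)
            (Fin nV → MvPolynomial (Fin N) k ⧸ Id) (Fin nV → MvPolynomial (Fin N) k ⧸ Id)
          →ₗ[k] TensorProduct (MvPolynomial (Fin N) k ⧸ Id)
            (Fin nV → MvPolynomial (Fin N) k ⧸ Id) (Fin nV → MvPolynomial (Fin N) k ⧸ Id),
        (∀ d d' : Fin nV → MvPolynomial (Fin N) k ⧸ Id,
          sw (TensorProduct.tmul _ d d') =
            TensorProduct.tmul _ (fun j => iB (d' j)) (fun j => iB (d j))) ∧
        (∀ x y : (Submodule.restrictScalars k (TwoSidedIdeal.asIdeal J : Ideal H)),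
          (y : H) = ω (x : H) → α y = sw (α x))

/-- `H` admits an affine cell chain of length `n` with respect to the involution `ω`
(formulated recursively: there is an affine cell ideal `J` of `H` and the induced involution
on `H/J` admits a chain of length `n - 1`). -/
def AffineCellularChain (k : Type) [Field k] :
    ℕ → ∀ (H : Type) [Ring H] [Algebra k H], (H →ₗ[k] H) → Prop
  | 0 => fun H _ _ _ => Subsingleton H
  | n + 1 => fun H _ _ ω =>
    ∃ J : TwoSidedIdeal H, IsAffineCellIdeal k H ω J ∧
      ∃ ω' : J.ringCon.Quotient →ₗ[k] J.ringCon.Quotient,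
        (∀ h : H, ω' (RingCon.mk' J.ringCon h) = RingCon.mk' J.ringCon (ω h)) ∧
        AffineCellularChain k n J.ringCon.Quotient ω'

/-- A `k`-algebra `H` is affine cellular with respect to the `k`-involution `ω` if it admits
a finite affine cell chain. -/
def IsAffineCellular (k : Type) [Field k] (H : Type) [Ring H] [Algebra k H]
    (ω : H →ₗ[k] H) : Prop :=
  IsKInvolution ω ∧ ∃ n : ℕ, AffineCellularChain k n H ω

end VVPaper

set_option autoImplicit false
set_option linter.unusedSectionVars false
set_option linter.unusedSimpArgs false

namespace VVPaper

/-- Closure rules for the set of words of nonzero idempotents under the type `A` relations. -/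
structure KR0 (W : List ℤ → Prop) : Prop where
  odd : ∀ w, W w → ∀ x ∈ w, x % 2 = 1
  swap : ∀ u v (x y : ℤ), W (u ++ x :: y :: v) → x ≠ y + 2 → y ≠ x + 2 → W (u ++ y :: x :: v)
  serre : ∀ u v (x y : ℤ), W (u ++ x :: y :: x :: v) → (y = x + 2 ∨ x = y + 2) →
    W (u ++ x :: x :: y :: v) ∨ W (u ++ y :: x :: x :: v)
  m3a : ∀ u v (x y : ℤ), W (u ++ x :: x :: y :: v) → (y = x + 2 ∨ x = y + 2) →
    W (u ++ x :: y :: x :: v)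
  m3b : ∀ u v (x y : ℤ), W (u ++ y :: x :: x :: v) → (y = x + 2 ∨ x = y + 2) →
    W (u ++ x :: y :: x :: v)

/-- The run `a, a - 2, …` with `n` letters. -/
def run (a : ℤ) : ℕ → List ℤ
  | 0 => []
  | n + 1 => a :: run (a - 2) n

lemma run_append (a : ℤ) (n j : ℕ) : run a (n + j) = run a n ++ run (a - 2 * n) j := by
  induction n generalizing a with
  | zero => simp [run]
  | succ n ih =>
    rw [show n + 1 + j = (n + j) + 1 by omega]
    simp only [run, ih, List.cons_append]
    congr 3
    push_cast; ring

lemma run_succ (a : ℤ) (n : ℕ) : run a (n + 1) = run a n ++ [a - 2 * n] := by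
  rw [run_append]; rfl

lemma mem_run {a c : ℤ} {n : ℕ} : c ∈ run a n ↔ ∃ t : ℕ, t < n ∧ c = a - 2 * t := by
  induction n generalizing a with
  | zero => simp [run]
  | succ n ih =>
    simp only [run, List.mem_cons, ih]
    constructor
    · rintro (rfl | ⟨t, ht, rfl⟩)
      · exact ⟨0, by omega, by simp⟩
      · exact ⟨t + 1, by omega, by push_cast; ring⟩
    · rintro ⟨t, ht, rfl⟩
      rcases t with _ | t
      · left; simp
      · right; exact ⟨t, by omega, by push_cast; ring⟩

lemma count_run (a c : ℤ) (n : ℕ) :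
    (run a n).count c = if ∃ t : ℕ, t < n ∧ c = a - 2 * t then 1 else 0 := by
  have hnd : (run a n).Nodup := by
    induction n generalizing a with
    | zero => simp [run]
    | succ n ih =>
      simp only [run, List.nodup_cons]
      refine ⟨?_, ih _⟩
      rw [mem_run]; rintro ⟨t, _, h⟩; omega
  split_ifs with h
  · exact List.count_eq_one_of_mem hnd (mem_run.2 h)
  · exact List.count_eq_zero.2 (fun h' => h (mem_run.1 h'))

lemma append_cons_lt (u v v' : List ℤ) {a c : ℤ} (h : c < a) : u ++ c :: v < u ++ a :: v' := by
  induction u with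
  | nil => simpa using List.Lex.rel h
  | cons x u ih => exact List.Lex.cons ih

namespace KR0
variable {W : List ℤ → Prop}

lemma pre (K : KR0 W) (p : List ℤ) : KR0 (fun w => W (p ++ w)) where
  odd w h x hx := K.odd _ h x (by simp [hx])
  swap u v x y h := by simpa using K.swap (p ++ u) v x y (by simpa using h)
  serre u v x y h := by simpa using K.serre (p ++ u) v x y (by simpa using h)
  m3a u v x y h := by simpa using K.m3a (p ++ u) v x y (by simpa using h)
  m3b u v x y h := by simpa using K.m3b (p ++ u) v x y (by simpa using h)

lemma suf (K : KR0 W) (p : List ℤ) : KR0 (fun w => W (w ++ p)) where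
  odd w h x hx := K.odd _ h x (by simp [hx])
  swap u v x y h := by simpa using K.swap u (v ++ p) x y (by simpa using h)
  serre u v x y h := by simpa using K.serre u (v ++ p) x y (by simpa using h)
  m3a u v x y h := by simpa using K.m3a u (v ++ p) x y (by simpa using h)
  m3b u v x y h := by simpa using K.m3b u (v ++ p) x y (by simpa using h)

lemma perm (K : KR0 W) (r : List ℤ) : KR0 (fun w => W w ∧ w.Perm r) where
  odd w h := K.odd w h.1
  swap u v x y h h1 h2 := ⟨K.swap u v x y h.1 h1 h2,
    (List.Perm.append_left u (List.Perm.swap x y v)).trans h.2⟩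
  serre u v x y h h1 := by
    rcases K.serre u v x y h.1 h1 with h' | h'
    · exact Or.inl ⟨h', (List.Perm.append_left u ((List.Perm.swap y x v).cons x)).trans h.2⟩
    · exact Or.inr ⟨h', (List.Perm.append_left u (List.Perm.swap x y (x :: v))).trans h.2⟩
  m3a u v x y h h1 := ⟨K.m3a u v x y h.1 h1,
    (List.Perm.append_left u ((List.Perm.swap x y v).cons x)).trans h.2⟩
  m3b u v x y h h1 := ⟨K.m3b u v x y h.1 h1,
    (List.Perm.append_left u (List.Perm.swap y x (x :: v))).trans h.2⟩

lemma comm_left (K : KR0 W) (u l v : List ℤ) (c : ℤ) (h : W (u ++ l ++ c :: v))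
    (hl : ∀ x ∈ l, x ≠ c + 2 ∧ c ≠ x + 2) : W (u ++ c :: l ++ v) := by
  induction l using List.reverseRecOn generalizing v with
  | nil => simpa using h
  | append_singleton l y ih =>
    have := ih (y :: v) ?_ (fun x hx => hl x (by simp [hx]))
    · simpa using this
    · have h2 := hl y (by simp)
      exact K.swap (u ++ l) v y c (by simpa using h) h2.1 h2.2

lemma comm_right (K : KR0 W) (u l v : List ℤ) (c : ℤ) (h : W (u ++ c :: l ++ v))
    (hl : ∀ x ∈ l, x ≠ c + 2 ∧ c ≠ x + 2) : W (u ++ l ++ c :: v) := by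
  induction l generalizing u with
  | nil => simpa using h
  | cons y l ih =>
    have := ih (u ++ [y]) ?_ (fun x hx => hl x (by simp [hx]))
    · simpa using this
    · have h2 := hl y (by simp)
      have := K.swap u (l ++ v) c y (by simpa using h) h2.2 h2.1
      simpa using this

lemma odd_append {u v : List ℤ} {x : ℤ} (K : KR0 W) (h : W (u ++ x :: v)) : x % 2 = 1 :=
  K.odd _ h x (by simp)

/-- A letter smaller than the start of a run and not continuing it gives a smaller word. -/
lemma run_then_small (K : KR0 W) (v : List ℤ) (a c : ℤ) (n : ℕ)
    (h : W (run a n ++ c :: v)) (hc : c < a) (hcn : c ≠ a - 2 * n) :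
    ∃ c' v', c' < a ∧ W (c' :: v') := by
  rcases Nat.eq_zero_or_pos n with rfl | hn
  · exact ⟨c, v, hc, by simpa [run] using h⟩
  have hco : c % 2 = 1 := odd_append K h
  have hao : a % 2 = 1 := K.odd _ h a (by
    obtain ⟨n, rfl⟩ := Nat.exists_eq_add_of_le' hn; simp [run])
  obtain ⟨j, hj⟩ : ∃ j : ℕ, c = a - 2 * (j + 1) := ⟨((a - c) / 2 - 1).toNat, by omega⟩
  by_cases hjn : n < j + 1
  · refine ⟨c, run a n ++ v, hc, ?_⟩
    have := K.comm_left [] (run a n) v c (by simpa using h) ?_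
    · simpa using this
    · intro x hx
      obtain ⟨t, ht, rfl⟩ := mem_run.1 hx
      omega
  obtain ⟨i, rfl⟩ : ∃ i, n = j + (i + 2) := ⟨n - j - 2, by omega⟩
  have e1 : run a (j + (i + 2)) = run a j ++ (c + 2) :: c :: run (c - 2) i := by
    rw [run_append, run, run]
    congr 2 <;> [skip; congr 1] <;> [omega; omega; skip]
    congr 1; omega
  rw [e1] at h
  have hfront : ∀ x ∈ run a j, x ≠ c + 2 ∧ c ≠ x + 2 ∧ x ≠ c := by
    intro x hx
    obtain ⟨t, ht, rfl⟩ := mem_run.1 hx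
    omega
  -- a word `run a j ++ c :: w` is good
  have fin1 : ∀ w, W (run a j ++ c :: w) → ∃ c' v', c' < a ∧ W (c' :: v') := fun w hw =>
    ⟨c, run a j ++ w, hc, by
      simpa using K.comm_left [] (run a j) w c (by simpa using hw)
        (fun x hx => ⟨(hfront x hx).1, (hfront x hx).2.1⟩)⟩
  have fin2 : ∀ w, W (run a j ++ (c + 2) :: c :: c :: w) → ∃ c' v', c' < a ∧ W (c' :: v') :=
    fun w hw => fin1 _ (K.m3b (run a j) w c (c + 2) hw (Or.inl rfl))
  rcases i with _ | i
  · exact fin2 v (by simpa [run] using h)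
  simp only [run] at h
  have h2 := K.comm_left (run a j ++ [c + 2, c, c - 2]) (run (c - 2 - 2) i) v c
    (by simpa using h) (by
      intro x hx
      obtain ⟨t, ht, rfl⟩ := mem_run.1 hx
      omega)
  rcases K.serre (run a j ++ [c + 2]) (run (c - 2 - 2) i ++ v) c (c - 2) (by simpa using h2)
    (Or.inr (by ring)) with h3 | h3
  · exact fin2 _ (by simpa using h3)
  · refine ⟨c - 2, run a j ++ (c + 2) :: c :: c :: (run (c - 2 - 2) i ++ v), by omega, ?_⟩
    have := K.comm_left [] (run a j ++ [c + 2]) (c :: c :: (run (c - 2 - 2) i ++ v)) (c - 2)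
      (by simpa using h3) (by
        intro x hx
        rcases List.mem_append.1 hx with hx | hx
        · obtain ⟨t, ht, rfl⟩ := mem_run.1 hx
          omega
        · simp at hx; omega)
    simpa using this

/-- Each letter of the run, doubled. -/
def _root_.VVPaper.dbl (a : ℤ) : ℕ → List ℤ
  | 0 => []
  | n + 1 => dbl a n ++ [a - 2 * n, a - 2 * n]

lemma to_dbl (K : KR0 W) (v : List ℤ) (a : ℤ) (n : ℕ) (h : W (run a n ++ run a n ++ v)) :
    W (dbl a n ++ v) ∨ ∃ c' v', c' < a ∧ W (c' :: v') := by
  induction n generalizing v with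
  | zero => left; simpa [run, dbl] using h
  | succ n ih =>
    set y := a - 2 * (n : ℤ) with hy
    have key : W (run a n ++ run a n ++ y :: y :: v) ∨ ∃ c' v', c' < a ∧ W (c' :: v') := by
      rcases n with _ | n
      · left; simpa [run, hy] using h
      rw [run_succ a (n + 1)] at h
      have e : a - 2 * (n : ℤ) = y + 2 := by rw [hy]; push_cast; ring
      have e2 : a - 2 * ((n + 1 : ℕ) : ℤ) = y := by rw [hy]
      rw [e2, run_succ, e] at h
      rw [run_succ, e]
      have far : ∀ x ∈ run a n, x ≠ y + 2 ∧ y ≠ x + 2 := by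
        intro x hx
        obtain ⟨t, ht, rfl⟩ := mem_run.1 hx
        push_cast at hy
        omega
      have h2 := K.comm_right (run a n ++ [y + 2]) (run a n) ((y + 2) :: y :: v) y
        (by simpa using h) far
      rcases K.serre (run a n ++ [y + 2] ++ run a n) v y (y + 2) (by simpa using h2)
        (Or.inl rfl) with h3 | h3
      · right
        have h4 := K.comm_left (run a n ++ [y + 2]) (run a n) (y :: (y + 2) :: v) y
          (by simpa using h3) far
        have h5 := K.comm_left (run a n ++ [y + 2, y]) (run a n) ((y + 2) :: v) y
          (by simpa using h4) far
        have h6 := K.m3b (run a n) (run a n ++ (y + 2) :: v) y (y + 2) (by simpa using h5)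
          (Or.inl rfl)
        refine ⟨y, run a n ++ (y + 2) :: y :: (run a n ++ (y + 2) :: v), ?_, ?_⟩
        · push_cast at hy; omega
        · simpa using K.comm_left [] (run a n) _ y (by simpa using h6) far
      · left; simpa using h3
    rcases key with h | h
    · simpa [dbl] using ih _ h
    · exact Or.inr h

lemma dbl_to_runs (K : KR0 W) (v : List ℤ) (a : ℤ) (n : ℕ)
    (h : W (dbl a n ++ (a - 2 * n) :: v)) : W (run a (n + 1) ++ run a n ++ v) := by
  induction n generalizing v with
  | zero => simpa [dbl, run] using h
  | succ n ih =>
    set b := a - 2 * (n : ℤ) with hb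
    have e : a - 2 * ((n + 1 : ℕ) : ℤ) = b - 2 := by rw [hb]; push_cast; ring
    rw [e] at h
    have h2 := K.m3a (dbl a n) v b (b - 2) (by simpa [dbl] using h) (Or.inr (by ring))
    have h3 := ih ((b - 2) :: b :: v) (by simpa using h2)
    have h4 := K.comm_left (run a (n + 1)) (run a n) (b :: v) (b - 2) (by simpa using h3) (by
      intro x hx
      obtain ⟨t, ht, rfl⟩ := mem_run.1 hx
      omega)
    rw [run_succ a (n + 1), e]
    nth_rewrite 2 [run_succ]
    simpa using h4

/-- Of two runs with equal start the longer one comes first in a minimal word. -/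
lemma short_then_long (K : KR0 W) (v : List ℤ) (a : ℤ) (n : ℕ) (hn : 1 ≤ n)
    (h : W (run a n ++ run a (n + 1) ++ v)) :
    ∃ w, w < run a n ++ run a (n + 1) ++ v ∧ W w := by
  obtain ⟨j, rfl⟩ := Nat.exists_eq_add_of_le' hn
  rw [run_succ a (j + 1)] at h
  rcases K.to_dbl ((a - 2 * ((j + 1 : ℕ) : ℤ)) :: v) a (j + 1) (by simpa using h) with h | h
  · refine ⟨_, ?_, K.dbl_to_runs v a _ h⟩
    conv_lhs => rw [run_succ a (j + 1)]
    conv_rhs => arg 1; arg 2; rw [run]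
    have := append_cons_lt (run a (j + 1)) (run a (j + 1) ++ v)
      (run (a - 2) (j + 1) ++ v) (a := a) (c := a - 2 * ((j + 1 : ℕ) : ℤ)) (by push_cast; omega)
    simpa using this
  · obtain ⟨c', v', hc, hw⟩ := h
    refine ⟨_, ?_, hw⟩
    exact append_cons_lt [] v' _ hc

/-- Every list is a concatenation of maximal runs. -/
lemma _root_.VVPaper.exists_runs (r : List ℤ) : ∃ segs : List (ℤ × ℕ),
    r = segs.flatMap (fun s => run s.1 s.2) ∧ (∀ s ∈ segs, 1 ≤ s.2) ∧
    segs.IsChain (fun s t => t.1 ≠ s.1 - 2 * (s.2 : ℤ)) := by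
  induction r with
  | nil => exact ⟨[], by simp⟩
  | cons x r ih =>
    obtain ⟨segs, rfl, h1, h2⟩ := ih
    rcases segs with _ | ⟨⟨a, n⟩, segs⟩
    · exact ⟨[(x, 1)], by simp [run]⟩
    by_cases hx : a = x - 2
    · refine ⟨(x, n + 1) :: segs, by simp [run, hx], ?_, ?_⟩
      · intro s hs
        rcases List.mem_cons.1 hs with rfl | hs
        · simp
        · exact h1 s (by simp [hs])
      · rcases segs with _ | ⟨t, segs⟩
        · simp
        · rw [List.isChain_cons_cons] at h2 ⊢
          refine ⟨?_, h2.2⟩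
          have := h2.1
          simp only at this ⊢
          push_cast
          omega
    · refine ⟨(x, 1) :: (a, n) :: segs, by simp [run], ?_, ?_⟩
      · intro s hs
        rcases List.mem_cons.1 hs with rfl | hs
        · simp
        · exact h1 s hs
      · rw [List.isChain_cons_cons]
        exact ⟨by simpa using hx, h2⟩

/-- The relation ordering the runs of a minimal word. -/
def _root_.VVPaper.SegLe (s t : ℤ × ℕ) : Prop := s.1 < t.1 ∨ (s.1 = t.1 ∧ t.2 ≤ s.2)

instance : Trans SegLe SegLe SegLe where
  trans := by
    intro a b c h1 h2
    unfold SegLe at *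
    omega

lemma sorted_of_min (K : KR0 W) (r : List ℤ) (hr : W r) (hmin : ∀ w, W w → r ≤ w) :
    ∃ segs : List (ℤ × ℕ), r = segs.flatMap (fun s => run s.1 s.2) ∧ (∀ s ∈ segs, 1 ≤ s.2) ∧
      segs.Pairwise SegLe := by
  obtain ⟨segs, rfl, h1, h2⟩ := exists_runs r
  refine ⟨segs, rfl, h1, ?_⟩
  rw [← List.isChain_iff_pairwise]
  induction segs generalizing W with
  | nil => simp
  | cons s segs ih =>
    have ih' := ih (K.pre (run s.1 s.2)) (by simpa using hr) (by
        intro w hw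
        have := hmin _ hw
        rw [List.flatMap_cons] at this
        by_contra hlt
        push Not at hlt
        have : run s.1 s.2 ++ w < run s.1 s.2 ++ segs.flatMap (fun s => run s.1 s.2) := by
          generalize run s.1 s.2 = l
          induction l with
          | nil => simpa
          | cons x l ih => exact List.Lex.cons ih
        exact absurd ‹_ ≤ _› (not_le.2 this))
      (fun t ht => h1 t (by simp [ht])) (h2.tail)
    rcases segs with _ | ⟨t, segs⟩
    · simp
    rw [List.isChain_cons_cons] at h2 ⊢
    refine ⟨?_, ih'⟩
    obtain ⟨a, n⟩ := s
    obtain ⟨c, l⟩ := t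
    have hn : 1 ≤ n := h1 (a, n) (by simp)
    have hl : 1 ≤ l := h1 (c, l) (by simp)
    by_contra hlt
    unfold SegLe at hlt
    simp only [List.flatMap_cons] at hr hmin h2
    obtain ⟨l, rfl⟩ := Nat.exists_eq_add_of_le' hl
    obtain ⟨n, rfl⟩ := Nat.exists_eq_add_of_le' hn
    by_cases hca : c < a
    · obtain ⟨c', v', hc', hw⟩ := K.run_then_small (run (c - 2) l ++ _) a c (n + 1)
        (by simpa [run] using hr) hca h2.1
      exact absurd (hmin _ hw) (not_le.2 (append_cons_lt [] v' _ hc'))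
    · obtain ⟨rfl, hln⟩ : c = a ∧ n < l := by
        simp only at hlt; omega
      obtain ⟨d, rfl⟩ : ∃ d, l = n + 1 + d := ⟨l - n - 1, by omega⟩
      have e : run c (n + 1 + d + 1) = run c (n + 1 + 1) ++ run (c - 2 * ((n + 1 + 1 : ℕ) : ℤ)) d := by
        rw [← run_append]; congr 1; omega
      rw [e] at hr hmin
      obtain ⟨w, hlt', hw⟩ := K.short_then_long _ c (n + 1) (by omega)
        (by simpa [List.append_assoc] using hr)
      have := hmin w hw
      exact absurd this (not_le.2 (lt_of_lt_of_eq hlt' (by simp [List.append_assoc])))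

lemma exists_min (W : List ℤ → Prop) (x : List ℤ) (hx : W x) :
    ∃ r, W r ∧ r.Perm x ∧ ∀ w, W w → w.Perm x → r ≤ w := by
  classical
  have hne : (x.permutations.toFinset.filter W).Nonempty := ⟨x, by
    rw [Finset.mem_filter, List.mem_toFinset]
    exact ⟨List.mem_permutations.2 (List.Perm.refl _), hx⟩⟩
  have := Finset.min'_mem _ hne
  rw [Finset.mem_filter, List.mem_toFinset, List.mem_permutations] at this
  refine ⟨_, this.2, this.1, fun w hw hp => Finset.min'_le _ w ?_⟩
  rw [Finset.mem_filter, List.mem_toFinset, List.mem_permutations]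
  exact ⟨hp, hw⟩

end KR0
end VVPaper

namespace VVPaper

/-- Closure rules for the set of words of nonzero idempotents. -/
structure KRules (W : List ℤ → Prop) : Prop extends KR0 W where
  flip : ∀ u (x : ℤ), W (u ++ [x]) → W (u ++ [-x])

lemma count_runs (segs : List (ℤ × ℕ)) (c : ℤ) :
    (segs.flatMap (fun s => run s.1 s.2)).count c =
      (segs.map fun s => (run s.1 s.2).count c).sum := by
  induction segs with
  | nil => simp
  | cons s l ih => simp [List.count_append, ih]

lemma count_runs_const (segs : List (ℤ × ℕ)) (c : ℤ)
    (h : ∀ s ∈ segs, ∃ t : ℕ, t < s.2 ∧ c = s.1 - 2 * t) :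
    (segs.flatMap (fun s => run s.1 s.2)).count c = segs.length := by
  induction segs with
  | nil => simp
  | cons s l ih =>
    rw [List.flatMap_cons, List.count_append, ih (fun t ht => h t (by simp [ht])), count_run,
      if_pos (h s (by simp))]
    simp [add_comm]

lemma count_runs_mono (segs : List (ℤ × ℕ)) (a c : ℤ) (hs : ∀ s ∈ segs, a ≤ s.1) (hc : c < a) :
    (segs.flatMap (fun s => run s.1 s.2)).count c ≤
      (segs.flatMap (fun s => run s.1 s.2)).count (c + 2) := by
  rw [count_runs, count_runs]
  refine List.sum_le_sum fun s h => ?_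
  rw [count_run, count_run]
  have := hs s h
  split_ifs with h1 h2 <;> try omega
  obtain ⟨t, ht, rfl⟩ := h1
  exact absurd ⟨t - 1, by omega, by omega⟩ h2

namespace KR0
variable {W : List ℤ → Prop}

/-- A letter in the interior of a run passes through it. -/
lemma interior_pass (K : KR0 W) (p v : List ℤ) (c a : ℤ) (n : ℕ)
    (h : W (p ++ c :: run a n ++ v)) (h1 : c < a) (h2 : a - 2 * ((n : ℤ) - 1) < c) :
    W (p ++ run a n ++ c :: v) ∨ ∃ v', W (p ++ c :: (c - 2) :: v') := by
  have hco : c % 2 = 1 := K.odd _ h c (by simp)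
  have hao : a % 2 = 1 := K.odd _ h a (by
    obtain ⟨n, rfl⟩ := Nat.exists_eq_add_of_le' (show 1 ≤ n by omega); simp [run])
  obtain ⟨j, hj⟩ : ∃ j : ℕ, c = a - 2 * (j + 1) := ⟨((a - c) / 2 - 1).toNat, by omega⟩
  obtain ⟨i, rfl⟩ : ∃ i, n = j + (i + 3) := ⟨n - j - 3, by omega⟩
  have e1 : run a (j + (i + 3)) = run a j ++ (c + 2) :: c :: (c - 2) :: run (c - 4) i := by
    rw [run_append, run, run, run]
    congr 2
    · omega
    congr 1
    · omega
    congr 1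
    · omega
    · congr 1; omega
  rw [e1] at h ⊢
  have far : ∀ x ∈ run a j, (x ≠ c + 2 ∧ c ≠ x + 2) ∧ (x ≠ (c - 2) + 2 ∧ c - 2 ≠ x + 2) := by
    intro x hx
    obtain ⟨t, ht, rfl⟩ := mem_run.1 hx
    omega
  have h3 := K.comm_right p (run a j) ((c + 2) :: c :: (c - 2) :: run (c - 4) i ++ v) c
    (by simpa using h) (fun x hx => (far x hx).1)
  rcases K.serre (p ++ run a j) ((c - 2) :: run (c - 4) i ++ v) c (c + 2) (by simpa using h3)
    (Or.inl rfl) with h4 | h4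
  · right
    have h5 := K.swap (p ++ run a j ++ [c, c]) (run (c - 4) i ++ v) (c + 2) (c - 2)
      (by simpa using h4) (by omega) (by omega)
    have h6 := K.m3a (p ++ run a j) ((c + 2) :: run (c - 4) i ++ v) c (c - 2)
      (by simpa using h5) (Or.inr (by ring))
    have h7 := K.comm_left p (run a j) _ c (by simpa using h6) (fun x hx => (far x hx).1)
    have h8 := K.comm_left (p ++ [c]) (run a j) _ (c - 2) (by simpa using h7)
      (fun x hx => (far x hx).2)
    exact ⟨_, by simpa using h8⟩
  · left
    have h5 := K.m3a (p ++ run a j ++ [c + 2]) (run (c - 4) i ++ v) c (c - 2)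
      (by simpa using h4) (Or.inr (by ring))
    have h6 := K.comm_right (p ++ run a j ++ [c + 2, c, c - 2]) (run (c - 4) i) v c
      (by simpa using h5) (by
        intro x hx
        obtain ⟨t, ht, rfl⟩ := mem_run.1 hx
        omega)
    simpa using h6

lemma exists_sorted_perm (K : KR0 W) (x : List ℤ) (hx : W x) (a : ℤ)
    (ha : ∀ c v, W (c :: v) → a ≤ c) :
    ∃ segs : List (ℤ × ℕ), W (segs.flatMap (fun s => run s.1 s.2)) ∧
      (segs.flatMap (fun s => run s.1 s.2)).Perm x ∧ (∀ s ∈ segs, 1 ≤ s.2) ∧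
      (∀ s ∈ segs, a ≤ s.1) ∧ segs.Pairwise SegLe := by
  obtain ⟨r, hr, hp, hmin⟩ := exists_min W x hx
  obtain ⟨segs, rfl, h1, h2⟩ := (K.perm x).sorted_of_min r ⟨hr, hp⟩ (fun w hw => hmin w hw.1 hw.2)
  refine ⟨segs, hr, hp, h1, ?_, h2⟩
  intro s hs
  rcases segs with _ | ⟨⟨c, n⟩, segs⟩
  · simp at hs
  obtain ⟨n, rfl⟩ := Nat.exists_eq_add_of_le' (h1 _ (List.mem_cons_self ..))
  have hac : a ≤ c := ha c _ (by simpa [run] using hr)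
  rcases List.mem_cons.1 hs with rfl | hs
  · exact hac
  · have := (List.pairwise_cons.1 h2).1 s hs
    unfold SegLe at this
    simp only at this
    omega

end KR0

lemma exists_last {α : Type} (P : α → Prop) (l : List α) (h : ∃ s ∈ l, P s) :
    ∃ l1 x l2, l = l1 ++ x :: l2 ∧ P x ∧ ∀ y ∈ l2, ¬ P y := by
  induction l with
  | nil => simp at h
  | cons y l ih =>
    by_cases hl : ∃ s ∈ l, P s
    · obtain ⟨l1, x, l2, rfl, h1, h2⟩ := ih hl
      exact ⟨y :: l1, x, l2, rfl, h1, h2⟩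
    · push Not at hl
      obtain ⟨s, hs, hPs⟩ := h
      rcases List.mem_cons.1 hs with rfl | hs
      · exact ⟨[], s, l, rfl, hPs, hl⟩
      · exact absurd hPs (hl s hs)

lemma append_lt_append_left' (p : List ℤ) {u v : List ℤ} (h : u < v) : p ++ u < p ++ v := by
  induction p with
  | nil => simpa
  | cons x l ih => exact List.Lex.cons ih

namespace KRules
variable {W : List ℤ → Prop}

lemma preF (K : KRules W) (p : List ℤ) : KRules (fun w => W (p ++ w)) where
  toKR0 := K.toKR0.pre p
  flip u x h := by simpa using K.flip (p ++ u) x (by simpa using h)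

/-- The branch of `interior_pass` that cannot occur in a minimal word. -/
lemma no_pair (K : KR0 W) (a : ℤ) (n : ℕ) (rest1 rest2 : List (ℤ × ℕ)) (v : List ℤ)
    (hao : a % 2 = 1)
    (hmin : ∀ w, W w → run a (n + 1) ++ (rest1 ++ rest2).flatMap (fun s => run s.1 s.2) ≤ w)
    (hne : rest2 ≠ [])
    (hbad : 0 < a + (a - 2 * n))
    (h1 : ∀ s ∈ rest1 ++ rest2, s.1 % 2 = 1 ∧ 1 ≤ s.2 ∧ a + 2 ≤ s.1 ∧
      s.1 - 2 * ((s.2 : ℤ) - 1) ≤ - a - 2)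
    (h : W (run a n ++ rest1.flatMap (fun s => run s.1 s.2) ++ (a - 2 * n) :: (a - 2 * n - 2) :: v)) :
    False := by
  obtain ⟨b, hb⟩ : ∃ b, b = a - 2 * (n : ℤ) := ⟨_, rfl⟩
  rw [← hb] at h hbad
  have hstart : ∀ c v', W (c :: v' ++ v) → a ≤ c := by
    intro c v' hw
    by_contra hlt
    push Not at hlt
    exact absurd (hmin _ hw) (not_le.2 (append_cons_lt [] _ _ hlt))
  obtain ⟨segs, hW, hp, hs1, hsa, hso⟩ := (K.suf v).exists_sorted_perm
    (run a n ++ rest1.flatMap (fun s => run s.1 s.2) ++ [b, b - 2]) (by simpa using h) a hstart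
  set D := rest1.length with hD
  have cnt : ∀ d, d % 2 = 1 → b - 2 ≤ d → d ≤ a →
      (segs.flatMap (fun s => run s.1 s.2)).count d = D + 1 := by
    intro d hdo hd1 hd2
    have e : (run a n ++ rest1.flatMap (fun s => run s.1 s.2) ++ [b, b - 2]).Perm
        (run a (n + 2) ++ rest1.flatMap (fun s => run s.1 s.2)) := by
      have : run a (n + 2) = run a n ++ [b, b - 2] := by
        rw [run_append, ← hb]; simp [run]
      rw [this, List.append_assoc, List.append_assoc]
      exact List.Perm.append_left _ List.perm_append_comm
    rw [(hp.trans e).count_eq, List.count_append, count_run, if_pos, count_runs_const, add_comm]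
    · intro s hs
      obtain ⟨g1, g2, g3, g4⟩ := h1 s (by simp [hs])
      exact ⟨((s.1 - d) / 2).toNat, by omega, by omega⟩
    · exact ⟨((a - d) / 2).toNat, by omega, by omega⟩
  have cnt2 : (segs.flatMap (fun s => run s.1 s.2)).count (a + 2) = D := by
    rw [hp.count_eq, List.count_append, List.count_append, count_run, if_neg, count_runs_const]
    · rw [List.count_eq_zero.2]
      · omega
      · simp; omega
    · intro s hs
      obtain ⟨g1, g2, g3, g4⟩ := h1 s (by simp [hs])
      exact ⟨((s.1 - (a + 2)) / 2).toNat, by omega, by omega⟩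
    · rintro ⟨t, ht, h⟩; omega
  -- some run starts at `a`
  obtain ⟨s, hs, hsa'⟩ : ∃ s ∈ segs, s.1 = a := by
    by_contra hno
    push Not at hno
    have := cnt a hao (by omega) le_rfl
    have h3 : (segs.flatMap (fun s => run s.1 s.2)).count a ≤
        (segs.flatMap (fun s => run s.1 s.2)).count (a + 2) := by
      rw [count_runs, count_runs]
      refine List.sum_le_sum fun s h => ?_
      rw [count_run, count_run]
      have := hsa s h
      have := hno s h
      split_ifs with h1 h2 <;> try omega
      obtain ⟨t, ht, h3⟩ := h1
      exact absurd ⟨t - 1, by omega, by omega⟩ h2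
    omega
  obtain ⟨⟨a', n'⟩, segs, rfl⟩ : ∃ t l, segs = t :: l := by
    rcases segs with _ | ⟨t, l⟩
    · simp at hs
    · exact ⟨t, l, rfl⟩
  obtain rfl : a' = a := by
    have g1 := hsa (a', n') (by simp)
    simp only at g1
    rcases List.mem_cons.1 hs with rfl | hs
    · exact hsa'
    · have := (List.pairwise_cons.1 hso).1 s hs
      unfold SegLe at this
      simp only at this
      omega
  have hn' : 1 ≤ n' := hs1 (a', n') (by simp)
  rcases Nat.lt_or_ge (n + 1) n' with hlt | hge
  · obtain ⟨d, rfl⟩ : ∃ d, n' = n + 1 + (d + 1) := ⟨n' - n - 2, by omega⟩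
    rcases rest2 with _ | ⟨t0, rest2⟩
    · exact hne rfl
    obtain ⟨t, hrest, ht⟩ : ∃ t l, (rest1 ++ t0 :: rest2).flatMap (fun s => run s.1 s.2) = t :: l ∧
        a' + 2 ≤ t := by
      rcases rest1 with _ | ⟨t1, rest1⟩
      · obtain ⟨g1, g2, g3, g4⟩ := h1 t0 (by simp)
        obtain ⟨j, hj⟩ := Nat.exists_eq_add_of_le' g2
        exact ⟨t0.1, _, by simp [hj, run]; rfl, g3⟩
      · obtain ⟨g1, g2, g3, g4⟩ := h1 t1 (by simp)
        obtain ⟨j, hj⟩ := Nat.exists_eq_add_of_le' g2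
        exact ⟨t1.1, _, by simp [hj, run]; rfl, g3⟩
    have := hmin _ hW
    rw [ht.1] at this
    refine absurd this (not_le.2 ?_)
    simp only [List.flatMap_cons]
    rw [run_append]
    simp only [run, List.append_assoc, List.cons_append]
    exact append_cons_lt (a' :: run (a' - 2) n) _ _ (by push_cast; omega)
  · set c := a' - 2 * ((n' : ℤ) - 1) with hc
    have e1 := cnt c (by omega) (by omega) (by omega)
    have e2 := cnt (c - 2) (by omega) (by omega) (by omega)
    rw [List.flatMap_cons, List.count_append, count_run] at e1 e2
    rw [if_pos ⟨n' - 1, by omega, by omega⟩] at e1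
    rw [if_neg (by rintro ⟨t, ht, h⟩; omega)] at e2
    have : (segs.flatMap (fun s => run s.1 s.2)).count (c - 2) ≤
        (segs.flatMap (fun s => run s.1 s.2)).count c := by
      have := count_runs_mono segs a' (c - 2) (fun s hs => hsa s (by simp [hs])) (by omega)
      simpa using this
    omega

theorem runs_of_min (K : KRules W) (r : List ℤ) (hr : W r) (hmin : ∀ w, W w → r ≤ w) :
    ∃ segs : List (ℤ × ℕ), r = segs.flatMap (fun s => run s.1 s.2) ∧ (∀ s ∈ segs, 1 ≤ s.2) ∧
      segs.Pairwise SegLe ∧ ∀ s ∈ segs, s.1 + 1 ≤ s.2 := by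
  obtain ⟨segs, rfl, h1, h2⟩ := K.toKR0.sorted_of_min r hr hmin
  refine ⟨segs, rfl, h1, h2, ?_⟩
  by_contra hno
  push Not at hno
  obtain ⟨s0, ⟨a, n⟩, rest, rfl, hbad, hgood⟩ := exists_last _ _ hno
  simp only [not_lt] at hgood
  have K' := K.preF (s0.flatMap (fun s => run s.1 s.2))
  set W' : List ℤ → Prop := fun w => W (s0.flatMap (fun s => run s.1 s.2) ++ w) with hW'
  obtain ⟨n, rfl⟩ := Nat.exists_eq_add_of_le' (show 1 ≤ n from h1 (a, n) (by simp))
  simp only at hbad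
  have hr' : W' (run a (n + 1) ++ rest.flatMap (fun s => run s.1 s.2)) := by
    simpa [hW'] using hr
  have hmin' : ∀ w, W' w → run a (n + 1) ++ rest.flatMap (fun s => run s.1 s.2) ≤ w := by
    intro w hw
    by_contra hlt
    push Not at hlt
    have := append_lt_append_left' (s0.flatMap (fun s => run s.1 s.2)) hlt
    refine absurd (hmin _ hw) (not_le.2 (lt_of_lt_of_eq this ?_))
    simp
  have hpw : ∀ s ∈ rest, SegLe (a, n + 1) s :=
    (List.pairwise_cons.1 (List.pairwise_append.1 h2).2.1).1
  have hao : a % 2 = 1 := K'.odd _ hr' a (by simp [run])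
  have hrest : ∀ s ∈ rest, s.1 % 2 = 1 ∧ 1 ≤ s.2 ∧ a + 2 ≤ s.1 ∧
      s.1 - 2 * ((s.2 : ℤ) - 1) ≤ - a - 2 := by
    intro s hs
    have g1 := hgood s hs
    have g2 := hpw s hs
    have g3 := h1 s (by simp [hs])
    have g4 : s.1 % 2 = 1 := K'.odd _ hr' s.1 (by
      simp only [List.mem_append, List.mem_flatMap]
      exact Or.inr ⟨s, hs, mem_run.2 ⟨0, by omega, by simp⟩⟩)
    unfold SegLe at g2
    simp only at g2
    omega
  obtain ⟨b, hb⟩ : ∃ b, b = a - 2 * (n : ℤ) := ⟨_, rfl⟩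
  have move : ∀ l1 l2, rest = l1 ++ l2 → W' (run a n ++ l1.flatMap (fun s => run s.1 s.2) ++
      b :: l2.flatMap (fun s => run s.1 s.2)) := by
    intro l1
    induction l1 using List.reverseRecOn with
    | nil =>
      rintro l2 rfl
      rw [run_succ, ← hb] at hr'
      simpa using hr'
    | append_singleton l1 t ih =>
      intro l2 hl
      have g := ih (t :: l2) (by simpa using hl)
      obtain ⟨g1, g2, g3, g4⟩ := hrest t (by simp [hl])
      rcases K'.toKR0.interior_pass (run a n ++ l1.flatMap (fun s => run s.1 s.2))
        (l2.flatMap (fun s => run s.1 s.2)) b t.1 t.2 (by simpa using g) (by omega)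
        (by push_cast at hbad; omega) with h | ⟨v', h⟩
      · simpa using h
      · exfalso
        have hl' : rest = l1 ++ t :: l2 := by simpa using hl
        subst hl'
        exact no_pair K'.toKR0 a n l1 (t :: l2) v' hao hmin' (by simp)
          (by push_cast at hbad; omega) hrest (by rw [← hb]; exact h)
  have hfin := K'.flip (run a n ++ rest.flatMap (fun s => run s.1 s.2)) b
    (by simpa using move rest [] (by simp))
  obtain ⟨segs, hW, hp, hs1, hsa, hso⟩ := K'.toKR0.exists_sorted_perm _ hfin a (by
    intro c v' hw
    by_contra hlt
    push Not at hlt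
    exact absurd (hmin' _ hw) (not_le.2 (append_cons_lt [] _ _ hlt)))
  have hmono := count_runs_mono segs a (-b) hsa (by push_cast at hbad; omega)
  rw [hp.count_eq, hp.count_eq] at hmono
  simp only [List.count_append] at hmono
  rw [count_runs_const, count_runs_const, count_run, count_run] at hmono
  · simp only [List.count_cons, List.count_nil, beq_iff_eq] at hmono
    rw [if_pos trivial, if_neg (by omega : ¬ (-b = -b + 2))] at hmono
    have : (if ∃ t < n, -b + 2 = a - 2 * (t : ℤ) then 1 else 0) ≤
        (if ∃ t < n, -b = a - 2 * (t : ℤ) then 1 else 0) := by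
      split_ifs with g1 g2 <;> try omega
      obtain ⟨t, ht, h⟩ := g1
      exact absurd ⟨t + 1, by omega, by push_cast; omega⟩ g2
    omega
  all_goals
    intro s hs
    obtain ⟨g1, g2, g3, g4⟩ := hrest s hs
    push_cast at hbad
  · exact ⟨((s.1 + b - 2) / 2).toNat, by omega, by omega⟩
  · exact ⟨((s.1 + b) / 2).toNat, by omega, by omega⟩

end KRules
end VVPaper

namespace VVPaper

/-- Negate the letter at position `0`. -/
def flip0 {G : Type} [Neg G] {m : ℕ} [NeZero m] (w : Fin m → G) : Fin m → G :=
  Function.update w 0 (-w 0)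

/-- The position `s + 2`. -/
def hi2 {m : ℕ} (s : Fin (m - 1)) (hs : s.1 + 1 < m - 1) : Fin m := ⟨s.1 + 2, by omega⟩

/-- The generators and relations of a (quotient of a) VV algebra, with letters written as odd
integers; `Wd` is the set of admissible words. -/
structure VVAlg (k : Type) [Field k] {m : ℕ} [NeZero m] (Wd : Finset (Fin m → ℤ))
    (R : Type) [Ring R] [Algebra k R] where
  x : Fin m → R
  sg : Fin (m - 1) → R
  pi : R
  e : (Fin m → ℤ) → R
  e_zero : ∀ w, w ∉ Wd → e w = 0
  e_mul : ∀ w, e w * e w = e w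
  e_orth : ∀ w w', w ≠ w' → e w * e w' = 0
  e_sum : ∑ w ∈ Wd, e w = 1
  x_comm : ∀ a b, x a * x b = x b * x a
  x_e : ∀ a w, x a * e w = e w * x a
  sg_e : ∀ s w, sg s * e w = e (swapAt s w) * sg s
  sq_eq : ∀ s w, w (lo s) = w (hi s) → sg s * sg s * e w = 0
  sq_none : ∀ s w, w (lo s) ≠ w (hi s) → w (lo s) ≠ w (hi s) + 2 → w (hi s) ≠ w (lo s) + 2 →
    sg s * sg s * e w = e w
  sq_up : ∀ s w, w (hi s) = w (lo s) + 2 → sg s * sg s * e w = (x (hi s) - x (lo s)) * e w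
  sq_dn : ∀ s w, w (lo s) = w (hi s) + 2 → sg s * sg s * e w = (x (lo s) - x (hi s)) * e w
  sg_comm : ∀ s t : Fin (m - 1), s.1 + 1 < t.1 → sg s * sg t = sg t * sg s
  braid_triv : ∀ (s : Fin (m - 1)) (hs : s.1 + 1 < m - 1) w,
    (w (lo s) ≠ w (hi2 s hs) ∨ (w (lo s) ≠ w (hi s) + 2 ∧ w (hi s) ≠ w (lo s) + 2)) →
    sg ⟨s.1 + 1, hs⟩ * sg s * sg ⟨s.1 + 1, hs⟩ * e w = sg s * sg ⟨s.1 + 1, hs⟩ * sg s * e w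
  braid_dn : ∀ (s : Fin (m - 1)) (hs : s.1 + 1 < m - 1) w, w (lo s) = w (hi2 s hs) →
    w (lo s) = w (hi s) + 2 →
    sg ⟨s.1 + 1, hs⟩ * sg s * sg ⟨s.1 + 1, hs⟩ * e w =
      sg s * sg ⟨s.1 + 1, hs⟩ * sg s * e w + e w
  braid_up : ∀ (s : Fin (m - 1)) (hs : s.1 + 1 < m - 1) w, w (lo s) = w (hi2 s hs) →
    w (hi s) = w (lo s) + 2 →
    sg ⟨s.1 + 1, hs⟩ * sg s * sg ⟨s.1 + 1, hs⟩ * e w =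
      sg s * sg ⟨s.1 + 1, hs⟩ * sg s * e w - e w
  sg_x_lo : ∀ s w, w (lo s) = w (hi s) → sg s * x (lo s) * e w = x (hi s) * sg s * e w - e w
  sg_x_hi : ∀ s w, w (lo s) = w (hi s) → sg s * x (hi s) * e w = x (lo s) * sg s * e w + e w
  sg_x : ∀ s l w, (w (lo s) ≠ w (hi s) ∨ (l ≠ lo s ∧ l ≠ hi s)) →
    sg s * x l * e w = x (Equiv.swap (lo s) (hi s) l) * sg s * e w
  pi_e : ∀ w, pi * e w = e (flip0 w) * pi
  pi_sq : pi * pi = 1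
  pi_x0 : pi * x 0 = -(x 0 * pi)
  pi_x : ∀ l : Fin m, 0 < l.1 → pi * x l = x l * pi
  pi_sg : ∀ s : Fin (m - 1), 0 < s.1 → pi * sg s = sg s * pi
  sg_pi : ∀ h1 : 0 < m - 1, sg ⟨0, h1⟩ * pi * (sg ⟨0, h1⟩ * pi) = pi * sg ⟨0, h1⟩ * (pi * sg ⟨0, h1⟩)

section
variable {k : Type} [Field k] {m : ℕ} [NeZero m]

lemma lo_ne_hi {m : ℕ} (s : Fin (m - 1)) : lo s ≠ hi s := by
  intro h; simp [lo, hi] at h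

lemma swapAt_lo {V : Type} {m : ℕ} (s : Fin (m - 1)) (w : Fin m → V) :
    swapAt s w (lo s) = w (hi s) := by simp [swapAt]

lemma swapAt_hi {V : Type} {m : ℕ} (s : Fin (m - 1)) (w : Fin m → V) :
    swapAt s w (hi s) = w (lo s) := by simp [swapAt]

lemma swapAt_ne {V : Type} {m : ℕ} (s : Fin (m - 1)) (w : Fin m → V) {l : Fin m} (h1 : l ≠ lo s)
    (h2 : l ≠ hi s) : swapAt s w l = w l := by
  simp [swapAt, Equiv.swap_apply_of_ne_of_ne h1 h2]

lemma swapAt_swapAt {V : Type} {m : ℕ} (s : Fin (m - 1)) (w : Fin m → V) :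
    swapAt s (swapAt s w) = w := by
  funext l; simp [swapAt]

lemma swapAt_eq {V : Type} {m : ℕ} (s : Fin (m - 1)) (w : Fin m → V) (h : w (lo s) = w (hi s)) :
    swapAt s w = w := by
  funext l
  by_cases h1 : l = lo s
  · subst h1; rw [swapAt_lo, h]
  by_cases h2 : l = hi s
  · subst h2; rw [swapAt_hi, h]
  exact swapAt_ne s w h1 h2

lemma flip0_flip0 {G : Type} [InvolutiveNeg G] (w : Fin m → G) : flip0 (flip0 w) = w := by
  simp [flip0]

namespace VVAlg
variable {Wd : Finset (Fin m → ℤ)} {R : Type} [Ring R] [Algebra k R] (A : VVAlg k Wd R)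
include A

lemma e_sg (s : Fin (m - 1)) (w : Fin m → ℤ) : A.e w * A.sg s = A.sg s * A.e (swapAt s w) := by
  rw [A.sg_e, swapAt_swapAt]

lemma e_pi (w : Fin m → ℤ) : A.e w * A.pi = A.pi * A.e (flip0 w) := by
  rw [A.pi_e, flip0_flip0]

lemma e_swap_ne (s : Fin (m - 1)) (w : Fin m → ℤ) (h : A.e w ≠ 0)
    (h1 : w (lo s) ≠ w (hi s) + 2) (h2 : w (hi s) ≠ w (lo s) + 2) : A.e (swapAt s w) ≠ 0 := by
  by_cases h0 : w (lo s) = w (hi s)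
  · rwa [swapAt_eq s w h0]
  intro hz
  apply h
  rw [← A.sq_none s w h0 h1 h2, mul_assoc, A.sg_e, hz, zero_mul, mul_zero]

lemma e_flip_ne (w : Fin m → ℤ) (h : A.e w ≠ 0) : A.e (flip0 w) ≠ 0 := by
  intro hz
  apply h
  rw [← one_mul (A.e w), ← A.pi_sq, mul_assoc, A.pi_e, hz, zero_mul, mul_zero]

lemma e_serre (s : Fin (m - 1)) (hs : s.1 + 1 < m - 1) (w : Fin m → ℤ) (h : A.e w ≠ 0)
    (h0 : w (lo s) = w (hi2 s hs)) (h1 : w (hi s) = w (lo s) + 2 ∨ w (lo s) = w (hi s) + 2) :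
    A.e (swapAt s w) ≠ 0 ∨ A.e (swapAt ⟨s.1 + 1, hs⟩ w) ≠ 0 := by
  by_contra hn
  push Not at hn
  apply h
  have e1 : A.sg ⟨s.1 + 1, hs⟩ * A.sg s * A.sg ⟨s.1 + 1, hs⟩ * A.e w = 0 := by
    rw [mul_assoc, A.sg_e, hn.2, zero_mul, mul_zero]
  have e2 : A.sg s * A.sg ⟨s.1 + 1, hs⟩ * A.sg s * A.e w = 0 := by
    rw [mul_assoc, A.sg_e, hn.1, zero_mul, mul_zero]
  rcases h1 with h1 | h1
  · have := A.braid_up s hs w h0 h1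
    rw [e1, e2] at this
    simpa using this.symm
  · have := A.braid_dn s hs w h0 h1
    rw [e1, e2] at this
    simpa using this.symm

lemma e_zero_of_x_eq (s : Fin (m - 1)) (c : Fin m) (w : Fin m → ℤ) (h0 : w (lo s) = w (hi s))
    (hc : c ≠ lo s ∧ c ≠ hi s) (b : Fin m) (hb : b = lo s ∨ b = hi s)
    (h : A.x c * A.e w = A.x b * A.e w) : A.e w = 0 := by
  have hw : swapAt s w = w := swapAt_eq s w h0
  have hse : A.sg s * A.e w = A.e w * A.sg s := by rw [A.sg_e, hw]
  have hc' : A.sg s * A.x c * A.e w = A.x c * A.sg s * A.e w := by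
    rw [A.sg_x s c w (Or.inr hc), Equiv.swap_apply_of_ne_of_ne hc.1 hc.2]
  have h2 : A.x c * A.sg s * A.e w = A.x b * A.sg s * A.e w := by
    rw [mul_assoc, hse, ← mul_assoc, h, mul_assoc, ← hse, ← mul_assoc]
  have hsq : A.sg s * A.e w * A.sg s = 0 := by
    rw [mul_assoc, ← hse, ← mul_assoc, A.sq_eq s w h0]
  have key : A.e w * A.sg s = 0 := by
    have h3 : A.sg s * A.x b * A.e w = A.x b * A.sg s * A.e w := by
      rw [← h2, ← hc', mul_assoc, ← h, ← mul_assoc]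
    rcases hb with rfl | rfl
    · rw [A.sg_x_lo s w h0] at h3
      have h4 : A.e w = A.x (hi s) * (A.sg s * A.e w) - A.x (lo s) * (A.sg s * A.e w) := by
        rw [← mul_assoc, ← mul_assoc, ← h3]; abel
      rw [h4, sub_mul, mul_assoc (A.x (hi s)), mul_assoc (A.x (lo s)), hsq, mul_zero, mul_zero, sub_zero]
    · rw [A.sg_x_hi s w h0] at h3
      have h4 : A.e w = A.x (hi s) * (A.sg s * A.e w) - A.x (lo s) * (A.sg s * A.e w) := by
        rw [← mul_assoc, ← mul_assoc, ← h3]; abel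
      rw [h4, sub_mul, mul_assoc (A.x (hi s)), mul_assoc (A.x (lo s)), hsq, mul_zero, mul_zero, sub_zero]
  have h6 := A.sg_x_lo s w h0
  rw [mul_assoc, A.x_e, ← mul_assoc, hse, key, zero_mul, mul_assoc, hse, key, mul_zero] at h6
  simpa using h6.symm

lemma e_m3_hi (s : Fin (m - 1)) (hs : s.1 + 1 < m - 1) (w : Fin m → ℤ) (h : A.e w ≠ 0)
    (h0 : w (lo s) = w (hi s))
    (h1 : w (hi2 s hs) = w (hi s) + 2 ∨ w (hi s) = w (hi2 s hs) + 2) :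
    A.e (swapAt ⟨s.1 + 1, hs⟩ w) ≠ 0 := by
  intro hz
  have e1 : A.sg ⟨s.1 + 1, hs⟩ * A.sg ⟨s.1 + 1, hs⟩ * A.e w = 0 := by
    rw [mul_assoc, A.sg_e, hz, zero_mul, mul_zero]
  have hl : lo (m := m) ⟨s.1 + 1, hs⟩ = hi s := rfl
  have hh : hi (m := m) ⟨s.1 + 1, hs⟩ = hi2 s hs := rfl
  refine h (A.e_zero_of_x_eq s (hi2 s hs) w h0 ?_ (hi s) (Or.inr rfl) ?_)
  · constructor <;> (intro h; simp [hi2, lo, hi] at h)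
  rcases h1 with h1 | h1
  · have := A.sq_up ⟨s.1 + 1, hs⟩ w h1
    rw [e1, sub_mul, hl, hh] at this
    exact (sub_eq_zero.1 this.symm)
  · have := A.sq_dn ⟨s.1 + 1, hs⟩ w h1
    rw [e1, sub_mul, hl, hh] at this
    exact (sub_eq_zero.1 this.symm).symm

lemma e_m3_lo (s : Fin (m - 1)) (hs : s.1 + 1 < m - 1) (w : Fin m → ℤ) (h : A.e w ≠ 0)
    (h0 : w (hi s) = w (hi2 s hs))
    (h1 : w (lo s) = w (hi s) + 2 ∨ w (hi s) = w (lo s) + 2) :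
    A.e (swapAt s w) ≠ 0 := by
  intro hz
  have e1 : A.sg s * A.sg s * A.e w = 0 := by
    rw [mul_assoc, A.sg_e, hz, zero_mul, mul_zero]
  have hl : lo (m := m) ⟨s.1 + 1, hs⟩ = hi s := rfl
  have hh : hi (m := m) ⟨s.1 + 1, hs⟩ = hi2 s hs := rfl
  refine h (A.e_zero_of_x_eq ⟨s.1 + 1, hs⟩ (lo s) w h0 ?_ (hi s) (Or.inl rfl) ?_)
  · constructor <;> (intro h; simp [lo, hi] at h; try omega)
  rcases h1 with h1 | h1
  · have := A.sq_dn s w h1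
    rw [e1, sub_mul] at this
    exact (sub_eq_zero.1 this.symm)
  · have := A.sq_up s w h1
    rw [e1, sub_mul] at this
    exact (sub_eq_zero.1 this.symm).symm

end VVAlg

/-- The word read from the last position to the first one. -/
def rd {m : ℕ} (w : Fin m → ℤ) : List ℤ := List.ofFn (fun p => w p.rev)

omit [NeZero m] in
lemma rd_injective : Function.Injective (rd (m := m)) := by
  intro w w' h
  have := List.ofFn_injective h
  funext p
  simpa using congrFun this p.rev

omit [NeZero m] in
lemma rd_getElem (w : Fin m → ℤ) (i : ℕ) (h : i < m) :
    (rd w)[i]'(by simpa [rd] using h) = w ⟨m - 1 - i, by omega⟩ := by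
  simp only [rd, List.getElem_ofFn]
  congr 1
  ext; simp [Fin.rev]; omega

omit [NeZero m] in
lemma rd_pair (w : Fin m → ℤ) (u v : List ℤ) (x y : ℤ) (h : rd w = u ++ x :: y :: v) :
    ∃ s : Fin (m - 1), s.1 + 2 + u.length = m ∧ w (hi s) = x ∧ w (lo s) = y ∧
      rd (swapAt s w) = u ++ y :: x :: v := by
  have hlen : m = u.length + v.length + 2 := by
    have := congrArg List.length h
    simp [rd] at this; omega
  have g : ∀ i (hi : i < m), w ⟨m - 1 - i, by omega⟩ = (u ++ x :: y :: v)[i]'(by simp; omega) := by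
    intro i hi
    rw [← rd_getElem w i hi]
    simp only [h]
  have hx : w ⟨v.length + 1, by omega⟩ = x := by
    have := g u.length (by omega)
    simp at this
    rw [← this]; congr 1; ext; simp; omega
  have hy : w ⟨v.length, by omega⟩ = y := by
    have := g (u.length + 1) (by omega)
    rw [List.getElem_append_right (by omega)] at this
    simp at this
    rw [← this]; congr 1; ext; simp; omega
  refine ⟨⟨v.length, by omega⟩, by simp; omega, hx, hy, ?_⟩
  apply List.ext_getElem
  · simp [rd]; omega
  intro i h1 h2
  have him : i < m := by simpa [rd] using h1
  rw [rd_getElem _ _ him]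
  rcases lt_trichotomy i u.length with hi | hi | hi
  · rw [swapAt_ne, g i him]
    · rw [List.getElem_append_left hi, List.getElem_append_left hi]
    · simp [lo]; omega
    · simp [VVPaper.hi]; omega
  · have : (⟨m - 1 - i, by omega⟩ : Fin m) = VVPaper.hi (m := m) ⟨v.length, by omega⟩ := by
      ext; simp [VVPaper.hi]; omega
    rw [this, swapAt_hi]
    subst hi
    simp
    exact hy
  · rcases Nat.lt_or_ge (u.length + 1) i with hi' | hi'
    · rw [swapAt_ne, g i him]
      · obtain ⟨j, rfl⟩ : ∃ j, i = u.length + (j + 2) := ⟨i - u.length - 2, by omega⟩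
        rw [List.getElem_append_right (by omega), List.getElem_append_right (by omega)]
        simp
      · simp [lo]; omega
      · simp [VVPaper.hi]; omega
    · obtain rfl : i = u.length + 1 := by omega
      have : (⟨m - 1 - (u.length + 1), by omega⟩ : Fin m) = VVPaper.lo (m := m) ⟨v.length, by omega⟩ := by
        ext; simp [VVPaper.lo]; omega
      rw [this, swapAt_lo, List.getElem_append_right (by omega)]
      simp
      exact hx

lemma rd_last (w : Fin m → ℤ) (u : List ℤ) (x : ℤ) (h : rd w = u ++ [x]) :
    rd (flip0 w) = u ++ [-x] := by
  have hlen : m = u.length + 1 := by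
    have := congrArg List.length h
    simpa [rd] using this
  have g : ∀ i (hi : i < m), w ⟨m - 1 - i, by omega⟩ = (u ++ [x])[i]'(by simp; omega) := by
    intro i hi
    rw [← rd_getElem w i hi]
    simp only [h]
  have hx : w 0 = x := by
    have := g u.length (by omega)
    simp at this
    rw [← this]; congr 1; ext; simp; omega
  apply List.ext_getElem
  · simp [rd]; omega
  intro i h1 h2
  have him : i < m := by simpa [rd] using h1
  rw [rd_getElem _ _ him]
  rcases Nat.lt_or_ge i u.length with hi | hi
  · rw [flip0, Function.update_of_ne, g i him, List.getElem_append_left hi,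
      List.getElem_append_left hi]
    intro h
    have := congrArg Fin.val h
    simp at this; omega
  · obtain rfl : i = u.length := by omega
    have : (⟨m - 1 - u.length, by omega⟩ : Fin m) = 0 := by ext; simp; omega
    rw [this]
    simp [flip0, hx]

/-- The words of nonzero idempotents obey the closure rules. -/
lemma VVAlg.kRules {Wd : Finset (Fin m → ℤ)} {R : Type} [Ring R] [Algebra k R]
    (A : VVAlg k Wd R) (hodd : ∀ w ∈ Wd, ∀ p, w p % 2 = 1) :
    KRules (fun l => ∃ w : Fin m → ℤ, A.e w ≠ 0 ∧ rd w = l) where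
  odd := by
    rintro _ ⟨w, hw, rfl⟩ x hx
    obtain ⟨p, rfl⟩ := (List.mem_ofFn' _ _).1 hx
    refine hodd w ?_ _
    by_contra hn
    exact hw (A.e_zero w hn)
  swap := by
    rintro u v x y ⟨w, hw, h⟩ h1 h2
    obtain ⟨s, -, rfl, rfl, hs⟩ := rd_pair w u v x y h
    exact ⟨_, A.e_swap_ne s w hw h2 h1, hs⟩
  serre := by
    rintro u v x y ⟨w, hw, h⟩ h1
    obtain ⟨s, es, hx, hy, hs⟩ := rd_pair w u _ x y h
    obtain ⟨t, et, hy', hx', ht⟩ := rd_pair w (u ++ [x]) _ y x (by simpa using h)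
    simp at et
    have hs' : t.1 + 1 < m - 1 := by omega
    obtain rfl : s = ⟨t.1 + 1, hs'⟩ := by ext; simp; omega
    have hh : hi (m := m) ⟨t.1 + 1, hs'⟩ = hi2 t hs' := rfl
    rcases A.e_serre t hs' w hw (by rw [hx', ← hh, hx]) (by rw [hx', hy']; exact h1) with g | g
    · exact Or.inl ⟨_, g, by simpa using ht⟩
    · exact Or.inr ⟨_, g, hs⟩
  m3a := by
    rintro u v x y ⟨w, hw, h⟩ h1
    obtain ⟨s, es, hx, hy, hs⟩ := rd_pair w u _ x x h
    obtain ⟨t, et, hy', hx', ht⟩ := rd_pair w (u ++ [x]) _ x y (by simpa using h)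
    simp at et
    have hs' : t.1 + 1 < m - 1 := by omega
    obtain rfl : s = ⟨t.1 + 1, hs'⟩ := by ext; simp; omega
    have hh : hi (m := m) ⟨t.1 + 1, hs'⟩ = hi2 t hs' := rfl
    exact ⟨_, A.e_m3_lo t hs' w hw (by rw [hy', ← hh, hx]) (by rw [hx', hy']; exact h1),
      by simpa using ht⟩
  m3b := by
    rintro u v x y ⟨w, hw, h⟩ h1
    obtain ⟨s, es, hx, hy, hs⟩ := rd_pair w u _ y x h
    obtain ⟨t, et, hy', hx', ht⟩ := rd_pair w (u ++ [y]) _ x x (by simpa using h)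
    simp at et
    have hs' : t.1 + 1 < m - 1 := by omega
    obtain rfl : s = ⟨t.1 + 1, hs'⟩ := by ext; simp; omega
    have hh : hi (m := m) ⟨t.1 + 1, hs'⟩ = hi2 t hs' := rfl
    exact ⟨_, A.e_m3_hi t hs' w hw (by rw [hy', hx'])
      (by rw [← hh, hx, hy']; exact h1), hs⟩
  flip := by
    rintro u x ⟨w, hw, h⟩
    exact ⟨_, A.e_flip_ne w hw, rd_last w u x h⟩

end
end VVPaper

namespace VVPaper

/-- A totally ordered set of signed strands, each carrying a letter and a parameter; `nx A B` says
that `B` directly follows `A` on the same segment. -/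
structure Strands (S K : Type) [LinearOrder S] [InvolutiveNeg S] [Field K] where
  L : S → ℤ
  z : S → K
  nx : S → S → Prop
  neg_lt : ∀ {A B : S}, A < B → -B < -A
  L_neg : ∀ A, L (-A) = -L A
  L_odd : ∀ A, L A % 2 = 1
  z_neg : ∀ A, z (-A) = -z A
  nx_neg : ∀ {A B : S}, nx A B → nx (-B) (-A)
  nx_lt : ∀ {A B : S}, nx A B → A < B
  nx_between : ∀ {A B C : S}, nx A B → A < C → B ≤ C
  nx_L : ∀ {A B : S}, nx A B → L B = L A + 2
  nx_z : ∀ {A B : S}, nx A B → z A = z B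
  nx_self : ∀ A, ¬ nx (-A) A
  z_ne : ∀ {A B : S}, L A = L B → A ≠ B → z A ≠ z B
  nx_of : ∀ {A B : S}, L B = L A + 2 → z A = z B → nx A B

/-- The action of a generator (`none` for `π`, `some s` for `σ_s`) on arrangements. -/
def gact {V : Type} [Neg V] {m : ℕ} [NeZero m] : Option (Fin (m - 1)) → (Fin m → V) → (Fin m → V)
  | none => flip0
  | some s => swapAt s

lemma gact_gact {V : Type} [InvolutiveNeg V] {m : ℕ} [NeZero m] (g : Option (Fin (m - 1)))
    (v : Fin m → V) : gact g (gact g v) = v := by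
  cases g with
  | none => exact flip0_flip0 v
  | some s => exact swapAt_swapAt s v

section
variable {S : Type} {m : ℕ} [NeZero m]

lemma flip0_zero [Neg S] (v : Fin m → S) : flip0 v 0 = -v 0 := by simp [flip0]

lemma flip0_ne [Neg S] (v : Fin m → S) {p : Fin m} (h : p ≠ 0) : flip0 v p = v p := by
  simp [flip0, h]

/-- Sum of a cost over the (signed) pairs of an arrangement. -/
def psum [Neg S] (c : S → S → ℤ) (v : Fin m → S) : ℤ :=
  ∑ p, ∑ q, if p < q then c (v p) (v q) + c (-v p) (v q) else 0

lemma psum_flip [InvolutiveNeg S] (c : S → S → ℤ) (v : Fin m → S) :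
    psum c (flip0 v) = psum c v := by
  unfold psum
  refine Finset.sum_congr rfl fun p _ => Finset.sum_congr rfl fun q _ => ?_
  split_ifs with h
  · have hq : q ≠ 0 := by rintro rfl; exact absurd h (by simp)
    rw [flip0_ne v hq]
    by_cases hp : p = 0
    · subst hp; rw [flip0_zero, neg_neg, add_comm]
    · rw [flip0_ne v hp]
  · rfl

omit [NeZero m] in
lemma swap_lt_iff (s : Fin (m - 1)) (p q : Fin m) (x : ℤ) :
    (if Equiv.swap (lo s) (hi s) p < Equiv.swap (lo s) (hi s) q then x else 0) =
      (if p < q then x else 0) + (if p = hi s then if q = lo s then x else 0 else 0)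
        - (if p = lo s then if q = hi s then x else 0 else 0) := by
  have hl : (lo s).1 = s.1 := rfl
  have hh : (hi s).1 = s.1 + 1 := rfl
  rcases s with ⟨s, hs⟩
  simp only at hl hh
  simp only [Equiv.swap_apply_def, Fin.ext_iff, Fin.lt_def, hl, hh]
  split_ifs <;> simp_all <;> omega

omit [NeZero m] in
lemma psum_swap [InvolutiveNeg S] (c : S → S → ℤ) (hc : ∀ A B, c (-A) B = c (-B) A)
    (s : Fin (m - 1)) (v : Fin m → S) :
    psum c (swapAt s v) = psum c v - c (v (lo s)) (v (hi s)) + c (v (hi s)) (v (lo s)) := by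
  have h1 : psum c (swapAt s v) = ∑ p, ∑ q,
      if Equiv.swap (lo s) (hi s) p < Equiv.swap (lo s) (hi s) q
        then c (v p) (v q) + c (-v p) (v q) else 0 := by
    unfold psum
    rw [← Equiv.sum_comp (Equiv.swap (lo s) (hi s))]
    refine Finset.sum_congr rfl fun p _ => ?_
    rw [← Equiv.sum_comp (Equiv.swap (lo s) (hi s))]
    refine Finset.sum_congr rfl fun q _ => ?_
    simp [swapAt]
  rw [h1]
  simp_rw [swap_lt_iff, Finset.sum_sub_distrib, Finset.sum_add_distrib]
  have e1 : ∀ a b : Fin m, ∑ p : Fin m, ∑ q : Fin m,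
      (if p = a then if q = b then c (v p) (v q) + c (-v p) (v q) else 0 else 0) =
        c (v a) (v b) + c (-v a) (v b) := by
    intro a b
    rw [Finset.sum_eq_single a (fun p _ h => by simp [h]) (by simp)]
    simp
  rw [e1, e1, hc (v (hi s)) (v (lo s))]
  unfold psum
  ring

end

namespace Strands
variable {S K : Type} [LinearOrder S] [InvolutiveNeg S] [Field K] (Y : Strands S K)
  {m : ℕ} [NeZero m]

include Y in
lemma neg_lt_iff {A B : S} : -B < -A ↔ A < B :=
  ⟨fun h => by simpa using Y.neg_lt h, Y.neg_lt⟩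

include Y in
lemma ne_neg (A : S) : A ≠ -A := by
  intro h
  have h1 := Y.L_neg A
  rw [← h] at h1
  have := Y.L_odd A
  omega

/-- Admissible arrangements of the strands. -/
structure Good (v : Fin m → S) : Prop where
  inj : Function.Injective v
  ne : ∀ p q, v p ≠ -v q
  full : ∀ A, ∃ p, v p = A ∨ v p = -A
  link : ∀ p A, Y.nx (v p) A → ∃ q, p < q ∧ v q = A

/-- The generator `g` creates a longer arrangement from `gact g v` to `v`. -/
def Descent : Option (Fin (m - 1)) → (Fin m → S) → Prop
  | none, v => v 0 < -v 0
  | some s, v => v (hi s) < v (lo s)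

/-- The generator `g` would exchange two linked strands. -/
def Linked : Option (Fin (m - 1)) → (Fin m → S) → Prop
  | none, _ => False
  | some s, v => Y.nx (v (lo s)) (v (hi s))

variable {Y}

lemma Good.not_linked {v : Fin m → S} {g : Option (Fin (m - 1))}
    (h : Descent g v) : ¬ Y.Linked g v := by
  cases g with
  | none => exact fun h => h
  | some s => exact fun h' => absurd (Y.nx_lt h') (not_lt.2 (le_of_lt h))

lemma Good.act {v : Fin m → S} (hv : Y.Good v) {g : Option (Fin (m - 1))}
    (h : ¬ Y.Linked g v) : Y.Good (gact g v) := by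
  cases g with
  | none =>
    have key : ∀ p, flip0 v p = v p ∨ flip0 v p = -v p := by
      intro p
      by_cases hp : p = 0
      · subst hp; right; exact flip0_zero v
      · left; exact flip0_ne v hp
    refine ⟨?_, ?_, ?_, ?_⟩
    · intro p q hpq
      change flip0 v p = flip0 v q at hpq
      rcases key p with h1 | h1 <;> rcases key q with h2 | h2 <;> rw [h1, h2] at hpq
      · exact hv.inj hpq
      · exact absurd hpq (hv.ne _ _)
      · exact absurd hpq.symm (hv.ne _ _)
      · exact hv.inj (neg_injective hpq)
    · intro p q hpq
      change flip0 v p = -flip0 v q at hpq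
      by_cases hp : p = 0
      · by_cases hq : q = 0
        · subst hp hq
          exact Y.ne_neg _ hpq
        · subst hp
          rw [flip0_zero, flip0_ne v hq] at hpq
          exact hq (hv.inj (neg_injective hpq)).symm
      · by_cases hq : q = 0
        · subst hq
          rw [flip0_zero, flip0_ne v hp, neg_neg] at hpq
          exact hp (hv.inj hpq)
        · rw [flip0_ne v hp, flip0_ne v hq] at hpq
          exact hv.ne _ _ hpq
    · intro A
      obtain ⟨p, hp⟩ := hv.full A
      refine ⟨p, ?_⟩
      change flip0 v p = A ∨ flip0 v p = -A
      rcases key p with h1 | h1 <;> rw [h1] <;> rcases hp with h2 | h2 <;> rw [h2] <;> simp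
    · intro p A hA
      change Y.nx (flip0 v p) A at hA
      change ∃ q, p < q ∧ flip0 v q = A
      by_cases hp : p = 0
      · subst hp
        rw [flip0_zero] at hA
        have hA' := Y.nx_neg hA
        rw [neg_neg] at hA'
        obtain ⟨q, hq⟩ := hv.full A
        rcases hq with hq | hq
        · have hq0 : q ≠ 0 := by
            rintro rfl
            rw [hq] at hA
            exact Y.nx_self A hA
          exact ⟨q, (Fin.pos_iff_ne_zero' _).2 hq0, by rw [flip0_ne v hq0, hq]⟩
        · rw [← hq] at hA'
          obtain ⟨q', h1, h2⟩ := hv.link _ _ hA'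
          have := hv.inj h2
          subst this
          exact absurd h1 (by simp)
      · rw [flip0_ne v hp] at hA
        obtain ⟨q, h1, h2⟩ := hv.link _ _ hA
        have hq0 : q ≠ 0 := by rintro rfl; exact absurd h1 (by simp)
        exact ⟨q, h1, by rw [flip0_ne v hq0, h2]⟩
  | some s =>
    refine ⟨?_, ?_, ?_, ?_⟩
    · exact hv.inj.comp (Equiv.injective _)
    · intro p q; exact hv.ne _ _
    · intro A
      obtain ⟨p, hp⟩ := hv.full A
      refine ⟨Equiv.swap (lo s) (hi s) p, ?_⟩
      change v (Equiv.swap _ _ (Equiv.swap _ _ p)) = A ∨ v (Equiv.swap _ _ (Equiv.swap _ _ p)) = -A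
      simpa using hp
    · intro p A hA
      change Y.nx (v (Equiv.swap _ _ p)) A at hA
      obtain ⟨q, h1, h2⟩ := hv.link _ _ hA
      refine ⟨Equiv.swap (lo s) (hi s) q, ?_, ?_⟩
      · by_contra hn
        apply h
        change Y.nx (v (lo s)) (v (hi s))
        have e1 : Equiv.swap (lo s) (hi s) p = lo s ∧ q = hi s := by
          have hl : (lo s).1 = s.1 := rfl
          have hh : (hi s).1 = s.1 + 1 := rfl
          rcases s with ⟨s, hs⟩
          simp only at hl hh
          clear h2 hA h
          simp only [Equiv.swap_apply_def, Fin.ext_iff, Fin.lt_def, hl, hh] at h1 hn ⊢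
          split_ifs at h1 hn ⊢ <;> simp_all <;> omega
        rw [← e1.2, h2, ← e1.1]
        exact hA
      · change v (Equiv.swap _ _ (Equiv.swap _ _ q)) = A
        simpa using h2

lemma Good.descent_or {v : Fin m → S} (hv : Y.Good v) (g : Option (Fin (m - 1))) :
    Descent g v ∨ Descent g (gact g v) := by
  cases g with
  | none =>
    rcases lt_or_gt_of_ne (Y.ne_neg (v 0)) with h | h
    · exact Or.inl h
    · right; change flip0 v 0 < -flip0 v 0; rw [flip0_zero, neg_neg]; exact h
  | some s =>
    have : v (lo s) ≠ v (hi s) := fun h => lo_ne_hi s (hv.inj h)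
    rcases lt_or_gt_of_ne this with h | h
    · right; change swapAt s v (hi s) < swapAt s v (lo s); rw [swapAt_hi, swapAt_lo]; exact h
    · exact Or.inl h

lemma Good.eq_of_no_descent {v v' : Fin m → S} (hv : Y.Good v) (hv' : Y.Good v')
    (h : ∀ g, ¬ Descent g v) (h' : ∀ g, ¬ Descent g v') : v = v' := by
  have mono : ∀ v : Fin m → S, Y.Good v → (∀ g, ¬ Descent g v) →
      StrictMono v ∧ Set.range v = {A | -A < A} := by
    intro v hv h
    have h1 : StrictMono v := by
      obtain ⟨n, rfl⟩ : ∃ n, m = n + 1 := ⟨m - 1, by have := NeZero.ne m; omega⟩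
      refine Fin.strictMono_iff_lt_succ.2 fun i => ?_
      have h2 := h (some i)
      exact lt_of_le_of_ne (not_lt.1 h2) fun h3 => by
        have := hv.inj h3
        simp [Fin.ext_iff] at this
    refine ⟨h1, ?_⟩
    have hpos : ∀ p, -v p < v p := by
      intro p
      have h0 : -v 0 < v 0 := lt_of_le_of_ne (not_lt.1 (h none)) (Y.ne_neg _).symm
      rcases eq_or_ne p 0 with rfl | hp
      · exact h0
      · have := h1 ((Fin.pos_iff_ne_zero' _).2 hp)
        exact (Y.neg_lt this).trans (h0.trans this)
    ext A
    simp only [Set.mem_range, Set.mem_ofPred_eq]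
    constructor
    · rintro ⟨p, rfl⟩; exact hpos p
    · intro hA
      obtain ⟨p, hp | hp⟩ := hv.full A
      · exact ⟨p, hp⟩
      · have := hpos p
        rw [hp, neg_neg] at this
        exact absurd hA (lt_asymm this)
  obtain ⟨a, b⟩ := mono v hv h
  obtain ⟨a', b'⟩ := mono v' hv' h'
  exact (StrictMono.range_inj a a').1 (b.trans b'.symm)

/-- The number of inversions of an arrangement, as an integer. -/
def invZ (v : Fin m → S) : ℤ :=
  psum (fun A B => if B < A then 1 else 0) v + ∑ p, if v p < -v p then 1 else 0

/-- The number of inversions of an arrangement. -/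
def inv (v : Fin m → S) : ℕ := (invZ v).toNat

omit [NeZero m] in
lemma invZ_nonneg (v : Fin m → S) : 0 ≤ invZ v := by
  unfold invZ psum
  refine add_nonneg (Finset.sum_nonneg fun p _ => Finset.sum_nonneg fun q _ => ?_)
    (Finset.sum_nonneg fun p _ => ?_)
  · dsimp only; split_ifs <;> norm_num
  · split_ifs <;> norm_num

variable (Y) in
include Y in
lemma inv_act {v : Fin m → S} {g : Option (Fin (m - 1))} (h : Descent g v) :
    inv (gact g v) + 1 = inv v := by
  have key : invZ (gact g v) + 1 = invZ v := by
    unfold invZ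
    cases g with
    | none =>
      change psum _ (flip0 v) + _ + 1 = _
      rw [psum_flip]
      have : ∀ w : Fin m → S, (∑ p, if w p < -w p then (1 : ℤ) else 0) =
          (if w 0 < -w 0 then 1 else 0) + ∑ p ∈ Finset.univ.erase 0,
            if w p < -w p then (1 : ℤ) else 0 := fun w =>
        (Finset.add_sum_erase _ _ (Finset.mem_univ _)).symm
      rw [this, this v]
      have h2 : ∑ p ∈ Finset.univ.erase 0, (if flip0 v p < -flip0 v p then (1 : ℤ) else 0) =
          ∑ p ∈ Finset.univ.erase 0, if v p < -v p then (1 : ℤ) else 0 := by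
        refine Finset.sum_congr rfl fun p hp => ?_
        rw [flip0_ne v (Finset.ne_of_mem_erase hp)]
      change _ + ((if flip0 v 0 < -flip0 v 0 then 1 else 0) + ∑ p ∈ Finset.univ.erase 0,
        (if flip0 v p < -flip0 v p then (1 : ℤ) else 0)) + 1 = _
      rw [h2, flip0_zero, neg_neg, if_neg (lt_asymm h), if_pos (show v 0 < -v 0 from h)]
      ring
    | some s =>
      change psum _ (swapAt s v) + _ + 1 = _
      have h2 : (∑ p, if gact (some s) v p < -gact (some s) v p then (1 : ℤ) else 0) =
          ∑ p, if v p < -v p then (1 : ℤ) else 0 :=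
        Equiv.sum_comp (Equiv.swap (lo s) (hi s)) fun p => if v p < -v p then (1 : ℤ) else 0
      rw [h2, psum_swap, if_neg (lt_asymm h), if_pos (show v (hi s) < v (lo s) from h)]
      · ring
      · intro A B
        have : B < -A ↔ A < -B := by
          rw [← Y.neg_lt_iff (A := B), neg_neg]
        simp [this]
  have h1 := invZ_nonneg v
  have h2 := invZ_nonneg (gact g v)
  unfold inv
  omega

end Strands
end VVPaper

namespace VVPaper
namespace Strands
variable {S K : Type} [LinearOrder S] [InvolutiveNeg S] [Field K] (Y : Strands S K)
  {m : ℕ} [NeZero m]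

/-- Diagonal coefficient of the exchange of two strands. -/
def ca (A B : S) : K := if Y.L A = Y.L B then -(Y.z A - Y.z B)⁻¹ else 0

/-- Off-diagonal coefficient of the exchange of two strands. -/
def cb (A B : S) : K :=
  if Y.L A = Y.L B then (Y.z A - Y.z B)⁻¹ else if Y.L B = Y.L A + 2 then Y.z B - Y.z A else 1

/-- Diagonal coefficient of a generator. -/
def al : Option (Fin (m - 1)) → (Fin m → S) → K
  | none, _ => 0
  | some s, v => Y.ca (v (lo s)) (v (hi s))

/-- Off-diagonal coefficient of a generator. -/
def be : Option (Fin (m - 1)) → (Fin m → S) → K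
  | none, _ => 1
  | some s, v => Y.cb (v (lo s)) (v (hi s))

/-- A generator acting on functions on all arrangements. -/
def opT (g : Option (Fin (m - 1))) (F : (Fin m → S) → K) : (Fin m → S) → K :=
  fun v => Y.al g v * F v + Y.be g v * F (gact g v)

lemma be_linked {g : Option (Fin (m - 1))} {v : Fin m → S} (h : Y.Linked g v) :
    Y.be g v = 0 := by
  cases g with
  | none => exact h.elim
  | some s =>
    have h1 := Y.nx_L h
    change Y.cb _ _ = 0
    unfold cb
    rw [if_neg (by omega), if_pos h1, Y.nx_z h, sub_self]

lemma opT_congr (g : Option (Fin (m - 1))) {F F' : (Fin m → S) → K}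
    (h : ∀ v, Y.Good v → F v = F' v) (v : Fin m → S) (hv : Y.Good v) :
    Y.opT g F v = Y.opT g F' v := by
  unfold opT
  rw [h v hv]
  by_cases hl : Y.Linked g v
  · rw [Y.be_linked hl, zero_mul, zero_mul]
  · rw [h _ (hv.act hl)]

/-- The strand difference is invertible when letters agree. -/
lemma Good.sub_ne {v : Fin m → S} (hv : Y.Good v) {p q : Fin m} (hpq : p ≠ q)
    (h : Y.L (v p) = Y.L (v q)) : Y.z (v p) - Y.z (v q) ≠ 0 :=
  sub_ne_zero.2 (Y.z_ne h fun h' => hpq (hv.inj h'))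

lemma Good.add_ne {v : Fin m → S} (hv : Y.Good v) {p q : Fin m}
    (h : Y.L (v p) = -Y.L (v q)) : Y.z (v p) + Y.z (v q) ≠ 0 := by
  have := Y.z_ne (A := v p) (B := -v q) (by rw [Y.L_neg, h]) (hv.ne _ _)
  rw [Y.z_neg] at this
  intro h'
  exact this (eq_neg_of_add_eq_zero_left h')

lemma opT_sq (s : Fin (m - 1)) (F : (Fin m → S) → K) (v : Fin m → S) (hv : Y.Good v) :
    Y.opT (some s) (Y.opT (some s) F) v =
      (if Y.L (v (lo s)) = Y.L (v (hi s)) then 0 else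
       if Y.L (v (hi s)) = Y.L (v (lo s)) + 2 then Y.z (v (hi s)) - Y.z (v (lo s)) else
       if Y.L (v (lo s)) = Y.L (v (hi s)) + 2 then Y.z (v (lo s)) - Y.z (v (hi s)) else 1) * F v := by
  have e1 : gact (some s) (gact (some s) v) = v := gact_gact _ _
  have e2 : gact (some s) v (lo s) = v (hi s) := swapAt_lo s v
  have e3 : gact (some s) v (hi s) = v (lo s) := swapAt_hi s v
  simp only [opT, al, be, e1, e2, e3]
  have hne : Y.L (v (lo s)) = Y.L (v (hi s)) → Y.z (v (lo s)) - Y.z (v (hi s)) ≠ 0 :=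
    fun h => hv.sub_ne Y (lo_ne_hi s) h
  generalize v (lo s) = A at *
  generalize v (hi s) = B at *
  unfold ca cb
  by_cases h : Y.L A = Y.L B
  · have h1 := hne h
    have h2 : Y.z B - Y.z A ≠ 0 := fun h' => h1 (by rw [← neg_sub, h', neg_zero])
    simp only [h, if_true]
    have : (Y.z B - Y.z A)⁻¹ = -(Y.z A - Y.z B)⁻¹ := by rw [← neg_sub, inv_neg]
    rw [this]; ring
  · have h' : ¬ Y.L B = Y.L A := fun h' => h h'.symm
    simp only [if_neg h, if_neg h']
    by_cases h1 : Y.L B = Y.L A + 2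
    · rw [if_pos h1, if_neg (by omega), if_pos h1]; ring
    · by_cases h2 : Y.L A = Y.L B + 2
      · simp only [if_neg h1, if_pos h2]; ring
      · simp only [if_neg h1, if_neg h2]; ring

/-- The arrangement with three prescribed consecutive entries. -/
def pl3 (s : Fin (m - 1)) (hs : s.1 + 1 < m - 1) (v : Fin m → S) (A B C : S) : Fin m → S :=
  fun p => if p = lo s then A else if p = hi s then B else if p = hi2 s hs then C else v p

omit [LinearOrder S] in
lemma pl3_lo (s : Fin (m - 1)) (hs : s.1 + 1 < m - 1) (v : Fin m → S) (A B C : S) :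
    pl3 s hs v A B C (lo s) = A := by simp [pl3]

omit [LinearOrder S] in
lemma pl3_hi (s : Fin (m - 1)) (hs : s.1 + 1 < m - 1) (v : Fin m → S) (A B C : S) :
    pl3 s hs v A B C (hi s) = B := by simp [pl3, (lo_ne_hi s).symm]

omit [LinearOrder S] in
lemma pl3_hi2 (s : Fin (m - 1)) (hs : s.1 + 1 < m - 1) (v : Fin m → S) (A B C : S) :
    pl3 s hs v A B C (hi2 s hs) = C := by
  have h1 : hi2 s hs ≠ lo s := by simp [hi2, lo]
  have h2 : hi2 s hs ≠ hi s := by simp [hi2, hi]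
  simp [pl3, h1, h2]

omit [LinearOrder S] in
lemma pl3_self (s : Fin (m - 1)) (hs : s.1 + 1 < m - 1) (v : Fin m → S) :
    v = pl3 s hs v (v (lo s)) (v (hi s)) (v (hi2 s hs)) := by
  funext p
  unfold pl3
  split_ifs with h1 h2 h3
  · rw [h1]
  · rw [h2]
  · rw [h3]
  · rfl

omit [LinearOrder S] in
lemma pl3_swap (s : Fin (m - 1)) (hs : s.1 + 1 < m - 1) (v : Fin m → S) (A B C : S) :
    swapAt s (pl3 s hs v A B C) = pl3 s hs v B A C := by
  funext p
  by_cases h1 : p = lo s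
  · subst h1; rw [swapAt_lo, pl3_hi, pl3_lo]
  by_cases h2 : p = hi s
  · subst h2; rw [swapAt_hi, pl3_hi, pl3_lo]
  rw [swapAt_ne _ _ h1 h2]
  simp [pl3, h1, h2]

omit [LinearOrder S] in
lemma pl3_swap' (s : Fin (m - 1)) (hs : s.1 + 1 < m - 1) (v : Fin m → S) (A B C : S) :
    swapAt ⟨s.1 + 1, hs⟩ (pl3 s hs v A B C) = pl3 s hs v A C B := by
  have hl : lo (m := m) ⟨s.1 + 1, hs⟩ = hi s := rfl
  have hh : hi (m := m) ⟨s.1 + 1, hs⟩ = hi2 s hs := rfl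
  funext p
  by_cases h1 : p = hi s
  · subst h1; rw [← hl, swapAt_lo, hh, hl, pl3_hi, pl3_hi2]
  by_cases h2 : p = hi2 s hs
  · subst h2; rw [← hh, swapAt_hi, hh, hl, pl3_hi, pl3_hi2]
  rw [swapAt_ne _ _ (hl ▸ h1) (hh ▸ h2)]
  simp [pl3, h1, h2]

lemma braid_scalar (A B C : S) (G : S → S → S → K)
    (h1 : Y.L A = Y.L B → Y.z A - Y.z B ≠ 0) (h2 : Y.L A = Y.L C → Y.z A - Y.z C ≠ 0)
    (h3 : Y.L B = Y.L C → Y.z B - Y.z C ≠ 0) :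
    Y.ca B C * (Y.ca A B * (Y.ca B C * G A B C + Y.cb B C * G A C B) +
        Y.cb A B * (Y.ca A C * G B A C + Y.cb A C * G B C A)) +
      Y.cb B C * (Y.ca A C * (Y.ca C B * G A C B + Y.cb C B * G A B C) +
        Y.cb A C * (Y.ca A B * G C A B + Y.cb A B * G C B A)) =
    Y.ca A B * (Y.ca B C * (Y.ca A B * G A B C + Y.cb A B * G B A C) +
        Y.cb B C * (Y.ca A C * G A C B + Y.cb A C * G C A B)) +
      Y.cb A B * (Y.ca A C * (Y.ca B A * G B A C + Y.cb B A * G A B C) +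
        Y.cb A C * (Y.ca B C * G B C A + Y.cb B C * G C B A)) +
    (if Y.L A = Y.L C then if Y.L A = Y.L B + 2 then 1 else if Y.L B = Y.L A + 2 then -1 else 0
      else 0) * G A B C := by
  have n1 : (Y.z B - Y.z A)⁻¹ = -(Y.z A - Y.z B)⁻¹ := by rw [← neg_sub, inv_neg]
  have n3 : (Y.z C - Y.z B)⁻¹ = -(Y.z B - Y.z C)⁻¹ := by rw [← neg_sub, inv_neg]
  unfold ca cb
  simp only [n1, n3]
  generalize Y.z A = a at *
  generalize Y.z B = b at *
  generalize Y.z C = c at *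
  generalize Y.L A = x at *
  generalize Y.L B = y at *
  generalize Y.L C = w at *
  clear n1 n3
  rcases eq_or_ne x y with rfl | hxy
  · rcases eq_or_ne x w with rfl | hxw
    · have h1 := h1 rfl
      have h2 := h2 rfl
      have h3 := h3 rfl
      simp
      field_simp
      ring
    · have h1 := h1 rfl
      have hwx := hxw.symm
      simp only [hxw, hwx, if_true, if_false]
      split_ifs <;> first | omega | (field_simp; ring)
  · have hyx := hxy.symm
    rcases eq_or_ne x w with rfl | hxw
    · have h2 := h2 rfl
      simp only [hxy, hyx, if_true, if_false]
      split_ifs <;> first | omega | (field_simp; ring)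
    · have hwx := hxw.symm
      rcases eq_or_ne y w with rfl | hyw
      · have h3 := h3 rfl
        simp only [hxy, hyx, if_true, if_false]
        split_ifs <;> first | omega | (field_simp; ring)
      · have hwy := hyw.symm
        simp only [hxy, hxw, hyw, hyx, hwx, hwy, if_true, if_false]
        ring

lemma opT_braid (s : Fin (m - 1)) (hs : s.1 + 1 < m - 1) (F : (Fin m → S) → K) (v : Fin m → S)
    (hv : Y.Good v) :
    Y.opT (some ⟨s.1 + 1, hs⟩) (Y.opT (some s) (Y.opT (some ⟨s.1 + 1, hs⟩) F)) v =
      Y.opT (some s) (Y.opT (some ⟨s.1 + 1, hs⟩) (Y.opT (some s) F)) v +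
      (if Y.L (v (lo s)) = Y.L (v (hi2 s hs)) then
        if Y.L (v (lo s)) = Y.L (v (hi s)) + 2 then 1 else
        if Y.L (v (hi s)) = Y.L (v (lo s)) + 2 then -1 else 0 else 0) * F v := by
  have hl : lo (m := m) ⟨s.1 + 1, hs⟩ = hi s := rfl
  have hh : hi (m := m) ⟨s.1 + 1, hs⟩ = hi2 s hs := rfl
  have k1 : lo s ≠ hi2 s hs := by simp [hi2, lo]
  have k2 : hi s ≠ hi2 s hs := by simp [hi2, hi]
  have H := Y.braid_scalar (v (lo s)) (v (hi s)) (v (hi2 s hs)) (fun A B C => F (pl3 s hs v A B C))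
    (fun h => hv.sub_ne Y (lo_ne_hi s) h) (fun h => hv.sub_ne Y k1 h) (fun h => hv.sub_ne Y k2 h)
  have e1 : ∀ A B C, ∀ F : (Fin m → S) → K, Y.opT (some s) F (pl3 s hs v A B C) =
      Y.ca A B * F (pl3 s hs v A B C) + Y.cb A B * F (pl3 s hs v B A C) := by
    intro A B C F
    simp only [opT, al, be, gact, pl3_swap, pl3_lo, pl3_hi]
  have e2 : ∀ A B C, ∀ F : (Fin m → S) → K, Y.opT (some ⟨s.1 + 1, hs⟩) F (pl3 s hs v A B C) =
      Y.ca B C * F (pl3 s hs v A B C) + Y.cb B C * F (pl3 s hs v A C B) := by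
    intro A B C F
    simp only [opT, al, be, gact, pl3_swap', hl, hh, pl3_hi, pl3_hi2]
  have e3 : ∀ F : (Fin m → S) → K, F v = F (pl3 s hs v (v (lo s)) (v (hi s)) (v (hi2 s hs))) :=
    fun F => congrArg F (pl3_self s hs v)
  rw [e3 (Y.opT _ (Y.opT _ (Y.opT (some ⟨s.1 + 1, hs⟩) F))),
    e3 (Y.opT _ (Y.opT _ (Y.opT (some s) F))), e3 F]
  simp only [e1, e2]
  exact H

/-- The arrangement with two prescribed initial entries. -/
def pl2 (v : Fin m → S) (A B : S) : Fin m → S :=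
  fun p => if p.1 = 0 then A else if p.1 = 1 then B else v p

lemma pl2_zero (v : Fin m → S) (A B : S) : pl2 v A B 0 = A := by simp [pl2]

lemma pl2_hi (h : 0 < m - 1) (v : Fin m → S) (A B : S) : pl2 v A B (hi ⟨0, h⟩) = B := by
  simp [pl2, hi]

lemma pl2_swap (h : 0 < m - 1) (v : Fin m → S) (A B : S) :
    swapAt ⟨0, h⟩ (pl2 v A B) = pl2 v B A := by
  have hl : (lo (m := m) ⟨0, h⟩) = 0 := rfl
  funext p
  by_cases h1 : p = lo ⟨0, h⟩
  · subst h1; rw [swapAt_lo, pl2_hi, hl, pl2_zero]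
  by_cases h2 : p = hi ⟨0, h⟩
  · subst h2; rw [swapAt_hi, pl2_hi, hl, pl2_zero]
  rw [swapAt_ne _ _ h1 h2]
  have k1 : p.1 ≠ 0 := fun h => h1 (Fin.ext h)
  have k2 : p.1 ≠ 1 := fun h => h2 (Fin.ext h)
  simp [pl2, k1, k2]

lemma pl2_flip (_ : 0 < m - 1) (v : Fin m → S) (A B : S) :
    flip0 (pl2 v A B) = pl2 v (-A) B := by
  funext p
  by_cases h1 : p = 0
  · subst h1; rw [flip0_zero, pl2_zero, pl2_zero]
  rw [flip0_ne _ h1]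
  have k1 : p.1 ≠ 0 := fun h => h1 (Fin.ext h)
  simp [pl2, k1]

lemma pl2_self (h : 0 < m - 1) (v : Fin m → S) : v = pl2 v (v 0) (v (hi ⟨0, h⟩)) := by
  funext p
  unfold pl2
  split_ifs with h1 h2
  · congr 1; exact Fin.ext h1
  · congr 1; exact Fin.ext h2
  · rfl

lemma braid4_scalar (A B : S) (G : S → S → K)
    (h1 : Y.L A = Y.L B → Y.z A - Y.z B ≠ 0) (h2 : Y.L A = -Y.L B → Y.z A + Y.z B ≠ 0) :
    Y.ca A B * (Y.ca (-A) B * G A B + Y.cb (-A) B * G (-B) (-A)) +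
      Y.cb A B * (Y.ca (-B) A * G B A + Y.cb (-B) A * G (-A) (-B)) =
    Y.ca (-A) B * (Y.ca A B * G A B + Y.cb A B * G B A) +
      Y.cb (-A) B * (Y.ca (-B) (-A) * G (-B) (-A) + Y.cb (-B) (-A) * G (-A) (-B)) := by
  have oA := Y.L_odd A
  have oB := Y.L_odd B
  have n1 : (Y.z B - Y.z A)⁻¹ = -(Y.z A - Y.z B)⁻¹ := by rw [← neg_sub, inv_neg]
  have n2 : (-Y.z A - Y.z B)⁻¹ = -(Y.z A + Y.z B)⁻¹ := by rw [← inv_neg, neg_add, sub_eq_add_neg]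
  have n3 : (-Y.z B - Y.z A)⁻¹ = -(Y.z A + Y.z B)⁻¹ := by
    rw [← inv_neg, neg_add, sub_eq_add_neg, add_comm]
  have n4 : (-Y.z B - -Y.z A)⁻¹ = (Y.z A - Y.z B)⁻¹ := by
    congr 1; ring
  have n5 : (-Y.z A - -Y.z B)⁻¹ = -(Y.z A - Y.z B)⁻¹ := by
    rw [← inv_neg]; congr 1; ring
  unfold ca cb
  simp only [Y.L_neg, Y.z_neg, n1, n2, n3, n4, n5]
  generalize Y.z A = a at *
  generalize Y.z B = b at *
  generalize Y.L A = x at *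
  generalize Y.L B = y at *
  clear n1 n2 n3 n4 n5
  rcases eq_or_ne x y with rfl | hxy
  · have hx : ¬ x = -x := by omega
    have hx' : ¬ -x = x := by omega
    have := h1 rfl
    simp only [hx', if_true, if_false]
    split_ifs <;> first | omega | ring
  · rcases eq_or_ne x (-y) with rfl | hxy'
    · have hx' : ¬ -y = y := by omega
      have hx : ¬ y = -y := by omega
      have := h2 rfl
      simp only [hx', hx, neg_neg, if_true, if_false]
      split_ifs <;> first | omega | ring
    · have hy : ¬ -x = y := by omega
      have hy' : ¬ -y = x := by omega
      have hy1 : ¬ y = x := by omega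
      have hy2 : ¬ -y = -x := by omega
      have hy3 : ¬ -x = -y := by omega
      simp only [hxy, hy, hy', hy1, hy2, hy3, if_false]
      split_ifs <;> first | omega | ring

lemma opT_braid4 (h : 0 < m - 1) (F : (Fin m → S) → K) (v : Fin m → S) (hv : Y.Good v) :
    Y.opT (some ⟨0, h⟩) (Y.opT none (Y.opT (some ⟨0, h⟩) (Y.opT none F))) v =
      Y.opT none (Y.opT (some ⟨0, h⟩) (Y.opT none (Y.opT (some ⟨0, h⟩) F))) v := by
  have hl : (lo (m := m) ⟨0, h⟩) = 0 := rfl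
  have s1 : ∀ A B, ∀ F : (Fin m → S) → K, Y.opT (some ⟨0, h⟩) F (pl2 v A B) =
      Y.ca A B * F (pl2 v A B) + Y.cb A B * F (pl2 v B A) := by
    intro A B F
    simp only [opT, al, be, gact, pl2_swap, hl, pl2_zero, pl2_hi]
  have s2 : ∀ A B, ∀ F : (Fin m → S) → K, Y.opT none F (pl2 v A B) = F (pl2 v (-A) B) := by
    intro A B F
    simp only [opT, al, be, gact, pl2_flip h]
    ring
  have H := Y.braid4_scalar (v 0) (v (hi ⟨0, h⟩)) (fun A B => F (pl2 v A B))
    (fun h' => hv.sub_ne Y (lo_ne_hi ⟨0, h⟩) h') (fun h' => hv.add_ne Y h')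
  rw [pl2_self h v]
  simp only [s1, s2, neg_neg]
  exact H

lemma opT_comm (s t : Fin (m - 1)) (hst : s.1 + 1 < t.1) (F : (Fin m → S) → K) (v : Fin m → S) :
    Y.opT (some s) (Y.opT (some t) F) v = Y.opT (some t) (Y.opT (some s) F) v := by
  have k1 : lo s ≠ lo t := by simp [lo]; omega
  have k2 : lo s ≠ hi t := by simp [lo, hi]; omega
  have k3 : hi s ≠ lo t := by simp [lo, hi]; omega
  have k4 : hi s ≠ hi t := by simp [hi]; omega
  have hc : swapAt s (swapAt t v) = swapAt t (swapAt s v) := by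
    funext p
    by_cases h1 : p = lo s
    · subst h1; rw [swapAt_lo, swapAt_ne t _ k3 k4, swapAt_ne t _ k1 k2, swapAt_lo]
    by_cases h2 : p = hi s
    · subst h2; rw [swapAt_hi, swapAt_ne t _ k1 k2, swapAt_ne t _ k3 k4, swapAt_hi]
    rw [swapAt_ne s _ h1 h2]
    by_cases h3 : p = lo t
    · subst h3; rw [swapAt_lo, swapAt_lo, swapAt_ne s _ k2.symm k4.symm]
    by_cases h4 : p = hi t
    · subst h4; rw [swapAt_hi, swapAt_hi, swapAt_ne s _ k1.symm k3.symm]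
    rw [swapAt_ne _ _ h3 h4, swapAt_ne _ _ h3 h4, swapAt_ne _ _ h1 h2]
  simp only [opT, al, be, gact, hc, swapAt_ne t v k1 k2, swapAt_ne t v k3 k4,
    swapAt_ne s v k1.symm k3.symm, swapAt_ne s v k2.symm k4.symm]
  ring

lemma opT_comm_pi (s : Fin (m - 1)) (hs : 0 < s.1) (F : (Fin m → S) → K) (v : Fin m → S) :
    Y.opT none (Y.opT (some s) F) v = Y.opT (some s) (Y.opT none F) v := by
  have k1 : lo s ≠ 0 := by intro h; simp [lo, Fin.ext_iff] at h; omega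
  have k2 : hi s ≠ 0 := by intro h; simp [hi, Fin.ext_iff] at h
  have hc : flip0 (swapAt s v) = swapAt s (flip0 v) := by
    funext p
    by_cases h1 : p = lo s
    · subst h1; rw [swapAt_lo, flip0_ne _ k1, flip0_ne _ k2, swapAt_lo]
    by_cases h2 : p = hi s
    · subst h2; rw [swapAt_hi, flip0_ne _ k2, flip0_ne _ k1, swapAt_hi]
    rw [swapAt_ne s _ h1 h2]
    by_cases h3 : p = 0
    · subst h3; rw [flip0_zero, flip0_zero, swapAt_ne s _ h1 h2]
    rw [flip0_ne _ h3, flip0_ne _ h3, swapAt_ne s _ h1 h2]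
  simp only [opT, al, be, gact, hc, flip0_ne v k1, flip0_ne v k2]
  ring

end Strands
end VVPaper

namespace VVPaper
namespace Strands
variable {S K : Type} [LinearOrder S] [InvolutiveNeg S] [Field K] (Y : Strands S K)
  {m : ℕ} [NeZero m]

variable (m) in
/-- The good arrangements. -/
abbrev GV : Type := {v : Fin m → S // Y.Good v}

open Classical in
/-- Extension by zero of a function on good arrangements. -/
noncomputable def ext (f : Y.GV m → K) (v : Fin m → S) : K := if h : Y.Good v then f ⟨v, h⟩ else 0

lemma ext_good (f : Y.GV m → K) {v : Fin m → S} (h : Y.Good v) : Y.ext f v = f ⟨v, h⟩ := by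
  simp [ext, h]

lemma ext_val (f : Y.GV m → K) (v : Y.GV m) : Y.ext f v.1 = f v := ext_good Y f v.2

lemma ext_add (f f' : Y.GV m → K) (v : Fin m → S) : Y.ext (f + f') v = Y.ext f v + Y.ext f' v := by
  unfold ext; split_ifs <;> simp

lemma ext_smul (c : K) (f : Y.GV m → K) (v : Fin m → S) : Y.ext (c • f) v = c * Y.ext f v := by
  unfold ext; split_ifs <;> simp

/-- The word of an arrangement. -/
def wrd (v : Fin m → S) : Fin m → ℤ := fun p => Y.L (v p)

lemma wrd_swapAt (s : Fin (m - 1)) (v : Fin m → S) : Y.wrd (swapAt s v) = swapAt s (Y.wrd v) := rfl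

lemma wrd_flip0 (v : Fin m → S) : Y.wrd (flip0 v) = flip0 (Y.wrd v) := by
  funext p
  by_cases h : p = 0
  · subst h; rw [flip0_zero]; change Y.L (flip0 v 0) = _; rw [flip0_zero, Y.L_neg]; rfl
  · rw [flip0_ne _ h]; change Y.L (flip0 v p) = _; rw [flip0_ne _ h]; rfl

/-- A generator `σ_s` or `π` acting on functions on good arrangements. -/
noncomputable def op (g : Option (Fin (m - 1))) : Module.End K (Y.GV m → K) where
  toFun f v := Y.opT g (Y.ext f) v.1
  map_add' f f' := by
    funext v
    simp only [opT, ext_add, Pi.add_apply]; ring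
  map_smul' c f := by
    funext v
    simp only [opT, ext_smul, Pi.smul_apply, smul_eq_mul, RingHom.id_apply]; ring

/-- The polynomial generator acting on functions on good arrangements. -/
def opx (p : Fin m) : Module.End K (Y.GV m → K) where
  toFun f v := Y.z (v.1 p) * f v
  map_add' f f' := by funext v; simp only [Pi.add_apply]; ring
  map_smul' c f := by funext v; simp only [Pi.smul_apply, smul_eq_mul, RingHom.id_apply]; ring

/-- The idempotent acting on functions on good arrangements. -/
def ope (w : Fin m → ℤ) : Module.End K (Y.GV m → K) where
  toFun f v := if Y.wrd v.1 = w then f v else 0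
  map_add' f f' := by funext v; simp only [Pi.add_apply]; split_ifs <;> simp
  map_smul' c f := by funext v; simp only [Pi.smul_apply, RingHom.id_apply]; split_ifs <;> simp

lemma op_apply (g : Option (Fin (m - 1))) (f : Y.GV m → K) (v : Y.GV m) :
    Y.op g f v = Y.opT g (Y.ext f) v.1 := rfl

lemma opx_apply (p : Fin m) (f : Y.GV m → K) (v : Y.GV m) :
    Y.opx p f v = Y.z (v.1 p) * f v := rfl

lemma ope_apply (w : Fin m → ℤ) (f : Y.GV m → K) (v : Y.GV m) :
    Y.ope w f v = if Y.wrd v.1 = w then f v else 0 := rfl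

lemma ext_op (g : Option (Fin (m - 1))) (f : Y.GV m → K) (v : Fin m → S) (hv : Y.Good v) :
    Y.ext (Y.op g f) v = Y.opT g (Y.ext f) v := by rw [ext_good Y _ hv]; rfl

lemma ext_opx (p : Fin m) (f : Y.GV m → K) (v : Fin m → S) :
    Y.ext (Y.opx p f) v = Y.z (v p) * Y.ext f v := by
  unfold ext; split_ifs <;> simp [opx]

lemma ext_ope (w : Fin m → ℤ) (f : Y.GV m → K) (v : Fin m → S) :
    Y.ext (Y.ope w f) v = if Y.wrd v = w then Y.ext f v else 0 := by
  unfold ext; split_ifs <;> simp_all [ope]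

lemma op_op (g h : Option (Fin (m - 1))) (f : Y.GV m → K) (v : Y.GV m) :
    Y.op g (Y.op h f) v = Y.opT g (Y.opT h (Y.ext f)) v.1 := by
  rw [op_apply]
  exact Y.opT_congr g (fun v hv => Y.ext_op h f v hv) _ v.2

lemma op_op_op (g h i : Option (Fin (m - 1))) (f : Y.GV m → K) (v : Y.GV m) :
    Y.op g (Y.op h (Y.op i f)) v = Y.opT g (Y.opT h (Y.opT i (Y.ext f))) v.1 := by
  rw [op_op]
  exact Y.opT_congr g (fun v hv => Y.opT_congr h (fun v hv => Y.ext_op i f v hv) v hv) _ v.2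

lemma op_op_op_op (g h i j : Option (Fin (m - 1))) (f : Y.GV m → K) (v : Y.GV m) :
    Y.op g (Y.op h (Y.op i (Y.op j f))) v = Y.opT g (Y.opT h (Y.opT i (Y.opT j (Y.ext f)))) v.1 := by
  rw [op_op_op]
  exact Y.opT_congr g (fun v hv => Y.opT_congr h (fun v hv => Y.opT_congr i
    (fun v hv => Y.ext_op j f v hv) v hv) v hv) _ v.2

lemma sq_ext (s : Fin (m - 1)) (w : Fin m → ℤ) (f : Y.GV m → K) (v : Y.GV m) :
    (Y.op (some s) * Y.op (some s) * Y.ope w) f v =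
      if Y.wrd v.1 = w then (if w (lo s) = w (hi s) then 0 else
       if w (hi s) = w (lo s) + 2 then Y.z (v.1 (hi s)) - Y.z (v.1 (lo s)) else
       if w (lo s) = w (hi s) + 2 then Y.z (v.1 (lo s)) - Y.z (v.1 (hi s)) else 1) * f v else 0 := by
  simp only [Module.End.mul_apply]
  rw [op_op, opT_sq _ _ _ _ v.2, ext_ope, ext_val]
  by_cases h : Y.wrd v.1 = w
  · subst h; rw [if_pos rfl, if_pos rfl]; rfl
  · simp [h]

lemma braid_ext (s : Fin (m - 1)) (hs : s.1 + 1 < m - 1) (w : Fin m → ℤ) (f : Y.GV m → K)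
    (v : Y.GV m) :
    (Y.op (some ⟨s.1 + 1, hs⟩) * Y.op (some s) * Y.op (some ⟨s.1 + 1, hs⟩) * Y.ope w) f v =
    (Y.op (some s) * Y.op (some ⟨s.1 + 1, hs⟩) * Y.op (some s) * Y.ope w) f v +
      if Y.wrd v.1 = w then (if w (lo s) = w (hi2 s hs) then
        if w (lo s) = w (hi s) + 2 then 1 else
        if w (hi s) = w (lo s) + 2 then -1 else 0 else 0) * f v else 0 := by
  simp only [Module.End.mul_apply]
  rw [op_op_op, op_op_op, opT_braid _ _ _ _ _ v.2, ext_ope, ext_val]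
  by_cases h : Y.wrd v.1 = w
  · subst h; rw [if_pos rfl, if_pos rfl]; rfl
  · simp [h]

variable (k : Type) [Field k] [Algebra k K]

/-- The strand representation of a VV algebra. -/
noncomputable def rep (Wd : Finset (Fin m → ℤ)) (hWd : ∀ v, Y.Good v → Y.wrd v ∈ Wd) :
    VVAlg k Wd (Module.End K (Y.GV m → K)) where
  x := Y.opx
  sg s := Y.op (some s)
  pi := Y.op none
  e := Y.ope
  e_zero w hw := by
    ext1 f; funext v
    rw [ope_apply, if_neg]; rfl
    rintro rfl; exact hw (hWd _ v.2)
  e_mul w := by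
    ext1 f; funext v
    simp only [Module.End.mul_apply, ope_apply]; split_ifs <;> rfl
  e_orth w w' h := by
    ext1 f; funext v
    simp only [Module.End.mul_apply, ope_apply]
    split_ifs with h1 h2
    · exact absurd (h1.symm.trans h2) h
    · rfl
    · rfl
  e_sum := by
    ext1 f; funext v
    rw [LinearMap.sum_apply, Finset.sum_apply]
    simp only [ope_apply]
    rw [Finset.sum_ite_eq, if_pos (hWd _ v.2)]; rfl
  x_comm a b := by
    ext1 f; funext v
    simp only [Module.End.mul_apply, opx_apply]; ring
  x_e a w := by
    ext1 f; funext v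
    simp only [Module.End.mul_apply, opx_apply, ope_apply]; split_ifs <;> simp
  sg_e s w := by
    ext1 f; funext v
    simp only [Module.End.mul_apply, ope_apply, op_apply, opT, ext_ope]
    have h2 : Y.wrd (gact (some s) v.1) = w ↔ Y.wrd v.1 = swapAt s w := by
      change swapAt s (Y.wrd v.1) = w ↔ _
      constructor
      · rintro rfl; rw [swapAt_swapAt]
      · intro h; rw [h, swapAt_swapAt]
    simp only [h2]
    by_cases h : Y.wrd v.1 (lo s) = Y.wrd v.1 (hi s)
    · have h3 : Y.wrd v.1 = w ↔ Y.wrd v.1 = swapAt s w := by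
        rw [← h2]; change _ ↔ swapAt s (Y.wrd v.1) = w; rw [swapAt_eq s _ h]
      simp only [h3]
      split_ifs <;> simp
    · have : Y.al (some s) v.1 = 0 := if_neg h
      simp only [this]
      split_ifs <;> simp
  sq_eq s w h := by
    ext1 f; funext v
    rw [sq_ext, if_pos h]; split_ifs <;> simp
  sq_none s w h1 h2 h3 := by
    ext1 f; funext v
    rw [sq_ext, if_neg h1, if_neg h2, if_neg h3, ope_apply]; split_ifs <;> simp
  sq_up s w h := by
    ext1 f; funext v
    rw [sq_ext, if_neg (show ¬ w (lo s) = w (hi s) by omega), if_pos h, Module.End.mul_apply, LinearMap.sub_apply, Pi.sub_apply,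
      opx_apply, opx_apply, ope_apply]
    split_ifs <;> ring
  sq_dn s w h := by
    ext1 f; funext v
    rw [sq_ext, if_neg (show ¬ w (lo s) = w (hi s) by omega),
      if_neg (show ¬ w (hi s) = w (lo s) + 2 by omega), if_pos h, Module.End.mul_apply,
      LinearMap.sub_apply, Pi.sub_apply, opx_apply, opx_apply, ope_apply]
    split_ifs <;> ring
  sg_comm s t h := by
    ext1 f; funext v
    rw [Module.End.mul_apply, Module.End.mul_apply, op_op, op_op, opT_comm _ _ _ h]
  braid_triv s hs w h := by
    ext1 f; funext v
    rw [braid_ext]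
    have : (if w (lo s) = w (hi2 s hs) then
        if w (lo s) = w (hi s) + 2 then 1 else
        if w (hi s) = w (lo s) + 2 then -1 else 0 else 0 : K) = 0 := by
      rcases h with h | h
      · rw [if_neg h]
      · rw [if_neg h.1, if_neg h.2, ite_self]
    rw [this]; simp
  braid_dn s hs w h h' := by
    ext1 f; funext v
    rw [braid_ext, if_pos h, if_pos h', LinearMap.add_apply, Pi.add_apply, ope_apply, one_mul]
  braid_up s hs w h h' := by
    ext1 f; funext v
    rw [braid_ext, if_pos h, if_neg (show ¬ w (lo s) = w (hi s) + 2 by omega), if_pos h', LinearMap.sub_apply, Pi.sub_apply, ope_apply]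
    split_ifs <;> ring
  sg_x_lo s w h := by
    ext1 f; funext v
    simp only [Module.End.mul_apply, LinearMap.sub_apply, Pi.sub_apply, opx_apply, op_apply, opT,
      ext_opx, ext_ope, ope_apply, ext_val]
    have e2 : gact (some s) v.1 (lo s) = v.1 (hi s) := swapAt_lo s v.1
    rw [e2]
    by_cases hw : Y.wrd v.1 = w
    · have hl : Y.L (v.1 (lo s)) = Y.L (v.1 (hi s)) := by subst hw; exact h
      have := v.2.sub_ne Y (lo_ne_hi s) hl
      simp only [hw, if_true, al, be, ca, cb, if_pos hl]
      field_simp; ring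
    · have hw' : ¬ Y.wrd (gact (some s) v.1) = w := by
        intro h'
        apply hw
        change swapAt s (Y.wrd v.1) = w at h'
        rw [← swapAt_swapAt s (Y.wrd v.1), h', swapAt_eq s w h]
      simp [hw, hw']
  sg_x_hi s w h := by
    ext1 f; funext v
    simp only [Module.End.mul_apply, LinearMap.add_apply, Pi.add_apply, opx_apply, op_apply, opT,
      ext_opx, ext_ope, ope_apply, ext_val]
    have e2 : gact (some s) v.1 (hi s) = v.1 (lo s) := swapAt_hi s v.1
    rw [e2]
    by_cases hw : Y.wrd v.1 = w
    · have hl : Y.L (v.1 (lo s)) = Y.L (v.1 (hi s)) := by subst hw; exact h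
      have := v.2.sub_ne Y (lo_ne_hi s) hl
      simp only [hw, if_true, al, be, ca, cb, if_pos hl]
      field_simp; ring
    · have hw' : ¬ Y.wrd (gact (some s) v.1) = w := by
        intro h'
        apply hw
        change swapAt s (Y.wrd v.1) = w at h'
        rw [← swapAt_swapAt s (Y.wrd v.1), h', swapAt_eq s w h]
      simp [hw, hw']
  sg_x s l w h := by
    ext1 f; funext v
    simp only [Module.End.mul_apply, opx_apply, op_apply, opT,
      ext_opx, ext_ope, ope_apply, ext_val]
    have e2 : gact (some s) v.1 l = v.1 (Equiv.swap (lo s) (hi s) l) := rfl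
    rw [e2]
    rcases h with h | h
    · by_cases hw : Y.wrd v.1 = w
      · have hl : ¬ Y.L (v.1 (lo s)) = Y.L (v.1 (hi s)) := by subst hw; exact h
        have : Y.al (some s) v.1 = 0 := if_neg hl
        rw [this]; ring_nf
      · simp only [hw, if_false]; ring_nf
    · rw [Equiv.swap_apply_of_ne_of_ne h.1 h.2]; ring_nf
  pi_e w := by
    ext1 f; funext v
    simp only [Module.End.mul_apply, ope_apply, op_apply, opT, ext_ope]
    have h2 : Y.wrd (gact none v.1) = w ↔ Y.wrd v.1 = flip0 w := by
      change Y.wrd (flip0 v.1) = w ↔ _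
      rw [wrd_flip0]
      constructor
      · rintro rfl; rw [flip0_flip0]
      · intro h; rw [h, flip0_flip0]
    simp only [h2, al]
    split_ifs <;> simp
  pi_sq := by
    ext1 f; funext v
    rw [Module.End.mul_apply, op_op]
    simp [opT, al, be, gact_gact, ext_val]
  pi_x0 := by
    ext1 f; funext v
    simp only [Module.End.mul_apply, LinearMap.neg_apply, Pi.neg_apply, opx_apply, op_apply, opT,
      ext_opx, al, be]
    have : gact none v.1 0 = -v.1 0 := flip0_zero _
    rw [this, Y.z_neg]; ring
  pi_x l hl := by
    ext1 f; funext v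
    simp only [Module.End.mul_apply, opx_apply, op_apply, opT, ext_opx, al, be]
    have : gact none v.1 l = v.1 l := flip0_ne _ (by rintro rfl; simp at hl)
    rw [this]; ring
  pi_sg s hs := by
    ext1 f; funext v
    rw [Module.End.mul_apply, Module.End.mul_apply, op_op, op_op, opT_comm_pi _ _ hs]
  sg_pi h1 := by
    ext1 f; funext v
    simp only [Module.End.mul_apply]
    rw [op_op_op_op, op_op_op_op, opT_braid4 _ _ _ _ v.2]

end Strands
end VVPaper

namespace VVPaper

namespace VVAlg
variable {k : Type} [Field k] {m : ℕ} [NeZero m]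
variable {Wd : Finset (Fin m → ℤ)} {R : Type} [Ring R] [Algebra k R] (A : VVAlg k Wd R)

/-- The generators `π` and `σ_s`, indexed uniformly. -/
def gn : Option (Fin (m - 1)) → R
  | none => A.pi
  | some s => A.sg s

lemma gn_e (g : Option (Fin (m - 1))) (w : Fin m → ℤ) :
    A.gn g * A.e w = A.e (gact g w) * A.gn g := by
  cases g with
  | none => exact A.pi_e w
  | some s => exact A.sg_e s w

lemma gn_sq_mem (g : Option (Fin (m - 1))) (w : Fin m → ℤ) (y : R) (hy : A.e w * y = y)
    (N : Submodule k R) (h0 : y ∈ N) (hx : ∀ p, A.x p * y ∈ N) : A.gn g * (A.gn g * y) ∈ N := by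
  cases g with
  | none =>
    change A.pi * (A.pi * y) ∈ N
    rw [← mul_assoc, A.pi_sq, one_mul]; exact h0
  | some s =>
    change A.sg s * (A.sg s * y) ∈ N
    have e1 : A.sg s * (A.sg s * y) = A.sg s * A.sg s * A.e w * y := by
      rw [mul_assoc _ (A.e w), hy, mul_assoc]
    rw [e1]
    by_cases h1 : w (lo s) = w (hi s)
    · rw [A.sq_eq s w h1, zero_mul]; exact N.zero_mem
    by_cases h2 : w (hi s) = w (lo s) + 2
    · rw [A.sq_up s w h2, mul_assoc, hy, sub_mul]
      exact N.sub_mem (hx _) (hx _)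
    by_cases h3 : w (lo s) = w (hi s) + 2
    · rw [A.sq_dn s w h3, mul_assoc, hy, sub_mul]
      exact N.sub_mem (hx _) (hx _)
    rw [A.sq_none s w h1 h3 h2, hy]; exact h0

lemma x_gn (g : Option (Fin (m - 1))) (w : Fin m → ℤ) (y : R) (hy : A.e w * y = y) (p : Fin m) :
    ∃ (p' : Fin m) (a c : k), A.x p * (A.gn g * y) = a • (A.gn g * (A.x p' * y)) + c • y := by
  cases g with
  | none =>
    change ∃ (p' : Fin m) (a c : k), A.x p * (A.pi * y) = a • (A.pi * (A.x p' * y)) + c • y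
    by_cases hp : p = 0
    · subst hp
      refine ⟨0, -1, 0, ?_⟩
      rw [← mul_assoc A.pi, A.pi_x0, neg_mul, mul_assoc]; simp
    · refine ⟨p, 1, 0, ?_⟩
      rw [← mul_assoc A.pi, A.pi_x p, mul_assoc]
      · simp
      · exact (Fin.pos_iff_ne_zero' _).2 hp
  | some s =>
    change ∃ (p' : Fin m) (a c : k), A.x p * (A.sg s * y) = a • (A.sg s * (A.x p' * y)) + c • y
    have e1 : ∀ p', A.sg s * (A.x p' * y) = A.sg s * A.x p' * A.e w * y := fun p' => by
      rw [mul_assoc _ (A.e w), hy, mul_assoc]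
    have e2 : ∀ p', A.x p' * A.sg s * A.e w * y = A.x p' * (A.sg s * y) := fun p' => by
      rw [mul_assoc _ (A.e w), hy, mul_assoc]
    by_cases h1 : w (lo s) = w (hi s)
    · by_cases hp : p = lo s
      · subst hp
        refine ⟨hi s, 1, -1, ?_⟩
        rw [e1, A.sg_x_hi s w h1, add_mul, e2, hy]; simp
      by_cases hp' : p = hi s
      · subst hp'
        refine ⟨lo s, 1, 1, ?_⟩
        rw [e1, A.sg_x_lo s w h1, sub_mul, e2, hy]; simp
      refine ⟨p, 1, 0, ?_⟩
      rw [e1, A.sg_x s p w (Or.inr ⟨hp, hp'⟩), e2, Equiv.swap_apply_of_ne_of_ne hp hp']; simp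
    · refine ⟨Equiv.swap (lo s) (hi s) p, 1, 0, ?_⟩
      rw [e1, A.sg_x s _ w (Or.inl h1), e2]; simp

lemma braid3 (s : Fin (m - 1)) (hs : s.1 + 1 < m - 1) (w : Fin m → ℤ) (y : R)
    (hy : A.e w * y = y) : ∃ c : k,
    A.sg ⟨s.1 + 1, hs⟩ * (A.sg s * (A.sg ⟨s.1 + 1, hs⟩ * y)) =
      A.sg s * (A.sg ⟨s.1 + 1, hs⟩ * (A.sg s * y)) + c • y := by
  have e1 : ∀ a b c : R, a * (b * (c * y)) = a * b * c * A.e w * y := fun a b c => by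
    rw [mul_assoc _ (A.e w), hy]; simp only [mul_assoc]
  rw [e1, e1]
  by_cases h0 : w (lo s) = w (hi2 s hs)
  · by_cases h1 : w (lo s) = w (hi s) + 2
    · exact ⟨1, by rw [A.braid_dn s hs w h0 h1, add_mul, hy, one_smul]⟩
    by_cases h2 : w (hi s) = w (lo s) + 2
    · exact ⟨-1, by rw [A.braid_up s hs w h0 h2, sub_mul, hy, neg_smul, one_smul, sub_eq_add_neg]⟩
    exact ⟨0, by rw [A.braid_triv s hs w (Or.inr ⟨h1, h2⟩), zero_smul, add_zero]⟩
  · exact ⟨0, by rw [A.braid_triv s hs w (Or.inl h0), zero_smul, add_zero]⟩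

end VVAlg

/-- Two distinct generators which commute. -/
def Far {m : ℕ} : Option (Fin (m - 1)) → Option (Fin (m - 1)) → Prop
  | none, none => False
  | none, some s => 0 < s.1
  | some s, none => 0 < s.1
  | some s, some t => s.1 + 1 < t.1 ∨ t.1 + 1 < s.1

section far
variable {m : ℕ} [NeZero m]

lemma Far.symm {g h : Option (Fin (m - 1))} (H : Far g h) : Far h g := by
  cases g <;> cases h <;> simp_all [Far]
  omega

lemma Far.gn {k : Type} [Field k] {Wd : Finset (Fin m → ℤ)} {R : Type} [Ring R] [Algebra k R]
    (A : VVAlg k Wd R) {g h : Option (Fin (m - 1))} (H : Far g h) :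
    A.gn g * A.gn h = A.gn h * A.gn g := by
  cases g with
  | none =>
    cases h with
    | none => exact H.elim
    | some s => exact A.pi_sg s H
  | some s =>
    cases h with
    | none => exact (A.pi_sg s H).symm
    | some t =>
      rcases H with H | H
      · exact A.sg_comm s t H
      · exact (A.sg_comm t s H).symm

/-- The positions moved by a generator. -/
def Touch : Option (Fin (m - 1)) → Fin m → Prop
  | none, p => p = 0
  | some s, p => p = lo s ∨ p = hi s

lemma gact_ne {V : Type} [Neg V] (g : Option (Fin (m - 1))) (v : Fin m → V) {p : Fin m}
    (h : ¬ Touch g p) : gact g v p = v p := by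
  cases g with
  | none => exact flip0_ne v h
  | some s =>
    simp only [Touch, not_or] at h
    exact swapAt_ne s v h.1 h.2

lemma Far.touch {g h : Option (Fin (m - 1))} (H : Far g h) (p : Fin m) (hp : Touch g p) :
    ¬ Touch h p := by
  cases g with
  | none =>
    cases h with
    | none => exact H.elim
    | some s =>
      have H : 0 < s.1 := H
      simp only [Touch] at hp ⊢
      subst hp
      simp only [Fin.ext_iff, lo, hi, Fin.val_zero]
      omega
  | some s =>
    cases h with
    | none =>
      have H : 0 < s.1 := H
      simp only [Touch] at hp ⊢
      simp only [Fin.ext_iff, lo, hi, Fin.val_zero] at hp ⊢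
      omega
    | some t =>
      have H : s.1 + 1 < t.1 ∨ t.1 + 1 < s.1 := H
      simp only [Touch] at hp ⊢
      simp only [Fin.ext_iff, lo, hi] at hp ⊢
      omega

lemma gact_local {V : Type} [Neg V] (g : Option (Fin (m - 1))) (v v' : Fin m → V)
    (h : ∀ p, Touch g p → v p = v' p) {p : Fin m} (hp : Touch g p) : gact g v p = gact g v' p := by
  cases g with
  | none =>
    have hp : p = 0 := hp
    subst hp
    change flip0 v 0 = flip0 v' 0
    rw [flip0_zero, flip0_zero, h 0 rfl]
  | some s =>
    change swapAt s v p = swapAt s v' p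
    rcases hp with rfl | rfl
    · rw [swapAt_lo, swapAt_lo, h _ (Or.inr rfl)]
    · rw [swapAt_hi, swapAt_hi, h _ (Or.inl rfl)]

lemma Far.gact {V : Type} [Neg V] {g h : Option (Fin (m - 1))} (H : Far g h) (v : Fin m → V) :
    gact g (gact h v) = gact h (gact g v) := by
  funext p
  by_cases hg : Touch g p
  · rw [gact_ne h _ (H.touch p hg)]
    exact gact_local g _ _ (fun q hq => gact_ne h _ (H.touch q hq)) hg
  by_cases hh : Touch h p
  · rw [gact_ne g _ hg]
    exact (gact_local h _ _ (fun q hq => gact_ne g _ (H.symm.touch q hq)) hh).symm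
  rw [gact_ne _ _ hg, gact_ne _ _ hh, gact_ne _ _ hh, gact_ne _ _ hg]

lemma trichotomy_gen (g h : Option (Fin (m - 1))) : g = h ∨ Far g h ∨
    (∃ (s : Fin (m - 1)) (hs : s.1 + 1 < m - 1), g = some s ∧ h = some ⟨s.1 + 1, hs⟩) ∨
    (∃ (s : Fin (m - 1)) (hs : s.1 + 1 < m - 1), h = some s ∧ g = some ⟨s.1 + 1, hs⟩) ∨
    (∃ h0 : 0 < m - 1, g = none ∧ h = some ⟨0, h0⟩) ∨
    (∃ h0 : 0 < m - 1, h = none ∧ g = some ⟨0, h0⟩) := by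
  cases g with
  | none =>
    cases h with
    | none => exact Or.inl rfl
    | some s =>
      by_cases hs : s.1 = 0
      · have h0 : 0 < m - 1 := by omega
        exact Or.inr (Or.inr (Or.inr (Or.inr (Or.inl ⟨h0, rfl, by rw [Option.some_inj]; exact Fin.ext hs⟩))))
      · exact Or.inr (Or.inl (Nat.pos_of_ne_zero hs))
  | some s =>
    cases h with
    | none =>
      by_cases hs : s.1 = 0
      · have h0 : 0 < m - 1 := by omega
        exact Or.inr (Or.inr (Or.inr (Or.inr (Or.inr ⟨h0, rfl, by rw [Option.some_inj]; exact Fin.ext hs⟩))))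
      · exact Or.inr (Or.inl (Nat.pos_of_ne_zero hs))
    | some t =>
      by_cases h1 : s.1 = t.1
      · left; rw [Option.some_inj]; exact Fin.ext h1
      by_cases h2 : s.1 + 1 = t.1
      · right; right; left
        exact ⟨s, by omega, rfl, by rw [Option.some_inj]; exact Fin.ext h2.symm⟩
      by_cases h3 : t.1 + 1 = s.1
      · right; right; right; left
        exact ⟨t, by omega, rfl, by rw [Option.some_inj]; exact Fin.ext h3.symm⟩
      · right; left
        change s.1 + 1 < t.1 ∨ t.1 + 1 < s.1
        omega

end far

namespace Strands
variable {S K : Type} [LinearOrder S] [InvolutiveNeg S] {m : ℕ} [NeZero m]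

lemma descent_local {g : Option (Fin (m - 1))} {v v' : Fin m → S}
    (h : ∀ p, Touch g p → v p = v' p) : Descent g v ↔ Descent g v' := by
  cases g with
  | none => change v 0 < -v 0 ↔ v' 0 < -v' 0; rw [h 0 rfl]
  | some s =>
    change v (hi s) < v (lo s) ↔ v' (hi s) < v' (lo s)
    rw [h _ (Or.inl rfl), h _ (Or.inr rfl)]

lemma Far.descent {g h : Option (Fin (m - 1))} (H : Far g h) (v : Fin m → S) :
    Descent g (gact h v) ↔ Descent g v :=
  descent_local fun _ hp => gact_ne h v (H.touch _ hp)

lemma Far.linked [Field K] (Y : Strands S K) {g h : Option (Fin (m - 1))} (H : Far g h)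
    (v : Fin m → S) : Y.Linked g (gact h v) ↔ Y.Linked g v := by
  cases g with
  | none => exact Iff.rfl
  | some s =>
    change Y.nx _ _ ↔ Y.nx _ _
    rw [gact_ne h v (H.touch _ (Or.inl rfl)), gact_ne h v (H.touch _ (Or.inr rfl))]

end Strands
end VVPaper

namespace VVPaper
namespace Strands
variable {k : Type} [Field k] {m : ℕ} [NeZero m]
variable {Wd : Finset (Fin m → ℤ)} {R : Type} [Ring R] [Algebra k R]
variable {S K : Type} [LinearOrder S] [InvolutiveNeg S] [Field K]

open Classical in
/-- The product of generators straightening an arrangement, applied to `g0`. -/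
noncomputable def bAux (A : VVAlg k Wd R) (g0 : R) : ℕ → (Fin m → S) → R
  | 0, _ => g0
  | n + 1, v => if h : ∃ g : Option (Fin (m - 1)), Descent g v
      then A.gn h.choose * bAux A g0 n (gact h.choose v) else g0

/-- The element attached to an arrangement. -/
noncomputable def bb (A : VVAlg k Wd R) (g0 : R) (v : Fin m → S) : R := bAux A g0 (inv v) v

include K in
lemma bb_step (Y : Strands S K) (A : VVAlg k Wd R) (g0 : R) {v : Fin m → S}
    (h : ∃ g : Option (Fin (m - 1)), Descent g v) :
    ∃ g, Descent g v ∧ bb A g0 v = A.gn g * bb A g0 (gact g v) := by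
  refine ⟨h.choose, h.choose_spec, ?_⟩
  have h1 := Y.inv_act h.choose_spec
  unfold bb
  rw [← h1, bAux, dif_pos h]

lemma bb_base (A : VVAlg k Wd R) (g0 : R) {v : Fin m → S}
    (h : ∀ g : Option (Fin (m - 1)), ¬ Descent g v) : bb A g0 v = g0 := by
  unfold bb
  cases inv v with
  | zero => rfl
  | succ n => rw [bAux, dif_neg (by push Not; exact h)]

lemma wrd_gact (Y : Strands S K) (g : Option (Fin (m - 1))) (v : Fin m → S) :
    Y.wrd (gact g v) = gact g (Y.wrd v) := by
  cases g with
  | none => exact Y.wrd_flip0 v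
  | some s => exact Y.wrd_swapAt s v

/-- Successive descents. -/
def Path : List (Option (Fin (m - 1))) → (Fin m → S) → Prop
  | [], _ => True
  | g :: l, v => Descent g v ∧ Path l (gact g v)

/-- The end point of a sequence of moves. -/
def pact : List (Option (Fin (m - 1))) → (Fin m → S) → (Fin m → S)
  | [], v => v
  | g :: l, v => pact l (gact g v)

/-- Left multiplication by a product of generators. -/
def pgn (A : VVAlg k Wd R) : List (Option (Fin (m - 1))) → R → R
  | [], y => y
  | g :: l, y => A.gn g * pgn A l y

/-- The polynomial subalgebra. -/
def _root_.VVPaper.VVAlg.P (A : VVAlg k Wd R) : Subalgebra k R := Algebra.adjoin k (Set.range A.x)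

/-- The data under which straightening works. -/
structure Str (A : VVAlg k Wd R) (Y : Strands S K) (v0 : Fin m → S) : Prop where
  good : Y.Good v0
  nodesc : ∀ g, ¬ Descent g v0
  link : ∀ g, Y.Linked g v0 → A.gn g * A.e (Y.wrd v0) = 0

namespace Str
variable {A : VVAlg k Wd R} {Y : Strands S K} {v0 : Fin m → S} (H : Str A Y v0)

/-- The straightened element attached to `v`. -/
noncomputable def b (_ : Str A Y v0) (v : Fin m → S) : R := bb A (A.e (Y.wrd v0)) v

lemma b_step {v : Fin m → S} (h : ∃ g : Option (Fin (m - 1)), Descent g v) :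
    ∃ g, Descent g v ∧ H.b v = A.gn g * H.b (gact g v) := bb_step Y A _ h

lemma eq_or_step {v : Fin m → S} (hv : Y.Good v) : v = v0 ∨
    ∃ g, Descent g v ∧ Y.Good (gact g v) ∧ inv (gact g v) + 1 = inv v ∧
      H.b v = A.gn g * H.b (gact g v) := by
  by_cases h : ∃ g : Option (Fin (m - 1)), Descent g v
  · obtain ⟨g, h1, h2⟩ := H.b_step h
    exact Or.inr ⟨g, h1, hv.act (Good.not_linked h1), Y.inv_act h1, h2⟩
  · push Not at h
    exact Or.inl (hv.eq_of_no_descent H.good h H.nodesc)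

lemma b_v0 : H.b v0 = A.e (Y.wrd v0) := bb_base A _ H.nodesc

/-- Induction along descents. -/
lemma ind {p : (Fin m → S) → Prop} (h0 : p v0)
    (h1 : ∀ v g, Y.Good v → Descent g v → Y.Good (gact g v) → inv (gact g v) + 1 = inv v →
      H.b v = A.gn g * H.b (gact g v) → p (gact g v) → p v) : ∀ v, Y.Good v → p v := by
  have : ∀ n v, Y.Good v → inv v = n → p v := by
    intro n
    induction n using Nat.strong_induction_on with
    | _ n ih =>
      intro v hv hn
      rcases H.eq_or_step hv with rfl | ⟨g, a, b, c, d⟩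
      · exact h0
      · exact h1 v g hv a b c d (ih _ (by omega) _ b rfl)
  exact fun v hv => this _ v hv rfl

lemma e_b {v : Fin m → S} (hv : Y.Good v) : A.e (Y.wrd v) * H.b v = H.b v := by
  refine H.ind (p := fun v => A.e (Y.wrd v) * H.b v = H.b v) ?_ ?_ v hv
  · rw [b_v0, A.e_mul]
  · intro v g hv hd hv' _ hb ih
    have : Y.wrd v = gact g (Y.wrd (gact g v)) := by rw [← wrd_gact, gact_gact]
    rw [hb, ← mul_assoc, this, ← A.gn_e, mul_assoc, ih]

lemma b_e {v : Fin m → S} (hv : Y.Good v) : H.b v * A.e (Y.wrd v0) = H.b v := by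
  refine H.ind (p := fun v => H.b v * A.e (Y.wrd v0) = H.b v) ?_ ?_ v hv
  · rw [b_v0, A.e_mul]
  · intro v g hv hd hv' _ hb ih
    rw [hb, mul_assoc, ih]

/-- The span of the elements of length below `n`. -/
def T (n : ℕ) : Submodule k R :=
  Submodule.span k {y | ∃ v, Y.Good v ∧ inv v < n ∧ ∃ c ∈ A.P, y = H.b v * c}

lemma T_mono {n n' : ℕ} (h : n ≤ n') : H.T n ≤ H.T n' :=
  Submodule.span_mono fun _ ⟨v, h1, h2, h3⟩ => ⟨v, h1, by omega, h3⟩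

lemma T_right {n : ℕ} {y c : R} (hy : y ∈ H.T n) (hc : c ∈ A.P) : y * c ∈ H.T n := by
  induction hy using Submodule.span_induction with
  | mem y hy =>
    obtain ⟨v, h1, h2, d, hd, rfl⟩ := hy
    exact Submodule.subset_span ⟨v, h1, h2, d * c, mul_mem hd hc, by rw [mul_assoc]⟩
  | zero => rw [zero_mul]; exact Submodule.zero_mem _
  | add y z _ _ h1 h2 => rw [add_mul]; exact Submodule.add_mem _ h1 h2
  | smul a y _ h1 => rw [smul_mul_assoc]; exact Submodule.smul_mem _ _ h1

lemma b_mem {n : ℕ} {v : Fin m → S} (hv : Y.Good v) (h : inv v < n) : H.b v ∈ H.T n :=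
  Submodule.subset_span ⟨v, hv, h, 1, one_mem _, by rw [mul_one]⟩

lemma T_map {n n' : ℕ} {a : R} (h : ∀ v, Y.Good v → inv v < n → a * H.b v ∈ H.T n') {y : R}
    (hy : y ∈ H.T n) : a * y ∈ H.T n' := by
  induction hy using Submodule.span_induction with
  | mem y hy =>
    obtain ⟨v, h1, h2, d, hd, rfl⟩ := hy
    rw [← mul_assoc]; exact H.T_right (h v h1 h2) hd
  | zero => rw [mul_zero]; exact Submodule.zero_mem _
  | add y z _ _ h1 h2 => rw [mul_add]; exact Submodule.add_mem _ h1 h2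
  | smul a y _ h1 => rw [mul_smul_comm]; exact Submodule.smul_mem _ _ h1

/-- Straightening along an arbitrary descent. -/
def Cc (n : ℕ) : Prop := ∀ v, Y.Good v → inv v = n → ∀ g, Descent g v →
  A.gn g * H.b (gact g v) - H.b v ∈ H.T n

/-- Straightening of non-increasing products. -/
def Cb (n : ℕ) : Prop := ∀ v, Y.Good v → inv v = n → ∀ g, (Descent g v ∨ Y.Linked g v) →
  A.gn g * H.b v ∈ H.T (n + 1)

/-- Straightening of polynomial generators. -/
def Ca (n : ℕ) : Prop := ∀ v, Y.Good v → inv v = n → ∀ p, A.x p * H.b v ∈ H.T (n + 1)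

lemma gn_T {n : ℕ} (hb : ∀ i < n, H.Cb i) (hc : ∀ i ≤ n, H.Cc i) (g : Option (Fin (m - 1))) {y : R}
    (hy : y ∈ H.T n) : A.gn g * y ∈ H.T (n + 1) := by
  refine H.T_map (fun v hv hn => ?_) hy
  by_cases h : Descent g v ∨ Y.Linked g v
  · exact H.T_mono (by omega) (hb _ hn v hv rfl g h)
  · push Not at h
    have hd := (hv.descent_or g).resolve_left h.1
    have hv' := hv.act h.2
    have e1 := Y.inv_act hd
    rw [gact_gact] at e1
    have := hc (inv (gact g v)) (by omega) _ hv' rfl g hd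
    rw [gact_gact] at this
    have h2 : H.b (gact g v) ∈ H.T (n + 1) := H.b_mem hv' (by omega)
    have h3 := Submodule.add_mem _ (H.T_mono (show _ ≤ n + 1 by omega) this) h2
    rwa [sub_add_cancel] at h3

lemma pgn_T {n : ℕ} (l : List (Option (Fin (m - 1)))) (hb : ∀ i, i + 1 < n + l.length → H.Cb i)
    (hc : ∀ i, i + 1 ≤ n + l.length → H.Cc i) {y : R}
    (hy : y ∈ H.T n) : pgn A l y ∈ H.T (n + l.length) := by
  induction l with
  | nil => exact hy
  | cons g l ih =>
    have := ih (fun i hi => hb i (by simp; omega)) (fun i hi => hc i (by simp; omega))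
    exact H.gn_T (n := n + l.length) (fun i hi => hb i (by rw [List.length_cons]; omega))
      (fun i hi => hc i (by rw [List.length_cons]; omega)) g this

lemma path_mem {n : ℕ} (hb : ∀ i < n, H.Cb i) (hc : ∀ i ≤ n, H.Cc i)
    (l : List (Option (Fin (m - 1)))) : ∀ v, Y.Good v → inv v ≤ n → Path l v →
      pgn A l (H.b (pact l v)) - H.b v ∈ H.T (inv v) := by
  induction l with
  | nil => intro v _ _ _; simp [pgn, pact]
  | cons g l ih =>
    intro v hv hn hp
    have e1 := Y.inv_act hp.1
    have h1 := ih _ (hv.act (Good.not_linked hp.1)) (by omega) hp.2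
    have h2 := H.gn_T (n := inv (gact g v)) (fun i hi => hb i (by omega))
      (fun i hi => hc i (by omega)) g h1
    rw [e1] at h2
    have h3 := hc (inv v) hn v hv rfl g hp.1
    have := Submodule.add_mem _ h2 h3
    rwa [mul_sub, sub_add_sub_cancel] at this

lemma path_good (l : List (Option (Fin (m - 1)))) : ∀ v, Y.Good v → Path l v →
    Y.Good (pact l v) ∧ inv (pact l v) + l.length = inv v := by
  induction l with
  | nil => intro v h _; exact ⟨h, rfl⟩
  | cons g l ih =>
    intro v hv hp
    obtain ⟨h1, h2⟩ := ih _ (hv.act (Good.not_linked hp.1)) hp.2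
    have e1 := Y.inv_act hp.1
    refine ⟨h1, ?_⟩
    rw [List.length_cons]
    change inv (pact l (gact g v)) + _ = _
    omega

lemma path_first {n : ℕ} (hb : ∀ i < n, H.Cb i) (hc : ∀ i < n, H.Cc i)
    (g : Option (Fin (m - 1))) (l : List (Option (Fin (m - 1)))) {v : Fin m → S} (hv : Y.Good v)
    (hn : inv v = n) (hp : Path (g :: l) v) :
    pgn A (g :: l) (H.b (pact (g :: l) v)) - A.gn g * H.b (gact g v) ∈ H.T n := by
  have e1 := Y.inv_act hp.1
  have h1 := H.path_mem (n := inv (gact g v)) (fun i hi => hb i (by omega))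
    (fun i hi => hc i (by omega)) l _ (hv.act (Good.not_linked hp.1)) le_rfl hp.2
  have h2 := H.gn_T (n := inv (gact g v)) (fun i hi => hb i (by omega))
    (fun i hi => hc i (by omega)) g h1
  rw [e1, hn, mul_sub] at h2
  exact h2

lemma two_paths {n : ℕ} (hb : ∀ i < n, H.Cb i) (hc : ∀ i < n, H.Cc i)
    (g g' : Option (Fin (m - 1))) (l l' : List (Option (Fin (m - 1)))) {v : Fin m → S}
    (hv : Y.Good v) (hn : inv v = n) (hp : Path (g :: l) v) (hp' : Path (g' :: l') v)
    (he : pact (g' :: l') v = pact (g :: l) v)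
    (hd : ∃ c : k, pgn A (g' :: l') (H.b (pact (g :: l) v)) =
      pgn A (g :: l) (H.b (pact (g :: l) v)) + c • H.b (pact (g :: l) v)) :
    A.gn g * H.b (gact g v) - A.gn g' * H.b (gact g' v) ∈ H.T n := by
  have h1 := H.path_first hb hc g l hv hn hp
  have h2 := H.path_first hb hc g' l' hv hn hp'
  obtain ⟨h3, h4⟩ := path_good _ v hv hp
  obtain ⟨c, hd⟩ := hd
  rw [he, hd] at h2
  have h5 : c • H.b (pact (g :: l) v) ∈ H.T n :=
    Submodule.smul_mem _ _ (H.b_mem h3 (by simp at h4; omega))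
  have := Submodule.sub_mem _ (Submodule.sub_mem _ h2 h1) h5
  convert this using 1
  abel

/-- Comparison of two descents. -/
lemma cc_pair {n : ℕ} (hb : ∀ i < n, H.Cb i) (hc : ∀ i < n, H.Cc i)
    (g h : Option (Fin (m - 1))) {v : Fin m → S} (hv : Y.Good v) (hn : inv v = n)
    (hg : Descent g v) (hh : Descent h v) :
    A.gn g * H.b (gact g v) - A.gn h * H.b (gact h v) ∈ H.T n := by
  have key3 : ∀ (s : Fin (m - 1)) (hs : s.1 + 1 < m - 1), Descent (some s) v →
      Descent (some ⟨s.1 + 1, hs⟩) v → A.gn (some s) * H.b (gact (some s) v) -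
        A.gn (some ⟨s.1 + 1, hs⟩) * H.b (gact (some ⟨s.1 + 1, hs⟩) v) ∈ H.T n := by
    intro s hs h1 h2
    have hl : lo (m := m) ⟨s.1 + 1, hs⟩ = hi s := rfl
    have hh : hi (m := m) ⟨s.1 + 1, hs⟩ = hi2 s hs := rfl
    have hp := pl3_self s hs v
    set a := v (lo s) with ha
    set c := v (hi s) with hc'
    set d := v (hi2 s hs) with hd'
    have h1 : c < a := h1
    have h2 : d < c := h2
    have s1 : ∀ a c d, gact (some s) (pl3 s hs v a c d) = pl3 s hs v c a d :=
      fun a c d => pl3_swap s hs v a c d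
    have s2 : ∀ a c d, gact (some ⟨s.1 + 1, hs⟩) (pl3 s hs v a c d) = pl3 s hs v a d c :=
      fun a c d => pl3_swap' s hs v a c d
    have d1 : ∀ a c d, Descent (some s) (pl3 s hs v a c d) ↔ c < a := by
      intro a c d; unfold Descent; simp only [pl3_lo, pl3_hi]
    have d2 : ∀ a c d, Descent (some ⟨s.1 + 1, hs⟩) (pl3 s hs v a c d) ↔ d < c := by
      intro a c d; unfold Descent; simp only [hl, hh, pl3_hi2, pl3_hi]
    have P1 : Path [some s, some ⟨s.1 + 1, hs⟩, some s] v := by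
      rw [hp]; simp only [Path, s1, s2, d1, d2]; exact ⟨h1, h2.trans h1, h2, trivial⟩
    have P2 : Path [some ⟨s.1 + 1, hs⟩, some s, some ⟨s.1 + 1, hs⟩] v := by
      rw [hp]; simp only [Path, s1, s2, d1, d2]; exact ⟨h2, h2.trans h1, h1, trivial⟩
    refine H.two_paths hb hc _ _ _ _ hv hn P1 P2 ?_ ?_
    · rw [hp]; simp only [pact, s1, s2]
    · exact A.braid3 s hs _ _ (H.e_b (path_good _ v hv P1).1)
  have key4 : ∀ h0 : 0 < m - 1, Descent (none) v → Descent (some ⟨0, h0⟩) v →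
      A.gn none * H.b (gact none v) -
        A.gn (some ⟨0, h0⟩) * H.b (gact (some ⟨0, h0⟩) v) ∈ H.T n := by
    intro h0 h1 h2
    obtain ⟨f, hf, s1, s2, d1, d2⟩ : ∃ f : S → S → (Fin m → S),
        v = f (v 0) (v (hi ⟨0, h0⟩)) ∧
        (∀ a c, gact (some ⟨0, h0⟩) (f a c) = f c a) ∧ (∀ a c, gact none (f a c) = f (-a) c) ∧
        (∀ a c, Descent (some ⟨0, h0⟩) (f a c) ↔ c < a) ∧ (∀ a c, Descent none (f a c) ↔ a < -a) :=
      ⟨pl2 v, pl2_self h0 v, pl2_swap h0 v, pl2_flip h0 v, fun a c => by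
        change pl2 v a c (hi ⟨0, h0⟩) < pl2 v a c 0 ↔ _; rw [pl2_zero, pl2_hi],
        fun a c => by unfold Descent; simp only [pl2_zero]⟩
    set a := v 0 with ha
    set c := v (hi ⟨0, h0⟩) with hc'
    have h1 : a < -a := h1
    have h2 : c < a := h2
    have h3 : c < -c := (h2.trans h1).trans (Y.neg_lt h2)
    have h4 : c < -a := h2.trans h1
    have h5 : -a < -c := Y.neg_lt h2
    have h6 : a < -c := h1.trans h5
    have P1 : Path [none, some ⟨0, h0⟩, none, some ⟨0, h0⟩] v := by
      rw [hf]; simp only [Path, s1, s2, d1, d2]; exact ⟨h1, h4, h3, h5, trivial⟩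
    have P2 : Path [some ⟨0, h0⟩, none, some ⟨0, h0⟩, none] v := by
      rw [hf]; simp only [Path, s1, s2, d1, d2]; exact ⟨h2, h3, h6, h1, trivial⟩
    refine H.two_paths hb hc _ _ _ _ hv hn P1 P2 ?_ ⟨0, ?_⟩
    · rw [hf]; simp only [pact, s1, s2]
    · have := congrArg (· * H.b (pact [none, some ⟨0, h0⟩, none, some ⟨0, h0⟩] v)) (A.sg_pi h0)
      simp only [mul_assoc] at this
      rw [zero_smul, add_zero]
      exact this
  have neg : ∀ {x y : R}, x - y ∈ H.T n → y - x ∈ H.T n := fun h => by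
    rw [← neg_sub]; exact Submodule.neg_mem _ h
  rcases trichotomy_gen g h with rfl | hf | ⟨s, hs, rfl, rfl⟩ | ⟨s, hs, rfl, rfl⟩ | ⟨h0, rfl, rfl⟩ |
    ⟨h0, rfl, rfl⟩
  · rw [sub_self]; exact Submodule.zero_mem _
  · refine H.two_paths hb hc g h [h] [g] hv hn ⟨hg, (Far.descent hf.symm v).2 hh, trivial⟩
      ⟨hh, (Far.descent hf v).2 hg, trivial⟩ (hf.gact v) ⟨0, ?_⟩
    rw [zero_smul, add_zero]
    simp only [pgn, ← mul_assoc, hf.gn A]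
  · exact key3 s hs hg hh
  · exact neg (key3 s hs hh hg)
  · exact key4 h0 hg hh
  · exact neg (key4 h0 hh hg)

lemma cc_step {n : ℕ} (hb : ∀ i < n, H.Cb i) (hc : ∀ i < n, H.Cc i) : H.Cc n := by
  intro v hv hn g hg
  obtain ⟨h, h1, h2⟩ := H.b_step ⟨g, hg⟩
  rw [h2]
  exact H.cc_pair hb hc g h hv hn hg h1

lemma linked_path {n : ℕ} (hb : ∀ i < n, H.Cb i) (hc : ∀ i ≤ n, H.Cc i)
    (g g' : Option (Fin (m - 1))) (l l' : List (Option (Fin (m - 1)))) {v : Fin m → S}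
    (hv : Y.Good v) (hn : inv v = n) (hp : Path l v) (hl : 0 < l.length)
    (hll : l'.length = l.length) (hlk : Y.Linked g' (pact l v))
    (hd : ∃ c : k, A.gn g * pgn A l (H.b (pact l v)) =
      pgn A l' (A.gn g' * H.b (pact l v)) + c • H.b (pact l v)) :
    A.gn g * H.b v ∈ H.T (n + 1) := by
  obtain ⟨h3, h4⟩ := path_good _ v hv hp
  have h1 := H.path_mem hb hc l v hv hn.le hp
  rw [hn] at h1
  have h2 := H.gn_T hb hc g h1
  obtain ⟨c, hd⟩ := hd
  rw [mul_sub, hd] at h2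
  have h5 : c • H.b (pact l v) ∈ H.T (n + 1) := Submodule.smul_mem _ _ (H.b_mem h3 (by omega))
  have h6 := hb (inv (pact l v)) (by omega) _ h3 rfl g' (Or.inr hlk)
  have h7 := H.pgn_T l' (fun i hi => hb i (by omega)) (fun i hi => hc i (by omega)) h6
  rw [hll, show inv (pact l v) + 1 + l.length = n + 1 by omega] at h7
  have := Submodule.sub_mem _ (Submodule.add_mem _ h7 h5) h2
  rwa [sub_sub_cancel] at this

lemma cb_linked {n : ℕ} (hb : ∀ i < n, H.Cb i) (hc : ∀ i ≤ n, H.Cc i) {v : Fin m → S}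
    (hv : Y.Good v) (hn : inv v = n) (g : Option (Fin (m - 1))) (hg : Y.Linked g v) :
    A.gn g * H.b v ∈ H.T (n + 1) := by
  rcases H.eq_or_step hv with rfl | ⟨h, hd, -, -, -⟩
  · rw [b_v0, H.link g hg]; exact Submodule.zero_mem _
  rcases trichotomy_gen g h with rfl | hf | ⟨s, hs, rfl, rfl⟩ | ⟨s, hs, rfl, rfl⟩ | ⟨h0, rfl, rfl⟩ |
    ⟨h0, rfl, rfl⟩
  · exact absurd hg (Good.not_linked hd)
  · refine H.linked_path hb hc g g [h] [h] hv hn ⟨hd, trivial⟩ Nat.one_pos rfl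
      ((Far.linked Y hf v).2 hg) ⟨0, ?_⟩
    rw [zero_smul, add_zero]
    simp only [pgn, ← mul_assoc, hf.gn A]
  · have hl : lo (m := m) ⟨s.1 + 1, hs⟩ = hi s := rfl
    have hh : hi (m := m) ⟨s.1 + 1, hs⟩ = hi2 s hs := rfl
    have k1 : lo s ≠ hi2 s hs := by simp [hi2, lo]
    have hp := pl3_self s hs v
    have hne : v (lo s) ≠ v (hi2 s hs) := fun h => k1 (hv.inj h)
    set a := v (lo s) with ha
    set c := v (hi s) with hc'
    set d := v (hi2 s hs) with hd'
    have hg : Y.nx a c := hg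
    have h2 : d < c := hd
    have h1 : d < a := lt_of_le_of_ne (not_lt.1 fun h => absurd (Y.nx_between hg h) (not_le.2 h2)) hne.symm
    have s1 : ∀ a c d, gact (some s) (pl3 s hs v a c d) = pl3 s hs v c a d :=
      fun a c d => pl3_swap s hs v a c d
    have s2 : ∀ a c d, gact (some ⟨s.1 + 1, hs⟩) (pl3 s hs v a c d) = pl3 s hs v a d c :=
      fun a c d => pl3_swap' s hs v a c d
    have d1 : ∀ a c d, Descent (some s) (pl3 s hs v a c d) ↔ c < a := by
      intro a c d; unfold Descent; simp only [pl3_lo, pl3_hi]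
    have d2 : ∀ a c d, Descent (some ⟨s.1 + 1, hs⟩) (pl3 s hs v a c d) ↔ d < c := by
      intro a c d; unfold Descent; simp only [hl, hh, pl3_hi2, pl3_hi]
    have P1 : Path [some ⟨s.1 + 1, hs⟩, some s] v := by
      rw [hp]; simp only [Path, s1, s2, d1, d2]; exact ⟨h2, h1, trivial⟩
    refine H.linked_path hb hc _ (some ⟨s.1 + 1, hs⟩) _ [some ⟨s.1 + 1, hs⟩, some s] hv hn P1
      (by simp) rfl ?_ ?_
    · rw [hp]; simp only [pact, s1, s2, Linked, hl, hh, pl3_hi, pl3_hi2]; exact hg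
    · obtain ⟨c, hc⟩ := A.braid3 s hs _ _ (H.e_b (path_good _ v hv P1).1)
      refine ⟨-c, ?_⟩
      change A.sg s * (A.sg ⟨s.1 + 1, hs⟩ * (A.sg s * _)) =
        A.sg ⟨s.1 + 1, hs⟩ * (A.sg s * (A.sg ⟨s.1 + 1, hs⟩ * _)) + _
      rw [hc, neg_smul, add_neg_cancel_right]; rfl
  · have hl : lo (m := m) ⟨s.1 + 1, hs⟩ = hi s := rfl
    have hh : hi (m := m) ⟨s.1 + 1, hs⟩ = hi2 s hs := rfl
    have k1 : lo s ≠ hi2 s hs := by simp [hi2, lo]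
    have hp := pl3_self s hs v
    have hne : v (lo s) ≠ v (hi2 s hs) := fun h => k1 (hv.inj h)
    set a := v (lo s) with ha
    set c := v (hi s) with hc'
    set d := v (hi2 s hs) with hd'
    have hg : Y.nx c d := hg
    have h2 : c < a := hd
    have h1 : d < a := lt_of_le_of_ne (Y.nx_between hg h2) hne.symm
    have s1 : ∀ a c d, gact (some s) (pl3 s hs v a c d) = pl3 s hs v c a d :=
      fun a c d => pl3_swap s hs v a c d
    have s2 : ∀ a c d, gact (some ⟨s.1 + 1, hs⟩) (pl3 s hs v a c d) = pl3 s hs v a d c :=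
      fun a c d => pl3_swap' s hs v a c d
    have d1 : ∀ a c d, Descent (some s) (pl3 s hs v a c d) ↔ c < a := by
      intro a c d; unfold Descent; simp only [pl3_lo, pl3_hi]
    have d2 : ∀ a c d, Descent (some ⟨s.1 + 1, hs⟩) (pl3 s hs v a c d) ↔ d < c := by
      intro a c d; unfold Descent; simp only [hl, hh, pl3_hi2, pl3_hi]
    have P1 : Path [some s, some ⟨s.1 + 1, hs⟩] v := by
      rw [hp]; simp only [Path, s1, s2, d1, d2]; exact ⟨h2, h1, trivial⟩
    refine H.linked_path hb hc _ (some s) _ [some s, some ⟨s.1 + 1, hs⟩] hv hn P1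
      (by simp) rfl ?_ ?_
    · rw [hp]; simp only [pact, s1, s2, Linked, pl3_hi, pl3_lo]; exact hg
    · exact A.braid3 s hs _ _ (H.e_b (path_good _ v hv P1).1)
  · exact hg.elim
  · obtain ⟨f, hf, s1, s2, d1, d2, l1⟩ : ∃ f : S → S → (Fin m → S),
        v = f (v 0) (v (hi ⟨0, h0⟩)) ∧
        (∀ a c, gact (some ⟨0, h0⟩) (f a c) = f c a) ∧ (∀ a c, gact none (f a c) = f (-a) c) ∧
        (∀ a c, Descent (some ⟨0, h0⟩) (f a c) ↔ c < a) ∧ (∀ a c, Descent none (f a c) ↔ a < -a) ∧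
        (∀ a c, Y.Linked (some ⟨0, h0⟩) (f a c) ↔ Y.nx a c) :=
      ⟨pl2 v, pl2_self h0 v, pl2_swap h0 v, pl2_flip h0 v, fun a c => by
        change pl2 v a c (hi ⟨0, h0⟩) < pl2 v a c 0 ↔ _; rw [pl2_zero, pl2_hi],
        fun a c => by unfold Descent; simp only [pl2_zero],
        fun a c => by
          change Y.nx (pl2 v a c 0) (pl2 v a c (hi ⟨0, h0⟩)) ↔ _; rw [pl2_zero, pl2_hi]⟩
    have hg : Y.nx (v 0) (v (hi ⟨0, h0⟩)) := hg
    have hne : v (hi ⟨0, h0⟩) ≠ -v 0 := hv.ne _ _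
    set a := v 0 with ha
    set c := v (hi ⟨0, h0⟩) with hc'
    have h1 : a < -a := hd
    have h2 : c < -a := lt_of_le_of_ne (Y.nx_between hg h1) hne
    have h3 : a < -c := by have := Y.neg_lt h2; rwa [neg_neg] at this
    have h4 : c < -c := lt_of_le_of_ne (Y.nx_between hg h3) (Y.ne_neg _)
    have P1 : Path [none, some ⟨0, h0⟩, none] v := by
      rw [hf]; simp only [Path, s1, s2, d1, d2]; exact ⟨h1, h2, h4, trivial⟩
    refine H.linked_path hb hc _ (some ⟨0, h0⟩) _ [none, some ⟨0, h0⟩, none] hv hn P1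
      (by simp) rfl ?_ ⟨0, ?_⟩
    · rw [hf]; simp only [pact, s1, s2, l1]; exact Y.nx_neg hg
    · have := congrArg (· * H.b (pact [none, some ⟨0, h0⟩, none] v)) (A.sg_pi h0)
      simp only [mul_assoc] at this
      rw [zero_smul, add_zero]
      exact this

lemma x_T {n : ℕ} (ha : ∀ i < n, H.Ca i) (p : Fin m) {y : R} (hy : y ∈ H.T n) :
    A.x p * y ∈ H.T n :=
  H.T_map (fun v hv hn => H.T_mono (by omega) (ha _ hn v hv rfl p)) hy

lemma cb_step {n : ℕ} (ha : ∀ i < n, H.Ca i) (hb : ∀ i < n, H.Cb i) (hc : ∀ i ≤ n, H.Cc i) :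
    H.Cb n := by
  intro v hv hn g hg
  rcases hg with hg | hg
  · have e1 := Y.inv_act hg
    have hv' := hv.act (Good.not_linked hg)
    have h1 := hc n le_rfl v hv hn g hg
    have h2 := H.gn_T hb hc g h1
    have h4 : H.b (gact g v) ∈ H.T n := H.b_mem hv' (by omega)
    have h3 : A.gn g * (A.gn g * H.b (gact g v)) ∈ H.T n :=
      A.gn_sq_mem g _ _ (H.e_b hv') _ h4 fun p => H.x_T ha p h4
    rw [mul_sub] at h2
    have := Submodule.sub_mem _ (H.T_mono (Nat.le_succ n) h3) h2
    rwa [sub_sub_cancel] at this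
  · exact H.cb_linked hb hc hv hn g hg

lemma ca_step {n : ℕ} (ha : ∀ i < n, H.Ca i) (hb : ∀ i < n, H.Cb i) (hc : ∀ i ≤ n, H.Cc i) :
    H.Ca n := by
  intro v hv hn p
  rcases H.eq_or_step hv with rfl | ⟨g, hd, hv', e1, e2⟩
  · rw [b_v0, A.x_e, ← H.b_v0]
    exact H.T_right (H.b_mem hv (by omega)) (Algebra.subset_adjoin ⟨p, rfl⟩)
  · obtain ⟨p', a, c, h⟩ := A.x_gn g _ _ (H.e_b hv') p
    have h4 : H.b (gact g v) ∈ H.T n := H.b_mem hv' (by omega)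
    rw [e2, h]
    exact Submodule.add_mem _ (Submodule.smul_mem _ _ (H.gn_T hb hc g (H.x_T ha p' h4)))
      (Submodule.smul_mem _ _ (H.T_mono (Nat.le_succ n) h4))

lemma all_C (n : ℕ) : H.Ca n ∧ H.Cb n ∧ H.Cc n := by
  induction n using Nat.strong_induction_on with
  | _ n ih =>
    have hc : ∀ i ≤ n, H.Cc i := fun i hi => by
      rcases hi.lt_or_eq with hi | rfl
      · exact (ih i hi).2.2
      · exact H.cc_step (fun i hi => (ih i hi).2.1) (fun i hi => (ih i hi).2.2)
    exact ⟨H.ca_step (fun i hi => (ih i hi).1) (fun i hi => (ih i hi).2.1) hc,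
      H.cb_step (fun i hi => (ih i hi).1) (fun i hi => (ih i hi).2.1) hc, hc n le_rfl⟩

end Str
end Strands
end VVPaper

namespace VVPaper
open Strands

/-- An algebra with VV generators acting on the strand representation, together with the standard
arrangement attached to an idempotent. -/
structure Ctx (k : Type) [Field k] {m : ℕ} [NeZero m] (Wd : Finset (Fin m → ℤ)) (R : Type) [Ring R]
    [Algebra k R] (S K : Type) [LinearOrder S] [InvolutiveNeg S] [Field K] [Algebra k K] (N : ℕ) where
  A : VVAlg k Wd R
  Y : Strands S K
  v0 : Fin m → S
  str : Str A Y v0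
  rho : R →ₐ[k] Module.End K (Y.GV m → K)
  rho_x : ∀ p, rho (A.x p) = Y.opx p
  rho_gn : ∀ g, rho (A.gn g) = Y.op g
  rho_e : ∀ w, rho (A.e w) = Y.ope w
  gen : Algebra.adjoin k (Set.range A.x ∪ Set.range A.gn ∪ Set.range A.e) = ⊤
  om : R →ₗ[k] R
  om_mul : ∀ a b, om (a * b) = om b * om a
  om_one : om 1 = 1
  om_om : ∀ a, om (om a) = a
  om_x : ∀ p, om (A.x p) = A.x p
  om_gn : ∀ g, om (A.gn g) = A.gn g
  om_e : ∀ w, om (A.e w) = A.e w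
  io : MvPolynomial (Fin N) k →ₐ[k] K
  io_inj : Function.Injective io
  pos : Fin N → Fin m
  blk : Fin m → Fin N
  z_v0 : ∀ p, Y.z (v0 p) = io (MvPolynomial.X (blk p))
  blk_pos : ∀ i, blk (pos i) = i
  x_blk : ∀ p, A.x p * A.e (Y.wrd v0) = A.x (pos (blk p)) * A.e (Y.wrd v0)

namespace Ctx
open Classical
variable {k : Type} [Field k] {m : ℕ} [NeZero m] {Wd : Finset (Fin m → ℤ)} {R : Type} [Ring R]
    [Algebra k R] {S K : Type} [LinearOrder S] [InvolutiveNeg S] [Field K] [Algebra k K] {N : ℕ}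
    (C : Ctx k Wd R S K N)

/-- The letters of the standard arrangement. -/
abbrev g : Fin m → ℤ := C.Y.wrd C.v0

/-- The idempotent of the standard arrangement. -/
abbrev eg : R := C.A.e C.g

/-- The straightened elements. -/
noncomputable abbrev b (v : C.Y.GV m) : R := C.str.b v.1

/-- The standard arrangement. -/
abbrev s0 : C.Y.GV m := ⟨C.v0, C.str.good⟩

/-- Evaluation of polynomials at an arrangement. -/
noncomputable def ev (v : Fin m → S) : MvPolynomial (Fin N) k →ₐ[k] K :=
  MvPolynomial.aeval fun i => C.Y.z (v (C.pos i))

lemma ev_X (v : Fin m → S) (i : Fin N) : C.ev v (MvPolynomial.X i) = C.Y.z (v (C.pos i)) := by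
  simp [ev]

lemma ev_v0 : C.ev C.v0 = C.io := by
  refine MvPolynomial.algHom_ext fun i => ?_
  rw [ev_X, C.z_v0, C.blk_pos]

open scoped IsMulCommutative in
lemma exists_psi : ∃ f : MvPolynomial (Fin N) k →ₐ[k] R, ∀ i, f (MvPolynomial.X i) = C.A.x (C.pos i) := by
  let P := Algebra.adjoin k (Set.range C.A.x)
  have : IsMulCommutative P := Algebra.isMulCommutative_adjoin k (by
    rintro _ ⟨a, rfl⟩ _ ⟨b, rfl⟩; exact C.A.x_comm a b)
  refine ⟨P.val.comp (MvPolynomial.aeval fun i => (⟨C.A.x (C.pos i),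
    Algebra.subset_adjoin ⟨_, rfl⟩⟩ : P)), fun i => ?_⟩
  rw [AlgHom.comp_apply, MvPolynomial.aeval_X]; rfl

/-- The polynomial subalgebra, one variable for each block. -/
noncomputable def psi : MvPolynomial (Fin N) k →ₐ[k] R := C.exists_psi.choose

lemma psi_X (i : Fin N) : C.psi (MvPolynomial.X i) = C.A.x (C.pos i) := C.exists_psi.choose_spec i

lemma psi_induct {p : R → Prop} (h1 : ∀ c : k, p (algebraMap k R c)) (h2 : ∀ a b, p a → p b → p (a + b))
    (h3 : ∀ F i, p (C.psi F) → p (C.psi F * C.A.x (C.pos i))) (F : MvPolynomial (Fin N) k) :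
    p (C.psi F) := by
  induction F using MvPolynomial.induction_on with
  | C c => rw [← MvPolynomial.algebraMap_eq, AlgHom.commutes]; exact h1 c
  | add F G hF hG => rw [map_add]; exact h2 _ _ hF hG
  | mul_X F i hF => rw [map_mul, C.psi_X]; exact h3 _ _ hF

lemma psi_e (F : MvPolynomial (Fin N) k) (w : Fin m → ℤ) : C.psi F * C.A.e w = C.A.e w * C.psi F := by
  refine C.psi_induct (p := fun a => a * C.A.e w = C.A.e w * a) ?_ ?_ ?_ F
  · intro c; exact Algebra.commutes _ _
  · intro a b ha hb; rw [add_mul, mul_add, ha, hb]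
  · intro F i h; rw [mul_assoc, C.A.x_e, ← mul_assoc, h, mul_assoc]

lemma om_algebraMap (c : k) : C.om (algebraMap k R c) = algebraMap k R c := by
  rw [Algebra.algebraMap_eq_smul_one, map_smul, C.om_one]

lemma psi_x (F : MvPolynomial (Fin N) k) (p : Fin m) : C.psi F * C.A.x p = C.A.x p * C.psi F := by
  refine C.psi_induct (p := fun a => a * C.A.x p = C.A.x p * a) ?_ ?_ ?_ F
  · intro c; exact Algebra.commutes _ _
  · intro a b ha hb; rw [add_mul, mul_add, ha, hb]
  · intro F i h; rw [mul_assoc, C.A.x_comm, ← mul_assoc, h, mul_assoc]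

lemma om_psi (F : MvPolynomial (Fin N) k) : C.om (C.psi F) = C.psi F := by
  refine C.psi_induct (p := fun a => C.om a = a) ?_ ?_ ?_ F
  · exact C.om_algebraMap
  · intro a b ha hb; rw [map_add, ha, hb]
  · intro F i h; rw [C.om_mul, h, C.om_x, C.psi_x]

lemma P_eg {c : R} (hc : c ∈ C.A.P) : ∃ F, c * C.eg = C.psi F * C.eg := by
  induction hc using Algebra.adjoin_induction with
  | mem y hy =>
    obtain ⟨p, rfl⟩ := hy
    exact ⟨MvPolynomial.X (C.blk p), by rw [C.psi_X]; exact C.x_blk p⟩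
  | algebraMap c => exact ⟨algebraMap k _ c, by rw [AlgHom.commutes]⟩
  | add a b _ _ ha hb =>
    obtain ⟨F, hF⟩ := ha; obtain ⟨G, hG⟩ := hb
    exact ⟨F + G, by rw [map_add, add_mul, add_mul, hF, hG]⟩
  | mul a b _ _ ha hb =>
    obtain ⟨F, hF⟩ := ha; obtain ⟨G, hG⟩ := hb
    refine ⟨F * G, ?_⟩
    rw [mul_assoc, hG, C.psi_e, ← mul_assoc, hF, mul_assoc, ← C.psi_e, ← mul_assoc, map_mul]

lemma eg_mul : C.eg * C.eg = C.eg := C.A.e_mul _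

lemma om_eg : C.om C.eg = C.eg := C.om_e _

lemma b_eg (v : C.Y.GV m) : C.b v * C.eg = C.b v := C.str.b_e v.2

lemma e_b (v : C.Y.GV m) : C.A.e (C.Y.wrd v.1) * C.b v = C.b v := C.str.e_b v.2

lemma b_s0 : C.b C.s0 = C.eg := C.str.b_v0

variable [Fintype S]

lemma T_span {n : ℕ} {y : R} (hy : y ∈ C.str.T n) :
    ∃ F : C.Y.GV m → MvPolynomial (Fin N) k, y = ∑ v, C.b v * C.psi (F v) := by
  induction hy using Submodule.span_induction with
  | mem y hy =>
    obtain ⟨v, h1, -, c, hc, rfl⟩ := hy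
    obtain ⟨F, hF⟩ := C.P_eg hc
    refine ⟨fun u => if u = ⟨v, h1⟩ then F else 0, ?_⟩
    rw [Finset.sum_eq_single ⟨v, h1⟩ (fun u _ h => by simp [h]) (by simp)]
    simp only [if_true]
    have hP : c * C.eg = C.eg * c := by
      clear hF
      induction hc using Algebra.adjoin_induction with
      | mem y hy => obtain ⟨p, rfl⟩ := hy; exact C.A.x_e _ _
      | algebraMap c => exact Algebra.commutes _ _
      | add a b _ _ ha hb => rw [add_mul, mul_add, ha, hb]
      | mul a b _ _ ha hb => rw [mul_assoc, hb, ← mul_assoc, ha, mul_assoc]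
    change C.b ⟨v, h1⟩ * c = _
    rw [← C.b_eg, mul_assoc, ← hP, hF, C.psi_e, ← mul_assoc, C.b_eg]
  | zero => exact ⟨0, by simp⟩
  | add y z _ _ h1 h2 =>
    obtain ⟨F, rfl⟩ := h1; obtain ⟨G, rfl⟩ := h2
    exact ⟨F + G, by simp [mul_add, Finset.sum_add_distrib]⟩
  | smul a y _ h1 =>
    obtain ⟨F, rfl⟩ := h1
    exact ⟨a • F, by simp [Finset.smul_sum]⟩

omit [Fintype S] in
lemma mem_T (h : R) : ∀ y, (∃ n, y ∈ C.str.T n) → ∃ n, h * y ∈ C.str.T n := by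
  have hh : h ∈ Algebra.adjoin k (Set.range C.A.x ∪ Set.range C.A.gn ∪ Set.range C.A.e) := by
    rw [C.gen]; trivial
  induction hh using Algebra.adjoin_induction with
  | mem a ha =>
    rintro y ⟨n, hy⟩
    rcases ha with (⟨p, rfl⟩ | ⟨g, rfl⟩) | ⟨w, rfl⟩
    · exact ⟨n, C.str.x_T (fun i _ => (C.str.all_C i).1) p hy⟩
    · exact ⟨n + 1, C.str.gn_T (fun i _ => (C.str.all_C i).2.1) (fun i _ => (C.str.all_C i).2.2) g hy⟩
    · refine ⟨n, C.str.T_map (fun v hv hn => ?_) hy⟩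
      by_cases hw : w = C.Y.wrd v
      · rw [hw, C.str.e_b hv]; exact C.str.b_mem hv hn
      · rw [← C.str.e_b hv, ← mul_assoc, C.A.e_orth _ _ hw, zero_mul]; exact Submodule.zero_mem _
  | algebraMap c =>
    rintro y ⟨n, hy⟩
    exact ⟨n, by rw [← Algebra.smul_def]; exact Submodule.smul_mem _ _ hy⟩
  | add a b _ _ ha hb =>
    rintro y hy
    obtain ⟨n, h1⟩ := ha y hy; obtain ⟨n', h2⟩ := hb y hy
    exact ⟨max n n', by
      rw [add_mul]
      exact Submodule.add_mem _ (C.str.T_mono (le_max_left _ _) h1) (C.str.T_mono (le_max_right _ _) h2)⟩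
  | mul a b _ _ ha hb =>
    rintro y hy
    obtain ⟨n, h1⟩ := ha _ (hb y hy)
    exact ⟨n, by rwa [mul_assoc]⟩

lemma exists_coord (h : R) (hh : h * C.eg = h) :
    ∃ F : C.Y.GV m → MvPolynomial (Fin N) k, h = ∑ v, C.b v * C.psi (F v) := by
  obtain ⟨n, hn⟩ := C.mem_T h C.eg ⟨inv C.v0 + 1, by
    have := C.str.b_mem C.str.good (Nat.lt_succ_self (inv C.v0)); rwa [C.str.b_v0] at this⟩
  rw [hh] at hn
  exact C.T_span hn

/-- The indicator function of an arrangement. -/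
noncomputable def dl (v : C.Y.GV m) : C.Y.GV m → K := Pi.single v 1

omit [Fintype S] in
lemma rho_psi (F : MvPolynomial (Fin N) k) (f : C.Y.GV m → K) (v : C.Y.GV m) :
    C.rho (C.psi F) f v = C.ev v.1 F * f v := by
  induction F using MvPolynomial.induction_on generalizing f with
  | C c =>
    rw [← MvPolynomial.algebraMap_eq, AlgHom.commutes, AlgHom.commutes, AlgHom.commutes,
      Module.algebraMap_end_apply, Pi.smul_apply, Algebra.smul_def]
  | add F G hF hG => rw [map_add, map_add, LinearMap.add_apply, Pi.add_apply, hF, hG, map_add, add_mul]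
  | mul_X F i hF =>
    rw [map_mul, map_mul, C.psi_X, C.rho_x, Module.End.mul_apply, hF, opx_apply, map_mul, C.ev_X,
      mul_assoc]

omit [Fintype S] in
lemma be_ne (g : Option (Fin (m - 1))) (v : Fin m → S) (hv : C.Y.Good v) (hv' : C.Y.Good (gact g v)) :
    C.Y.be g v ≠ 0 := by
  cases g with
  | none => exact one_ne_zero
  | some s =>
    change C.Y.cb _ _ ≠ 0
    unfold cb
    split_ifs with h1 h2
    · exact inv_ne_zero (hv.sub_ne C.Y (lo_ne_hi s) h1)
    · intro h
      have h3 := C.Y.nx_of h2 (sub_eq_zero.1 h).symm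
      obtain ⟨q, h4, h5⟩ := hv'.link (hi s) (v (hi s)) (by
        change C.Y.nx (swapAt s v (hi s)) _; rw [swapAt_hi]; exact h3)
      have : q = lo s := by
        change swapAt s v q = v (hi s) at h5
        rw [← swapAt_lo s v] at h5
        exact hv'.inj h5
      rw [this] at h4
      exact absurd h4 (by simp [Fin.lt_def, lo, hi])
    · exact one_ne_zero

omit [Fintype S] in
lemma inv_gact_le (g : Option (Fin (m - 1))) (v : Fin m → S) (hv : C.Y.Good v) :
    inv (gact g v) ≤ inv v + 1 := by
  rcases hv.descent_or g with h | h
  · have := C.Y.inv_act h; omega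
  · have := C.Y.inv_act h; rw [gact_gact] at this; omega

omit [Fintype S] in
lemma tri_left (v : C.Y.GV m) : C.rho (C.b v) (C.dl C.s0) v ≠ 0 ∧
    ∀ u, C.rho (C.b v) (C.dl C.s0) u ≠ 0 → u = v ∨ inv u.1 < inv v.1 := by
  obtain ⟨v, hv⟩ := v
  refine C.str.ind (p := fun v => ∀ hv : C.Y.Good v, C.rho (C.str.b v) (C.dl C.s0) ⟨v, hv⟩ ≠ 0 ∧
    ∀ u : C.Y.GV m, C.rho (C.str.b v) (C.dl C.s0) u ≠ 0 → u = ⟨v, hv⟩ ∨ inv u.1 < inv v) ?_ ?_ v hv hv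
  · intro hv
    have : C.rho (C.str.b C.v0) (C.dl C.s0) = C.dl C.s0 := by
      rw [C.str.b_v0, C.rho_e]
      funext u
      rw [ope_apply]
      split_ifs with h
      · rfl
      · have : u ≠ C.s0 := by rintro rfl; exact h rfl
        simp [dl, this]
    rw [this]
    refine ⟨by simp [dl], fun u hu => Or.inl ?_⟩
    by_contra hne
    exact hu (by simp only [dl]; exact Pi.single_eq_of_ne hne _)
  · intro v g hv hd hv' hi hb ih hv1
    obtain ⟨ih1, ih2⟩ := ih hv'
    have key : ∀ u : C.Y.GV m, C.rho (C.str.b v) (C.dl C.s0) u =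
        C.Y.al g u.1 * C.rho (C.str.b (gact g v)) (C.dl C.s0) u +
        C.Y.be g u.1 * C.Y.ext (C.rho (C.str.b (gact g v)) (C.dl C.s0)) (gact g u.1) := by
      intro u
      rw [hb, map_mul, Module.End.mul_apply, C.rho_gn, op_apply, opT, ext_val]
    constructor
    · rw [key, ext_good _ _ hv']
      have : C.rho (C.str.b (gact g v)) (C.dl C.s0) ⟨v, hv1⟩ = 0 := by
        by_contra hne
        rcases ih2 _ hne with h | h
        · have := congrArg (fun u => Strands.inv u.1) h
          simp only at this; omega
        · simp only at h; omega
      rw [this, mul_zero, zero_add]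
      exact mul_ne_zero (C.be_ne g v hv hv') ih1
    · intro u hu
      rw [key] at hu
      by_cases h1 : C.rho (C.str.b (gact g v)) (C.dl C.s0) u = 0
      · rw [h1, mul_zero, zero_add] at hu
        have h2 := right_ne_zero_of_mul hu
        by_cases hgu : C.Y.Good (gact g u.1)
        · rw [ext_good _ _ hgu] at h2
          rcases ih2 _ h2 with h | h
          · left
            have h3 := congrArg (fun u => gact g u.1) h
            simp only [gact_gact] at h3
            exact Subtype.ext h3
          · right
            have h3 := C.inv_gact_le g (gact g u.1) hgu
            rw [gact_gact] at h3
            simp only at h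
            omega
        · exact absurd (by simp [ext, hgu]) h2
      · rcases ih2 u h1 with h | h
        · right; rw [h]; simp only; omega
        · right; omega

omit [Fintype S] in
lemma tri_right (v : C.Y.GV m) (f : C.Y.GV m → K) (hf : ∀ u : C.Y.GV m, inv u.1 < inv v.1 → f u = 0)
    (h0 : C.rho (C.om (C.b v)) f C.s0 = 0) : f v = 0 := by
  obtain ⟨v, hv⟩ := v
  have key : ∀ hv : C.Y.Good v, ∃ c : K, c ≠ 0 ∧ ∀ f : C.Y.GV m → K,
      (∀ u : C.Y.GV m, inv u.1 < inv v → f u = 0) →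
        C.rho (C.om (C.str.b v)) f C.s0 = c * f ⟨v, hv⟩ := by
    refine C.str.ind (p := fun v => ∀ hv : C.Y.Good v, ∃ c : K, c ≠ 0 ∧ ∀ f : C.Y.GV m → K,
      (∀ u : C.Y.GV m, inv u.1 < inv v → f u = 0) →
        C.rho (C.om (C.str.b v)) f C.s0 = c * f ⟨v, hv⟩) ?_ ?_ v hv
    · intro hv
      refine ⟨1, one_ne_zero, fun f _ => ?_⟩
      rw [C.str.b_v0, C.om_e, C.rho_e, ope_apply, if_pos rfl, one_mul]
    · intro v g hv hd hv' hi hb ih hv1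
      obtain ⟨c, hc, ih⟩ := ih hv'
      refine ⟨c * C.Y.be g (gact g v), mul_ne_zero hc (C.be_ne g _ hv' (by rwa [gact_gact])),
        fun f hf => ?_⟩
      have h2 : ∀ u : C.Y.GV m, inv u.1 < inv (gact g v) → C.Y.op g f u = 0 := by
        intro u hu
        rw [op_apply, opT, ext_val, hf u (by omega), mul_zero, zero_add]
        by_cases hgu : C.Y.Good (gact g u.1)
        · rw [ext_good _ _ hgu, hf, mul_zero]
          have := C.inv_gact_le g u.1 u.2
          simp only; omega
        · simp [ext, hgu]
      rw [hb, C.om_mul, C.om_gn, map_mul, Module.End.mul_apply, C.rho_gn, ih _ h2, op_apply, opT,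
        ext_good _ _ hv', hf ⟨gact g v, hv'⟩ (by simp only; omega), gact_gact, ext_good _ _ hv1]
      ring
  obtain ⟨c, hc, h⟩ := key hv
  rw [h f hf] at h0
  exact (mul_eq_zero.1 h0).resolve_left hc

omit [Fintype S] in
lemma rho_psi_dl (F : MvPolynomial (Fin N) k) : C.rho (C.psi F) (C.dl C.s0) = C.io F • C.dl C.s0 := by
  funext u
  rw [C.rho_psi, Pi.smul_apply, smul_eq_mul]
  by_cases h : u = C.s0
  · subst h; rw [← C.ev_v0]
  · simp [dl, Pi.single_eq_of_ne h]

lemma coord_zero (F : C.Y.GV m → MvPolynomial (Fin N) k)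
    (h : C.rho (∑ v, C.b v * C.psi (F v)) (C.dl C.s0) = 0) : ∀ v, F v = 0 := by
  by_contra hne
  push Not at hne
  obtain ⟨v1, hv1⟩ := hne
  obtain ⟨v, hv, hmax⟩ := (Finset.univ.filter fun v => F v ≠ 0).exists_max_image
    (fun v => inv v.1) ⟨v1, by simpa using hv1⟩
  have hv : F v ≠ 0 := by simpa using hv
  have h2 := congrFun h v
  rw [map_sum, LinearMap.sum_apply, Finset.sum_apply, Finset.sum_eq_single v] at h2
  · rw [map_mul, Module.End.mul_apply, C.rho_psi_dl, map_smul, Pi.smul_apply, smul_eq_mul] at h2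
    rcases mul_eq_zero.1 h2 with h3 | h3
    · exact hv (C.io_inj (by rw [h3, map_zero]))
    · exact (C.tri_left v).1 h3
  · intro u _ hu
    rw [map_mul, Module.End.mul_apply, C.rho_psi_dl, map_smul, Pi.smul_apply, smul_eq_mul]
    by_cases hFu : F u = 0
    · rw [hFu, map_zero, zero_mul]
    · have h3 : C.rho (C.b u) (C.dl C.s0) v = 0 := by
        by_contra hne
        rcases (C.tri_left u).2 v hne with h4 | h4
        · exact hu h4.symm
        · have := hmax u (by simpa using hFu)
          omega
      rw [h3, mul_zero]
  · simp

/-- The coordinates of an element of the left ideal generated by the idempotent. -/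
noncomputable def co (h : R) : C.Y.GV m → MvPolynomial (Fin N) k :=
  if hh : h * C.eg = h then (C.exists_coord h hh).choose else 0

lemma co_sum {h : R} (hh : h * C.eg = h) : ∑ v, C.b v * C.psi (C.co h v) = h := by
  rw [co, dif_pos hh]; exact (C.exists_coord h hh).choose_spec.symm

lemma sum_eg (F : C.Y.GV m → MvPolynomial (Fin N) k) :
    (∑ v, C.b v * C.psi (F v)) * C.eg = ∑ v, C.b v * C.psi (F v) := by
  rw [Finset.sum_mul]
  refine Finset.sum_congr rfl fun v _ => ?_
  rw [mul_assoc, C.psi_e, ← mul_assoc, C.b_eg]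

lemma co_eq {h : R} {F : C.Y.GV m → MvPolynomial (Fin N) k} (hF : ∑ v, C.b v * C.psi (F v) = h) :
    C.co h = F := by
  have hh : h * C.eg = h := by rw [← hF, C.sum_eg]
  have := C.coord_zero (fun v => C.co h v - F v) (by
    simp only [map_sub, mul_sub, Finset.sum_sub_distrib]
    rw [C.co_sum hh, hF]; simp)
  funext v
  exact sub_eq_zero.1 (this v)

lemma inj_dl {h : R} (hh : h * C.eg = h) (h0 : C.rho h (C.dl C.s0) = 0) : h = 0 := by
  have := C.coord_zero (C.co h) (by rw [C.co_sum hh, h0])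
  rw [← C.co_sum hh]
  simp [this]

end Ctx
end VVPaper

namespace VVPaper
open Strands

lemma exists_divdiff {k : Type} [Field k] {m : ℕ} (a b : Fin m) (F : MvPolynomial (Fin m) k) :
    ∃ G, MvPolynomial.rename (Equiv.swap a b) F - F = (MvPolynomial.X a - MvPolynomial.X b) * G := by
  induction F using MvPolynomial.induction_on with
  | C c => exact ⟨0, by simp⟩
  | add F G hF hG =>
    obtain ⟨F', h1⟩ := hF; obtain ⟨G', h2⟩ := hG
    exact ⟨F' + G', by rw [map_add, mul_add, ← h1, ← h2]; ring⟩
  | mul_X F i hF =>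
    obtain ⟨F', h1⟩ := hF
    have h2 : ∃ c : MvPolynomial (Fin m) k, MvPolynomial.X (Equiv.swap a b i) - MvPolynomial.X i =
        (MvPolynomial.X a - MvPolynomial.X b) * c := by
      by_cases ha : i = a
      · subst ha; exact ⟨-1, by rw [Equiv.swap_apply_left]; ring⟩
      · by_cases hb : i = b
        · subst hb; exact ⟨1, by rw [Equiv.swap_apply_right]; ring⟩
        · exact ⟨0, by rw [Equiv.swap_apply_of_ne_of_ne ha hb]; ring⟩
    obtain ⟨c, hc⟩ := h2
    refine ⟨F' * MvPolynomial.X (Equiv.swap a b i) + F * c, ?_⟩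
    rw [map_mul, MvPolynomial.rename_X]
    linear_combination (MvPolynomial.X (Equiv.swap a b i)) * h1 + F * hc

namespace Ctx
variable {k : Type} [Field k] {m : ℕ} [NeZero m] {Wd : Finset (Fin m → ℤ)} {R : Type} [Ring R]
    [Algebra k R] {S K : Type} [LinearOrder S] [InvolutiveNeg S] [Field K] [Algebra k K] {N : ℕ}
    (C : Ctx k Wd R S K N)

open Classical in
/-- The indicator function of the standard word. -/
noncomputable def f1 : C.Y.GV m → K := fun v => if C.Y.wrd v.1 = C.g then 1 else 0

/-- Functions given by polynomials in the positions, one for each word. -/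
def Pol (f : C.Y.GV m → K) : Prop :=
  ∃ F : (Fin m → ℤ) → MvPolynomial (Fin m) k, ∀ v : C.Y.GV m,
    f v = MvPolynomial.aeval (fun p => C.Y.z (v.1 p)) (F (C.Y.wrd v.1))

lemma pol_f1 : C.Pol C.f1 := by
  classical
  refine ⟨fun w => if w = C.g then 1 else 0, fun v => ?_⟩
  simp only [f1]
  split_ifs <;> simp

lemma pol_op (g : Option (Fin (m - 1))) {f : C.Y.GV m → K} (hf : C.Pol f) : C.Pol (C.Y.op g f) := by
  classical
  obtain ⟨F, hF⟩ := hf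
  cases g with
  | none =>
    refine ⟨fun w => MvPolynomial.aeval (fun p => if p = 0 then -MvPolynomial.X p
      else MvPolynomial.X p) (F (flip0 w)), fun v => ?_⟩
    have hg : C.Y.Good (gact none v.1) := v.2.act (fun h => h)
    rw [op_apply, opT, ext_good _ _ hg, hF]
    change 0 * _ + 1 * _ = _
    rw [zero_mul, zero_add, one_mul]
    change MvPolynomial.aeval _ (F (C.Y.wrd (flip0 v.1))) = _
    rw [wrd_flip0, ← AlgHom.comp_apply, MvPolynomial.comp_aeval]
    congr 2
    funext p
    change C.Y.z (flip0 v.1 p) = _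
    by_cases h : p = 0
    · subst h; rw [flip0_zero, C.Y.z_neg]; simp
    · rw [flip0_ne _ h]; simp [h]
  | some s =>
    choose dd hdd using fun F : MvPolynomial (Fin m) k => exists_divdiff (lo s) (hi s) F
    refine ⟨fun w => if w (lo s) = w (hi s) then dd (F w) else
      if w (hi s) = w (lo s) + 2 then (MvPolynomial.X (hi s) - MvPolynomial.X (lo s)) *
        MvPolynomial.rename (Equiv.swap (lo s) (hi s)) (F (swapAt s w))
      else MvPolynomial.rename (Equiv.swap (lo s) (hi s)) (F (swapAt s w)), fun v => ?_⟩
    have hz : ∀ G : MvPolynomial (Fin m) k, MvPolynomial.aeval (fun p => C.Y.z (v.1 p))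
        (MvPolynomial.rename (Equiv.swap (lo s) (hi s)) G) =
        MvPolynomial.aeval (fun p => C.Y.z (swapAt s v.1 p)) G := by
      intro G
      rw [MvPolynomial.aeval_rename]; rfl
    rw [op_apply, opT, ext_val]
    change C.Y.ca _ _ * _ + C.Y.cb _ _ * _ = _
    unfold ca cb
    have hL : ∀ p, C.Y.wrd v.1 p = C.Y.L (v.1 p) := fun _ => rfl
    by_cases h1 : C.Y.L (v.1 (lo s)) = C.Y.L (v.1 (hi s))
    · have hnl : ¬ C.Y.Linked (some s) v.1 := fun h => by
        have := C.Y.nx_L h; omega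
      have hg := v.2.act hnl
      have hw : C.Y.wrd (gact (some s) v.1) = C.Y.wrd v.1 := by
        change C.Y.wrd (swapAt s v.1) = _
        funext p
        change C.Y.L (v.1 (Equiv.swap (lo s) (hi s) p)) = C.Y.L (v.1 p)
        by_cases ha : p = lo s
        · subst ha; rw [Equiv.swap_apply_left, h1]
        · by_cases hb : p = hi s
          · subst hb; rw [Equiv.swap_apply_right, h1]
          · rw [Equiv.swap_apply_of_ne_of_ne ha hb]
      have hne := v.2.sub_ne C.Y (lo_ne_hi s) h1
      simp only [hL]
      rw [if_pos h1, if_pos h1, if_pos h1, ext_good _ _ hg, hF, hF, hw]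
      have h3 := congrArg (MvPolynomial.aeval (fun p => C.Y.z (v.1 p))) (hdd (F (C.Y.wrd v.1)))
      rw [map_sub, map_mul, map_sub, MvPolynomial.aeval_X, MvPolynomial.aeval_X, hz] at h3
      change _ * _ + _ * MvPolynomial.aeval (fun p => C.Y.z (swapAt s v.1 p)) _ = _
      field_simp
      linear_combination h3
    · simp only [hL]
      rw [if_neg h1, if_neg h1, if_neg h1, zero_mul, zero_add]
      by_cases h2 : C.Y.L (v.1 (hi s)) = C.Y.L (v.1 (lo s)) + 2
      · rw [if_pos h2, if_pos h2, map_mul, map_sub, MvPolynomial.aeval_X, MvPolynomial.aeval_X, hz]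
        by_cases hl : C.Y.Linked (some s) v.1
        · rw [C.Y.nx_z hl, sub_self, zero_mul, zero_mul]
        · rw [ext_good _ _ (v.2.act hl), hF]; rfl
      · rw [if_neg h2, if_neg h2, one_mul, hz]
        have hl : ¬ C.Y.Linked (some s) v.1 := fun h => h2 (C.Y.nx_L h)
        rw [ext_good _ _ (v.2.act hl), hF]; rfl

lemma pol_rho (h : R) : ∀ f, C.Pol f → C.Pol (C.rho h f) := by
  classical
  have hh : h ∈ Algebra.adjoin k (Set.range C.A.x ∪ Set.range C.A.gn ∪ Set.range C.A.e) := by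
    rw [C.gen]; trivial
  induction hh using Algebra.adjoin_induction with
  | mem a ha =>
    rintro f hf
    rcases ha with (⟨p, rfl⟩ | ⟨g, rfl⟩) | ⟨w, rfl⟩
    · obtain ⟨F, hF⟩ := hf
      refine ⟨fun w => MvPolynomial.X p * F w, fun v => ?_⟩
      rw [C.rho_x, opx_apply, hF, map_mul, MvPolynomial.aeval_X]
    · rw [C.rho_gn]; exact C.pol_op g hf
    · obtain ⟨F, hF⟩ := hf
      refine ⟨fun w' => if w' = w then F w' else 0, fun v => ?_⟩
      rw [C.rho_e, ope_apply]
      by_cases h : C.Y.wrd v.1 = w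
      · simp only [if_pos h]; rw [hF]
      · simp only [if_neg h, map_zero]
  | algebraMap c =>
    rintro f ⟨F, hF⟩
    refine ⟨fun w => c • F w, fun v => ?_⟩
    rw [AlgHom.commutes, Module.algebraMap_end_apply, Pi.smul_apply, hF, map_smul]
  | add a b _ _ ha hb =>
    rintro f hf
    obtain ⟨F, hF⟩ := ha f hf; obtain ⟨G, hG⟩ := hb f hf
    exact ⟨fun w => F w + G w, fun v => by
      rw [map_add, LinearMap.add_apply, Pi.add_apply, hF, hG, map_add]⟩
  | mul a b _ _ ha hb =>
    rintro f hf
    rw [map_mul, Module.End.mul_apply]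
    exact ha _ (hb _ hf)

/-- The arrangements with the standard word. -/
def G0 (v : C.Y.GV m) : Prop := C.Y.wrd v.1 = C.g

lemma G0_s0 : C.G0 C.s0 := rfl

lemma f1_of {v : C.Y.GV m} (h : C.G0 v) : C.f1 v = 1 := if_pos h

lemma z_blk {v : C.Y.GV m} (h : C.G0 v) (p : Fin m) :
    C.Y.z (v.1 p) = C.Y.z (v.1 (C.pos (C.blk p))) := by
  have h1 := congrFun (congrArg (fun a => C.rho a C.f1) (C.x_blk p)) v
  simp only [map_mul, Module.End.mul_apply, C.rho_x, opx_apply, C.rho_e, ope_apply] at h1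
  have h' : C.Y.wrd v.1 = C.g := h
  rw [if_pos h', C.f1_of h, mul_one, mul_one] at h1
  exact h1

lemma exists_th (h : R) : ∃ G : MvPolynomial (Fin N) k, ∀ v, C.G0 v → C.rho h C.f1 v = C.ev v.1 G := by
  obtain ⟨F, hF⟩ := C.pol_rho h _ C.pol_f1
  refine ⟨MvPolynomial.rename C.blk (F C.g), fun v hv => ?_⟩
  rw [hF, hv, ev, MvPolynomial.aeval_rename]
  congr 2
  funext p
  exact C.z_blk hv p

/-- The polynomial representing the value of an element at the indicator of the standard word. -/
noncomputable def th (h : R) : MvPolynomial (Fin N) k := (C.exists_th h).choose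

lemma th_spec (h : R) {v : C.Y.GV m} (hv : C.G0 v) : C.rho h C.f1 v = C.ev v.1 (C.th h) :=
  (C.exists_th h).choose_spec v hv

lemma ev_inj {F G : MvPolynomial (Fin N) k} (h : C.ev C.v0 F = C.ev C.v0 G) : F = G := by
  rw [C.ev_v0] at h; exact C.io_inj h

lemma th_eq {h : R} {G : MvPolynomial (Fin N) k} (hG : C.rho h C.f1 C.s0 = C.ev C.v0 G) :
    C.th h = G := C.ev_inj (by rw [← hG, C.th_spec h C.G0_s0])

lemma th_add (a b : R) : C.th (a + b) = C.th a + C.th b := C.th_eq (by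
  rw [map_add, LinearMap.add_apply, Pi.add_apply, C.th_spec a C.G0_s0, C.th_spec b C.G0_s0, map_add])

lemma th_zero : C.th 0 = 0 := C.th_eq (by rw [map_zero, map_zero]; rfl)

lemma th_sum {ι : Type} (s : Finset ι) (a : ι → R) : C.th (∑ i ∈ s, a i) = ∑ i ∈ s, C.th (a i) := by
  classical
  induction s using Finset.induction_on with
  | empty => simp [C.th_zero]
  | insert i s h ih => rw [Finset.sum_insert h, Finset.sum_insert h, C.th_add, ih]

/-- The operator on polynomials attached to an algebra element. -/
noncomputable def Tt (h : R) (F : MvPolynomial (Fin N) k) : MvPolynomial (Fin N) k := C.th (h * C.psi F)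

lemma rho_psi_f1 (F : MvPolynomial (Fin N) k) {v : C.Y.GV m} (hv : C.G0 v) :
    C.rho (C.psi F) C.f1 v = C.ev v.1 F := by rw [C.rho_psi, C.f1_of hv, mul_one]

lemma Tt_spec (h : R) (F : MvPolynomial (Fin N) k) {v : C.Y.GV m} (hv : C.G0 v) :
    C.rho h (C.rho (C.psi F) C.f1) v = C.ev v.1 (C.Tt h F) := by
  rw [Tt, ← C.th_spec _ hv, map_mul]; rfl

lemma rho_eg_zero {h : R} (hh : C.eg * h = h) (f : C.Y.GV m → K) {v : C.Y.GV m} (hv : ¬ C.G0 v) :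
    C.rho h f v = 0 := by
  rw [← hh, map_mul, Module.End.mul_apply, C.rho_e, ope_apply]; exact if_neg hv

lemma f1_not {v : C.Y.GV m} (hv : ¬ C.G0 v) : C.f1 v = 0 := if_neg hv

/-- The value of an element of the left corner is again a polynomial multiple of the indicator. -/
lemma rho_Tt {h : R} (hh : C.eg * h = h) (F : MvPolynomial (Fin N) k) :
    C.rho h (C.rho (C.psi F) C.f1) = C.rho (C.psi (C.Tt h F)) C.f1 := by
  funext v
  by_cases hv : C.G0 v
  · rw [C.Tt_spec _ _ hv, C.rho_psi_f1 _ hv]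
  · rw [C.rho_eg_zero hh _ hv, C.rho_psi, C.f1_not hv, mul_zero]

lemma Tt_mul (a : R) {b : R} (hb : C.eg * b = b) (F : MvPolynomial (Fin N) k) :
    C.Tt (a * b) F = C.Tt a (C.Tt b F) := by
  refine C.th_eq ?_
  rw [map_mul, map_mul, Module.End.mul_apply, Module.End.mul_apply, C.rho_Tt hb, C.Tt_spec _ _ C.G0_s0]

lemma Tt_psi_mul (G : MvPolynomial (Fin N) k) (a : R) (F : MvPolynomial (Fin N) k) :
    C.Tt (C.psi G * a) F = G * C.Tt a F := by
  refine C.th_eq ?_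
  rw [mul_assoc, map_mul, Module.End.mul_apply, C.rho_psi, map_mul, map_mul, Module.End.mul_apply,
    C.Tt_spec _ _ C.G0_s0]

lemma Tt_mul_psi (a : R) (G F : MvPolynomial (Fin N) k) : C.Tt (a * C.psi G) F = C.Tt a (G * F) := by
  rw [Tt, Tt, mul_assoc, ← map_mul]

lemma Tt_add (a b : R) (F : MvPolynomial (Fin N) k) : C.Tt (a + b) F = C.Tt a F + C.Tt b F := by
  rw [Tt, add_mul, C.th_add]; rfl

lemma Tt_sum {ι : Type} (s : Finset ι) (a : ι → R) (F : MvPolynomial (Fin N) k) :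
    C.Tt (∑ i ∈ s, a i) F = ∑ i ∈ s, C.Tt (a i) F := by
  rw [Tt, Finset.sum_mul, C.th_sum]; rfl

lemma Tt_map_add (a : R) (F G : MvPolynomial (Fin N) k) : C.Tt a (F + G) = C.Tt a F + C.Tt a G := by
  rw [Tt, map_add, mul_add, C.th_add]; rfl

lemma Tt_zero (F : MvPolynomial (Fin N) k) : C.Tt 0 F = 0 := by rw [Tt, zero_mul, C.th_zero]

lemma Tt_eg (F : MvPolynomial (Fin N) k) : C.Tt C.eg F = F := by
  refine C.th_eq ?_
  rw [map_mul, Module.End.mul_apply, C.rho_e, ope_apply, if_pos rfl, C.rho_psi_f1 _ C.G0_s0]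

end Ctx
end VVPaper

namespace VVPaper
open Strands

/-- Homogeneous polynomials, with possibly negative degree. -/
def Homp {k : Type} [Field k] {N : ℕ} (d : ℤ) (F : MvPolynomial (Fin N) k) : Prop :=
  ∀ s, MvPolynomial.coeff s F ≠ 0 → (s.degree : ℤ) = d

/-- A context together with a grading, realised by a scaling automorphism, and the dual families of
polynomials separating the arrangements with the standard word. -/
structure Gr (k : Type) [Field k] {m : ℕ} [NeZero m] (Wd : Finset (Fin m → ℤ)) (R : Type) [Ring R]
    [Algebra k R] (S K : Type) [LinearOrder S] [InvolutiveNeg S] [Field K] [Algebra k K] (N : ℕ)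
    extends Ctx k Wd R S K N where
  p : k
  p_ne : p ≠ 0
  p_pow : ∀ n : ℕ, 0 < n → p ^ n ≠ 1
  phi : K →+* K
  phi_alg : ∀ c, phi (algebraMap k K c) = algebraMap k K c
  phi_z : ∀ A, phi (Y.z A) = p • Y.z A
  evperm : ∀ v, toCtx.G0 v → ∃ τ : Equiv.Perm (Fin N), ∀ i,
    Y.z (v.1 (pos i)) ^ 2 = io (MvPolynomial.X (τ i)) ^ 2
  J : Type
  fJ : Fintype J
  fj : J → MvPolynomial (Fin N) k
  gj : J → MvPolynomial (Fin N) k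
  df : J → ℕ
  dg : J → ℕ
  n : ℕ
  df_dg : ∀ j, df j + dg j = n
  fj_hom : ∀ j, (fj j).IsHomogeneous (df j)
  gj_hom : ∀ j, (gj j).IsHomogeneous (dg j)
  ev_orth : ∀ v v', toCtx.G0 v → toCtx.G0 v' → v ≠ v' →
    ∑ j, toCtx.ev v.1 (fj j) * toCtx.ev v'.1 (gj j) = 0
  ev_ne : ∀ v, toCtx.G0 v → ∑ j, toCtx.ev v.1 (fj j) * toCtx.ev v.1 (gj j) ≠ 0
  bd : Y.GV m → ℤ
  bd' : Y.GV m → ℤ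
  bd_hom : ∀ v f u, phi (rho (toCtx.b v) f u) =
    algebraMap k K (p ^ bd v) * rho (toCtx.b v) (fun w => phi (f w)) u
  bd'_hom : ∀ v f u, phi (rho (om (toCtx.b v)) f u) =
    algebraMap k K (p ^ bd' v) * rho (om (toCtx.b v)) (fun w => phi (f w)) u
  bd'_neg : ∀ v, toCtx.G0 v → v ≠ toCtx.s0 → bd' v ≤ -1
  vs : Y.GV m
  vs_G0 : toCtx.G0 vs
  bd_vs : bd vs = -n
  bd'_vs : bd' vs = -n

namespace Gr
variable {k : Type} [Field k] {m : ℕ} [NeZero m] {Wd : Finset (Fin m → ℤ)} {R : Type} [Ring R]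
    [Algebra k R] {S K : Type} [LinearOrder S] [InvolutiveNeg S] [Field K] [Algebra k K] {N : ℕ}
    (C : Gr k Wd R S K N)

attribute [instance] Gr.fJ

/-- Homogeneous elements of the algebra. -/
def Hom (d : ℤ) (h : R) : Prop := ∀ f u, C.phi (C.rho h f u) =
    algebraMap k K (C.p ^ d) * C.rho h (fun w => C.phi (f w)) u

lemma p_zpow {a b : ℤ} (h : C.p ^ a = C.p ^ b) : a = b := by
  have key : ∀ a b : ℤ, a < b → C.p ^ a ≠ C.p ^ b := by
    intro a b hab h
    have h1 : C.p ^ (b - a) = 1 := by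
      rw [zpow_sub₀ C.p_ne, ← h, div_self (zpow_ne_zero _ C.p_ne)]
    obtain ⟨c, hc⟩ := Int.eq_ofNat_of_zero_le (by omega : 0 ≤ b - a)
    rw [hc, zpow_natCast] at h1
    exact C.p_pow c (by omega) h1
  rcases lt_trichotomy a b with h' | h' | h'
  · exact absurd h (key _ _ h')
  · exact h'
  · exact absurd h.symm (key _ _ h')

/-- Scaling of the variables. -/
noncomputable def scl : MvPolynomial (Fin N) k →ₐ[k] MvPolynomial (Fin N) k :=
  MvPolynomial.aeval fun i => C.p • MvPolynomial.X i

lemma coeff_scl (F : MvPolynomial (Fin N) k) (s : Fin N →₀ ℕ) :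
    MvPolynomial.coeff s (C.scl F) = C.p ^ s.degree * MvPolynomial.coeff s F := by
  induction F using MvPolynomial.induction_on' with
  | monomial u a =>
    have : C.scl (MvPolynomial.monomial u a) = C.p ^ u.degree • MvPolynomial.monomial u a := by
      rw [scl, MvPolynomial.aeval_monomial, MvPolynomial.monomial_eq (a := a),
        MvPolynomial.algebraMap_eq]
      simp only [Finsupp.prod, smul_pow, Finset.prod_smul]
      rw [Finset.prod_pow_eq_pow_sum, mul_smul_comm]; rfl
    rw [this, MvPolynomial.coeff_smul, MvPolynomial.coeff_monomial, smul_eq_mul]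
    split_ifs with h
    · rw [h]
    · simp
  | add F G hF hG => rw [map_add, MvPolynomial.coeff_add, MvPolynomial.coeff_add, hF, hG, mul_add]

lemma phi_smul (c : k) (x : K) : C.phi (c • x) = c • C.phi x := by
  rw [Algebra.smul_def, map_mul, C.phi_alg, Algebra.smul_def]

lemma phi_ev (v : Fin m → S) (F : MvPolynomial (Fin N) k) : C.phi (C.ev v F) = C.ev v (C.scl F) := by
  induction F using MvPolynomial.induction_on with
  | C c => rw [← MvPolynomial.algebraMap_eq, AlgHom.commutes, AlgHom.commutes, AlgHom.commutes, C.phi_alg]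
  | add F G hF hG => rw [map_add, map_add, map_add, map_add, hF, hG]
  | mul_X F i hF => rw [map_mul, map_mul, map_mul, map_mul, hF, C.ev_X, C.phi_z, scl,
      MvPolynomial.aeval_X, map_smul, C.ev_X]

lemma Homp.scl {d : ℤ} {F : MvPolynomial (Fin N) k} (h : Homp d F) : C.scl F = (C.p ^ d) • F := by
  ext s
  rw [C.coeff_scl, MvPolynomial.coeff_smul, smul_eq_mul]
  by_cases h0 : MvPolynomial.coeff s F = 0
  · rw [h0]; simp
  · rw [← h s h0, zpow_natCast]

lemma homp_of_scl {d : ℤ} {F : MvPolynomial (Fin N) k} (h : C.scl F = (C.p ^ d) • F) : Homp d F := by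
  intro s hs
  have h1 := congrArg (MvPolynomial.coeff s) h
  rw [C.coeff_scl, MvPolynomial.coeff_smul, smul_eq_mul] at h1
  have h2 := mul_right_cancel₀ hs h1
  rw [← zpow_natCast] at h2
  exact C.p_zpow h2

lemma homp_of_phi {d : ℤ} {F : MvPolynomial (Fin N) k}
    (h : C.phi (C.ev C.v0 F) = algebraMap k K (C.p ^ d) * C.ev C.v0 F) : Homp d F := by
  refine C.homp_of_scl (C.ev_inj ?_)
  rw [← C.phi_ev, h, map_smul, Algebra.smul_def]

lemma Homp.phi {d : ℤ} {F : MvPolynomial (Fin N) k} (h : Homp d F) (v : Fin m → S) :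
    C.phi (C.ev v F) = algebraMap k K (C.p ^ d) * C.ev v F := by
  rw [C.phi_ev, Homp.scl C h, map_smul, Algebra.smul_def]

lemma homp_iff {d : ℕ} {F : MvPolynomial (Fin N) k} : Homp d F ↔ F.IsHomogeneous d := by
  constructor
  · intro h s hs
    have := h s hs
    have h2 : Finsupp.weight (1 : Fin N → ℕ) s = s.degree := (DFunLike.congr_fun Finsupp.degree_eq_weight_one s).symm
    rw [h2]; exact_mod_cast this
  · intro h s hs
    have := h hs
    have h2 : Finsupp.weight (1 : Fin N → ℕ) s = s.degree := (DFunLike.congr_fun Finsupp.degree_eq_weight_one s).symm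
    rw [h2] at this; exact_mod_cast this

lemma Homp.zero_of_neg {d : ℤ} {F : MvPolynomial (Fin N) k} (h : Homp d F) (hd : d < 0) : F = 0 := by
  ext s
  by_contra h0
  have := h s h0
  omega

lemma Homp.const {F : MvPolynomial (Fin N) k} (h : Homp 0 F) :
    F = MvPolynomial.C (MvPolynomial.coeff 0 F) := by
  ext s
  rw [MvPolynomial.coeff_C]
  split_ifs with hs
  · rw [hs]
  · by_contra h0
    have := h s h0
    have h2 : s.degree = 0 := by exact_mod_cast this
    exact hs ((Finsupp.degree_eq_zero_iff s).1 h2).symm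

include C in
lemma Homp.mul {d d' : ℤ} {F G : MvPolynomial (Fin N) k} (h : Homp d F) (h' : Homp d' G) :
    Homp (d + d') (F * G) := by
  refine C.homp_of_scl ?_
  rw [map_mul, Homp.scl C h, Homp.scl C h', zpow_add₀ C.p_ne, smul_mul_smul_comm]

include C in
lemma Homp.sum {ι : Type} (s : Finset ι) {d : ℤ} {F : ι → MvPolynomial (Fin N) k}
    (h : ∀ i ∈ s, Homp d (F i)) : Homp d (∑ i ∈ s, F i) := by
  refine C.homp_of_scl ?_
  rw [map_sum, Finset.smul_sum]
  exact Finset.sum_congr rfl fun i hi => Homp.scl C (h i hi)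

include C in
lemma homp_one : Homp 0 (1 : MvPolynomial (Fin N) k) := C.homp_of_scl (by rw [map_one]; simp)

lemma homp_zero (d : ℤ) : Homp d (0 : MvPolynomial (Fin N) k) := fun _ hs => absurd rfl hs

include C in
lemma Homp.smul {d : ℤ} {F : MvPolynomial (Fin N) k} (h : Homp d F) (c : k) : Homp d (c • F) :=
  C.homp_of_scl (by rw [map_smul, Homp.scl C h, smul_comm])

lemma Hom.mul {d d' : ℤ} {a b : R} (h : C.Hom d a) (h' : C.Hom d' b) : C.Hom (d + d') (a * b) := by
  intro f u
  rw [map_mul, Module.End.mul_apply, h, Module.End.mul_apply]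
  have : (fun w => C.phi (C.rho b f w)) =
      (algebraMap k K (C.p ^ d')) • C.rho b (fun w => C.phi (f w)) := by
    funext w; rw [h' f w]; rfl
  rw [this, map_smul, Pi.smul_apply, smul_eq_mul, zpow_add₀ C.p_ne, map_mul, mul_assoc]

lemma hom_psi {d : ℤ} {F : MvPolynomial (Fin N) k} (h : Homp d F) : C.Hom d (C.psi F) := by
  intro f u
  rw [C.rho_psi, C.rho_psi, map_mul, Homp.phi C h, mul_assoc]

lemma hom_b (v : C.Y.GV m) : C.Hom (C.bd v) (C.b v) := C.bd_hom v

lemma hom_om_b (v : C.Y.GV m) : C.Hom (C.bd' v) (C.om (C.b v)) := C.bd'_hom v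

lemma phi_f1 : (fun w => C.phi (C.f1 w)) = C.f1 := by
  classical
  funext w
  simp only [Ctx.f1]
  split_ifs <;> simp

lemma homp_th {d : ℤ} {h : R} (hh : C.Hom d h) : Homp d (C.th h) := by
  refine C.homp_of_phi ?_
  rw [← C.th_spec h C.G0_s0, hh, C.phi_f1]

lemma homp_Tt {d d' : ℤ} {h : R} {F : MvPolynomial (Fin N) k} (hh : C.Hom d h) (hF : Homp d' F) :
    Homp (d + d') (C.Tt h F) := C.homp_th (Hom.mul C hh (C.hom_psi hF))

lemma gj_homp (j : C.J) : Homp (C.dg j) (C.gj j) := homp_iff.2 (C.gj_hom j)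

lemma fj_homp (j : C.J) : Homp (C.df j) (C.fj j) := homp_iff.2 (C.fj_hom j)

end Gr
end VVPaper

namespace VVPaper
open Strands

namespace Gr
open Classical
variable {k : Type} [Field k] {m : ℕ} [NeZero m] {Wd : Finset (Fin m → ℤ)} {R : Type} [Ring R]
    [Algebra k R] {S K : Type} [LinearOrder S] [InvolutiveNeg S] [Field K] [Algebra k K] {N : ℕ}
    (C : Gr k Wd R S K N)

/-- The normalising factor of the dual families. -/
noncomputable def cc (v : C.Y.GV m) : K := ∑ j, C.ev v.1 (C.fj j) * C.ev v.1 (C.gj j)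

lemma sum_fg {u v : C.Y.GV m} (hu : C.G0 u) (hv : C.G0 v) [Decidable (v = u)] :
    ∑ j, C.ev u.1 (C.fj j) * C.ev v.1 (C.gj j) = if v = u then C.cc u else 0 := by
  split_ifs with h
  · subst h; rfl
  · exact C.ev_orth u v hu hv fun h' => h h'.symm

lemma dl_span {u : C.Y.GV m} (hu : C.G0 u) :
    ∑ j, C.ev u.1 (C.fj j) • C.rho (C.psi (C.gj j)) C.f1 = C.cc u • C.dl u := by
  classical
  funext v
  rw [Finset.sum_apply]
  simp only [Pi.smul_apply, smul_eq_mul]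
  by_cases hv : C.G0 v
  · simp_rw [C.rho_psi_f1 _ hv]
    rw [C.sum_fg hu hv]
    by_cases h : v = u
    · subst h; simp [Ctx.dl]
    · simp [Ctx.dl, h, Pi.single_eq_of_ne h]
  · have h : v ≠ u := by rintro rfl; exact hv hu
    simp_rw [C.rho_psi, C.f1_not hv]
    simp [Ctx.dl, Pi.single_eq_of_ne h]

variable [Fintype S]

/-- Elements of the corner are determined by the values on the dual family. -/
lemma faithful {h : R} (h1 : C.eg * h = h) (h2 : h * C.eg = h) (h3 : ∀ j, C.Tt h (C.gj j) = 0) : h = 0 := by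
  refine C.inj_dl h2 ?_
  have h4 := congrArg (C.rho h) (C.dl_span C.G0_s0)
  rw [map_smul, map_sum] at h4
  simp_rw [map_smul, C.rho_Tt h1, h3, map_zero] at h4
  rw [Finset.sum_eq_zero (fun j _ => by rw [LinearMap.zero_apply, smul_zero])] at h4
  exact (smul_eq_zero.1 h4.symm).resolve_left (C.ev_ne _ C.G0_s0)

omit [Fintype S] in
lemma Tt_sub (a b : R) (F : MvPolynomial (Fin N) k) : C.Tt (a - b) F = C.Tt a F - C.Tt b F := by
  rw [eq_sub_iff_add_eq, ← C.Tt_add, sub_add_cancel]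

lemma faithful_eq {a b : R} (h1 : C.eg * a = a) (h2 : a * C.eg = a) (h1' : C.eg * b = b)
    (h2' : b * C.eg = b) (h3 : ∀ F, C.Tt a F = C.Tt b F) : a = b := by
  refine sub_eq_zero.1 (C.faithful ?_ ?_ fun j => ?_)
  · rw [mul_sub, h1, h1']
  · rw [sub_mul, h2, h2']
  · rw [C.Tt_sub, h3, sub_self]

lemma zero_of_deg {h : R} (h1 : C.eg * h = h) (h2 : h * C.eg = h) {d : ℤ} (hd : C.Hom d h)
    (hn : d < -C.n) : h = 0 := by
  refine C.faithful h1 h2 fun j => ?_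
  refine Homp.zero_of_neg (C.homp_Tt hd (C.gj_homp j)) ?_
  have := C.df_dg j
  omega

/-- An element of the corner of minimal degree takes the value one. -/
lemma exists_one {h : R} (h1 : C.eg * h = h) (h2 : h * C.eg = h) (hd : C.Hom (-C.n) h) (h0 : h ≠ 0) :
    ∃ F : MvPolynomial (Fin N) k, Homp C.n F ∧ C.Tt h F = 1 := by
  by_contra hne
  push Not at hne
  refine h0 (C.faithful h1 h2 fun j => ?_)
  have hj := C.homp_Tt hd (C.gj_homp j)
  have h4 := C.df_dg j
  by_cases h3 : C.dg j = C.n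
  · by_contra h5
    rw [h3, neg_add_cancel] at hj
    set c := MvPolynomial.coeff 0 (C.Tt h (C.gj j)) with hc
    have h6 := Homp.const hj
    rw [← hc] at h6
    have hc0 : c ≠ 0 := by
      intro h; rw [h, map_zero] at h6; exact h5 h6
    refine hne (c⁻¹ • C.gj j) (Homp.smul C (h3 ▸ C.gj_homp j) _) ?_
    have h7 : c⁻¹ • C.gj j = C.gj j * MvPolynomial.C c⁻¹ := by
      rw [MvPolynomial.smul_eq_C_mul, mul_comm]
    rw [Ctx.Tt, map_smul, mul_smul_comm]
    have h8 : C.th (c⁻¹ • (h * C.psi (C.gj j))) = c⁻¹ • C.Tt h (C.gj j) := by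
      refine C.th_eq ?_
      rw [map_smul, map_smul, LinearMap.smul_apply, Pi.smul_apply, C.th_spec _ C.G0_s0]; rfl
    rw [h8, h6, MvPolynomial.smul_eq_C_mul, ← map_mul, inv_mul_cancel₀ hc0, map_one]
  · exact Homp.zero_of_neg hj (by omega)

omit [Fintype S] in
lemma eg_b {v : C.Y.GV m} (hv : C.G0 v) : C.eg * C.b v = C.b v := by
  have := C.e_b v
  rwa [hv] at this

omit [Fintype S] in
lemma eg_om_b (v : C.Y.GV m) : C.eg * C.om (C.b v) = C.om (C.b v) := by
  conv_rhs => rw [← C.b_eg, C.om_mul, C.om_eg]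

omit [Fintype S] in
lemma om_b_eg {v : C.Y.GV m} (hv : C.G0 v) : C.om (C.b v) * C.eg = C.om (C.b v) := by
  conv_rhs => rw [← C.eg_b hv, C.om_mul, C.om_eg]

omit [Fintype S] in
lemma om_b_not {v : C.Y.GV m} (hv : ¬ C.G0 v) : C.om (C.b v) * C.eg = 0 := by
  rw [← C.e_b v, C.om_mul, C.om_e, mul_assoc, C.A.e_orth _ _ hv, mul_zero]

lemma om_b_D1 {v : C.Y.GV m} (hv : v ≠ C.s0) : C.om (C.b v) * C.b C.vs = 0 := by
  by_cases h : C.G0 v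
  · refine C.zero_of_deg ?_ ?_ (Hom.mul C (C.hom_om_b v) (C.hom_b C.vs)) ?_
    · rw [← mul_assoc, C.eg_om_b]
    · rw [mul_assoc, C.b_eg]
    · have := C.bd'_neg v h hv
      rw [C.bd_vs]; omega
  · rw [← C.eg_b C.vs_G0, ← mul_assoc, C.om_b_not h, zero_mul]

omit [Fintype S] in
lemma om_zero : C.om 0 = 0 := map_zero _

lemma b_ne (v : C.Y.GV m) : C.b v ≠ 0 := by
  intro h
  have := (C.tri_left v).1
  rw [h, map_zero] at this
  exact this rfl

/-- The key element of minimal degree, fixed by the involution. -/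
lemma exists_D : ∃ D : R, C.om D = D ∧ C.Hom (-C.n) D ∧ C.eg * D = D ∧ D * C.eg = D ∧
    (∀ v, v ≠ C.s0 → C.om (C.b v) * D = 0) ∧ D ≠ 0 := by
  have hD1 : C.Hom (-C.n) (C.b C.vs) := C.bd_vs ▸ C.hom_b C.vs
  have hD2 : C.Hom (-C.n) (C.om (C.b C.vs)) := C.bd'_vs ▸ C.hom_om_b C.vs
  obtain ⟨F, hF, hF1⟩ := C.exists_one (C.eg_b C.vs_G0) (C.b_eg _) hD1 (C.b_ne _)
  obtain ⟨G, hG, hG1⟩ := C.exists_one (C.eg_om_b C.vs) (C.om_b_eg C.vs_G0) hD2 (fun h => C.b_ne C.vs (by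
    rw [← C.om_om (C.b C.vs), h, C.om_zero]))
  refine ⟨C.b C.vs * C.psi F * C.om (C.b C.vs), ?_, ?_, ?_, ?_, ?_, ?_⟩
  · rw [C.om_mul, C.om_mul, C.om_om, C.om_psi, mul_assoc]
  · have := Hom.mul C (Hom.mul C hD1 (C.hom_psi hF)) hD2
    rwa [neg_add_cancel, zero_add] at this
  · rw [← mul_assoc, ← mul_assoc, C.eg_b C.vs_G0]
  · rw [mul_assoc, C.om_b_eg C.vs_G0]
  · intro v hv
    rw [← mul_assoc, ← mul_assoc, C.om_b_D1 hv, zero_mul, zero_mul]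
  · intro h
    have h1 : C.Tt (C.b C.vs * C.psi F * C.om (C.b C.vs)) G = 1 := by
      rw [C.Tt_mul _ (C.eg_om_b _), hG1, C.Tt_mul_psi, mul_one, hF1]
    rw [h, C.Tt_zero] at h1
    exact zero_ne_one h1

/-- The key element. -/
noncomputable def D : R := C.exists_D.choose
lemma om_D : C.om C.D = C.D := C.exists_D.choose_spec.1
lemma hom_D : C.Hom (-C.n) C.D := C.exists_D.choose_spec.2.1
lemma eg_D : C.eg * C.D = C.D := C.exists_D.choose_spec.2.2.1
lemma D_eg : C.D * C.eg = C.D := C.exists_D.choose_spec.2.2.2.1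
lemma om_b_D {v : C.Y.GV m} (hv : v ≠ C.s0) : C.om (C.b v) * C.D = 0 :=
  C.exists_D.choose_spec.2.2.2.2.1 v hv
lemma D_ne : C.D ≠ 0 := C.exists_D.choose_spec.2.2.2.2.2

lemma exists_F' : ∃ F : MvPolynomial (Fin N) k, Homp C.n F ∧ C.Tt C.D F = 1 :=
  C.exists_one C.eg_D C.D_eg C.hom_D C.D_ne

/-- A polynomial on which the key element takes the value one. -/
noncomputable def F' : MvPolynomial (Fin N) k := C.exists_F'.choose
lemma homp_F' : Homp C.n C.F' := C.exists_F'.choose_spec.1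
lemma Tt_F' : C.Tt C.D C.F' = 1 := C.exists_F'.choose_spec.2

lemma rho_D (f : C.Y.GV m → K) : C.rho C.D f = (C.rho C.D f C.s0) • C.f1 := by
  have key : ∀ n, ∀ v : C.Y.GV m, inv v.1 = n → C.rho C.D f v = ((C.rho C.D f C.s0) • C.f1) v := by
    intro n
    induction n using Nat.strong_induction_on with
    | _ n ih =>
      intro v hn
      by_cases hv : C.G0 v
      · by_cases hs : v = C.s0
        · subst hs
          rw [Pi.smul_apply, C.f1_of C.G0_s0, smul_eq_mul, mul_one]
        · refine sub_eq_zero.1 (C.tri_right v (C.rho C.D f - (C.rho C.D f C.s0) • C.f1) ?_ ?_)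
          · intro u hu
            rw [Pi.sub_apply, ih (inv u.1) (by omega) u rfl, sub_self]
          · rw [map_sub, map_smul, ← Module.End.mul_apply, ← map_mul, C.om_b_D hs, map_zero,
              LinearMap.zero_apply, Pi.sub_apply, Pi.smul_apply, C.th_spec _ C.G0_s0,
              Homp.zero_of_neg (C.homp_th (C.hom_om_b v)) (by have := C.bd'_neg v hv hs; omega), map_zero,
              smul_zero]; simp
      · rw [C.rho_eg_zero C.eg_D f hv, Pi.smul_apply, C.f1_not hv, smul_zero]
  funext v
  exact key _ v rfl

omit [Fintype S] in
/-- The polynomials taking the same value at all arrangements with the standard word. -/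
def B : Subalgebra k (MvPolynomial (Fin N) k) where
  carrier := {G | ∀ v, C.G0 v → C.ev v.1 G = C.ev C.v0 G}
  mul_mem' {a b} ha hb v hv := by rw [map_mul, map_mul, ha v hv, hb v hv]
  add_mem' {a b} ha hb v hv := by rw [map_add, map_add, ha v hv, hb v hv]
  algebraMap_mem' c v _ := by rw [AlgHom.commutes, AlgHom.commutes]

lemma Tt_D_mem (F : MvPolynomial (Fin N) k) : C.Tt C.D F ∈ C.B := by
  intro v hv
  rw [← C.Tt_spec _ _ hv, C.rho_D, Pi.smul_apply, C.f1_of hv, smul_eq_mul, mul_one,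
    C.Tt_spec _ _ C.G0_s0]

omit [Fintype S] in
lemma rho_psi_B {G : MvPolynomial (Fin N) k} (hG : G ∈ C.B) (F : MvPolynomial (Fin N) k) :
    C.rho (C.psi (G * F)) C.f1 = C.ev C.v0 G • C.rho (C.psi F) C.f1 := by
  funext v
  rw [Pi.smul_apply, C.rho_psi, C.rho_psi, map_mul, smul_eq_mul]
  by_cases hv : C.G0 v
  · rw [hG v hv, mul_assoc]
  · rw [C.f1_not hv]; ring

omit [Fintype S] in
lemma Tt_B (a : R) {G : MvPolynomial (Fin N) k} (hG : G ∈ C.B) (F : MvPolynomial (Fin N) k) :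
    C.Tt a (G * F) = G * C.Tt a F := by
  refine C.th_eq ?_
  rw [map_mul C.rho, Module.End.mul_apply, C.rho_psi_B hG, map_smul, Pi.smul_apply,
    C.Tt_spec _ _ C.G0_s0, map_mul]; rfl

lemma comm_B {a : R} (h1 : C.eg * a = a) (h2 : a * C.eg = a) {G : MvPolynomial (Fin N) k}
    (hG : G ∈ C.B) : a * C.psi G = C.psi G * a := by
  refine C.faithful_eq ?_ ?_ ?_ ?_ fun F => ?_
  · rw [← mul_assoc, h1]
  · rw [mul_assoc, C.psi_e, ← mul_assoc, h2]
  · rw [← mul_assoc, ← C.psi_e, mul_assoc, h1]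
  · rw [mul_assoc, h2]
  · rw [C.Tt_mul_psi, C.Tt_B _ hG, C.Tt_psi_mul]

lemma D_comm {G : MvPolynomial (Fin N) k} (hG : G ∈ C.B) : C.D * C.psi G = C.psi G * C.D :=
  C.comm_B C.eg_D C.D_eg hG

lemma mul_D {a : R} (ha : C.eg * a = a) : ∃ F, a * C.D = C.psi F * C.D := by
  have h1 : C.om a * C.eg = C.om a := by
    conv_rhs => rw [← ha, C.om_mul, C.om_eg]
  refine ⟨C.co (C.om a) C.s0, ?_⟩
  have h2 : a = ∑ v, C.psi (C.co (C.om a) v) * C.om (C.b v) := by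
    rw [← C.om_om a]
    conv_lhs => rw [← C.co_sum h1, map_sum]
    rw [C.om_om]
    exact Finset.sum_congr rfl fun v _ => by rw [C.om_mul, C.om_psi]
  conv_lhs => rw [h2]
  rw [Finset.sum_mul, Finset.sum_eq_single C.s0]
  · rw [C.b_s0, C.om_eg, mul_assoc, C.eg_D]
  · intro v _ hv
    rw [mul_assoc, C.om_b_D hv, mul_zero]
  · simp

lemma D_mul_D (a : R) : ∃ G ∈ C.B, C.D * a * C.D = C.D * C.psi G := by
  obtain ⟨G, hG⟩ := C.mul_D (a := C.D * a) (by rw [← mul_assoc, C.eg_D])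
  have h1 : C.Tt (C.D * a * C.D) C.F' = G := by
    rw [hG, C.Tt_psi_mul, C.Tt_F', mul_one]
  have h2 : G ∈ C.B := by
    rw [← h1, mul_assoc, Ctx.Tt, mul_assoc]
    have : C.D * (a * C.D * C.psi C.F') = C.D * (C.eg * a * C.D) * C.psi C.F' := by
      rw [← mul_assoc, ← mul_assoc, ← mul_assoc, ← mul_assoc, C.D_eg]
    rw [this]
    have h3 := C.Tt_mul C.D (b := C.eg * a * C.D) (by rw [← mul_assoc, ← mul_assoc, C.eg_mul]) C.F'
    rw [Ctx.Tt] at h3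
    rw [h3]
    exact C.Tt_D_mem _
  exact ⟨G, h2, by rw [hG, C.D_comm h2]⟩

lemma D_psi_D (F : MvPolynomial (Fin N) k) : C.D * C.psi F * C.D = C.psi (C.Tt C.D F) * C.D := by
  obtain ⟨G, hG⟩ := C.mul_D (a := C.D * C.psi F) (by rw [← mul_assoc, C.eg_D])
  have h1 : C.Tt (C.D * C.psi F * C.D) C.F' = G := by
    rw [hG, C.Tt_psi_mul, C.Tt_F', mul_one]
  rw [C.Tt_mul _ C.eg_D, C.Tt_F', C.Tt_mul_psi, mul_one] at h1
  rw [hG, h1]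

/-- The weights of the key element. -/
noncomputable def lam (v : C.Y.GV m) : K := C.rho C.D (C.dl v) C.s0

lemma rho_D_s0 (f : C.Y.GV m → K) : C.rho C.D f C.s0 = ∑ v, f v * C.lam v := by
  classical
  have : f = ∑ v, f v • C.dl v := by
    funext u
    simp [Finset.sum_apply, Ctx.dl, Pi.single_apply]
  conv_lhs => rw [this, map_sum, Finset.sum_apply]
  exact Finset.sum_congr rfl fun v _ => by rw [map_smul, Pi.smul_apply]; rfl

lemma ev_Tt_D {u : C.Y.GV m} (hu : C.G0 u) (F : MvPolynomial (Fin N) k) [DecidablePred C.G0] :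
    C.ev u.1 (C.Tt C.D F) = ∑ v, if C.G0 v then C.ev v.1 F * C.lam v else 0 := by
  rw [C.Tt_D_mem F u hu, ← C.Tt_spec C.D F C.G0_s0, C.rho_D_s0]
  refine Finset.sum_congr rfl fun v _ => ?_
  split_ifs with h
  · rw [C.rho_psi_f1 _ h]
  · rw [C.rho_psi, C.f1_not h, mul_zero, zero_mul]

lemma ev_sum_fTg {u : C.Y.GV m} (hu : C.G0 u) (F : MvPolynomial (Fin N) k) :
    C.ev u.1 (∑ j, C.fj j * C.Tt C.D (C.gj j * F)) = C.lam u * C.cc u * C.ev u.1 F := by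
  classical
  rw [map_sum]
  simp_rw [map_mul, C.ev_Tt_D hu, Finset.mul_sum]
  rw [Finset.sum_comm]
  have : ∀ v : C.Y.GV m, ∑ j, C.ev u.1 (C.fj j) *
      (if C.G0 v then C.ev v.1 (C.gj j * F) * C.lam v else 0) =
      if v = u then C.lam u * C.cc u * C.ev u.1 F else 0 := by
    intro v
    by_cases hv : C.G0 v
    · have h1 := C.sum_fg hu hv
      simp only [if_pos hv]
      have h2 : ∀ j, C.ev u.1 (C.fj j) * (C.ev v.1 (C.gj j * F) * C.lam v) =
          (C.ev u.1 (C.fj j) * C.ev v.1 (C.gj j)) * (C.ev v.1 F * C.lam v) := by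
        intro j; rw [map_mul]; ring
      simp_rw [h2]
      rw [← Finset.sum_mul, h1]
      split_ifs with h
      · subst h; ring
      · ring
    · have h : v ≠ u := by rintro rfl; exact hv hu
      simp [hv, h]
  simp_rw [this]
  simp

lemma exists_q : ∃ q : k, q ≠ 0 ∧ ∀ F, ∑ j, C.fj j * C.Tt C.D (C.gj j * F) = MvPolynomial.C q * F := by
  set Q := ∑ j, C.fj j * C.Tt C.D (C.gj j * 1) with hQ
  have h0 : Homp 0 Q := by
    refine Homp.sum C _ fun j _ => ?_
    have := Homp.mul C (C.fj_homp j) (C.homp_Tt C.hom_D (C.gj_homp j))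
    have h2 := C.df_dg j
    rw [mul_one]
    convert this using 1
    omega
  have h1 := Homp.const h0
  have hF : ∀ F, ∑ j, C.fj j * C.Tt C.D (C.gj j * F) = Q * F := by
    intro F
    refine C.ev_inj ?_
    rw [C.ev_sum_fTg C.G0_s0, map_mul, hQ, C.ev_sum_fTg C.G0_s0, map_one, mul_one]
  refine ⟨MvPolynomial.coeff 0 Q, fun hq => ?_, fun F => by rw [← h1]; exact hF F⟩
  classical
  rw [hq, map_zero] at h1
  have h2 : ∀ u, C.G0 u → C.lam u = 0 := by
    intro u hu
    have h3 := C.ev_sum_fTg hu 1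
    rw [← hQ, h1, map_zero, map_one, mul_one] at h3
    exact (mul_eq_zero.1 h3.symm).resolve_right (C.ev_ne u hu)
  have h4 := C.ev_Tt_D C.G0_s0 C.F'
  rw [C.Tt_F', map_one, Finset.sum_eq_zero] at h4
  · exact one_ne_zero h4
  · intro v _
    split_ifs with h
    · rw [h2 v h, mul_zero]
    · rfl

/-- The constant relating the dual families and the key element. -/
noncomputable def q : k := C.exists_q.choose
lemma q_ne : C.q ≠ 0 := C.exists_q.choose_spec.1
lemma sum_fTg (F : MvPolynomial (Fin N) k) :
    ∑ j, C.fj j * C.Tt C.D (C.gj j * F) = MvPolynomial.C C.q * F := C.exists_q.choose_spec.2 F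

lemma sum_fDg : ∑ j, C.psi (C.fj j) * C.D * C.psi (C.gj j) = C.psi (MvPolynomial.C C.q) * C.eg := by
  refine C.faithful_eq ?_ ?_ ?_ ?_ fun F => ?_
  · rw [Finset.mul_sum]
    refine Finset.sum_congr rfl fun j _ => ?_
    rw [← mul_assoc, ← mul_assoc, ← C.psi_e, mul_assoc (C.psi _), C.eg_D]
  · rw [Finset.sum_mul]
    refine Finset.sum_congr rfl fun j _ => ?_
    rw [mul_assoc, C.psi_e, ← mul_assoc, mul_assoc (C.psi _), C.D_eg]
  · rw [← mul_assoc, ← C.psi_e, mul_assoc, C.eg_mul]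
  · rw [mul_assoc, C.eg_mul]
  · rw [C.Tt_sum, C.Tt_psi_mul, C.Tt_eg, ← C.sum_fTg]
    refine Finset.sum_congr rfl fun j _ => ?_
    rw [C.Tt_mul_psi, C.Tt_psi_mul]

/-- The idempotent generating the same left ideal as the key element. -/
noncomputable def ep : R := C.psi C.F' * C.D

lemma D_ep : C.D * C.ep = C.D := by
  rw [ep, ← mul_assoc, C.D_psi_D, C.Tt_F', map_one, one_mul]

lemma hom_ep : C.Hom 0 C.ep := by
  have := Hom.mul C (C.hom_psi C.homp_F') C.hom_D
  rwa [add_neg_cancel] at this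

end Gr
end VVPaper

namespace VVPaper

lemma exists_rank_factor {k : Type} [Field k] {X : Type} [Fintype X] [DecidableEq X] (P : Matrix X X k)
    (hP : P * P = P) : ∃ (r : ℕ) (a : Matrix X (Fin r) k) (c : Matrix (Fin r) X k), c * a = 1 ∧ a * c = P := by
  let p := Matrix.toLin' P
  have hp : ∀ x, p (p x) = p x := fun x => by
    change P.mulVec (P.mulVec x) = P.mulVec x
    rw [Matrix.mulVec_mulVec, hP]
  let b := Module.finBasis k (LinearMap.range p)
  let A : (Fin (Module.finrank k (LinearMap.range p)) → k) →ₗ[k] (X → k) :=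
    (LinearMap.range p).subtype ∘ₗ b.equivFun.symm.toLinearMap
  let Cc : (X → k) →ₗ[k] (Fin (Module.finrank k (LinearMap.range p)) → k) :=
    b.equivFun.toLinearMap ∘ₗ p.rangeRestrict
  have h1 : Cc ∘ₗ A = LinearMap.id := by
    ext1 i
    ext1
    have : p.rangeRestrict ((b.equivFun.symm (Pi.single i 1) : LinearMap.range p) : X → k) =
        b.equivFun.symm (Pi.single i 1) := by
      apply Subtype.ext
      obtain ⟨y, hy⟩ := (b.equivFun.symm (Pi.single i 1)).2
      change p _ = _
      rw [← hy, hp]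
    change b.equivFun (p.rangeRestrict ((b.equivFun.symm (Pi.single i 1) : LinearMap.range p) : X → k)) = Pi.single i 1
    rw [this, LinearEquiv.apply_symm_apply]
  have h2 : A ∘ₗ Cc = p := by
    apply LinearMap.ext
    intro x
    change ((b.equivFun.symm (b.equivFun (p.rangeRestrict x)) : LinearMap.range p) : X → k) = p x
    rw [LinearEquiv.symm_apply_apply]; rfl
  refine ⟨_, LinearMap.toMatrix' A, LinearMap.toMatrix' Cc, ?_, ?_⟩
  · rw [← LinearMap.toMatrix'_comp, h1, LinearMap.toMatrix'_id]
  · rw [← LinearMap.toMatrix'_comp, h2, LinearMap.toMatrix'_toLin']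

namespace Gr
variable {k : Type} [Field k] {m : ℕ} [NeZero m] {Wd : Finset (Fin m → ℤ)} {R : Type} [Ring R]
    [Algebra k R] {S K : Type} [LinearOrder S] [InvolutiveNeg S] [Field K] [Algebra k K] {N : ℕ}
    (C : Gr k Wd R S K N)

include C in
lemma Homp.prod {ι : Type} (s : Finset ι) {d : ι → ℤ} {F : ι → MvPolynomial (Fin N) k}
    (h : ∀ i ∈ s, Homp (d i) (F i)) : Homp (∑ i ∈ s, d i) (∏ i ∈ s, F i) := by
  classical
  induction s using Finset.induction_on with
  | empty => exact homp_one C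
  | insert i s hi ih =>
    rw [Finset.sum_insert hi, Finset.prod_insert hi]
    exact Homp.mul C (h i (Finset.mem_insert_self _ _))
      (ih fun j hj => h j (Finset.mem_insert_of_mem hj))

include C in
/-- A homogeneous idempotent matrix has free image. -/
lemma idem_free (B : Subalgebra k (MvPolynomial (Fin N) k)) {X : Type} [Fintype X] [DecidableEq X]
    (P : Matrix X X B) (hP : P * P = P) (d : X → ℤ)
    (hd : ∀ i j, Homp (d j - d i) (P i j : MvPolynomial (Fin N) k)) :
    ∃ (r : ℕ) (a : Matrix X (Fin r) B) (c : Matrix (Fin r) X B), c * a = 1 ∧ a * c = P := by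
  let κ : B →+* k := MvPolynomial.constantCoeff.comp B.val.toRingHom
  let ι : k →+* B := algebraMap k B
  have hκι : ∀ c, κ (ι c) = c := fun c => by
    change MvPolynomial.constantCoeff (MvPolynomial.C c) = c
    simp
  have hκιm : ∀ M : Matrix X X k, (M.map ι).map κ = M := fun M => by
    ext i j; exact hκι _
  obtain ⟨r, a0, c0, hca, hac⟩ := exists_rank_factor (P.map κ) (by rw [← Matrix.map_mul, hP])
  let P0 : Matrix X X B := (P.map κ).map ι
  have hP0 : P0 * P0 = P0 := by
    change (P.map κ).map ι * (P.map κ).map ι = _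
    rw [← Matrix.map_mul, ← Matrix.map_mul, hP]
  have hP0d : ∀ i j, Homp (d j - d i) (P0 i j : MvPolynomial (Fin N) k) := by
    intro i j s hs
    change MvPolynomial.coeff s (MvPolynomial.C (MvPolynomial.coeff 0 (P i j : MvPolynomial (Fin N) k))) ≠ 0 at hs
    rw [MvPolynomial.coeff_C] at hs
    split_ifs at hs with h
    · rw [← h]; exact hd i j 0 hs
    · exact absurd rfl hs
  have h1d : ∀ i j, Homp (d j - d i) ((1 : Matrix X X B) i j : MvPolynomial (Fin N) k) := by
    intro i j
    rw [Matrix.one_apply]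
    split_ifs with h
    · rw [h, sub_self]; exact homp_one C
    · exact homp_zero _
  have hsub : ∀ {e : ℤ} {F G : MvPolynomial (Fin N) k}, Homp e F → Homp e G → Homp e (F - G) := by
    intro e F G hF hG s hs
    rw [MvPolynomial.coeff_sub] at hs
    by_cases h : MvPolynomial.coeff s F = 0
    · exact hG s fun h' => hs (by rw [h, h', sub_self])
    · exact hF s h
  have hadd : ∀ {e : ℤ} {F G : MvPolynomial (Fin N) k}, Homp e F → Homp e G → Homp e (F + G) := by
    intro e F G hF hG s hs
    rw [MvPolynomial.coeff_add] at hs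
    by_cases h : MvPolynomial.coeff s F = 0
    · exact hG s fun h' => hs (by rw [h, h', add_zero])
    · exact hF s h
  have hmul : ∀ M M' : Matrix X X B, (∀ i j, Homp (d j - d i) (M i j : MvPolynomial (Fin N) k)) →
      (∀ i j, Homp (d j - d i) (M' i j : MvPolynomial (Fin N) k)) →
      ∀ i j, Homp (d j - d i) ((M * M') i j : MvPolynomial (Fin N) k) := by
    intro M M' h h' i j
    rw [Matrix.mul_apply, AddSubmonoidClass.coe_finsetSum]
    refine Homp.sum C _ fun l _ => ?_
    have := Homp.mul C (h i l) (h' l j)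
    rwa [show d l - d i + (d j - d l) = d j - d i by ring] at this
  let U : Matrix X X B := P * P0 + (1 - P) * (1 - P0)
  have hU : ∀ i j, Homp (d j - d i) (U i j : MvPolynomial (Fin N) k) := fun i j =>
    hadd (hmul _ _ hd hP0d i j) (hmul _ _ (fun i j => hsub (h1d i j) (hd i j))
      (fun i j => hsub (h1d i j) (hP0d i j)) i j)
  have hUκ : U.map κ = 1 := by
    have e1 : P0.map κ = P.map κ := hκιm _
    have e2 : (P.map κ) * (P.map κ) = P.map κ := by rw [← Matrix.map_mul, hP]
    have e3 : U.map κ = κ.mapMatrix U := rfl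
    rw [e3, map_add, map_mul, map_mul, map_sub, map_sub, map_one]
    change P.map κ * P0.map κ + (1 - P.map κ) * (1 - P0.map κ) = 1
    rw [e1, sub_mul, one_mul, mul_sub, mul_one, e2]
    abel
  have hdet : U.det = 1 := by
    have h1 : Homp 0 (U.det : MvPolynomial (Fin N) k) := by
      rw [Matrix.det_apply, AddSubmonoidClass.coe_finsetSum]
      refine Homp.sum C _ fun σ _ => ?_
      have h2 : Homp 0 ((∏ i, U (σ i) i : B) : MvPolynomial (Fin N) k) := by
        rw [SubmonoidClass.coe_finsetProd]
        have h3 := Homp.prod C Finset.univ (d := fun i => d i - d (σ i)) (fun i _ => hU (σ i) i)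
        rwa [Finset.sum_sub_distrib, Equiv.sum_comp σ d, sub_self] at h3
      rcases Int.units_eq_one_or (Equiv.Perm.sign σ) with h | h
      · rw [h, one_smul]; exact h2
      · rw [h]
        have := hsub (homp_zero 0) h2
        rw [zero_sub] at this
        simpa using this
    have h2 : κ U.det = 1 := by
      rw [RingHom.map_det]
      change (U.map κ).det = 1
      rw [hUκ, Matrix.det_one]
    apply Subtype.ext
    have h3 := Homp.const h1
    rw [h3]
    change MvPolynomial.C (κ U.det) = 1
    rw [h2, map_one]
  have hu : IsUnit U.det := by rw [hdet]; exact isUnit_one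
  have hPU : P * U = U * P0 := by
    have e1 : P * (1 - P) = 0 := by rw [mul_sub, mul_one, hP, sub_self]
    have e2 : (1 - P0) * P0 = 0 := by rw [sub_mul, one_mul, hP0, sub_self]
    change P * (P * P0 + (1 - P) * (1 - P0)) = (P * P0 + (1 - P) * (1 - P0)) * P0
    rw [mul_add, add_mul, ← mul_assoc, ← mul_assoc, hP, e1, zero_mul, mul_assoc, mul_assoc, hP0, e2,
      mul_zero]
  refine ⟨r, U * a0.map ι, c0.map ι * U⁻¹, ?_, ?_⟩
  · rw [Matrix.mul_assoc, ← Matrix.mul_assoc U⁻¹, Matrix.nonsing_inv_mul _ hu, Matrix.one_mul,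
      ← Matrix.map_mul, hca]
    exact Matrix.map_one ι (map_zero _) (map_one _)
  · have e1 : a0.map ι * c0.map ι = P0 := by rw [← Matrix.map_mul, hac]
    rw [Matrix.mul_assoc, ← Matrix.mul_assoc (a0.map ι), e1, ← Matrix.mul_assoc, ← hPU, Matrix.mul_assoc,
      Matrix.mul_nonsing_inv _ hu, Matrix.mul_one]

end Gr
end VVPaper

namespace VVPaper
open Strands

namespace Gr
open Classical
variable {k : Type} [Field k] {m : ℕ} [NeZero m] {Wd : Finset (Fin m → ℤ)} {R : Type} [Ring R]
    [Algebra k R] {S K : Type} [LinearOrder S] [InvolutiveNeg S] [Field K] [Algebra k K] {N : ℕ}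
    (C : Gr k Wd R S K N) [Fintype S]

lemma ep_eg : C.ep * C.eg = C.ep := by rw [ep, mul_assoc, C.D_eg]

lemma eg_ep : C.eg * C.ep = C.ep := by rw [ep, ← mul_assoc, ← C.psi_e, mul_assoc, C.eg_D]

lemma ep_ep : C.ep * C.ep = C.ep := by
  change C.psi C.F' * C.D * C.ep = C.ep
  rw [mul_assoc, C.D_ep]; rfl

lemma ep_comm {G : MvPolynomial (Fin N) k} (hG : G ∈ C.B) : C.ep * C.psi G = C.psi G * C.ep :=
  C.comm_B C.eg_ep C.ep_eg hG

lemma phi_dl (v : C.Y.GV m) : (fun w => C.phi (C.dl v w)) = C.dl v := by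
  funext w
  by_cases h : w = v
  · subst h; simp [Ctx.dl]
  · simp [Ctx.dl, Pi.single_eq_of_ne h]

lemma rho_sum_dl (F : C.Y.GV m → MvPolynomial (Fin N) k) (u : C.Y.GV m) :
    C.rho (∑ v, C.b v * C.psi (F v)) (C.dl C.s0) u =
      ∑ v, C.io (F v) * C.rho (C.b v) (C.dl C.s0) u := by
  rw [map_sum, LinearMap.sum_apply, Finset.sum_apply]
  refine Finset.sum_congr rfl fun v _ => ?_
  rw [map_mul, Module.End.mul_apply, C.rho_psi_dl, map_smul, Pi.smul_apply, smul_eq_mul]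

lemma co_homp {d : ℤ} {y : R} (hy : y * C.eg = y) (hd : C.Hom d y) (v : C.Y.GV m) :
    Homp (d - C.bd v) (C.co y v) := by
  have key : (fun v => (C.p ^ C.bd v) • C.scl (C.co y v) - (C.p ^ d) • C.co y v) = fun _ => 0 := by
    have h1 : C.rho (∑ v, C.b v * C.psi ((C.p ^ C.bd v) • C.scl (C.co y v) - (C.p ^ d) • C.co y v))
        (C.dl C.s0) = 0 := by
      funext u
      rw [C.rho_sum_dl]
      simp_rw [map_sub, map_smul, sub_mul, smul_mul_assoc]
      rw [Finset.sum_sub_distrib, ← Finset.smul_sum, Pi.zero_apply, sub_eq_zero, ← C.rho_sum_dl,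
        C.co_sum hy]
      have h2 := hd (C.dl C.s0) u
      rw [C.phi_dl, ← Algebra.smul_def] at h2
      rw [← h2]
      conv_rhs => rw [← C.co_sum hy, C.rho_sum_dl, map_sum]
      refine Finset.sum_congr rfl fun v _ => ?_
      rw [map_mul, C.hom_b v, C.phi_dl, ← C.ev_v0, C.phi_ev, Algebra.smul_def]
      ring
    funext v
    have := C.coord_zero _ h1
    exact this v
  refine C.homp_of_scl ?_
  have h3 := congrFun key v
  simp only [sub_eq_zero] at h3
  rw [zpow_sub₀ C.p_ne, div_eq_inv_mul, mul_smul, ← h3, smul_smul, inv_mul_cancel₀ (zpow_ne_zero _ C.p_ne),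
    one_smul]

lemma co_add {a b : R} (ha : a * C.eg = a) (hb : b * C.eg = b) (v : C.Y.GV m) :
    C.co (a + b) v = C.co a v + C.co b v := by
  have : C.co (a + b) = fun v => C.co a v + C.co b v := C.co_eq (by
    simp_rw [map_add, mul_add]
    rw [Finset.sum_add_distrib, C.co_sum ha, C.co_sum hb])
  rw [this]

lemma co_mul {a : R} (ha : a * C.eg = a) (G : MvPolynomial (Fin N) k) (v : C.Y.GV m) :
    C.co (a * C.psi G) v = G * C.co a v := by
  have : C.co (a * C.psi G) = fun v => G * C.co a v := C.co_eq (by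
    simp_rw [mul_comm G, map_mul, ← mul_assoc]
    rw [← Finset.sum_mul, C.co_sum ha])
  rw [this]

/-- Index set of the coordinates. -/
abbrev Ix : Type := C.Y.GV m × C.J

/-- Coordinates with values in the centre of the corner. -/
noncomputable def iot (y : R) (l : C.Ix) : C.B :=
  ⟨C.Tt C.D (C.gj l.2 * C.co y l.1), C.Tt_D_mem _⟩

/-- Generators of the left ideal of the key element. -/
noncomputable def E (l : C.Ix) : R := C.q⁻¹ • (C.b l.1 * C.psi (C.fj l.2) * C.ep)

lemma E_ep (l : C.Ix) : C.E l * C.ep = C.E l := by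
  rw [E, smul_mul_assoc, mul_assoc, C.ep_ep]

lemma E_eg (l : C.Ix) : C.E l * C.eg = C.E l := by
  rw [E, smul_mul_assoc, mul_assoc, C.ep_eg]

lemma iot_mul {y : R} (hy : y * C.eg = y) (G : C.B) (l : C.Ix) :
    C.iot (y * C.psi G.1) l = G * C.iot y l := by
  apply Subtype.ext
  change C.Tt C.D (C.gj l.2 * C.co (y * C.psi G.1) l.1) = G.1 * C.Tt C.D (C.gj l.2 * C.co y l.1)
  rw [C.co_mul hy, ← C.Tt_B _ G.2]
  congr 1; ring

lemma iot_add {a b : R} (ha : a * C.eg = a) (hb : b * C.eg = b) (l : C.Ix) :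
    C.iot (a + b) l = C.iot a l + C.iot b l := by
  apply Subtype.ext
  change C.Tt C.D (C.gj l.2 * C.co (a + b) l.1) = C.Tt C.D _ + C.Tt C.D _
  rw [C.co_add ha hb, mul_add, C.Tt_map_add]

lemma iot_zero (l : C.Ix) : C.iot 0 l = 0 := by
  have := C.iot_add (a := 0) (b := 0) (by simp) (by simp) l
  rw [add_zero] at this
  exact left_eq_add.1 this

lemma iot_sum {ι : Type} (s : Finset ι) (y : ι → R) (hy : ∀ i, y i * C.eg = y i) (l : C.Ix) :
    C.iot (∑ i ∈ s, y i) l = ∑ i ∈ s, C.iot (y i) l := by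
  induction s using Finset.induction_on with
  | empty => rw [Finset.sum_empty, Finset.sum_empty, C.iot_zero]
  | insert i s hi ih =>
    rw [Finset.sum_insert hi, Finset.sum_insert hi, C.iot_add (hy i), ih]
    rw [Finset.sum_mul]
    exact Finset.sum_congr rfl fun j _ => hy j

lemma sum_E_iot {y : R} (hy : y * C.eg = y) : ∑ l, C.E l * C.psi (C.iot y l).1 = y * C.ep := by
  rw [Fintype.sum_prod_type]
  have h1 : ∀ v, ∑ j, C.E (v, j) * C.psi (C.iot y (v, j)).1 = C.b v * C.psi (C.co y v) * C.ep := by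
    intro v
    have h2 : ∀ j, C.E (v, j) * C.psi (C.iot y (v, j)).1 =
        C.q⁻¹ • (C.b v * C.psi (C.fj j * C.Tt C.D (C.gj j * C.co y v)) * C.ep) := by
      intro j
      rw [E, smul_mul_assoc, mul_assoc _ C.ep, C.ep_comm (C.iot y (v, j)).2, map_mul]
      simp only [iot, mul_assoc]
    simp_rw [h2]
    rw [← Finset.smul_sum, ← Finset.sum_mul, ← Finset.mul_sum, ← map_sum, C.sum_fTg,
      ← MvPolynomial.smul_eq_C_mul, map_smul, mul_smul_comm, smul_mul_assoc, smul_smul,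
      inv_mul_cancel₀ C.q_ne, one_smul]
  simp_rw [h1]
  rw [← Finset.sum_mul, C.co_sum hy]

/-- The projection matrix. -/
noncomputable def Pm : Matrix C.Ix C.Ix C.B := Matrix.of fun i j => C.iot (C.E j) i

lemma E_psi_eg (l : C.Ix) (G : MvPolynomial (Fin N) k) : C.E l * C.psi G * C.eg = C.E l * C.psi G := by
  rw [mul_assoc, C.psi_e, ← mul_assoc, C.E_eg]

lemma iot_sum_E (β : C.Ix → C.B) (i : C.Ix) :
    C.iot (∑ l, C.E l * C.psi (β l).1) i = ∑ l, C.Pm i l * β l := by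
  rw [C.iot_sum _ _ (fun l => C.E_psi_eg l _)]
  refine Finset.sum_congr rfl fun l _ => ?_
  rw [C.iot_mul (C.E_eg l), mul_comm]; rfl

lemma Pm_Pm : C.Pm * C.Pm = C.Pm := by
  refine Matrix.ext fun i j => ?_
  rw [Matrix.mul_apply]
  have h1 := C.iot_sum_E (C.iot (C.E j)) i
  rw [C.sum_E_iot (C.E_eg j), C.E_ep] at h1
  exact h1.symm

/-- Degrees of the coordinates. -/
def dd (l : C.Ix) : ℤ := C.bd l.1 - C.dg l.2

lemma Hom.smul {d : ℤ} {h : R} (hh : C.Hom d h) (c : k) : C.Hom d (c • h) := by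
  intro f u
  rw [map_smul, LinearMap.smul_apply, LinearMap.smul_apply, Pi.smul_apply, Pi.smul_apply, C.phi_smul, hh f u,
    mul_smul_comm]

lemma Pm_homp (i j : C.Ix) : Homp (C.dd j - C.dd i) (C.Pm i j : MvPolynomial (Fin N) k) := by
  change Homp _ (C.Tt C.D (C.gj i.2 * C.co (C.E j) i.1))
  have h1 : C.Hom (C.bd j.1 + C.df j.2 + 0) (C.E j) :=
    Hom.smul C (Hom.mul C (Hom.mul C (C.hom_b _) (C.hom_psi (C.fj_homp _))) C.hom_ep) _
  have h2 := C.homp_Tt C.hom_D (Homp.mul C (C.gj_homp i.2) (C.co_homp (C.E_eg j) h1 i.1))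
  have h3 := C.df_dg j.2
  convert h2 using 1
  simp only [dd]
  omega

/-- The left ideal of the key element is free over the centre of the corner. -/
lemma exists_basis : ∃ (r : ℕ) (δ : Fin r → R), (∀ i, ∃ a, δ i = a * C.D) ∧
    (∀ a : R, ∃ β : Fin r → C.B, a * C.D = ∑ i, δ i * C.psi (β i).1) ∧
    ∀ β : Fin r → C.B, ∑ i, δ i * C.psi (β i).1 = 0 → β = 0 := by
  obtain ⟨r, a, c, hca, hac⟩ := idem_free C C.B C.Pm C.Pm_Pm C.dd C.Pm_homp
  have hδ : ∀ β : Fin r → C.B, ∑ i, (∑ l, C.E l * C.psi (a l i).1) * C.psi (β i).1 =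
      ∑ l, C.E l * C.psi ((a.mulVec β) l).1 := by
    intro β
    simp_rw [Finset.sum_mul]
    rw [Finset.sum_comm]
    refine Finset.sum_congr rfl fun l _ => ?_
    simp_rw [mul_assoc, ← map_mul]
    rw [← Finset.mul_sum, ← map_sum]
    congr 2
    rw [Matrix.mulVec, dotProduct]
    rw [AddSubmonoidClass.coe_finsetSum]
    rfl
  refine ⟨r, fun i => ∑ l, C.E l * C.psi (a l i).1, ?_, ?_, ?_⟩
  · intro i
    refine ⟨(∑ l, C.E l * C.psi (a l i).1) * C.psi C.F', ?_⟩
    rw [mul_assoc]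
    change _ = _ * C.ep
    rw [Finset.sum_mul]
    refine Finset.sum_congr rfl fun l _ => ?_
    rw [mul_assoc, ← C.ep_comm (a l i).2, ← mul_assoc, C.E_ep]
  · intro y
    refine ⟨c.mulVec (C.iot (y * C.D)), ?_⟩
    have hy : y * C.D * C.eg = y * C.D := by rw [mul_assoc, C.D_eg]
    rw [hδ, Matrix.mulVec_mulVec, hac]
    have h1 : C.Pm.mulVec (C.iot (y * C.D)) = C.iot (y * C.D) := by
      funext i
      have := C.iot_sum_E (C.iot (y * C.D)) i
      rw [C.sum_E_iot hy, mul_assoc, C.D_ep] at this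
      exact this.symm
    rw [h1, C.sum_E_iot hy, mul_assoc, C.D_ep]
  · intro β hβ
    rw [hδ] at hβ
    have h1 : C.Pm.mulVec (a.mulVec β) = 0 := by
      funext i
      have := C.iot_sum_E (a.mulVec β) i
      rw [hβ, C.iot_zero] at this
      exact this.symm
    rw [← hac, Matrix.mulVec_mulVec, Matrix.mul_assoc, hca, Matrix.mul_one] at h1
    have h2 : c.mulVec (a.mulVec β) = 0 := by rw [h1, Matrix.mulVec_zero]
    rwa [Matrix.mulVec_mulVec, hca, Matrix.one_mulVec] at h2

end Gr
end VVPaper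

namespace VVPaper
open Strands

namespace Gr
open Classical
variable {k : Type} [Field k] {m : ℕ} [NeZero m] {Wd : Finset (Fin m → ℤ)} {R : Type} [Ring R]
    [Algebra k R] {S K : Type} [LinearOrder S] [InvolutiveNeg S] [Field K] [Algebra k K] {N : ℕ}
    (C : Gr k Wd R S K N)

lemma isIntegral_X (i : Fin N) : IsIntegral C.B (MvPolynomial.X i : MvPolynomial (Fin N) k) := by
  let P : Polynomial (MvPolynomial (Fin N) k) :=
    ∏ j, (Polynomial.X ^ 2 - Polynomial.C (MvPolynomial.X j ^ 2))
  have hP : P.Monic := Polynomial.monic_prod_of_monic _ _ fun j _ =>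
    Polynomial.monic_X_pow_sub_C _ two_ne_zero
  have hev : ∀ v, C.G0 v → P.map (C.ev v.1).toRingHom = P.map (C.ev C.v0).toRingHom := by
    intro v hv
    obtain ⟨τ, hτ⟩ := C.evperm v hv
    simp only [P, Polynomial.map_prod, Polynomial.map_sub, Polynomial.map_pow, Polynomial.map_X,
      Polynomial.map_C]
    refine Fintype.prod_equiv τ _ _ fun j => ?_
    congr 2
    change C.ev v.1 (MvPolynomial.X j ^ 2) = C.ev C.v0 (MvPolynomial.X (τ j) ^ 2)
    rw [map_pow, C.ev_X, hτ, C.ev_v0, map_pow]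
  have hl : P ∈ Polynomial.lifts (algebraMap C.B (MvPolynomial (Fin N) k)) := by
    rw [Polynomial.lifts_iff_coeff_lifts]
    intro n
    refine ⟨⟨P.coeff n, fun v hv => ?_⟩, rfl⟩
    have := congrArg (fun Q => Polynomial.coeff Q n) (hev v hv)
    simp only [Polynomial.coeff_map] at this
    exact this
  obtain ⟨Q, hQ, -, hm⟩ := Polynomial.lifts_and_degree_eq_and_monic hl hP
  refine ⟨Q, hm, ?_⟩
  rw [← Polynomial.eval_map, hQ]
  simp only [P, Polynomial.eval_prod]
  exact Finset.prod_eq_zero (Finset.mem_univ i) (by simp)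

lemma finiteType_B : Algebra.FiniteType k C.B := by
  have hi : Algebra.IsIntegral C.B (MvPolynomial (Fin N) k) := ⟨fun F => by
    induction F using MvPolynomial.induction_on with
    | C c => exact isIntegral_algebraMap (R := C.B) (x := algebraMap k C.B c)
    | add F G hF hG => exact hF.add hG
    | mul_X F i hF => exact hF.mul (C.isIntegral_X i)⟩
  have hft : Algebra.FiniteType C.B (MvPolynomial (Fin N) k) :=
    Algebra.FiniteType.of_restrictScalars_finiteType k _ _
  have hf : Module.Finite C.B (MvPolynomial (Fin N) k) := Algebra.IsIntegral.finite
  exact ⟨fg_of_fg_of_fg k C.B (MvPolynomial (Fin N) k) Algebra.FiniteType.out hf.fg_top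
    Subtype.val_injective⟩

lemma exists_pres : ∃ (n : ℕ) (Id : Ideal (MvPolynomial (Fin n) k)),
    Nonempty ((MvPolynomial (Fin n) k ⧸ Id) ≃ₐ[k] C.B) := by
  obtain ⟨n, f, hf⟩ := Algebra.FiniteType.iff_quotient_mvPolynomial''.1 C.finiteType_B
  exact ⟨n, RingHom.ker f, ⟨Ideal.quotientKerAlgEquivOfSurjective hf⟩⟩

variable [Fintype S]

/-- The pairing given by the key element is nondegenerate. -/
lemma nondeg {y : R} (hy : y * C.eg = y) (h : ∀ a, C.D * a * y = 0) : y = 0 := by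
  by_contra h0
  have h1 : C.rho y (C.dl C.s0) ≠ 0 := fun h1 => h0 (C.inj_dl hy h1)
  set f := C.rho y (C.dl C.s0) with hf
  obtain ⟨v0, hv0⟩ := Function.ne_iff.1 h1
  have hex : ∃ n, ∃ v : C.Y.GV m, inv v.1 = n ∧ f v ≠ 0 := ⟨_, v0, rfl, hv0⟩
  obtain ⟨v, hn, hv⟩ := Nat.find_spec hex
  have h2 : C.rho (C.om (C.b v)) f C.s0 ≠ 0 := by
    intro h3
    refine hv (C.tri_right v f (fun u hu => ?_) h3)
    by_contra h4
    exact Nat.find_min hex (hn ▸ hu) ⟨u, rfl, h4⟩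
  set f' := C.rho (C.om (C.b v)) f with hf'
  have h3 : ∑ j, C.ev C.v0 (C.fj j) • C.rho (C.psi (C.gj j)) f' = (C.cc C.s0 * f' C.s0) • C.dl C.s0 := by
    funext u
    rw [Finset.sum_apply]
    simp only [Pi.smul_apply, smul_eq_mul, C.rho_psi]
    by_cases hu : C.G0 u
    · simp_rw [← mul_assoc]
      rw [← Finset.sum_mul, C.sum_fg C.G0_s0 hu]
      by_cases h : u = C.s0
      · subst h; simp [Ctx.dl]
      · simp [Ctx.dl, h, Pi.single_eq_of_ne h]
    · have h : u ≠ C.s0 := by rintro rfl; exact hu C.G0_s0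
      have h4 : f' u = 0 := C.rho_eg_zero (C.eg_om_b v) f hu
      simp [h4, Ctx.dl, Pi.single_eq_of_ne h]
  have h5 := congrArg (C.rho C.D) h3
  have h6 : ∀ j, C.rho C.D (C.rho (C.psi (C.gj j)) f') = 0 := by
    intro j
    rw [hf', hf, ← Module.End.mul_apply, ← Module.End.mul_apply, ← Module.End.mul_apply, ← map_mul,
      ← map_mul, ← map_mul]
    have : C.D * C.psi (C.gj j) * C.om (C.b v) * y = C.D * (C.psi (C.gj j) * C.om (C.b v)) * y := by
      simp only [mul_assoc]
    rw [this, h, map_zero, LinearMap.zero_apply]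
  rw [map_sum, map_smul] at h5
  simp_rw [map_smul, h6, smul_zero] at h5
  rw [Finset.sum_const_zero] at h5
  have h7 := (smul_eq_zero.1 h5.symm).resolve_left (mul_ne_zero (C.ev_ne _ C.G0_s0) h2)
  exact C.D_ne (C.inj_dl C.D_eg h7)

end Gr
end VVPaper

namespace VVPaper

/-- Data on an algebra with involution producing an affine cell ideal generated by one element. -/
structure CellData (k : Type) [Field k] {H : Type} [Ring H] [Algebra k H] (ω : H →ₗ[k] H)
    (Q : Type) [CommRing Q] [Algebra k Q] where
  inv : IsKInvolution ω
  D : H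
  om_D : ω D = D
  psi : Q →ₐ[k] H
  om_psi : ∀ b, ω (psi b) = psi b
  comm : ∀ b, D * psi b = psi b * D
  r : ℕ
  a : Fin r → H
  span : ∀ h, ∃ β : Fin r → Q, h * D = ∑ i, a i * D * psi (β i)
  indep : ∀ β : Fin r → Q, ∑ i, a i * D * psi (β i) = 0 → β = 0
  mid : ∀ h, ∃ b, D * h * D = D * psi b
  nondeg : ∀ h, (∀ a, D * a * (h * D) = 0) → h * D = 0

namespace CellData
variable {k : Type} [Field k] {H : Type} [Ring H] [Algebra k H] {ω : H →ₗ[k] H}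
    {Q : Type} [CommRing Q] [Algebra k Q] (C : CellData k ω Q)

/-- The combination of the basis elements with given coefficients. -/
def el : (Fin C.r → Q) →ₗ[k] H where
  toFun β := ∑ i, C.a i * C.D * C.psi (β i)
  map_add' β γ := by simp [mul_add, Finset.sum_add_distrib]
  map_smul' c β := by simp [Finset.smul_sum]

lemma el_inj {β γ : Fin C.r → Q} (h : C.el β = C.el γ) : β = γ :=
  sub_eq_zero.1 (C.indep _ (by
    change C.el (β - γ) = 0
    rw [map_sub, h, sub_self]))

lemma el_smul (b : Q) (β : Fin C.r → Q) : C.el (b • β) = C.el β * C.psi b := by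
  change ∑ i, C.a i * C.D * C.psi (b • β i) = (∑ i, C.a i * C.D * C.psi (β i)) * C.psi b
  rw [Finset.sum_mul]
  refine Finset.sum_congr rfl fun i _ => ?_
  rw [mul_assoc _ (C.psi _), ← map_mul, mul_comm, smul_eq_mul, mul_comm b]

lemma exists_el (β : Fin C.r → Q) : ∃ h, C.el β = h * C.D := by
  refine ⟨∑ i, C.a i * C.psi (β i), ?_⟩
  rw [Finset.sum_mul]
  change ∑ i, C.a i * C.D * C.psi (β i) = _
  exact Finset.sum_congr rfl fun i _ => by rw [mul_assoc, C.comm, mul_assoc]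

lemma exists_coord (h : H) : ∃ β, C.el β = h * C.D := by
  obtain ⟨β, hβ⟩ := C.span h
  exact ⟨β, hβ.symm⟩

lemma exists_act (h : H) (β : Fin C.r → Q) : ∃ γ, C.el γ = h * C.el β := by
  obtain ⟨g, hg⟩ := C.exists_el β
  obtain ⟨γ, hγ⟩ := C.exists_coord (h * g)
  exact ⟨γ, by rw [hγ, hg, mul_assoc]⟩

/-- The left action on coordinates. -/
noncomputable def act0 (h : H) (β : Fin C.r → Q) : Fin C.r → Q := (C.exists_act h β).choose
lemma el_act0 (h : H) (β : Fin C.r → Q) : C.el (C.act0 h β) = h * C.el β := (C.exists_act h β).choose_spec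

/-- The left action on coordinates, as an algebra homomorphism. -/
noncomputable def act : H →ₐ[k] Module.End Q (Fin C.r → Q) where
  toFun h :=
    { toFun := C.act0 h
      map_add' := fun β γ => C.el_inj (by rw [map_add, C.el_act0, C.el_act0, C.el_act0, map_add, mul_add])
      map_smul' := fun b β => C.el_inj (by
        rw [RingHom.id_apply, C.el_smul, C.el_act0, C.el_act0, C.el_smul, mul_assoc]) }
  map_one' := LinearMap.ext fun β => C.el_inj (by
    change C.el (C.act0 1 β) = C.el β
    rw [C.el_act0, one_mul])
  map_mul' a b := LinearMap.ext fun β => C.el_inj (by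
    change C.el (C.act0 (a * b) β) = C.el (C.act0 a (C.act0 b β))
    rw [C.el_act0, C.el_act0, C.el_act0, mul_assoc])
  map_zero' := LinearMap.ext fun β => C.el_inj (by
    change C.el (C.act0 0 β) = C.el 0
    rw [C.el_act0, zero_mul, map_zero])
  map_add' a b := LinearMap.ext fun β => C.el_inj (by
    change C.el (C.act0 (a + b) β) = C.el (C.act0 a β + C.act0 b β)
    rw [map_add, C.el_act0, C.el_act0, C.el_act0, add_mul])
  commutes' c := LinearMap.ext fun β => C.el_inj (by
    change C.el (C.act0 (algebraMap k H c) β) = C.el (c • β)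
    rw [C.el_act0, map_smul, Algebra.smul_def])

lemma el_act (h : H) (β : Fin C.r → Q) : C.el (C.act h β) = h * C.el β := C.el_act0 h β

open TensorProduct

/-- Multiplication on families. -/
def mu0 : (Fin C.r → (Fin C.r → Q)) →ₗ[k] H where
  toFun t := ∑ j, C.el (t j) * ω (C.a j)
  map_add' s t := by simp [add_mul, Finset.sum_add_distrib]
  map_smul' c t := by simp [Finset.smul_sum]

/-- The multiplication map. -/
noncomputable def mu : (Fin C.r → Q) ⊗[Q] (Fin C.r → Q) →ₗ[k] H :=
  C.mu0 ∘ₗ (TensorProduct.piScalarRight Q Q (Fin C.r → Q) (Fin C.r)).toLinearMap.restrictScalars k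

lemma mu_tmul' (β γ : Fin C.r → Q) : C.mu (β ⊗ₜ γ) = ∑ j, C.el β * C.psi (γ j) * ω (C.a j) := by
  change ∑ j, C.el (TensorProduct.piScalarRight Q Q (Fin C.r → Q) (Fin C.r) (β ⊗ₜ γ) j) * ω (C.a j) = _
  refine Finset.sum_congr rfl fun j _ => ?_
  rw [TensorProduct.piScalarRight_apply, TensorProduct.piScalarRightHom_tmul, C.el_smul]

lemma om_el (γ : Fin C.r → Q) : ω (C.el γ) = ∑ j, C.D * C.psi (γ j) * ω (C.a j) := by
  change ω (∑ i, C.a i * C.D * C.psi (γ i)) = _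
  rw [map_sum]
  refine Finset.sum_congr rfl fun j _ => ?_
  rw [C.inv.map_mul, C.inv.map_mul, C.om_psi, C.om_D, ← mul_assoc, C.comm]

lemma mu_tmul {β : Fin C.r → Q} {b : H} (hb : C.el β = b * C.D) (γ : Fin C.r → Q) :
    C.mu (β ⊗ₜ γ) = b * ω (C.el γ) := by
  rw [C.mu_tmul', C.om_el, Finset.mul_sum]
  refine Finset.sum_congr rfl fun j _ => ?_
  rw [hb]; simp only [mul_assoc]

lemma mu_left (h : H) (t : (Fin C.r → Q) ⊗[Q] (Fin C.r → Q)) :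
    C.mu (LinearMap.rTensor (Fin C.r → Q) (C.act h) t) = h * C.mu t := by
  induction t using TensorProduct.induction_on with
  | zero => rw [map_zero, map_zero, mul_zero]
  | add s t hs ht => rw [map_add, map_add, map_add, hs, ht, mul_add]
  | tmul β γ =>
    obtain ⟨b, hb⟩ := C.exists_el β
    rw [LinearMap.rTensor_tmul, C.mu_tmul hb, C.mu_tmul (b := h * b) (by rw [C.el_act, hb, mul_assoc]),
      mul_assoc]

lemma mu_right (h : H) (t : (Fin C.r → Q) ⊗[Q] (Fin C.r → Q)) :
    C.mu (LinearMap.lTensor (Fin C.r → Q) (C.act (ω h)) t) = C.mu t * h := by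
  induction t using TensorProduct.induction_on with
  | zero => rw [map_zero, map_zero, zero_mul]
  | add s t hs ht => rw [map_add, map_add, map_add, hs, ht, add_mul]
  | tmul β γ =>
    obtain ⟨b, hb⟩ := C.exists_el β
    rw [LinearMap.lTensor_tmul, C.mu_tmul hb, C.mu_tmul hb, C.el_act, C.inv.map_mul, C.inv.involutive,
      mul_assoc]

lemma mu_comm (t : (Fin C.r → Q) ⊗[Q] (Fin C.r → Q)) :
    C.mu (TensorProduct.comm Q _ _ t) = ω (C.mu t) := by
  induction t using TensorProduct.induction_on with
  | zero => rw [map_zero, map_zero, map_zero]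
  | add s t hs ht => rw [map_add, map_add, map_add, hs, ht, map_add]
  | tmul β γ =>
    obtain ⟨b, hb⟩ := C.exists_el β
    obtain ⟨c, hc⟩ := C.exists_el γ
    rw [TensorProduct.comm_tmul, C.mu_tmul hb, C.mu_tmul hc, hb, hc]
    simp only [C.inv.map_mul, C.inv.involutive, C.om_D, mul_assoc]

lemma mu_inj : Function.Injective C.mu := by
  have key : ∀ t, C.mu0 t = 0 → t = 0 := by
    intro t ht
    funext j
    choose b hb using fun j => C.exists_el (t j)
    have h1 : ∀ h, ∀ j, C.D * h * (b j * C.D) = 0 := by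
      intro h
      choose c hc using fun j => C.mid (h * b j)
      have h2 : C.el c = 0 := by
        have h3 := congrArg (fun x => ω (C.D * h * x)) ht
        change ω (C.D * h * ∑ j, C.el (t j) * ω (C.a j)) = ω (C.D * h * 0) at h3
        rw [mul_zero, map_zero, Finset.mul_sum, map_sum] at h3
        rw [← h3]
        change ∑ i, C.a i * C.D * C.psi (c i) = _
        refine Finset.sum_congr rfl fun j _ => ?_
        have h4 : C.D * h * (C.el (t j) * ω (C.a j)) = C.D * (h * b j) * C.D * ω (C.a j) := by
          rw [hb]; simp only [mul_assoc]
        rw [h4, hc, C.inv.map_mul, C.inv.map_mul, C.inv.involutive, C.om_psi, C.om_D, ← C.comm,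
          mul_assoc]
      have h5 : c = 0 := C.el_inj (by rw [h2, map_zero])
      intro j
      have h6 := hc j
      rw [h5, Pi.zero_apply, map_zero, mul_zero] at h6
      rw [← h6]; simp only [mul_assoc]
    exact C.el_inj (by rw [hb, C.nondeg _ fun h => h1 h j, Pi.zero_apply, map_zero])
  refine (injective_iff_map_eq_zero _).2 fun t ht => ?_
  have h := key _ ht
  exact (TensorProduct.piScalarRight Q Q (Fin C.r → Q) (Fin C.r)).injective (h.trans (map_zero _).symm)

/-- The ideal generated by the distinguished element. -/
def J : TwoSidedIdeal H := TwoSidedIdeal.span {C.D}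

lemma mem_J {x : H} : x ∈ C.J ↔ ∃ t, C.mu t = x := by
  constructor
  · intro hx
    have hgen : ∀ a b : H, ∃ t, C.mu t = a * C.D * b := by
      intro a b
      obtain ⟨β, hβ⟩ := C.exists_coord a
      obtain ⟨γ, hγ⟩ := C.exists_coord (ω b)
      exact ⟨β ⊗ₜ γ, by rw [C.mu_tmul hβ, hγ, C.inv.map_mul, C.inv.involutive, C.om_D, mul_assoc]⟩
    let I : TwoSidedIdeal H := TwoSidedIdeal.mk' (Set.range C.mu) ⟨0, map_zero _⟩
      (by rintro _ _ ⟨s, rfl⟩ ⟨t, rfl⟩; exact ⟨s + t, map_add _ _ _⟩)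
      (by rintro _ ⟨s, rfl⟩; exact ⟨-s, map_neg _ _⟩)
      (by rintro x _ ⟨s, rfl⟩; exact ⟨_, C.mu_left x s⟩)
      (by rintro _ y ⟨s, rfl⟩; exact ⟨_, C.mu_right y s⟩)
    have hI : x ∈ I := by
      refine TwoSidedIdeal.mem_span_iff.1 hx I ?_
      rintro _ rfl
      obtain ⟨t, ht⟩ := hgen 1 1
      rw [one_mul, mul_one] at ht
      exact (TwoSidedIdeal.mem_mk' _ _ _ _ _ _ _).2 ⟨t, ht⟩
    have hx' : x ∈ Set.range C.mu := (TwoSidedIdeal.mem_mk' _ _ _ _ _ _ _).1 hI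
    exact hx'
  · rintro ⟨t, rfl⟩
    have hD : C.D ∈ C.J := TwoSidedIdeal.subset_span rfl
    induction t using TensorProduct.induction_on with
    | zero => rw [map_zero]; exact zero_mem _
    | add s t hs ht => rw [map_add]; exact add_mem hs ht
    | tmul β γ =>
      obtain ⟨b, hb⟩ := C.exists_el β
      rw [C.mu_tmul hb, C.om_el, Finset.mul_sum]
      refine sum_mem fun j _ => ?_
      exact C.J.mul_mem_left _ _ (C.J.mul_mem_right _ _ (C.J.mul_mem_right _ _ hD))

lemma om_mem {x : H} (hx : x ∈ C.J) : ω x ∈ C.J := by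
  obtain ⟨t, rfl⟩ := C.mem_J.1 hx
  exact C.mem_J.2 ⟨_, C.mu_comm t⟩

/-- The ideal as a vector space. -/
abbrev Jk : Submodule k H := Submodule.restrictScalars k (TwoSidedIdeal.asIdeal C.J : Ideal H)

/-- The ideal is a tensor product. -/
noncomputable def equ : (Fin C.r → Q) ⊗[Q] (Fin C.r → Q) ≃ₗ[k] C.Jk :=
  LinearEquiv.ofBijective (LinearMap.codRestrict C.Jk C.mu fun t =>
      TwoSidedIdeal.mem_asIdeal.2 (C.mem_J.2 ⟨t, rfl⟩))
    ⟨fun s t h => C.mu_inj (congrArg Subtype.val h), fun x => by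
      obtain ⟨t, ht⟩ := C.mem_J.1 (TwoSidedIdeal.mem_asIdeal.1 x.2)
      exact ⟨t, Subtype.ext ht⟩⟩

lemma equ_symm_eq {x : C.Jk} {t : (Fin C.r → Q) ⊗[Q] (Fin C.r → Q)} (h : (x : H) = C.mu t) :
    C.equ.symm x = t := by
  rw [LinearEquiv.symm_apply_eq]
  exact Subtype.ext h

lemma mu_equ_symm (x : C.Jk) : C.mu (C.equ.symm x) = x :=
  congrArg Subtype.val (C.equ.apply_symm_apply x)

end CellData

lemma CellData.isAffineCellIdeal {k : Type} [Field k] {H : Type} [Ring H] [Algebra k H] {ω : H →ₗ[k] H}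
    {N : ℕ} {Id : Ideal (MvPolynomial (Fin N) k)} (C : CellData k ω (MvPolynomial (Fin N) k ⧸ Id)) :
    IsAffineCellIdeal k H ω C.J := by
  refine ⟨fun x => ⟨C.om_mem, fun h => ?_⟩, C.r, N, Id, AlgEquiv.refl, fun b => rfl, C.act, C.equ.symm,
    ?_, ?_, ((TensorProduct.comm _ _ _).toLinearMap.restrictScalars k), ?_, ?_⟩
  · rw [← C.inv.involutive x]; exact C.om_mem h
  · intro h x y hxy
    exact C.equ_symm_eq (by rw [C.mu_left, C.mu_equ_symm, hxy])
  · intro h x y hxy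
    exact C.equ_symm_eq (by rw [C.mu_right, C.mu_equ_symm, hxy])
  · intro d d'
    rfl
  · intro x y hxy
    refine C.equ_symm_eq ?_
    change (y : H) = C.mu (TensorProduct.comm _ _ _ _)
    rw [C.mu_comm, C.mu_equ_symm, hxy]

/-- Transport of cell data along an isomorphism of the coefficient algebras. -/
def CellData.congr {k : Type} [Field k] {H : Type} [Ring H] [Algebra k H] {ω : H →ₗ[k] H}
    {Q Q' : Type} [CommRing Q] [Algebra k Q] [CommRing Q'] [Algebra k Q'] (C : CellData k ω Q)
    (f : Q' ≃ₐ[k] Q) : CellData k ω Q' where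
  inv := C.inv
  D := C.D
  om_D := C.om_D
  psi := C.psi.comp f.toAlgHom
  om_psi b := C.om_psi _
  comm b := C.comm _
  r := C.r
  a := C.a
  span h := by
    obtain ⟨β, hβ⟩ := C.span h
    refine ⟨fun i => f.symm (β i), ?_⟩
    rw [hβ]
    refine Finset.sum_congr rfl fun i _ => ?_
    change _ = _ * C.psi (f (f.symm (β i)))
    rw [f.apply_symm_apply]
  indep β h := by
    have := C.indep (fun i => f (β i)) h
    funext i
    exact (map_eq_zero_iff f f.injective).1 (congrFun this i)
  mid h := by
    obtain ⟨b, hb⟩ := C.mid h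
    refine ⟨f.symm b, ?_⟩
    change _ = _ * C.psi (f (f.symm b))
    rw [f.apply_symm_apply, hb]
  nondeg := C.nondeg

namespace Gr
open Classical Strands
variable {k : Type} [Field k] {m : ℕ} [NeZero m] {Wd : Finset (Fin m → ℤ)} {R : Type} [Ring R]
    [Algebra k R] {S K : Type} [LinearOrder S] [InvolutiveNeg S] [Field K] [Algebra k K] {N : ℕ}
    (C : Gr k Wd R S K N) [Fintype S]

/-- The cell data of the standard word. -/
noncomputable def cellData : CellData k C.om C.B where
  inv := ⟨C.om_mul, C.om_one, C.om_om⟩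
  D := C.D
  om_D := C.om_D
  psi := C.psi.comp C.B.val
  om_psi b := C.om_psi _
  comm b := C.D_comm b.2
  r := C.exists_basis.choose
  a i := (C.exists_basis.choose_spec.choose_spec.1 i).choose
  span h := by
    obtain ⟨β, hβ⟩ := C.exists_basis.choose_spec.choose_spec.2.1 h
    refine ⟨β, ?_⟩
    rw [hβ]
    refine Finset.sum_congr rfl fun i _ => ?_
    rw [← (C.exists_basis.choose_spec.choose_spec.1 i).choose_spec]; rfl
  indep β h := by
    refine C.exists_basis.choose_spec.choose_spec.2.2 β ?_
    refine Eq.trans ?_ h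
    refine Finset.sum_congr rfl fun i _ => ?_
    rw [← (C.exists_basis.choose_spec.choose_spec.1 i).choose_spec]; rfl
  mid h := by
    obtain ⟨G, hG, h1⟩ := C.D_mul_D h
    exact ⟨⟨G, hG⟩, h1⟩
  nondeg h hh := C.nondeg (by rw [mul_assoc, C.D_eg]) hh

lemma exists_cellIdeal : IsAffineCellIdeal k R C.om (TwoSidedIdeal.span {C.eg}) := by
  obtain ⟨n, Id, ⟨f⟩⟩ := C.exists_pres
  have h1 := (C.cellData.congr f).isAffineCellIdeal
  have h2 : (C.cellData.congr f).J = TwoSidedIdeal.span {C.eg} := by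
    change TwoSidedIdeal.span {C.D} = _
    apply le_antisymm
    · rw [TwoSidedIdeal.span_le]
      rintro _ rfl
      rw [SetLike.mem_coe, ← C.D_eg]
      exact TwoSidedIdeal.mul_mem_left _ _ _ (TwoSidedIdeal.subset_span rfl)
    · rw [TwoSidedIdeal.span_le]
      rintro _ rfl
      have h3 : C.eg = C.psi (MvPolynomial.C C.q⁻¹) * ∑ j, C.psi (C.fj j) * C.D * C.psi (C.gj j) := by
        rw [C.sum_fDg, ← mul_assoc, ← map_mul, ← map_mul, inv_mul_cancel₀ C.q_ne, map_one, map_one, one_mul]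
      rw [SetLike.mem_coe, h3]
      refine TwoSidedIdeal.mul_mem_left _ _ _ (sum_mem fun j _ => ?_)
      exact TwoSidedIdeal.mul_mem_right _ _ _ (TwoSidedIdeal.mul_mem_left _ _ _ (TwoSidedIdeal.subset_span rfl))
  rwa [h2] at h1

end Gr
end VVPaper

namespace VVPaper

/-- Signed blocks: block `a` consists of the odd letters from `b a` to `t a`. -/
structure Blk where
  N : ℕ
  b : ℤ → ℤ
  t : ℤ → ℤ
  b_neg : ∀ a, b (-a) = -t a
  t_neg : ∀ a, t (-a) = -b a
  b_odd : ∀ a, b a % 2 = 1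
  t_odd : ∀ a, t a % 2 = 1
  b_le : ∀ a, b a ≤ t a
  low : ∀ a, 0 < a → b a + t a ≤ 0
  sorted : ∀ a a' : ℤ, 0 < a → a < a' → a' ≤ N → t a' < t a ∨ (t a' = t a ∧ b a' ≤ b a)

namespace Blk

/-- The strands of a family of blocks. -/
@[ext] structure S (D : Blk) where
  a : ℤ
  l : ℤ
  a_ne : a ≠ 0
  le_a : -(D.N : ℤ) ≤ a
  a_le : a ≤ D.N
  le_l : D.b a ≤ l
  l_le : l ≤ D.t a
  l_odd : l % 2 = 1

variable {D : Blk}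

noncomputable instance : LinearOrder D.S :=
  LinearOrder.lift' (fun A => toLex (A.a, A.l)) (by
    intro A B h
    have h1 := toLex.injective h
    exact S.ext (congrArg Prod.fst h1) (congrArg Prod.snd h1))

lemma lt_iff {A B : D.S} : A < B ↔ A.a < B.a ∨ (A.a = B.a ∧ A.l < B.l) := by
  change toLex (A.a, A.l) < toLex (B.a, B.l) ↔ _
  rw [Prod.Lex.toLex_lt_toLex]

lemma le_iff {A B : D.S} : A ≤ B ↔ A.a < B.a ∨ (A.a = B.a ∧ A.l ≤ B.l) := by
  rw [← not_lt, lt_iff]; omega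

instance : InvolutiveNeg D.S where
  neg A := ⟨-A.a, -A.l, by have := A.a_ne; omega, by have := A.a_le; omega, by have := A.le_a; omega,
    by rw [D.b_neg]; have := A.l_le; omega, by rw [D.t_neg]; have := A.le_l; omega,
    by have := A.l_odd; omega⟩
  neg_neg A := S.ext (neg_neg _) (neg_neg _)

@[simp] lemma neg_a (A : D.S) : (-A).a = -A.a := rfl
@[simp] lemma neg_l (A : D.S) : (-A).l = -A.l := rfl

variable (k : Type) [Field k]

/-- The signed variable of a block. -/
noncomputable def zp (N : ℕ) (a : ℤ) : MvPolynomial (Fin N) k :=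
  if h : 0 < a ∧ a ≤ N then MvPolynomial.X ⟨(a - 1).toNat, by omega⟩ else
  if h : a < 0 ∧ -(N : ℤ) ≤ a then -MvPolynomial.X ⟨(-a - 1).toNat, by omega⟩ else 0

lemma zp_neg (N : ℕ) (a : ℤ) : zp k N (-a) = -zp k N a := by
  unfold zp
  rcases lt_trichotomy a 0 with h | h | h
  · by_cases h' : -(N : ℤ) ≤ a
    · rw [dif_pos (by omega), dif_neg (by omega), dif_pos (by omega), neg_neg]
    · rw [dif_neg (by omega), dif_neg (by omega), dif_neg (by omega), dif_neg (by omega), neg_zero]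
  · subst h; simp
  · by_cases h' : a ≤ N
    · rw [dif_neg (by omega), dif_pos (by omega), dif_pos (by omega)]
      congr 3; omega
    · rw [dif_neg (by omega), dif_neg (by omega), dif_neg (by omega), dif_neg (by omega), neg_zero]

lemma zp_pos {N : ℕ} (i : Fin N) : zp k N (i.1 + 1) = MvPolynomial.X i := by
  unfold zp
  have := i.2
  rw [dif_pos (by omega)]
  congr 1; ext; simp

/-- The (absolute) index of a nonzero block. -/
lemma exists_fin {N : ℕ} {a : ℤ} (h0 : a ≠ 0) (h1 : -(N : ℤ) ≤ a) (h2 : a ≤ N) :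
    ∃ i : Fin N, a = i.1 + 1 ∨ a = -(i.1 + 1) := by
  rcases lt_or_gt_of_ne h0 with h | h
  · exact ⟨⟨(-a - 1).toNat, by omega⟩, Or.inr (by simp; omega)⟩
  · exact ⟨⟨(a - 1).toNat, by omega⟩, Or.inl (by simp; omega)⟩

lemma zp_inj (h2 : (2 : k) ≠ 0) {N : ℕ} {a a' : ℤ} (h0 : a ≠ 0) (hl : -(N : ℤ) ≤ a) (hu : a ≤ N)
    (h0' : a' ≠ 0) (hl' : -(N : ℤ) ≤ a') (hu' : a' ≤ N) (h : zp k N a = zp k N a') : a = a' := by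
  have key : ∀ i j : Fin N, (MvPolynomial.X i : MvPolynomial (Fin N) k) ≠ -MvPolynomial.X j := by
    intro i j hij
    have := congrArg (MvPolynomial.eval (fun _ => (1 : k))) hij
    simp only [MvPolynomial.eval_X, map_neg] at this
    apply h2
    have h3 : (1 : k) + 1 = 0 := by nth_rewrite 1 [this]; simp
    rw [← h3]; norm_num
  obtain ⟨i, rfl | rfl⟩ := exists_fin h0 hl hu <;> obtain ⟨j, rfl | rfl⟩ := exists_fin h0' hl' hu'
  · rw [zp_pos, zp_pos] at h
    rw [MvPolynomial.X_injective h]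
  · rw [zp_neg, zp_pos, zp_pos] at h
    exact absurd h (key _ _)
  · rw [zp_neg, zp_pos, zp_pos] at h
    exact absurd h.symm (key _ _)
  · rw [zp_neg, zp_neg, zp_pos, zp_pos] at h
    rw [MvPolynomial.X_injective (neg_injective h)]

/-- The field of parameters. -/
abbrev KK (k : Type) [Field k] (N : ℕ) : Type := FractionRing (MvPolynomial (Fin N) k)

/-- The inclusion of polynomials. -/
noncomputable def ioK (N : ℕ) : MvPolynomial (Fin N) k →ₐ[k] KK k N :=
  IsScalarTower.toAlgHom k _ _

lemma ioK_inj (N : ℕ) : Function.Injective (ioK k N) :=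
  IsFractionRing.injective (MvPolynomial (Fin N) k) (KK k N)

variable (D)

/-- The strands as a `Strands` structure. -/
noncomputable def Y (h2 : (2 : k) ≠ 0) : Strands D.S (KK k D.N) where
  L A := A.l
  z A := ioK k D.N (zp k D.N A.a)
  nx A B := A.a = B.a ∧ B.l = A.l + 2
  neg_lt {A B} h := by rw [lt_iff] at *; simp only [neg_a, neg_l]; omega
  L_neg _ := rfl
  L_odd A := A.l_odd
  z_neg A := by rw [neg_a, zp_neg, map_neg]
  nx_neg {A B} h := by simp only [neg_a, neg_l]; omega
  nx_lt {A B} h := by rw [lt_iff]; omega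
  nx_between {A B C} h h' := by
    rw [lt_iff] at h'; rw [le_iff]
    have := A.l_odd; have := C.l_odd; have := B.l_odd
    omega
  nx_L h := h.2
  nx_z {A B} h := by rw [h.1]
  nx_self A h := by have := A.a_ne; have := h.1; simp only [neg_a] at this; omega
  z_ne {A B} h h' hz := h' (S.ext (zp_inj k h2 A.a_ne A.le_a A.a_le B.a_ne B.le_a B.a_le
    (ioK_inj k _ hz)) h)
  nx_of {A B} h hz := ⟨zp_inj k h2 A.a_ne A.le_a A.a_le B.a_ne B.le_a B.a_le (ioK_inj k _ hz), h⟩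

end Blk
end VVPaper

namespace VVPaper
namespace Blk

/-- The segment with index `a`, counted from the end. -/
def sgm (segs : List (ℤ × ℕ)) (a : ℤ) : ℤ × ℕ := segs.reverse.getD (a - 1).toNat (-1, 1)

lemma sgm_prop {P : ℤ × ℕ → Prop} (segs : List (ℤ × ℕ)) (h : ∀ s ∈ segs, P s) (h0 : P (-1, 1)) (a : ℤ) :
    P (sgm segs a) := by
  unfold sgm
  by_cases hl : (a - 1).toNat < segs.reverse.length
  · rw [List.getD_eq_getElem _ _ hl]
    exact h _ (List.mem_reverse.1 (List.getElem_mem hl))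
  · rw [List.getD_eq_default _ _ (by omega)]; exact h0

lemma sgm_cons (s : ℤ × ℕ) (segs : List (ℤ × ℕ)) (a : ℤ) (h : 0 < a) (h' : a ≤ segs.length) :
    sgm (s :: segs) a = sgm segs a := by
  unfold sgm
  rw [List.reverse_cons, List.getD_append _ _ _ _ (by simp; omega)]

lemma sgm_last (s : ℤ × ℕ) (segs : List (ℤ × ℕ)) : sgm (s :: segs) (segs.length + 1) = s := by
  unfold sgm
  rw [List.reverse_cons, List.getD_append_right _ _ _ _ (by simp)]
  simp

/-- The blocks of a list of segments. -/
def ofSegs (segs : List (ℤ × ℕ)) (h1 : ∀ s ∈ segs, 1 ≤ s.2) (hs : segs.Pairwise SegLe)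
    (hl : ∀ s ∈ segs, s.1 + 1 ≤ s.2) (ho : ∀ s ∈ segs, s.1 % 2 = 1) : Blk where
  N := segs.length
  b a := if 0 < a then (sgm segs a).1 - 2 * ((sgm segs a).2 - 1) else
    if a < 0 then -(sgm segs (-a)).1 else -1
  t a := if 0 < a then (sgm segs a).1 else
    if a < 0 then -((sgm segs (-a)).1 - 2 * ((sgm segs (-a)).2 - 1)) else 1
  b_neg a := by split_ifs <;> first | omega | simp
  t_neg a := by split_ifs <;> first | omega | simp
  b_odd a := by
    have h := sgm_prop segs ho (by norm_num)
    have := h a; have := h (-a)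
    split_ifs <;> omega
  t_odd a := by
    have h := sgm_prop segs ho (by norm_num)
    have := h a; have := h (-a)
    split_ifs <;> omega
  b_le a := by
    have h := sgm_prop segs h1 (by norm_num)
    have := h a; have := h (-a)
    split_ifs <;> omega
  low a ha := by
    have h := sgm_prop segs hl (by norm_num)
    have := h a
    rw [if_pos ha, if_pos ha]; omega
  sorted a a' h0 h h' := by
    rw [if_pos h0, if_pos (by omega), if_pos h0, if_pos (by omega)]
    have h3 : SegLe (sgm segs a') (sgm segs a) := by
      unfold sgm
      rw [List.getD_eq_getElem _ _ (by simp; omega), List.getD_eq_getElem _ _ (by simp; omega),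
        List.getElem_reverse, List.getElem_reverse]
      exact List.pairwise_iff_getElem.1 hs _ _ _ _ (by omega)
    unfold SegLe at h3
    omega

/-- The positive strands with block at most `j`, in reading order. -/
def stl (t : ℤ → ℤ) (n : ℤ → ℕ) : ℕ → List (ℤ × ℤ)
  | 0 => []
  | j + 1 => (run (t (j + 1)) (n (j + 1))).map (fun l => ((j : ℤ) + 1, l)) ++ stl t n j

lemma mem_stl {t : ℤ → ℤ} {n : ℤ → ℕ} {j : ℕ} {x : ℤ × ℤ} :
    x ∈ stl t n j ↔ 0 < x.1 ∧ x.1 ≤ j ∧ ∃ i : ℕ, i < n x.1 ∧ x.2 = t x.1 - 2 * i := by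
  induction j with
  | zero => simp [stl]; omega
  | succ j ih =>
    simp only [stl, List.mem_append, List.mem_map, mem_run, ih]
    constructor
    · rintro (⟨l, ⟨i, hi, rfl⟩, rfl⟩ | ⟨h1, h2, h3⟩)
      · exact ⟨by dsimp; omega, by dsimp; omega, i, hi, rfl⟩
      · exact ⟨h1, by omega, h3⟩
    · rintro ⟨h1, h2, i, h3, h4⟩
      by_cases h : x.1 = j + 1
      · left
        exact ⟨x.2, ⟨i, by rw [← h]; exact h3, by rw [← h]; exact h4⟩, by rw [← h]⟩
      · right
        exact ⟨h1, by push_cast at h2; omega, i, h3, h4⟩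

lemma run_pairwise (a : ℤ) (n : ℕ) : (run a n).Pairwise (fun x y => y < x) := by
  induction n generalizing a with
  | zero => exact List.Pairwise.nil
  | succ n ih =>
    refine List.Pairwise.cons ?_ (ih _)
    intro y hy
    obtain ⟨t, _, rfl⟩ := mem_run.1 hy
    omega

lemma stl_pairwise (t : ℤ → ℤ) (n : ℤ → ℕ) (j : ℕ) :
    (stl t n j).Pairwise (fun x y => y.1 < x.1 ∨ (y.1 = x.1 ∧ y.2 < x.2)) := by
  induction j with
  | zero => exact List.Pairwise.nil
  | succ j ih =>
    rw [stl, List.pairwise_append]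
    refine ⟨?_, ih, ?_⟩
    · rw [List.pairwise_map]
      exact (run_pairwise _ _).imp fun h => Or.inr ⟨rfl, h⟩
    · intro x hx y hy
      obtain ⟨l, _, rfl⟩ := List.mem_map.1 hx
      obtain ⟨h1, h2, _⟩ := mem_stl.1 hy
      left; dsimp; omega

lemma stl_congr {t t' : ℤ → ℤ} {n n' : ℤ → ℕ} (j : ℕ)
    (h : ∀ a : ℤ, 0 < a → a ≤ j → t a = t' a ∧ n a = n' a) : stl t n j = stl t' n' j := by
  induction j with
  | zero => rfl
  | succ j ih =>
    rw [stl, stl, ih fun a h1 h2 => h a h1 (by push_cast; omega)]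
    obtain ⟨e1, e2⟩ := h (j + 1) (by omega) (by push_cast; omega)
    rw [e1, e2]

lemma stl_map (segs : List (ℤ × ℕ)) :
    (stl (fun a => (sgm segs a).1) (fun a => (sgm segs a).2) segs.length).map Prod.snd =
      segs.flatMap (fun s => run s.1 s.2) := by
  induction segs with
  | nil => rfl
  | cons s segs ih =>
    rw [List.length_cons, stl, List.flatMap_cons, List.map_append, List.map_map, sgm_last, ← ih,
      stl_congr (t' := fun a => (sgm segs a).1) (n' := fun a => (sgm segs a).2)]
    · congr 1
      exact List.map_id _
    · intro a h1 h2
      simp only [sgm_cons s segs a h1 h2, and_self]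

/-- The increasing arrangement of the positive strands. -/
structure Std (D : Blk) {m : ℕ} (v0 : Fin m → D.S) : Prop where
  mono : StrictMono v0
  pos : ∀ p, 0 < (v0 p).a
  surj : ∀ A : D.S, 0 < A.a → ∃ p, v0 p = A

theorem exists_std {m : ℕ} (g : Fin m → ℤ) (segs : List (ℤ × ℕ))
    (hg : rd g = segs.flatMap (fun s => run s.1 s.2)) (h1 : ∀ s ∈ segs, 1 ≤ s.2)
    (hs : segs.Pairwise SegLe) (hl : ∀ s ∈ segs, s.1 + 1 ≤ s.2) (ho : ∀ p, g p % 2 = 1) :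
    ∃ (D : Blk) (v0 : Fin m → D.S), Std D v0 ∧ ∀ p, (v0 p).l = g p := by
  have ho' : ∀ s ∈ segs, s.1 % 2 = 1 := by
    intro s hs
    have : s.1 ∈ rd g := by
      rw [hg, List.mem_flatMap]
      refine ⟨s, hs, mem_run.2 ⟨0, ?_, by simp⟩⟩
      have := h1 s hs; omega
    rw [rd, List.mem_ofFn] at this
    obtain ⟨p, hp⟩ := this
    rw [← hp]; exact ho _
  let D := ofSegs segs h1 hs hl ho'
  let L := stl (fun a => (sgm segs a).1) (fun a => (sgm segs a).2) segs.length
  have hmap : L.map Prod.snd = rd g := by rw [hg]; exact stl_map segs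
  have hlen : L.length = m := by
    have := congrArg List.length hmap
    simpa [rd] using this
  have hn := sgm_prop segs h1 (by norm_num)
  have hodd := sgm_prop segs ho' (by norm_num)
  have hmem : ∀ x, x ∈ L ↔ 0 < x.1 ∧ x.1 ≤ D.N ∧ D.b x.1 ≤ x.2 ∧ x.2 ≤ D.t x.1 ∧ x.2 % 2 = 1 := by
    intro x
    rw [mem_stl]
    have hh := hn x.1; have hh' := hodd x.1
    constructor
    · rintro ⟨e1, e2, i, e3, e4⟩
      refine ⟨e1, e2, ?_, ?_, ?_⟩
      · change (if 0 < x.1 then _ else _) ≤ _; rw [if_pos e1]; omega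
      · change _ ≤ (if 0 < x.1 then _ else _); rw [if_pos e1]; omega
      · omega
    · rintro ⟨e1, e2, e3, e4, e5⟩
      change (if 0 < x.1 then _ else _) ≤ _ at e3; rw [if_pos e1] at e3
      change _ ≤ (if 0 < x.1 then _ else _) at e4; rw [if_pos e1] at e4
      exact ⟨e1, e2, (((sgm segs x.1).1 - x.2) / 2).toNat, by omega, by omega⟩
  have hm : ∀ p : Fin m, m - 1 - p.1 < L.length := fun p => by have := p.2; omega
  let v0 : Fin m → D.S := fun p =>
    have h := (hmem _).1 (List.getElem_mem (hm p))
    ⟨(L[m - 1 - p.1]'(hm p)).1, (L[m - 1 - p.1]'(hm p)).2, by omega, by omega, h.2.1, h.2.2.1,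
      h.2.2.2.1, h.2.2.2.2⟩
  refine ⟨D, v0, ⟨?_, ?_, ?_⟩, ?_⟩
  · intro p q hpq
    rw [lt_iff]
    exact List.pairwise_iff_getElem.1 (stl_pairwise _ _ _) (m - 1 - q.1) (m - 1 - p.1) (hm q) (hm p)
      (by have := q.2; have : p.1 < q.1 := hpq; omega)
  · intro p; exact ((hmem _).1 (List.getElem_mem (hm p))).1
  · intro A hA
    have : (A.a, A.l) ∈ L := (hmem _).2 ⟨hA, A.a_le, A.le_l, A.l_le, A.l_odd⟩
    obtain ⟨i, hi, h⟩ := List.getElem_of_mem this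
    refine ⟨⟨m - 1 - i, by omega⟩, ?_⟩
    have e : m - 1 - (m - 1 - i) = i := by omega
    apply S.ext
    · change (L[m - 1 - (m - 1 - i)]'_).1 = _; simp only [e, h]
    · change (L[m - 1 - (m - 1 - i)]'_).2 = _; simp only [e, h]
  · intro p
    have h2 := rd_getElem g (m - 1 - p.1) (by have := p.2; omega)
    have e : (⟨m - 1 - (m - 1 - p.1), by have := p.2; omega⟩ : Fin m) = p := by
      ext; have := p.2; dsimp; omega
    rw [e] at h2
    rw [← h2]
    change (L[m - 1 - p.1]'_).2 = _
    simp only [← hmap, List.getElem_map]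

end Blk
end VVPaper

namespace VVPaper
namespace Blk
open Strands
variable {D : Blk} {m : ℕ} [NeZero m] {v0 : Fin m → D.S} {k : Type} [Field k] {h2 : (2 : k) ≠ 0}

lemma pap (γ : Equiv.Perm ℤ) (a : ℤ) : γ (γ⁻¹ a) = a := γ.apply_symm_apply a

lemma pip (γ : Equiv.Perm ℤ) (a : ℤ) : γ⁻¹ (γ a) = a := γ.symm_apply_apply a

lemma neg_lt_of_pos {A : D.S} (h : 0 < A.a) : -A < A := by
  rw [lt_iff]
  simp only [neg_a, neg_l]
  omega

lemma Std.good (H : Std D v0) : (D.Y k h2).Good v0 where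
  inj := H.mono.injective
  ne p q h := by
    have h1 := congrArg S.a h
    have := H.pos p; have := H.pos q
    simp only [neg_a] at h1; omega
  full A := by
    rcases lt_or_gt_of_ne A.a_ne with h | h
    · obtain ⟨p, hp⟩ := H.surj (-A) (by simp only [neg_a]; omega)
      exact ⟨p, Or.inr hp⟩
    · obtain ⟨p, hp⟩ := H.surj A h
      exact ⟨p, Or.inl hp⟩
  link p A h := by
    have h1 := h.1
    have h3 := H.pos p
    obtain ⟨q, hq⟩ := H.surj A (by omega)
    refine ⟨q, ?_, hq⟩
    rw [← H.mono.lt_iff_lt, hq]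
    exact (D.Y k h2).nx_lt h

lemma Std.nodesc (H : Std D v0) (g : Option (Fin (m - 1))) : ¬ Descent g v0 := by
  cases g with
  | none => exact fun h => absurd h (lt_asymm (neg_lt_of_pos (H.pos 0)))
  | some s => exact fun h => absurd h (lt_asymm (H.mono (by simp [lo, hi, Fin.lt_def])))

/-- Odd permutations of the blocks preserving their types. -/
structure Gam (D : Blk) (γ : Equiv.Perm ℤ) : Prop where
  neg : ∀ a, γ (-a) = -γ a
  b : ∀ a, D.b (γ a) = D.b a
  t : ∀ a, D.t (γ a) = D.t a
  rng : ∀ a, (-(D.N : ℤ) ≤ γ a ∧ γ a ≤ D.N) ↔ (-(D.N : ℤ) ≤ a ∧ a ≤ D.N)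

namespace Gam
variable {γ δ : Equiv.Perm ℤ}

lemma map_zero (h : Gam D γ) : γ 0 = 0 := by
  have := h.neg 0
  rw [neg_zero] at this
  omega

lemma ne_zero (h : Gam D γ) {a : ℤ} (ha : a ≠ 0) : γ a ≠ 0 := by
  rw [← h.map_zero]; exact fun h' => ha (γ.injective h')

lemma one : Gam D 1 := ⟨fun _ => rfl, fun _ => rfl, fun _ => rfl, fun _ => Iff.rfl⟩

lemma mul (h : Gam D γ) (h' : Gam D δ) : Gam D (γ * δ) where
  neg a := by rw [Equiv.Perm.mul_apply, Equiv.Perm.mul_apply, h'.neg, h.neg]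
  b a := by rw [Equiv.Perm.mul_apply, h.b, h'.b]
  t a := by rw [Equiv.Perm.mul_apply, h.t, h'.t]
  rng a := by rw [Equiv.Perm.mul_apply, h.rng, h'.rng]

lemma inv (h : Gam D γ) : Gam D γ⁻¹ where
  neg a := by
    apply γ.injective
    rw [h.neg, pap, pap]
  b a := by rw [← h.b, pap]
  t a := by rw [← h.t, pap]
  rng a := by rw [← h.rng, pap]

/-- The action on strands. -/
def act (h : Gam D γ) (A : D.S) : D.S where
  a := γ A.a
  l := A.l
  a_ne := h.ne_zero A.a_ne
  le_a := ((h.rng _).2 ⟨A.le_a, A.a_le⟩).1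
  a_le := ((h.rng _).2 ⟨A.le_a, A.a_le⟩).2
  le_l := by rw [h.b]; exact A.le_l
  l_le := by rw [h.t]; exact A.l_le
  l_odd := A.l_odd

lemma act_neg (h : Gam D γ) (A : D.S) : h.act (-A) = -h.act A := S.ext (h.neg _) rfl

lemma act_inj (h : Gam D γ) : Function.Injective h.act := fun _ _ hAB =>
  S.ext (γ.injective (congrArg S.a hAB)) (congrArg S.l hAB :)

lemma act_inv (h : Gam D γ) (A : D.S) : h.act (h.inv.act A) = A :=
  S.ext (γ.apply_symm_apply _) rfl

lemma good (h : Gam D γ) {v : Fin m → D.S} (hv : (D.Y k h2).Good v) :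
    (D.Y k h2).Good (fun p => h.act (v p)) where
  inj := h.act_inj.comp hv.inj
  ne p q hpq := hv.ne p q (h.act_inj (by rw [act_neg]; exact hpq))
  full A := by
    obtain ⟨p, hp | hp⟩ := hv.full (h.inv.act A)
    · exact ⟨p, Or.inl (by rw [hp, act_inv])⟩
    · exact ⟨p, Or.inr (by rw [hp, act_neg, act_inv])⟩
  link p A hA := by
    have h1 : γ (v p).a = A.a := hA.1
    obtain ⟨q, hq, hq'⟩ := hv.link p (h.inv.act A) ⟨by
      change _ = γ⁻¹ A.a
      rw [← h1, pip], hA.2⟩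
    exact ⟨q, hq, by rw [hq', act_inv]⟩

end Gam

/-- The odd exchange of two blocks. -/
def sw (a b x : ℤ) : ℤ :=
  if x = a then b else if x = b then a else if x = -a then -b else if x = -b then -a else x

lemma sw_sw (a b x : ℤ) (ha : a ≠ 0) (hb : b ≠ 0) : sw a b (sw a b x) = x := by
  unfold sw; split_ifs <;> omega

lemma gam_sw (a b : ℤ) (ha : a ≠ 0) (hb : b ≠ 0) (hN : -(D.N : ℤ) ≤ a ∧ a ≤ D.N)
    (hN' : -(D.N : ℤ) ≤ b ∧ b ≤ D.N) (e1 : D.b a = D.b b) (e2 : D.t a = D.t b) :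
    ∃ γ, Gam D γ ∧ ∀ x, γ x = sw a b x := by
  refine ⟨⟨sw a b, sw a b, fun x => sw_sw a b x ha hb, fun x => sw_sw a b x ha hb⟩,
    ⟨?_, ?_, ?_, ?_⟩, fun _ => rfl⟩
  · intro x; change sw a b (-x) = -sw a b x; unfold sw; split_ifs <;> omega
  · intro x; change D.b (sw a b x) = D.b x; unfold sw
    split_ifs with h1 h3 h4 h5
    · rw [h1, e1]
    · rw [h3, e1]
    · rw [h4, D.b_neg, D.b_neg, e2]
    · rw [h5, D.b_neg, D.b_neg, e2]
    · rfl
  · intro x; change D.t (sw a b x) = D.t x; unfold sw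
    split_ifs with h1 h3 h4 h5
    · rw [h1, e2]
    · rw [h3, e2]
    · rw [h4, D.t_neg, D.t_neg, e1]
    · rw [h5, D.t_neg, D.t_neg, e1]
    · rfl
  · intro x; change (_ ≤ sw a b x ∧ sw a b x ≤ _) ↔ _; unfold sw; split_ifs <;> omega

lemma rd_lex {w w' : Fin m → ℤ} (h : rd w ≤ rd w') (p : Fin m) (hp : ∀ q, p < q → w q = w' q) :
    w p ≤ w' p := by
  by_contra hlt
  push Not at hlt
  refine absurd h (not_le.2 ?_)
  rw [List.lt_iff_exists]
  right
  have hm := p.2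
  refine ⟨m - 1 - p.1, by simp [rd]; omega, by simp [rd]; omega, ?_, ?_⟩
  · intro j hj
    rw [rd_getElem _ _ (by omega), rd_getElem _ _ (by omega)]
    exact (hp _ (by rw [Fin.lt_def]; dsimp; omega)).symm
  · rw [rd_getElem _ _ (by omega), rd_getElem _ _ (by omega)]
    convert hlt using 2 <;> (ext; dsimp; omega)

lemma top_le (a b : ℤ) (ha : a ≠ 0) (hb : b ≤ D.N) (h1 : -b ≤ a) (h3 : a ≤ b) :
    D.t b ≤ D.t a ∧ (D.t b = D.t a → D.b b ≤ D.b a) := by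
  rcases lt_or_gt_of_ne ha with h | h
  · have e1 := D.low (-a) (by omega)
    have e2 := D.b_neg a; have e3 := D.t_neg a
    rcases eq_or_lt_of_le (show -a ≤ b by omega) with h' | h'
    · subst h'; omega
    · have := D.sorted (-a) b (by omega) h' hb
      omega
  · rcases eq_or_lt_of_le h3 with h' | h'
    · subst h'; omega
    · have := D.sorted a b h h' hb
      omega

lemma Std.block (H : Std D v0) {v : Fin m → D.S} (hv : (D.Y k h2).Good v)
    (hle : ∀ p, (∀ q, p < q → (v q).l = (v0 q).l) → (v p).l ≤ (v0 p).l) (b : ℤ) (hb : 0 < b)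
    (hbN : b ≤ D.N) (hid : ∀ q, b < (v0 q).a → v q = v0 q) :
    ∃ a, a ≠ 0 ∧ -b ≤ a ∧ a ≤ b ∧ D.b a = D.b b ∧ D.t a = D.t b ∧
      ∀ p, (v0 p).a = b → (v p).a = a ∧ (v p).l = (v0 p).l := by
  have F1 : ∀ p, (v0 p).a = b → -b ≤ (v p).a ∧ (v p).a ≤ b := by
    intro p hp
    constructor
    · by_contra hlt
      obtain ⟨q, hq⟩ := H.surj (-(v p)) (by simp only [neg_a]; omega)
      have e := hid q (by rw [hq]; simp only [neg_a]; omega)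
      exact hv.ne q p (by rw [e, hq])
    · by_contra hlt
      obtain ⟨q, hq⟩ := H.surj (v p) (by omega)
      have e := hid q (by rw [hq]; omega)
      have := hv.inj (e.trans hq)
      subst this; rw [← hq, hp] at hlt; exact hlt le_rfl
  have hgt : ∀ p q, (v0 p).a = b → p < q → b < (v0 q).a ∨ ((v0 q).a = b ∧ (v0 p).l < (v0 q).l) := by
    intro p q hp hpq
    have := lt_iff.1 (H.mono hpq)
    omega
  have hnext : ∀ p, (v p).l < D.t (v p).a → ∃ q, p < q ∧ (v q).a = (v p).a ∧ (v q).l = (v p).l + 2 := by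
    intro p hp
    have := D.t_odd (v p).a; have := (v p).l_odd; have := (v p).le_l
    obtain ⟨q, h1, h3⟩ := hv.link p ⟨(v p).a, (v p).l + 2, (v p).a_ne, (v p).le_a, (v p).a_le,
      by omega, by omega, by omega⟩ ⟨rfl, rfl⟩
    exact ⟨q, h1, by rw [h3], by rw [h3]⟩
  obtain ⟨p1, hp1⟩ := H.surj ⟨b, D.t b, by omega, by omega, hbN, D.b_le b, le_rfl, D.t_odd b⟩ hb
  obtain ⟨p2, hp2⟩ := H.surj ⟨b, D.b b, by omega, by omega, hbN, le_rfl, D.b_le b, D.b_odd b⟩ hb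
  have hp1a : (v0 p1).a = b := by rw [hp1]
  have hp1l : (v0 p1).l = D.t b := by rw [hp1]
  have hp2a : (v0 p2).a = b := by rw [hp2]
  have hp2l : (v0 p2).l = D.b b := by rw [hp2]
  have hbig : ∀ q, p1 < q → b < (v0 q).a := by
    intro q hq
    rcases hgt p1 q hp1a hq with h | ⟨h, h'⟩
    · exact h
    · have := (v0 q).l_le; rw [h] at this; omega
  have c1 : (v p1).l ≤ D.t b := by
    rw [← hp1l]
    exact hle p1 fun q hq => by rw [hid q (hbig q hq)]
  have c2 : (v p1).l = D.t (v p1).a := by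
    by_contra hne
    have := (v p1).l_le
    obtain ⟨q, hq, hq1, -⟩ := hnext p1 (by omega)
    have h3 := hbig q hq
    rw [hid q h3] at hq1
    have := F1 p1 hp1a
    omega
  have T := fun p (hp : (v0 p).a = b) => top_le (D := D) (v p).a b (v p).a_ne hbN (F1 p hp).1 (F1 p hp).2
  have c3 := T p1 hp1a
  have key : ∀ n : ℕ, ∀ p, m - p.1 ≤ n → (v0 p).a = b → (v p).a = (v p1).a ∧ (v p).l = (v0 p).l := by
    intro n
    induction n with
    | zero => intro p hp; have := p.2; omega
    | succ n ih =>
      intro p hpn hp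
      rcases eq_or_ne p p1 with rfl | hne
      · exact ⟨rfl, by omega⟩
      have d0 : (v0 p).l < D.t b := by
        have := (v0 p).l_le
        rw [hp] at this
        refine lt_of_le_of_ne this fun h => hne (H.mono.injective ?_)
        rw [hp1]; exact S.ext hp h
      have ihq : ∀ q, p < q → (v0 q).a = b → (v q).a = (v p1).a ∧ (v q).l = (v0 q).l :=
        fun q hq hqb => ih q (by rw [Fin.lt_def] at hq; omega) hqb
      have d1 : (v p).l ≤ (v0 p).l := hle p fun q hq => by
        rcases hgt p q hp hq with h | ⟨h, -⟩
        · rw [hid q h]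
        · exact (ihq q hq h).2
      have d2 := T p hp
      have d3 := F1 p hp
      obtain ⟨q, hq, e1, e2⟩ := hnext p (by omega)
      rcases hgt p q hp hq with h | ⟨h, h'⟩
      · rw [hid q h] at e1; omega
      · obtain ⟨f1, f2⟩ := ihq q hq h
        have := (v0 p).l_odd; have := (v0 q).l_odd
        exact ⟨by omega, by omega⟩
  have c4 := key m p2 (by omega) hp2a
  have c5 := (v p2).le_l
  rw [c4.1, c4.2, hp2l] at c5
  have c6 := F1 p1 hp1a
  exact ⟨(v p1).a, (v p1).a_ne, c6.1, c6.2, by omega, by omega, fun p hp => key m p (by omega) hp⟩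

theorem Std.lex (H : Std D v0) {v : Fin m → D.S} (hv : (D.Y k h2).Good v)
    (hle : rd ((D.Y k h2).wrd v) ≤ rd ((D.Y k h2).wrd v0)) :
    ∃ γ, ∃ h : Gam D γ, ∀ p, v p = h.act (v0 p) := by
  have key : ∀ (b : ℕ), b ≤ D.N → ∀ v : Fin m → D.S, (D.Y k h2).Good v →
      rd ((D.Y k h2).wrd v) ≤ rd ((D.Y k h2).wrd v0) → (∀ q, (b : ℤ) < (v0 q).a → v q = v0 q) →
      (∀ p, (∀ q, p < q → (v q).l = (v0 q).l) → (v p).l ≤ (v0 p).l) →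
      ∃ γ, ∃ h : Gam D γ, ∀ p, v p = h.act (v0 p) := by
    intro b
    induction b with
    | zero =>
      intro _ v hv _ hid _
      exact ⟨1, Gam.one, fun p => hid p (by exact_mod_cast H.pos p)⟩
    | succ b ih =>
      intro hb v hv hl hid hx
      obtain ⟨a, h0, h1, h3, e1, e2, h4⟩ := H.block hv hx (b + 1) (by omega) (by omega)
        (fun q hq => hid q (by push_cast; omega))
      obtain ⟨σ, hσ, hs⟩ := gam_sw (D := D) a (b + 1) h0 (by omega) (by omega) (by omega) e1 e2
      have hfix : ∀ q, (b : ℤ) < (v0 q).a → hσ.act (v q) = v0 q := by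
        intro q hq
        rcases eq_or_lt_of_le (show (b : ℤ) + 1 ≤ (v0 q).a by omega) with h | h
        · obtain ⟨h5, h7⟩ := h4 q h.symm
          apply S.ext
          · change σ (v q).a = _
            rw [hs, h5, ← h]; simp [sw]
          · exact h7
        · rw [hid q (by push_cast; omega)]
          apply S.ext
          · change σ (v0 q).a = _
            rw [hs]; unfold sw; split_ifs <;> omega
          · rfl
      obtain ⟨γ, hγ, h6⟩ := ih (by omega) (fun p => hσ.act (v p)) (hσ.good hv) hl hfix hx
      refine ⟨_, hσ.inv.mul hγ, fun p => ?_⟩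
      apply hσ.act_inj
      rw [h6]
      apply S.ext
      · change γ _ = σ ((σ⁻¹ * γ) _)
        rw [Equiv.Perm.mul_apply, pap]
      · rfl
  exact key D.N le_rfl v hv hle (fun q hq => absurd (v0 q).a_le (by omega)) (fun p hp =>
    rd_lex hle p hp)

end Blk
end VVPaper

namespace VVPaper
open Strands

/-- An involutive quotient of a VV algebra, universal among the VV algebras in which the words
below all its words vanish. -/
structure Full (k : Type) [Field k] {m : ℕ} [NeZero m] (Wd : Finset (Fin m → ℤ)) (R : Type) [Ring R]
    [Algebra k R] where
  A : VVAlg k Wd R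
  gen : Algebra.adjoin k (Set.range A.x ∪ Set.range A.gn ∪ Set.range A.e) = ⊤
  om : R →ₗ[k] R
  om_mul : ∀ a b, om (a * b) = om b * om a
  om_one : om 1 = 1
  om_om : ∀ a, om (om a) = a
  om_x : ∀ p, om (A.x p) = A.x p
  om_gn : ∀ g, om (A.gn g) = A.gn g
  om_e : ∀ w, om (A.e w) = A.e w
  univ : ∀ (T : Type) [Ring T] [Algebra k T] (ρ : VVAlg k Wd T),
    (∀ w, (∀ w', A.e w' ≠ 0 → rd w < rd w') → ρ.e w = 0) →
    ∃ f : R →ₐ[k] T, (∀ p, f (A.x p) = ρ.x p) ∧ (∀ g, f (A.gn g) = ρ.gn g) ∧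
      ∀ w, f (A.e w) = ρ.e w

namespace Blk
variable {k : Type} [Field k] {m : ℕ} [NeZero m] {Wd : Finset (Fin m → ℤ)} {R : Type} [Ring R]
  [Algebra k R] {D : Blk} {v0 : Fin m → D.S} {h2 : (2 : k) ≠ 0}

instance : Finite D.S :=
  Finite.of_injective (fun A : D.S => ((⟨A.a, Finset.mem_Icc.2 ⟨A.le_a, A.a_le⟩⟩, ⟨A.l,
    Finset.mem_biUnion.2 ⟨A.a, Finset.mem_Icc.2 ⟨A.le_a, A.a_le⟩, Finset.mem_Icc.2 ⟨A.le_l, A.l_le⟩⟩⟩) :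
      (Finset.Icc (-(D.N : ℤ)) D.N) ×
      ((Finset.Icc (-(D.N : ℤ)) D.N).biUnion fun a => Finset.Icc (D.b a) (D.t a)))) (by
    intro A B h
    simp only [Prod.mk.injEq, Subtype.mk.injEq] at h
    exact S.ext h.1 h.2)

lemma rd_swap_lt (s : Fin (m - 1)) (g : Fin m → ℤ) (h : g (lo s) < g (hi s)) :
    rd (swapAt s g) < rd g := by
  by_contra hlt
  have h1 := rd_lex (not_lt.1 hlt) (hi s) (fun q hq => by
    simp only [swapAt, Function.comp_apply]
    rw [Equiv.swap_apply_of_ne_of_ne]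
    · rintro rfl; exact absurd hq (by simp [lo, hi, Fin.lt_def])
    · exact hq.ne')
  simp only [swapAt, Function.comp_apply, Equiv.swap_apply_right] at h1
  omega

lemma Std.str (A : VVAlg k Wd R) (H : Std D v0)
    (hmin : ∀ w, A.e w ≠ 0 → rd ((D.Y k h2).wrd v0) ≤ rd w) : Str A (D.Y k h2) v0 where
  good := H.good
  nodesc := H.nodesc
  link g hg := by
    cases g with
    | none => exact hg.elim
    | some s =>
      have h1 := (D.Y k h2).nx_L hg
      change A.sg s * _ = 0
      rw [A.sg_e]
      have h3 : A.e (swapAt s ((D.Y k h2).wrd v0)) = 0 := by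
        by_contra hne
        exact absurd (hmin _ hne) (not_le.2 (rd_swap_lt s _ (by unfold wrd; omega)))
      rw [h3, zero_mul]

lemma Std.exists_pos (H : Std D v0) (i : Fin D.N) :
    ∃ p, (v0 p).a = i.1 + 1 ∧ (v0 p).l = D.t (i.1 + 1) := by
  have := i.2
  obtain ⟨p, hp⟩ := H.surj ⟨i.1 + 1, D.t (i.1 + 1), by omega, by omega, by omega, D.b_le _, le_rfl,
    D.t_odd _⟩ (by dsimp; omega)
  exact ⟨p, by rw [hp], by rw [hp]⟩

lemma Std.x_eq (A : VVAlg k Wd R) (H : Std D v0) (K : Str A (D.Y k h2) v0) (r : Fin m)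
    (hr : (v0 r).l = D.t (v0 r).a) : ∀ n : ℕ, ∀ p, (v0 p).a = (v0 r).a → D.t (v0 r).a - (v0 p).l ≤ n →
      A.x p * A.e ((D.Y k h2).wrd v0) = A.x r * A.e ((D.Y k h2).wrd v0) := by
  intro n
  induction n with
  | zero =>
    intro p hp hn
    have := (v0 p).l_le
    rw [hp] at this
    rw [H.mono.injective (S.ext hp (by omega) : v0 p = v0 r)]
  | succ n ih =>
    intro p hp hn
    have h1 := (v0 p).l_le
    rw [hp] at h1
    rcases eq_or_lt_of_le h1 with h | h
    · rw [H.mono.injective (S.ext hp (by omega) : v0 p = v0 r)]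
    have := (v0 p).l_odd; have := (v0 r).l_odd; have := (v0 p).le_l
    have hpos := H.pos p
    obtain ⟨q, hq⟩ := H.surj ⟨(v0 p).a, (v0 p).l + 2, (v0 p).a_ne, (v0 p).le_a, (v0 p).a_le,
      by omega, by rw [hp]; omega, by omega⟩ hpos
    have nx : (D.Y k h2).nx (v0 p) (v0 q) := by rw [hq]; exact ⟨rfl, rfl⟩
    have hpq : p < q := H.mono.lt_iff_lt.1 ((D.Y k h2).nx_lt nx)
    have hpq' : q.1 = p.1 + 1 := by
      by_contra hne
      have hq2 := q.2
      have h3 : p < (⟨p.1 + 1, by rw [Fin.lt_def] at hpq; omega⟩ : Fin m) := by simp [Fin.lt_def]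
      have h4 := (D.Y k h2).nx_between nx (H.mono h3)
      rw [H.mono.le_iff_le, Fin.le_def] at h4
      rw [Fin.lt_def] at hpq
      dsimp at h4
      omega
    have hq2 := q.2
    have e1 : lo (⟨p.1, by omega⟩ : Fin (m - 1)) = p := rfl
    have e2 : hi (⟨p.1, by omega⟩ : Fin (m - 1)) = q := Fin.ext hpq'.symm
    have h5 := K.link (some ⟨p.1, by omega⟩) (by
      change (D.Y k h2).nx (v0 (lo _)) (v0 (hi _))
      rw [e1, e2]; exact nx)
    have h6 := A.sq_up ⟨p.1, by omega⟩ ((D.Y k h2).wrd v0) (by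
      rw [e1, e2]; exact (D.Y k h2).nx_L nx)
    rw [mul_assoc, show A.sg _ * A.e _ = 0 from h5, mul_zero, e1, e2, sub_mul] at h6
    rw [← sub_eq_zero.1 h6.symm]
    refine ih q ?_ ?_
    · rw [hq]; exact hp
    · rw [hq]; dsimp; push_cast at hn; omega

/-- The block of a position of a standard arrangement. -/
def Std.blk (H : Std D v0) (p : Fin m) : Fin D.N :=
  ⟨((v0 p).a - 1).toNat, by have := H.pos p; have := (v0 p).a_le; omega⟩

lemma Std.blk_a (H : Std D v0) (p : Fin m) : ((H.blk p).1 : ℤ) + 1 = (v0 p).a := by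
  have := H.pos p; simp only [Std.blk]; omega

lemma Std.wrd_mem (A : VVAlg k Wd R) (K : Str A (D.Y k h2) v0)
    (hcl : ∀ w ∈ Wd, ∀ g, gact g w ∈ Wd) (h0 : (D.Y k h2).wrd v0 ∈ Wd) :
    ∀ v, (D.Y k h2).Good v → (D.Y k h2).wrd v ∈ Wd := by
  refine K.ind h0 ?_
  intro v g hv hd hg _ _ ih
  have h1 := hcl _ ih g
  cases g with
  | none =>
    change flip0 ((D.Y k h2).wrd (flip0 v)) ∈ Wd at h1
    rwa [← wrd_flip0, flip0_flip0] at h1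
  | some s =>
    change swapAt s (swapAt s ((D.Y k h2).wrd v)) ∈ Wd at h1
    rwa [swapAt_swapAt] at h1

lemma Full.exists_rho (F : Full k Wd R) (hcl : ∀ w ∈ Wd, ∀ g, gact g w ∈ Wd) (H : Std D v0)
    (h0 : F.A.e ((D.Y k h2).wrd v0) ≠ 0)
    (hmin : ∀ w, F.A.e w ≠ 0 → rd ((D.Y k h2).wrd v0) ≤ rd w) :
    ∃ rho : R →ₐ[k] Module.End (KK k D.N) ((D.Y k h2).GV m → KK k D.N),
      (∀ p, rho (F.A.x p) = (D.Y k h2).opx p) ∧ (∀ g, rho (F.A.gn g) = (D.Y k h2).op g) ∧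
      ∀ w, rho (F.A.e w) = (D.Y k h2).ope w := by
  have hWd := Std.wrd_mem F.A (H.str F.A hmin) hcl (by
    by_contra h; exact h0 (F.A.e_zero _ h))
  obtain ⟨f, h1, h3, h4⟩ := F.univ _ ((D.Y k h2).rep k Wd hWd) (by
    intro w hw
    change (D.Y k h2).ope w = 0
    refine LinearMap.ext fun f => funext fun v => ?_
    rw [ope_apply, if_neg]; · rfl
    rintro rfl
    have hlt := hw _ h0
    obtain ⟨γ, h, hv⟩ := H.lex v.2 hlt.le
    have : (D.Y k h2).wrd v.1 = (D.Y k h2).wrd v0 := by funext p; unfold wrd; rw [hv p]; rfl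
    rw [this] at hlt
    exact lt_irrefl _ hlt)
  refine ⟨f, h1, fun g => ?_, h4⟩
  rw [h3]; cases g <;> rfl

/-- The strand representation attached to a minimal word. -/
noncomputable def ctx (F : Full k Wd R) (hcl : ∀ w ∈ Wd, ∀ g, gact g w ∈ Wd) (H : Std D v0)
    (h0 : F.A.e ((D.Y k h2).wrd v0) ≠ 0)
    (hmin : ∀ w, F.A.e w ≠ 0 → rd ((D.Y k h2).wrd v0) ≤ rd w) :
    Ctx k Wd R D.S (KK k D.N) D.N where
  A := F.A
  Y := D.Y k h2
  v0 := v0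
  str := H.str F.A hmin
  rho := (Full.exists_rho F hcl H h0 hmin).choose
  rho_x := (Full.exists_rho F hcl H h0 hmin).choose_spec.1
  rho_gn := (Full.exists_rho F hcl H h0 hmin).choose_spec.2.1
  rho_e := (Full.exists_rho F hcl H h0 hmin).choose_spec.2.2
  gen := F.gen
  om := F.om
  om_mul := F.om_mul
  om_one := F.om_one
  om_om := F.om_om
  om_x := F.om_x
  om_gn := F.om_gn
  om_e := F.om_e
  io := ioK k D.N
  io_inj := ioK_inj k D.N
  pos i := (H.exists_pos i).choose
  blk := H.blk
  z_v0 p := by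
    change ioK k D.N (zp k D.N (v0 p).a) = _
    rw [← H.blk_a, zp_pos]
  blk_pos i := by
    have := (H.exists_pos i).choose_spec.1
    have h := H.blk_a (H.exists_pos i).choose
    ext; omega
  x_blk p := by
    obtain ⟨h1, h3⟩ := (H.exists_pos (H.blk p)).choose_spec
    have h4 := h1.trans (H.blk_a p)
    exact H.x_eq F.A (H.str F.A hmin) _ (by rw [h3, h1])
      (D.t (v0 (H.exists_pos (H.blk p)).choose).a - (v0 p).l).toNat p h4.symm (by
        have := (v0 p).l_le
        rw [h4]; omega)

end Blk
end VVPaper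

namespace VVPaper
open Strands

/-- The degree of an exchange of two letters. -/
def wt (ε x y : ℤ) : ℤ := (if y = x + ε then 1 else 0) - if x = y then 1 else 0

/-- The degree contributed by a pair of strands. -/
def Strands.cst {S K : Type} [LinearOrder S] [InvolutiveNeg S] [Field K] (Y : Strands S K) (ε : ℤ)
    (A B : S) : ℤ := if B < A then wt ε (Y.L A) (Y.L B) else 0

namespace Ctx
variable {k : Type} [Field k] {m : ℕ} [NeZero m] {Wd : Finset (Fin m → ℤ)} {R : Type} [Ring R]
    [Algebra k R] {S K : Type} [LinearOrder S] [InvolutiveNeg S] [Field K] [Algebra k K] {N : ℕ}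
    (C : Ctx k Wd R S K N) (phi : K →+* K) (p : k)

/-- Homogeneity with respect to a scaling. -/
def Hm (d : ℤ) (h : R) : Prop := ∀ f u, phi (C.rho h f u) =
    algebraMap k K (p ^ d) * C.rho h (fun w => phi (f w)) u

variable {C phi p}

lemma Hm.mul (hp : p ≠ 0) {d d' : ℤ} {h h' : R} (a : C.Hm phi p d h) (b : C.Hm phi p d' h') :
    C.Hm phi p (d + d') (h * h') := by
  intro f u
  rw [map_mul, Module.End.mul_apply, a, Module.End.mul_apply, zpow_add₀ hp, map_mul, mul_assoc]
  congr 1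
  rw [show (fun w => phi (C.rho h' f w)) = algebraMap k K (p ^ d') • C.rho h' (fun w => phi (f w)) from
    funext fun w => b f w, map_smul]
  rfl

lemma hm_e (w : Fin m → ℤ) : C.Hm phi p 0 (C.A.e w) := by
  intro f u
  rw [C.rho_e, ope_apply, ope_apply, zpow_zero, map_one, one_mul]
  split_ifs <;> simp

/-- The degree of a generator on a word. -/
def gdeg : Option (Fin (m - 1)) → (Fin m → ℤ) → ℤ
  | none, _ => 0
  | some s, w => wt 2 (w (hi s)) (w (lo s))

lemma hm_gn_e (hp : p ≠ 0) (hz : ∀ A, phi (C.Y.z A) = p • C.Y.z A) (g : Option (Fin (m - 1)))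
    (w : Fin m → ℤ) : C.Hm phi p (gdeg g w) (C.A.gn g * C.A.e w) := by
  have hp' : algebraMap k K p ≠ 0 := by simpa using hp
  intro f u
  rw [map_mul, Module.End.mul_apply, Module.End.mul_apply, C.rho_gn, C.rho_e, op_apply, op_apply, opT,
    opT, ext_ope, ext_ope, ext_ope, ext_ope, map_add, map_mul, map_mul]
  have hx : ∀ v, phi (C.Y.ext f v) = C.Y.ext (fun w => phi (f w)) v := by
    intro v; unfold ext; split_ifs <;> simp
  have h1 : phi (if C.Y.wrd u.1 = w then C.Y.ext f u.1 else 0) =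
      if C.Y.wrd u.1 = w then C.Y.ext (fun w => phi (f w)) u.1 else 0 := by
    rw [apply_ite phi, hx, map_zero]
  have h3 : phi (if C.Y.wrd (gact g u.1) = w then C.Y.ext f (gact g u.1) else 0) =
      if C.Y.wrd (gact g u.1) = w then C.Y.ext (fun w => phi (f w)) (gact g u.1) else 0 := by
    rw [apply_ite phi, hx, map_zero]
  rw [h1, h3, mul_add]
  cases g with
  | none =>
    have e1 : C.Y.al none u.1 = 0 := rfl
    have e2 : C.Y.be none u.1 = 1 := rfl
    have e3 : gdeg none w = 0 := rfl
    rw [e1, e2, e3, zpow_zero]; simp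
  | some s =>
    have e1 : C.Y.al (some s) u.1 = C.Y.ca (u.1 (lo s)) (u.1 (hi s)) := rfl
    have e2 : C.Y.be (some s) u.1 = C.Y.cb (u.1 (lo s)) (u.1 (hi s)) := rfl
    have e3 : gdeg (some s) w = wt 2 (w (hi s)) (w (lo s)) := rfl
    rw [e1, e2, e3]
    congr 1
    · split_ifs with h
      · rw [← mul_assoc]; congr 1
        subst h
        unfold ca wrd wt
        by_cases h4 : C.Y.L (u.1 (lo s)) = C.Y.L (u.1 (hi s))
        · rw [if_pos h4, h4, if_neg (by omega), if_pos rfl, map_neg, map_inv₀, map_sub, hz, hz, ← smul_sub,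
            zero_sub, zpow_neg_one, map_inv₀, Algebra.smul_def, mul_inv]
          ring
        · rw [if_neg h4]; simp
      · simp
    · split_ifs with h
      · rw [← mul_assoc]; congr 1
        have hlo : w (lo s) = C.Y.L (u.1 (hi s)) := by
          rw [← h]; exact congrArg C.Y.L (congrArg u.1 (Equiv.swap_apply_left _ _))
        have hhi : w (hi s) = C.Y.L (u.1 (lo s)) := by
          rw [← h]; exact congrArg C.Y.L (congrArg u.1 (Equiv.swap_apply_right _ _))
        unfold cb wt
        rw [hlo, hhi]
        by_cases h4 : C.Y.L (u.1 (lo s)) = C.Y.L (u.1 (hi s))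
        · rw [if_pos h4, h4, if_neg (by omega), if_pos rfl, map_inv₀, map_sub, hz, hz, ← smul_sub,
            zero_sub, zpow_neg_one, map_inv₀, Algebra.smul_def, mul_inv]
        · rw [if_neg h4, if_neg h4]
          by_cases h5 : C.Y.L (u.1 (hi s)) = C.Y.L (u.1 (lo s)) + 2
          · rw [if_pos h5, if_pos h5, map_sub, hz, hz, ← smul_sub, sub_zero, zpow_one, Algebra.smul_def]
          · rw [if_neg h5, if_neg h5]; simp
      · simp

lemma cst_symm (ε : ℤ) (A B : S) : C.Y.cst ε (-A) B = C.Y.cst ε (-B) A := by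
  unfold cst wt
  have h : B < -A ↔ A < -B := by
    rw [← C.Y.neg_lt_iff, neg_neg]
  simp only [h, C.Y.L_neg]
  split_ifs <;> omega

lemma psum_step (ε : ℤ) {v : Fin m → S} {g : Option (Fin (m - 1))} (hd : Descent g v) :
    psum (C.Y.cst ε) v = psum (C.Y.cst ε) (gact g v) + (match g with
      | none => 0
      | some s => wt ε (C.Y.L (v (lo s))) (C.Y.L (v (hi s)))) := by
  cases g with
  | none => change _ = psum _ (flip0 v) + 0; rw [psum_flip, add_zero]
  | some s =>
    change _ = psum _ (swapAt s v) + _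
    rw [psum_swap _ (cst_symm ε)]
    have h1 : C.Y.cst ε (v (lo s)) (v (hi s)) = wt ε (C.Y.L (v (lo s))) (C.Y.L (v (hi s))) :=
      if_pos hd
    have h3 : C.Y.cst ε (v (hi s)) (v (lo s)) = 0 := if_neg (not_lt.2 (le_of_lt hd))
    rw [h1, h3]; ring

lemma hm_b (hp : p ≠ 0) (hz : ∀ A, phi (C.Y.z A) = p • C.Y.z A)
    (h0 : ∀ ε, ε = 2 ∨ ε = -2 → psum (C.Y.cst ε) C.v0 = 0) : ∀ v, C.Y.Good v →
      C.Hm phi p (psum (C.Y.cst 2) v) (C.str.b v) ∧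
      C.Hm phi p (psum (C.Y.cst (-2)) v) (C.om (C.str.b v)) := by
  refine C.str.ind ?_ ?_
  · rw [h0 _ (Or.inl rfl), h0 _ (Or.inr rfl), C.str.b_v0, C.om_e]; exact ⟨hm_e _, hm_e _⟩
  · intro v g hv hd hg _ hb ih
    rw [psum_step 2 hd, psum_step (-2) hd]
    constructor
    · have h1 := (hm_gn_e hp hz g (C.Y.wrd (gact g v))).mul hp ih.1
      rw [mul_assoc, C.str.e_b hg, ← hb, add_comm] at h1
      convert h1 using 2
      cases g with
      | none => rfl
      | some s =>
        change _ = wt 2 (C.Y.L (swapAt s v (hi s))) (C.Y.L (swapAt s v (lo s)))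
        simp [swapAt]
    · have h1 := ih.2.mul hp (hm_gn_e hp hz g (C.Y.wrd v))
      have h3 : C.om (C.str.b (gact g v)) * (C.A.gn g * C.A.e (C.Y.wrd v)) = C.om (C.str.b v) := by
        conv_rhs => rw [← C.str.e_b hv, hb]
        rw [C.om_mul, C.om_mul, C.om_gn, C.om_e, mul_assoc]
      rw [h3] at h1
      convert h1 using 2
      cases g with
      | none => rfl
      | some s =>
        change wt (-2) (C.Y.L (v (lo s))) (C.Y.L (v (hi s))) = wt 2 (C.Y.L (v (hi s))) (C.Y.L (v (lo s)))
        unfold wt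
        split_ifs <;> omega

end Ctx
end VVPaper

namespace VVPaper
namespace Blk
open Strands
variable {D : Blk} {m : ℕ} [NeZero m] {v0 : Fin m → D.S} {k : Type} [Field k] {h2 : (2 : k) ≠ 0}
  {γ : Equiv.Perm ℤ}

noncomputable instance : Fintype D.S := Fintype.ofFinite _

variable (D) in
/-- The signed block indices. -/
noncomputable def Ra : Finset ℤ := (Finset.Icc (-(D.N : ℤ)) D.N).erase 0

variable (D) in
/-- The letters of a block. -/
noncomputable def Lt (a : ℤ) : Finset ℤ := (Finset.Icc (D.b a) (D.t a)).filter (· % 2 = 1)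

lemma mem_Ra {a : ℤ} : a ∈ D.Ra ↔ a ≠ 0 ∧ -(D.N : ℤ) ≤ a ∧ a ≤ D.N := by
  simp [Ra]

lemma mem_Lt {a l : ℤ} : l ∈ D.Lt a ↔ D.b a ≤ l ∧ l ≤ D.t a ∧ l % 2 = 1 := by
  simp [Lt, and_assoc]

lemma Gam.mem_Ra (h : Gam D γ) {a : ℤ} : γ a ∈ D.Ra ↔ a ∈ D.Ra := by
  rw [Blk.mem_Ra, Blk.mem_Ra, h.rng]
  constructor
  · rintro ⟨h1, h3⟩; exact ⟨fun h4 => h1 (by rw [h4, h.map_zero]), h3⟩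
  · rintro ⟨h1, h3⟩; exact ⟨h.ne_zero h1, h3⟩

lemma sum_S (G : ℤ → ℤ → ℤ) : ∑ A : D.S, G A.a A.l = ∑ a ∈ D.Ra, ∑ l ∈ D.Lt a, G a l := by
  rw [Finset.sum_sigma']
  refine Finset.sum_bij (fun A _ => ⟨A.a, A.l⟩) ?_ ?_ ?_ ?_
  · intro A _
    rw [Finset.mem_sigma]
    exact ⟨mem_Ra.2 ⟨A.a_ne, A.le_a, A.a_le⟩, mem_Lt.2 ⟨A.le_l, A.l_le, A.l_odd⟩⟩
  · intro A _ B _ h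
    simp only [Sigma.mk.injEq, heq_eq_eq] at h
    exact S.ext h.1 h.2
  · rintro ⟨a, l⟩ h
    rw [Finset.mem_sigma] at h
    obtain ⟨h1, h3, h4⟩ := mem_Ra.1 h.1
    obtain ⟨h5, h6, h7⟩ := mem_Lt.1 h.2
    exact ⟨⟨a, l, h1, h3, h4, h5, h6, h7⟩, Finset.mem_univ _, rfl⟩
  · intro A _; rfl

lemma Std.sum_pos (H : Std D v0) (F : D.S → ℤ) :
    ∑ A : D.S, (if 0 < A.a then F A else 0) = ∑ p, F (v0 p) := by
  rw [← Finset.sum_filter]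
  symm
  refine Finset.sum_bij (fun p _ => v0 p) ?_ ?_ ?_ ?_
  · intro p _; simpa using H.pos p
  · intro p _ q _ h; exact H.mono.injective h
  · intro A hA
    obtain ⟨p, hp⟩ := H.surj A (by simpa using hA)
    exact ⟨p, Finset.mem_univ _, hp⟩
  · intro p _; rfl

lemma sum_neg (F : D.S → ℤ) : ∑ A : D.S, F (-A) = ∑ A : D.S, F A :=
  Equiv.sum_comp (Equiv.neg D.S) F

lemma Std.psum_eq (H : Std D v0) (f : D.S → D.S) (hf : ∀ A, f (-A) = -f A) (c : D.S → D.S → ℤ) :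
    psum c (fun p => f (v0 p)) = ∑ B : D.S, ∑ A : D.S,
      if 0 < B.a ∧ -B < A ∧ A < B then c (f A) (f B) else 0 := by
  have h1 : ∀ B : D.S, 0 < B.a → (∑ A : D.S, if 0 < B.a ∧ -B < A ∧ A < B then c (f A) (f B) else 0) =
      ∑ p, if v0 p < B then c (f (v0 p)) (f B) + c (-f (v0 p)) (f B) else 0 := by
    intro B hB
    rw [← H.sum_pos (fun A => if A < B then c (f A) (f B) + c (-f A) (f B) else 0)]
    have h3 : ∀ A : D.S, (if 0 < B.a ∧ -B < A ∧ A < B then c (f A) (f B) else 0) =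
        (if 0 < A.a then if A < B then c (f A) (f B) else 0 else 0) +
        (if 0 < (-A).a then if -A < B then c (-f (-A)) (f B) else 0 else 0) := by
      intro A
      have := A.a_ne
      rw [hf, neg_neg]
      simp only [lt_iff, neg_a, neg_l]
      split_ifs <;> omega
    rw [Finset.sum_congr rfl fun A _ => h3 A, Finset.sum_add_distrib,
      sum_neg (fun A => if 0 < A.a then if A < B then c (-f A) (f B) else 0 else 0),
      ← Finset.sum_add_distrib]
    refine Finset.sum_congr rfl fun A _ => ?_
    split_ifs <;> simp
  have h4 : ∀ B : D.S, (∑ A : D.S, if 0 < B.a ∧ -B < A ∧ A < B then c (f A) (f B) else 0) =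
      if 0 < B.a then ∑ p, (if v0 p < B then c (f (v0 p)) (f B) + c (-f (v0 p)) (f B) else 0) else 0 := by
    intro B
    split_ifs with h
    · exact h1 B h
    · exact Finset.sum_eq_zero fun A _ => if_neg fun h' => h h'.1
  rw [Finset.sum_congr rfl fun B _ => h4 B, H.sum_pos (fun B => ∑ p, (if v0 p < B then
    c (f (v0 p)) (f B) + c (-f (v0 p)) (f B) else 0)), psum, Finset.sum_comm]
  refine Finset.sum_congr rfl fun q _ => Finset.sum_congr rfl fun p _ => ?_
  simp only [H.mono.lt_iff_lt]

lemma sum_wt (a t ε : ℤ) : ∑ l ∈ D.Lt a, wt ε l t =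
    (if t - ε ∈ D.Lt a then 1 else 0) - if t ∈ D.Lt a then 1 else 0 := by
  unfold wt
  rw [Finset.sum_sub_distrib]
  congr 1
  · rw [← Finset.sum_ite_eq' (D.Lt a) (t - ε) (fun _ => (1 : ℤ))]
    refine Finset.sum_congr rfl fun l _ => ?_
    split_ifs <;> omega
  · rw [← Finset.sum_ite_eq' (D.Lt a) t (fun _ => (1 : ℤ))]

lemma sum_wt2 (a b : ℤ) : ∑ t ∈ D.Lt b, ∑ l ∈ D.Lt a, wt 2 l t =
    (if D.t a + 2 ∈ D.Lt b then 1 else 0) - if D.b a ∈ D.Lt b then 1 else 0 := by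
  rw [← Finset.sum_ite_eq' (D.Lt b) (D.t a + 2) (fun _ => (1 : ℤ)),
    ← Finset.sum_ite_eq' (D.Lt b) (D.b a) (fun _ => (1 : ℤ)), ← Finset.sum_sub_distrib]
  refine Finset.sum_congr rfl fun t ht => ?_
  rw [sum_wt]
  simp only [mem_Lt] at *
  have := D.b_odd a; have := D.t_odd a; have := D.b_le a
  split_ifs <;> omega

lemma sum_wt2' (a b : ℤ) : ∑ t ∈ D.Lt b, ∑ l ∈ D.Lt a, wt (-2) l t =
    (if D.b a - 2 ∈ D.Lt b then 1 else 0) - if D.t a ∈ D.Lt b then 1 else 0 := by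
  rw [← Finset.sum_ite_eq' (D.Lt b) (D.b a - 2) (fun _ => (1 : ℤ)),
    ← Finset.sum_ite_eq' (D.Lt b) (D.t a) (fun _ => (1 : ℤ)), ← Finset.sum_sub_distrib]
  refine Finset.sum_congr rfl fun t ht => ?_
  rw [sum_wt]
  simp only [mem_Lt] at *
  have := D.b_odd a; have := D.t_odd a; have := D.b_le a
  split_ifs <;> omega

lemma sum_half {b : ℤ} (hb : D.b b = -D.t b) {ε : ℤ} (hε : ε = 2 ∨ ε = -2) :
    ∑ t ∈ D.Lt b, ∑ l ∈ D.Lt (-b), (if -t < l then wt ε l t else 0) = -1 := by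
  have h1 := D.b_neg b; have h3 := D.t_neg b; have h4 := D.t_odd b; have h5 := D.b_le b
  have key : ∀ t ∈ D.Lt b, ∑ l ∈ D.Lt (-b), (if -t < l then wt ε l t else 0) =
      if t = (if ε = 2 then 1 else D.t b) then -1 else 0 := by
    intro t ht
    have e : ∀ l ∈ D.Lt (-b), (if -t < l then wt ε l t else 0) =
        (if l = t - ε then if -t < t - ε then 1 else 0 else 0) -
        (if l = t then if -t < t then 1 else 0 else 0) := by
      intro l _
      unfold wt
      split_ifs <;> omega
    rw [Finset.sum_congr rfl e, Finset.sum_sub_distrib, Finset.sum_ite_eq', Finset.sum_ite_eq']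
    rw [mem_Lt] at ht
    obtain ⟨i1, i2, i3⟩ := ht
    simp only [mem_Lt]
    rcases hε with rfl | rfl
    · have : (t - 2) % 2 = 1 := by omega
      rw [if_pos rfl]; split_ifs <;> omega
    · have : (t - -2) % 2 = 1 := by omega
      rw [if_neg (show ¬ ((-2 : ℤ) = 2) by omega)]; split_ifs <;> omega
  rw [Finset.sum_congr rfl key, Finset.sum_ite_eq', if_pos]
  rw [mem_Lt]
  split_ifs <;> omega

lemma low_neg (x : ℤ) (hx : x < 0) : 0 ≤ D.b x + D.t x := by
  have := D.low (-x) (by omega); have := D.b_neg x; have := D.t_neg x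
  omega

lemma sorted_abs {a b : ℤ} (ha : a ≠ 0) (hb : b ≤ D.N) (h1 : -b < a) (h3 : a < b) :
    D.t b < D.t a ∨ (D.t b = D.t a ∧ D.b b ≤ D.b a) := by
  rcases lt_or_gt_of_ne ha with h' | h'
  · have := D.sorted (-a) b (by omega) (by omega) hb
    have := D.b_neg a; have := D.t_neg a; have := D.low_neg a h'
    omega
  · exact D.sorted a b h' h3 hb

lemma sorted_gen {x y : ℤ} (hx : x ∈ D.Ra) (hy : y ∈ D.Ra) (h : x < y) :
    (D.t y < D.t x ∨ (D.t y = D.t x ∧ D.b y ≤ D.b x)) ∨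
    (D.b y < D.b x ∨ (D.b y = D.b x ∧ D.t y ≤ D.t x)) ∨
    (D.b y + D.t y ≤ 0 ∧ 0 ≤ D.b x + D.t x) := by
  rw [mem_Ra] at hx hy
  rcases lt_or_gt_of_ne hx.1 with h4 | h4
  · rcases lt_or_gt_of_ne hy.1 with h5 | h5
    · have := D.sorted (-y) (-x) (by omega) (by omega) (by omega)
      have := D.b_neg x; have := D.t_neg x; have := D.b_neg y; have := D.t_neg y
      omega
    · exact Or.inr (Or.inr ⟨D.low y h5, D.low_neg x h4⟩)
  · exact Or.inl (D.sorted x y (by omega) (by omega) (by omega))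

lemma Gam.inv_type (h : Gam D γ) {a b : ℤ} (ha : a ∈ D.Ra) (hb : b ∈ D.Ra) (h1 : -b < a) (h3 : a < b)
    (hi : γ b < γ a) : (D.b a = D.b b ∧ D.t a = D.t b) ∨ (D.b a < D.b b ∧ D.t b < D.t a) := by
  have s2 := sorted_gen (h.mem_Ra.2 hb) (h.mem_Ra.2 ha) hi
  rw [h.b, h.t, h.b, h.t] at s2
  rw [Blk.mem_Ra] at ha hb
  have s1 := sorted_abs ha.1 hb.2.2 h1 h3
  have lb := D.low b (by omega)
  omega

variable (D) in
/-- The positive pairs of blocks of the same type. -/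
noncomputable def Phi : Finset (ℤ × ℤ) := (D.Ra ×ˢ D.Ra).filter fun x =>
  0 < x.2 ∧ -x.2 ≤ x.1 ∧ x.1 < x.2 ∧ D.b x.1 = D.b x.2 ∧ D.t x.1 = D.t x.2

set_option maxHeartbeats 800000 in
lemma Gam.pair_sum (h : Gam D γ) {a b : ℤ} (ha : a ∈ D.Ra) (hb : b ∈ D.Ra) {ε : ℤ}
    (hε : ε = 2 ∨ ε = -2) :
    (∑ t ∈ D.Lt b, ∑ l ∈ D.Lt a, if 0 < b ∧ (-b < a ∨ (-b = a ∧ -t < l)) ∧ (a < b ∨ (a = b ∧ l < t))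
      then (if γ b < γ a ∨ (γ b = γ a ∧ t < l) then wt ε l t else 0) else 0) =
    -(if (a, b) ∈ D.Phi ∧ γ b < γ a then 1 else 0) := by
  have hP : (a, b) ∈ D.Phi ↔ 0 < b ∧ -b ≤ a ∧ a < b ∧ D.b a = D.b b ∧ D.t a = D.t b := by
    simp [Phi, ha, hb]
  have ha' := Blk.mem_Ra.1 ha; have hb' := Blk.mem_Ra.1 hb
  have hinj : γ b = γ a → b = a := fun h' => γ.injective h'
  have zero : (¬ (0 < b ∧ -b ≤ a ∧ a < b) ∨ ¬ γ b < γ a) →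
      (∑ t ∈ D.Lt b, ∑ l ∈ D.Lt a, if 0 < b ∧ (-b < a ∨ (-b = a ∧ -t < l)) ∧ (a < b ∨ (a = b ∧ l < t))
      then (if γ b < γ a ∨ (γ b = γ a ∧ t < l) then wt ε l t else 0) else 0) =
      -(if (a, b) ∈ D.Phi ∧ γ b < γ a then 1 else 0) := by
    intro hz
    have hn : ¬ ((a, b) ∈ D.Phi ∧ γ b < γ a) := fun h' => hz.elim
      (fun h => h ⟨(hP.1 h'.1).1, (hP.1 h'.1).2.1, (hP.1 h'.1).2.2.1⟩) (fun h => h h'.2)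
    rw [if_neg hn, neg_zero]
    refine Finset.sum_eq_zero fun t _ => Finset.sum_eq_zero fun l _ => ?_
    split_ifs with c1 c2
    · exfalso
      by_cases hab : b = a
      · subst hab; omega
      · have := fun h' => hab (hinj h')
        omega
    · rfl
    · rfl
  by_cases c1 : 0 < b ∧ -b ≤ a ∧ a < b
  · by_cases c2 : γ b < γ a
    · obtain ⟨c3, c4, c5⟩ := c1
      rcases eq_or_lt_of_le c4 with c6 | c6
      · subst c6
        rw [h.neg] at c2
        have e1 := h.b b; have e2 := h.t b
        have e3 := D.b_neg b; have e4 := D.t_neg b; have e5 := D.b_neg (γ b); have e6 := D.t_neg (γ b)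
        have e7 := D.low (-γ b) (by omega)
        have e8 := D.low b c3
        have e9 : D.b b = -D.t b := by omega
        rw [if_pos ⟨hP.2 ⟨c3, c4, c5, by omega, by omega⟩, by rw [h.neg]; exact c2⟩, ← sum_half e9 hε]
        refine Finset.sum_congr rfl fun t _ => Finset.sum_congr rfl fun l _ => ?_
        have : (γ b < γ (-b) ∨ (γ b = γ (-b) ∧ t < l)) := Or.inl (by rw [h.neg]; exact c2)
        rw [if_pos this]
        simp [c3, c5]
      · have e : (∑ t ∈ D.Lt b, ∑ l ∈ D.Lt a, if 0 < b ∧ (-b < a ∨ (-b = a ∧ -t < l)) ∧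
            (a < b ∨ (a = b ∧ l < t)) then
            (if γ b < γ a ∨ (γ b = γ a ∧ t < l) then wt ε l t else 0) else 0) =
            ∑ t ∈ D.Lt b, ∑ l ∈ D.Lt a, wt ε l t :=
          Finset.sum_congr rfl fun t _ => Finset.sum_congr rfl fun l _ => by
            rw [if_pos ⟨c3, Or.inl c6, Or.inl c5⟩, if_pos (Or.inl c2)]
        have f1 := D.b_odd b; have f2 := D.t_odd b; have f3 := D.b_le b
        have f4 := D.b_odd a; have f5 := D.t_odd a; have f6 := D.b_le a
        rw [e]
        rcases h.inv_type ha hb c6 c5 c2 with ⟨g1, g2⟩ | ⟨g1, g2⟩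
        · rw [if_pos ⟨hP.2 ⟨c3, c4, c5, g1, g2⟩, c2⟩]
          rcases hε with rfl | rfl
          · rw [sum_wt2]; simp only [mem_Lt]; split_ifs <;> omega
          · rw [sum_wt2']; simp only [mem_Lt]; split_ifs <;> omega
        · rw [if_neg (by rw [hP]; omega)]
          rcases hε with rfl | rfl
          · rw [sum_wt2]; simp only [mem_Lt]; split_ifs <;> omega
          · rw [sum_wt2']; simp only [mem_Lt]; split_ifs <;> omega
    · exact zero (Or.inr c2)
  · exact zero (Or.inl c1)

/-- The degree of the arrangement given by a permutation of the blocks. -/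
theorem Std.psum_gam (H : Std D v0) (h : Gam D γ) {ε : ℤ} (hε : ε = 2 ∨ ε = -2) :
    psum ((D.Y k h2).cst ε) (fun p => h.act (v0 p)) =
      -((D.Phi.filter fun x => γ x.2 < γ x.1).card : ℤ) := by
  rw [H.psum_eq h.act h.act_neg]
  have e1 : ∀ B A : D.S, (if 0 < B.a ∧ -B < A ∧ A < B then (D.Y k h2).cst ε (h.act A) (h.act B) else 0) =
      (fun b t a l => if 0 < b ∧ (-b < a ∨ (-b = a ∧ -t < l)) ∧ (a < b ∨ (a = b ∧ l < t))
      then (if γ b < γ a ∨ (γ b = γ a ∧ t < l) then wt ε l t else 0) else 0) B.a B.l A.a A.l := by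
    intro B A
    simp only [lt_iff, neg_a, neg_l, cst]
    rfl
  rw [Finset.sum_congr rfl fun B _ => (Finset.sum_congr rfl fun A _ => e1 B A).trans
    (sum_S (fun a l => if 0 < B.a ∧ (-B.a < a ∨ (-B.a = a ∧ -B.l < l)) ∧ (a < B.a ∨ (a = B.a ∧ l < B.l))
      then (if γ B.a < γ a ∨ (γ B.a = γ a ∧ B.l < l) then wt ε l B.l else 0) else 0)),
    sum_S (fun b t => ∑ a ∈ D.Ra, ∑ l ∈ D.Lt a, if 0 < b ∧ (-b < a ∨ (-b = a ∧ -t < l)) ∧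
      (a < b ∨ (a = b ∧ l < t))
      then (if γ b < γ a ∨ (γ b = γ a ∧ t < l) then wt ε l t else 0) else 0)]
  have e2 : ∀ b ∈ D.Ra, (∑ t ∈ D.Lt b, ∑ a ∈ D.Ra, ∑ l ∈ D.Lt a, if 0 < b ∧ (-b < a ∨ (-b = a ∧ -t < l)) ∧
      (a < b ∨ (a = b ∧ l < t))
      then (if γ b < γ a ∨ (γ b = γ a ∧ t < l) then wt ε l t else 0) else 0) =
      ∑ a ∈ D.Ra, -(if (a, b) ∈ D.Phi ∧ γ b < γ a then 1 else 0) := by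
    intro b hb
    rw [Finset.sum_comm]
    exact Finset.sum_congr rfl fun a ha => h.pair_sum ha hb hε
  rw [Finset.sum_congr rfl e2, Finset.sum_comm, ← Finset.sum_product', Finset.sum_neg_distrib,
    Finset.card_filter, Nat.cast_sum, Phi, Finset.sum_filter]
  congr 1
  refine Finset.sum_congr rfl fun x hx => ?_
  simp only [Finset.mem_filter, hx, true_and]
  split_ifs <;> simp_all

end Blk
end VVPaper

namespace VVPaper
namespace Blk
open Strands
variable {D : Blk} {γ δ : Equiv.Perm ℤ}

lemma neg_mem_Ra {a : ℤ} (h : a ∈ D.Ra) : -a ∈ D.Ra := by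
  rw [mem_Ra] at *; omega

lemma mem_Phi {x : ℤ × ℤ} : x ∈ D.Phi ↔ (x.1 ∈ D.Ra ∧ x.2 ∈ D.Ra) ∧
    0 < x.2 ∧ -x.2 ≤ x.1 ∧ x.1 < x.2 ∧ D.b x.1 = D.b x.2 ∧ D.t x.1 = D.t x.2 := by
  rw [Phi, Finset.mem_filter, Finset.mem_product]

lemma Gam.mono_of_noinv (h : Gam D γ) (hn : ∀ x ∈ D.Phi, ¬ γ x.2 < γ x.1) {a b : ℤ} (ha : a ∈ D.Ra)
    (hb : b ∈ D.Ra) (hab : a < b) (e1 : D.b a = D.b b) (e2 : D.t a = D.t b) : γ a < γ b := by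
  have hne : γ a ≠ γ b := fun h' => hab.ne (γ.injective h')
  by_cases hc : 0 < b ∧ -b ≤ a
  · have := hn (a, b) (mem_Phi.2 ⟨⟨ha, hb⟩, hc.1, hc.2, hab, e1, e2⟩)
    simp only at this
    omega
  · have ha' := Blk.mem_Ra.1 ha; have hb' := Blk.mem_Ra.1 hb
    have := hn (-b, -a) (mem_Phi.2 ⟨⟨neg_mem_Ra hb, neg_mem_Ra ha⟩, by
      simp only [D.b_neg, D.t_neg]; omega⟩)
    simp only [h.neg] at this
    omega

lemma Gam.eq_of_noinv (h : Gam D γ) (hn : ∀ x ∈ D.Phi, ¬ γ x.2 < γ x.1) {a : ℤ} (ha : a ∈ D.Ra) :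
    γ a = a := by
  have key : ∀ n : ℕ, ∀ a ∈ D.Ra, (a + D.N).toNat = n → ¬ γ a < a := by
    intro n
    induction n using Nat.strong_induction_on with
    | _ n ih =>
      intro a ha hn' hlt
      have h1 := h.mem_Ra.2 ha
      have h3 := h.mono_of_noinv hn h1 ha hlt (h.b a) (h.t a)
      refine ih (γ a + D.N).toNat ?_ (γ a) h1 rfl h3
      rw [Blk.mem_Ra] at ha h1
      omega
  have h1 := key _ a ha rfl
  have h3 := key _ (-a) (neg_mem_Ra ha) rfl
  rw [h.neg] at h3
  omega

/-- A nontrivial permutation of the blocks moves some element down, within a positive pair. -/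
lemma Gam.exists_pair (h : Gam D γ) {a : ℤ} (ha : a ∈ D.Ra) (hm : γ a ≠ a) :
    ∃ x ∈ D.Phi, γ x.1 = x.2 := by
  classical
  have hne : (D.Ra.filter fun a => γ a ≠ a).Nonempty := ⟨a, by simp [ha, hm]⟩
  obtain ⟨b, hb, hmax⟩ := Finset.exists_max_image _ id hne
  rw [Finset.mem_filter] at hb
  have mx : ∀ x ∈ D.Ra, γ x ≠ x → x ≤ b := fun x hx hx' => hmax x (Finset.mem_filter.2 ⟨hx, hx'⟩)
  have hng : ∀ x, γ x ≠ x → γ (-x) ≠ -x := by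
    intro x hx; rw [h.neg]; omega
  have h1 := mx _ (neg_mem_Ra hb.1) (hng _ hb.2)
  have hb' := Blk.mem_Ra.1 hb.1
  have h3 : γ⁻¹ b ∈ D.Ra := by rw [← h.mem_Ra, pap]; exact hb.1
  have h4 : γ (γ⁻¹ b) ≠ γ⁻¹ b := by
    rw [pap]; intro h'; apply hb.2; nth_rewrite 1 [h']; exact pap γ b
  have h5 := mx _ h3 h4
  have h6 := mx _ (neg_mem_Ra h3) (hng _ h4)
  rw [pap] at h4
  exact ⟨(γ⁻¹ b, b), mem_Phi.2 ⟨⟨h3, hb.1⟩, by simp only; omega, by simp only; omega,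
    by simp only; omega, h.inv.b b, h.inv.t b⟩, pap γ b⟩

variable (D) in
/-- The positive blocks of a given type. -/
noncomputable def cl (a : ℤ) : Finset ℤ :=
  (Finset.Icc 1 (D.N : ℤ)).filter fun x => D.b x = D.b a ∧ D.t x = D.t a

open Classical in
variable (D) in
/-- The sum of the extreme positive blocks of a given type. -/
noncomputable def ctr (a : ℤ) : ℤ :=
  if h : (D.cl a).Nonempty then (D.cl a).min' h + (D.cl a).max' h else 0

lemma mem_cl {a x : ℤ} : x ∈ D.cl a ↔ (1 ≤ x ∧ x ≤ D.N) ∧ D.b x = D.b a ∧ D.t x = D.t a := by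
  simp [cl]

lemma ctr_congr {a b : ℤ} (h1 : D.b a = D.b b) (h2 : D.t a = D.t b) : D.ctr a = D.ctr b := by
  have : D.cl a = D.cl b := by ext x; rw [mem_cl, mem_cl, h1, h2]
  unfold ctr; rw [this]

lemma ctr_mem {a : ℤ} (h0 : 0 < a) (hN : a ≤ D.N) : D.ctr a - a ∈ D.cl a := by
  have ha : a ∈ D.cl a := mem_cl.2 ⟨⟨by omega, hN⟩, rfl, rfl⟩
  have hne : (D.cl a).Nonempty := ⟨a, ha⟩
  rw [ctr, dif_pos hne]
  have h1 := (D.cl a).min'_le a ha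
  have h3 := (D.cl a).le_max' a ha
  have h4 := mem_cl.1 ((D.cl a).min'_mem hne)
  have h5 := mem_cl.1 ((D.cl a).max'_mem hne)
  generalize (D.cl a).min' hne = lo at *
  generalize (D.cl a).max' hne = hi at *
  rw [mem_cl]
  refine ⟨by omega, ?_⟩
  rcases eq_or_ne a lo with h6 | h6
  · subst h6; rw [add_sub_cancel_left]; exact h5.2
  rcases eq_or_ne a hi with h7 | h7
  · subst h7; rw [add_sub_cancel_right]; exact h4.2
  have := D.sorted lo (lo + hi - a) (by omega) (by omega) (by omega)
  have := D.sorted (lo + hi - a) hi (by omega) (by omega) (by omega)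
  omega

open Classical in
variable (D) in
/-- The longest permutation of the blocks. -/
noncomputable def rev (a : ℤ) : ℤ :=
  if a ∈ D.Ra then if D.b a + D.t a = 0 then -a else if 0 < a then D.ctr a - a else -D.ctr (-a) - a
  else a

lemma rev_neg (a : ℤ) : D.rev (-a) = -D.rev a := by
  unfold rev
  by_cases h : a ∈ D.Ra
  · have h0 := (mem_Ra.1 h).1
    rw [if_pos h, if_pos (neg_mem_Ra h), D.b_neg, D.t_neg, neg_neg]
    split_ifs <;> omega
  · have h' : -a ∉ D.Ra := fun h' => h (neg_neg a ▸ neg_mem_Ra h')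
    rw [if_neg h, if_neg h']

lemma rev_pos {a : ℤ} (ha : a ∈ D.Ra) (h0 : 0 < a) : D.rev a ∈ D.Ra ∧ D.b (D.rev a) = D.b a ∧
    D.t (D.rev a) = D.t a ∧ D.rev (D.rev a) = a := by
  have ha' := mem_Ra.1 ha
  by_cases hc : D.b a + D.t a = 0
  · have e : D.rev a = -a := by rw [rev, if_pos ha, if_pos hc]
    rw [e, rev_neg, e, D.b_neg, D.t_neg, neg_neg]
    exact ⟨neg_mem_Ra ha, by omega, by omega, rfl⟩
  · have e : D.rev a = D.ctr a - a := by rw [rev, if_pos ha, if_neg hc, if_pos h0]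
    have h1 := mem_cl.1 (ctr_mem h0 ha'.2.2)
    have h3 := ctr_congr h1.2.1 h1.2.2
    have h4 : D.ctr a - a ∈ D.Ra := mem_Ra.2 (by omega)
    refine ⟨e ▸ h4, e ▸ h1.2.1, e ▸ h1.2.2, ?_⟩
    rw [e, rev, if_pos h4, if_neg (by rw [h1.2.1, h1.2.2]; exact hc), if_pos (by omega), h3]
    omega

lemma rev_prop (a : ℤ) : (D.rev a ∈ D.Ra ↔ a ∈ D.Ra) ∧ D.b (D.rev a) = D.b a ∧
    D.t (D.rev a) = D.t a ∧ D.rev (D.rev a) = a := by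
  by_cases h : a ∈ D.Ra
  · rcases lt_or_gt_of_ne (mem_Ra.1 h).1 with h0 | h0
    · obtain ⟨h1, h3, h4, h5⟩ := rev_pos (neg_mem_Ra h) (by omega)
      rw [rev_neg] at h1 h3 h4 h5
      rw [rev_neg] at h5
      rw [D.b_neg, D.b_neg] at h3
      rw [D.t_neg, D.t_neg] at h4
      exact ⟨⟨fun _ => h, fun _ => neg_neg (D.rev a) ▸ neg_mem_Ra h1⟩, by omega, by omega, by omega⟩
    · obtain ⟨h1, h3⟩ := rev_pos h h0
      exact ⟨⟨fun _ => h, fun _ => h1⟩, h3⟩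
  · have e : D.rev a = a := by rw [rev, if_neg h]
    rw [e]; exact ⟨Iff.rfl, rfl, rfl, e⟩

variable (D) in
/-- The longest permutation of the blocks, as a permutation. -/
noncomputable def revP : Equiv.Perm ℤ :=
  ⟨D.rev, D.rev, fun a => (rev_prop a).2.2.2, fun a => (rev_prop a).2.2.2⟩

lemma revP_gam : Gam D D.revP where
  neg a := rev_neg a
  b a := (rev_prop a).2.1
  t a := (rev_prop a).2.2.1
  rng a := by
    have h := (rev_prop (D := D) a).1
    change (_ ≤ D.rev a ∧ D.rev a ≤ _) ↔ _
    rcases eq_or_ne a 0 with rfl | h0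
    · have : D.rev 0 = 0 := by have := D.rev_neg 0; rw [neg_zero] at this; omega
      rw [this]
    · have h1 : D.rev a ≠ 0 := by
        intro h1
        have h3 := (rev_prop (D := D) a).2.2.2
        rw [h1] at h3
        have : D.rev 0 = 0 := by have := D.rev_neg 0; rw [neg_zero] at this; omega
        omega
      rw [mem_Ra, mem_Ra] at h
      exact ⟨fun h' => (h.1 ⟨h1, h'⟩).2, fun h' => (h.2 ⟨h0, h'⟩).2⟩

lemma revP_inv {x : ℤ × ℤ} (hx : x ∈ D.Phi) : D.revP x.2 < D.revP x.1 := by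
  obtain ⟨⟨h1, h3⟩, h4, h5, h6, h7, h8⟩ := mem_Phi.1 hx
  change D.rev x.2 < D.rev x.1
  unfold rev
  rw [if_pos h1, if_pos h3, h7, h8]
  by_cases hc : D.b x.2 + D.t x.2 = 0
  · rw [if_pos hc, if_pos hc]; omega
  · have h9 := D.low _ h4
    have : 0 < x.1 := by
      by_contra h'
      have := D.low_neg x.1 (by have := (mem_Ra.1 h1).1; omega)
      omega
    rw [if_neg hc, if_neg hc, if_pos h4, if_pos this, ctr_congr h7 h8]
    omega

section scale
variable {k : Type} [Field k]

/-- The rescaling of the polynomial ring. -/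
noncomputable def scl (N : ℕ) (p : k) : MvPolynomial (Fin N) k →ₐ[k] MvPolynomial (Fin N) k :=
  MvPolynomial.aeval fun i => p • MvPolynomial.X i

lemma scl_scl (N : ℕ) {p : k} (hp : p ≠ 0) (F : MvPolynomial (Fin N) k) :
    scl N p⁻¹ (scl N p F) = F := by
  have : (scl N p⁻¹).comp (scl N p) = AlgHom.id k _ := by
    ext i
    simp [scl, smul_smul, hp]
  exact DFunLike.congr_fun this F

/-- The rescaling of the field of parameters. -/
noncomputable def phiK (N : ℕ) {p : k} (hp : p ≠ 0) : KK k N →+* KK k N :=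
  IsFractionRing.lift (A := MvPolynomial (Fin N) k) (g := (ioK k N).toRingHom.comp (scl N p).toRingHom)
    ((ioK_inj k N).comp (Function.LeftInverse.injective (scl_scl N hp)))

lemma phiK_io (N : ℕ) {p : k} (hp : p ≠ 0) (F : MvPolynomial (Fin N) k) :
    phiK N hp (ioK k N F) = ioK k N (scl N p F) :=
  IsFractionRing.lift_algebraMap _ F

lemma phiK_alg (N : ℕ) {p : k} (hp : p ≠ 0) (c : k) :
    phiK N hp (algebraMap k (KK k N) c) = algebraMap k (KK k N) c := by
  rw [← (ioK k N).commutes, phiK_io, (scl N p).commutes]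

lemma phiK_zp (N : ℕ) {p : k} (hp : p ≠ 0) (a : ℤ) :
    phiK N hp (ioK k N (zp k N a)) = p • ioK k N (zp k N a) := by
  rw [phiK_io, ← map_smul]
  congr 1
  unfold zp
  split_ifs
  · simp [scl]
  · simp [scl]
  · simp

end scale

end Blk
end VVPaper

namespace VVPaper
namespace Blk
open Strands
variable {k : Type} [Field k] {m : ℕ} [NeZero m] {Wd : Finset (Fin m → ℤ)} {R : Type} [Ring R]
  [Algebra k R] {D : Blk} {v0 : Fin m → D.S} {h2 : (2 : k) ≠ 0}
  (F : Full k Wd R) (hcl : ∀ w ∈ Wd, ∀ g, gact g w ∈ Wd) (H : Std D v0)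
  (h0 : F.A.e ((D.Y k h2).wrd v0) ≠ 0) (hmin : ∀ w, F.A.e w ≠ 0 → rd ((D.Y k h2).wrd v0) ≤ rd w)

lemma G0_iff (v : (D.Y k h2).GV m) : (ctx F hcl H h0 hmin).G0 v ↔
    ∃ γ, ∃ h : Gam D γ, ∀ p, v.1 p = h.act (v0 p) := by
  constructor
  · intro h
    exact H.lex v.2 (le_of_eq (congrArg rd h))
  · rintro ⟨γ, h, hv⟩
    change (D.Y k h2).wrd v.1 = (D.Y k h2).wrd v0
    funext p; unfold wrd; rw [hv p]; rfl

lemma ctx_pos (i : Fin D.N) : (v0 ((ctx F hcl H h0 hmin).pos i)).a = i.1 + 1 :=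
  (H.exists_pos i).choose_spec.1

lemma ev_zp {v : Fin m → D.S} {γ : Equiv.Perm ℤ} {h : Gam D γ} (hv : ∀ p, v p = h.act (v0 p)) {a : ℤ}
    (ha : a ∈ D.Ra) : (ctx F hcl H h0 hmin).ev v (zp k D.N a) = ioK k D.N (zp k D.N (γ a)) := by
  have key : ∀ i : Fin D.N, (ctx F hcl H h0 hmin).ev v (zp k D.N (i.1 + 1)) =
      ioK k D.N (zp k D.N (γ (i.1 + 1))) := by
    intro i
    rw [zp_pos, Ctx.ev_X, hv, ← ctx_pos F hcl H h0 hmin i]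
    rfl
  rw [mem_Ra] at ha
  obtain ⟨i, rfl | rfl⟩ := exists_fin ha.1 ha.2.1 ha.2.2
  · exact key i
  · rw [zp_neg, map_neg, key, h.neg, zp_neg, map_neg]

lemma psum_one (ε : ℤ) (hε : ε = 2 ∨ ε = -2) (H : Std D v0) : psum ((D.Y k h2).cst ε) v0 = 0 := by
  have h := H.psum_gam (k := k) (h2 := h2) Gam.one hε
  have e : (fun p => Gam.one.act (v0 p)) = v0 := funext fun p => S.ext rfl rfl
  rw [e] at h
  rw [h, Finset.card_eq_zero.2, Nat.cast_zero, neg_zero]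
  rw [Finset.filter_eq_empty_iff]
  intro x hx
  have := mem_Phi.1 hx
  change ¬ x.2 < x.1
  omega

/-- The product pairing of two arrangements. -/
lemma ev_pair (v v' : Fin m → D.S) :
    ∑ t : Finset D.Phi, (ctx F hcl H h0 hmin).ev v (∏ x ∈ t, zp k D.N x.1.1) *
      (ctx F hcl H h0 hmin).ev v' (∏ x ∈ tᶜ, -zp k D.N x.1.2) =
    ∏ x : D.Phi, ((ctx F hcl H h0 hmin).ev v (zp k D.N x.1.1) +
      -(ctx F hcl H h0 hmin).ev v' (zp k D.N x.1.2)) := by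
  classical
  rw [Finset.prod_add, Finset.powerset_univ]
  refine Finset.sum_congr rfl fun t _ => ?_
  rw [map_prod, map_prod, Finset.compl_eq_univ_sdiff]
  simp only [map_neg]

lemma zp_hom (N : ℕ) (a : ℤ) : (zp k N a).IsHomogeneous 1 := by
  unfold zp
  split_ifs
  · exact MvPolynomial.isHomogeneous_X _ _
  · exact (MvPolynomial.isHomogeneous_X _ _).neg
  · exact MvPolynomial.isHomogeneous_zero _ _ _

lemma prod_hom (N : ℕ) {ι : Type} (t : Finset ι) (f : ι → MvPolynomial (Fin N) k)
    (hf : ∀ i, (f i).IsHomogeneous 1) : (∏ i ∈ t, f i).IsHomogeneous t.card := by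
  have := MvPolynomial.IsHomogeneous.prod t f (fun _ => 1) fun i _ => hf i
  rwa [Finset.sum_const, smul_eq_mul, mul_one] at this

lemma exists_sgn {γ : Equiv.Perm ℤ} (h : Gam D γ) : ∃ τ : Equiv.Perm (Fin D.N), ∀ i,
    γ (i.1 + 1) = (τ i).1 + 1 ∨ γ (i.1 + 1) = -((τ i).1 + 1) := by
  have h1 : ∀ i : Fin D.N, ∃ j : Fin D.N, γ (i.1 + 1) = j.1 + 1 ∨ γ (i.1 + 1) = -(j.1 + 1) := by
    intro i
    have : γ (i.1 + 1) ∈ D.Ra := h.mem_Ra.2 (mem_Ra.2 (by have := i.2; omega))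
    rw [mem_Ra] at this
    exact exists_fin this.1 this.2.1 this.2.2
  choose τ hτ using h1
  refine ⟨Equiv.ofBijective τ (Finite.injective_iff_bijective.1 ?_), hτ⟩
  intro i i' hi
  have h3 : γ (i.1 + 1) = γ (i'.1 + 1) ∨ γ (i.1 + 1) = γ (-(i'.1 + 1)) := by
    have h5 := hτ i; have h6 := hτ i'
    rw [← hi] at h6
    rw [h.neg]
    omega
  ext
  rcases h3 with h3 | h3 <;> have := γ.injective h3 <;> omega

lemma bd_hm {p : k} (hp : p ≠ 0) (v : (D.Y k h2).GV m) :
    (ctx F hcl H h0 hmin).Hm (phiK D.N hp) p (psum ((D.Y k h2).cst 2) v.1)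
      ((ctx F hcl H h0 hmin).b v) ∧
    (ctx F hcl H h0 hmin).Hm (phiK D.N hp) p (psum ((D.Y k h2).cst (-2)) v.1)
      (F.om ((ctx F hcl H h0 hmin).b v)) :=
  Ctx.hm_b (C := ctx F hcl H h0 hmin) hp (fun A => phiK_zp D.N hp A.a) (fun ε hε => psum_one (h2 := h2) ε hε H) v.1 v.2

lemma count_neg {v : (D.Y k h2).GV m} (hv : (ctx F hcl H h0 hmin).G0 v)
    (hne : v ≠ (ctx F hcl H h0 hmin).s0) {ε : ℤ} (hε : ε = 2 ∨ ε = -2) :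
    psum ((D.Y k h2).cst ε) v.1 ≤ -1 := by
  obtain ⟨γ, h, hv⟩ := (G0_iff F hcl H h0 hmin v).1 hv
  rw [show v.1 = fun p => h.act (v0 p) from funext hv, H.psum_gam h hε]
  have : 0 < (D.Phi.filter fun x => γ x.2 < γ x.1).card := by
    rw [Finset.card_pos]
    by_contra hn
    rw [Finset.not_nonempty_iff_eq_empty, Finset.filter_eq_empty_iff] at hn
    refine hne (Subtype.ext (funext fun p => ?_))
    rw [hv p]
    exact S.ext (h.eq_of_noinv hn (mem_Ra.2 ⟨(v0 p).a_ne, (v0 p).le_a, (v0 p).a_le⟩)) rfl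
  omega

/-- The graded context attached to a minimal word. -/
noncomputable def gr (p : k) (hp : p ≠ 0) (hpow : ∀ n : ℕ, 0 < n → p ^ n ≠ 1) :
    Gr k Wd R D.S (KK k D.N) D.N where
  toCtx := ctx F hcl H h0 hmin
  p := p
  p_ne := hp
  p_pow := hpow
  phi := phiK D.N hp
  phi_alg := phiK_alg D.N hp
  phi_z A := phiK_zp D.N hp A.a
  evperm v hv := by
    obtain ⟨γ, h, hv⟩ := (G0_iff F hcl H h0 hmin v).1 hv
    obtain ⟨τ, hτ⟩ := exists_sgn h
    refine ⟨τ, fun i => ?_⟩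
    have e : (v.1 ((ctx F hcl H h0 hmin).pos i)).a = γ (i.1 + 1) := by
      rw [hv, ← ctx_pos F hcl H h0 hmin i]; rfl
    change (ioK k D.N (zp k D.N _)) ^ 2 = ioK k D.N _ ^ 2
    rw [e]
    rcases hτ i with h' | h' <;> rw [h']
    · rw [zp_pos]
    · rw [zp_neg, zp_pos, map_neg, neg_sq]
  J := Finset D.Phi
  fJ := inferInstance
  fj t := ∏ x ∈ t, zp k D.N x.1.1
  gj t := ∏ x ∈ tᶜ, -zp k D.N x.1.2
  df t := t.card
  dg t := tᶜ.card
  n := D.Phi.card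
  df_dg t := by rw [Finset.card_add_card_compl, Fintype.card_coe]
  fj_hom t := prod_hom _ t _ fun x => zp_hom _ _
  gj_hom t := prod_hom _ _ _ fun x => (zp_hom _ _).neg
  ev_orth v v' hv hv' hne := by
    obtain ⟨γ, h, hv⟩ := (G0_iff F hcl H h0 hmin v).1 hv
    obtain ⟨δ, h', hv'⟩ := (G0_iff F hcl H h0 hmin v').1 hv'
    rw [ev_pair]
    have : ∃ a ∈ D.Ra, (δ⁻¹ * γ) a ≠ a := by
      by_contra! hn
      refine hne (Subtype.ext (funext fun p => ?_))
      rw [hv p, hv' p]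
      refine S.ext ?_ rfl
      have := hn (v0 p).a (mem_Ra.2 ⟨(v0 p).a_ne, (v0 p).le_a, (v0 p).a_le⟩)
      rw [Equiv.Perm.mul_apply] at this
      change γ (v0 p).a = δ (v0 p).a
      nth_rewrite 2 [← this]
      rw [pap]
    obtain ⟨a, ha, hm⟩ := this
    obtain ⟨x, hx, hx'⟩ := (h'.inv.mul h).exists_pair ha hm
    have hR := mem_Phi.1 hx
    refine Finset.prod_eq_zero (Finset.mem_univ ⟨x, hx⟩) ?_
    rw [ev_zp F hcl H h0 hmin hv hR.1.1, ev_zp F hcl H h0 hmin hv' hR.1.2, ← hx',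
      Equiv.Perm.mul_apply, pap, add_neg_cancel]
  ev_ne v hv := by
    obtain ⟨γ, h, hv⟩ := (G0_iff F hcl H h0 hmin v).1 hv
    rw [ev_pair, Finset.prod_ne_zero_iff]
    rintro ⟨x, hx⟩ _ hz
    have hR := mem_Phi.1 hx
    rw [ev_zp F hcl H h0 hmin hv hR.1.1, ev_zp F hcl H h0 hmin hv hR.1.2, ← sub_eq_add_neg, sub_eq_zero] at hz
    have h1 := mem_Ra.1 (h.mem_Ra.2 hR.1.1); have h3 := mem_Ra.1 (h.mem_Ra.2 hR.1.2)
    have := γ.injective (zp_inj k h2 h1.1 h1.2.1 h1.2.2 h3.1 h3.2.1 h3.2.2 (ioK_inj k _ hz))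
    omega
  bd v := psum ((D.Y k h2).cst 2) v.1
  bd' v := psum ((D.Y k h2).cst (-2)) v.1
  bd_hom v := (bd_hm F hcl H h0 hmin hp v).1
  bd'_hom v := (bd_hm F hcl H h0 hmin hp v).2
  bd'_neg v hv hne := count_neg F hcl H h0 hmin hv hne (Or.inr rfl)
  vs := ⟨fun p => (revP_gam (D := D)).act (v0 p), (revP_gam (D := D)).good (k := k) (h2 := h2) H.good⟩
  vs_G0 := (G0_iff F hcl H h0 hmin _).2 ⟨_, revP_gam, fun _ => rfl⟩
  bd_vs := by rw [H.psum_gam revP_gam (Or.inl rfl), Finset.filter_true_of_mem fun x hx => revP_inv hx]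
  bd'_vs := by rw [H.psum_gam revP_gam (Or.inr rfl), Finset.filter_true_of_mem fun x hx => revP_inv hx]

end Blk

/-- The ideal generated by the smallest idempotent is an affine cell ideal. -/
theorem Full.exists_cellIdeal {k : Type} [Field k] {m : ℕ} [NeZero m] {Wd : Finset (Fin m → ℤ)}
    {R : Type} [Ring R] [Algebra k R] (h2 : (2 : k) ≠ 0) {p : k} (hp : p ≠ 0)
    (hpow : ∀ n : ℕ, 0 < n → p ^ n ≠ 1) (F : Full k Wd R) (hcl : ∀ w ∈ Wd, ∀ g, gact g w ∈ Wd)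
    (hodd : ∀ w ∈ Wd, ∀ i, w i % 2 = 1) {g : Fin m → ℤ} (hg : F.A.e g ≠ 0)
    (hmin : ∀ w, F.A.e w ≠ 0 → rd g ≤ rd w) :
    IsAffineCellIdeal k R F.om (TwoSidedIdeal.span {F.A.e g}) := by
  obtain ⟨segs, h1, h3, h4, h5⟩ := (F.A.kRules hodd).runs_of_min (rd g) ⟨g, hg, rfl⟩ (by
    rintro _ ⟨w, hw, rfl⟩; exact hmin w hw)
  have ho : ∀ i, g i % 2 = 1 := hodd g (by by_contra h; exact hg (F.A.e_zero _ h))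
  obtain ⟨D, v0, H, hw⟩ := Blk.exists_std g segs h1 h3 h4 h5 ho
  have hw' : (D.Y k h2).wrd v0 = g := funext hw
  subst hw'
  exact (Blk.gr F hcl H hg hmin p hp hpow).exists_cellIdeal

end VVPaper

namespace VVPaper

section
variable {k : Type} [Field k] {m : ℕ} [NeZero m] {Wd : Finset (Fin m → ℤ)} {R : Type} [Ring R]
  [Algebra k R]

/-- The image of a VV algebra under an algebra homomorphism. -/
def VVAlg.map {S : Type} [Ring S] [Algebra k S] (A : VVAlg k Wd R) (f : R →ₐ[k] S) :
    VVAlg k Wd S where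
  x p := f (A.x p)
  sg s := f (A.sg s)
  pi := f A.pi
  e w := f (A.e w)
  e_zero w h := by rw [A.e_zero w h, map_zero]
  e_mul w := by rw [← map_mul, A.e_mul]
  e_orth w w' h := by rw [← map_mul, A.e_orth w w' h, map_zero]
  e_sum := by rw [← map_sum, A.e_sum, map_one]
  x_comm a b := by rw [← map_mul, A.x_comm, map_mul]
  x_e a w := by rw [← map_mul, A.x_e, map_mul]
  sg_e s w := by rw [← map_mul, A.sg_e, map_mul]
  sq_eq s w h := by simp only [← map_mul, A.sq_eq s w h, map_zero]
  sq_none s w h h1 h2 := by simp only [← map_mul, A.sq_none s w h h1 h2]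
  sq_up s w h := by simp only [← map_mul, ← map_sub, A.sq_up s w h]
  sq_dn s w h := by simp only [← map_mul, ← map_sub, A.sq_dn s w h]
  sg_comm s t h := by simp only [← map_mul, A.sg_comm s t h]
  braid_triv s hs w h := by simp only [← map_mul, A.braid_triv s hs w h]
  braid_dn s hs w h h' := by simp only [← map_mul, ← map_add, A.braid_dn s hs w h h']
  braid_up s hs w h h' := by simp only [← map_mul, ← map_sub, A.braid_up s hs w h h']
  sg_x_lo s w h := by simp only [← map_mul, ← map_sub, A.sg_x_lo s w h]
  sg_x_hi s w h := by simp only [← map_mul, ← map_add, A.sg_x_hi s w h]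
  sg_x s l w h := by simp only [← map_mul, A.sg_x s l w h]
  pi_e w := by simp only [← map_mul, A.pi_e]
  pi_sq := by rw [← map_mul, A.pi_sq, map_one]
  pi_x0 := by simp only [← map_mul, A.pi_x0, map_neg]
  pi_x l h := by simp only [← map_mul, A.pi_x l h]
  pi_sg s h := by simp only [← map_mul, A.pi_sg s h]
  sg_pi h := by simp only [← map_mul, A.sg_pi h]

lemma VVAlg.map_gn {S : Type} [Ring S] [Algebra k S] (A : VVAlg k Wd R) (f : R →ₐ[k] S)
    (g : Option (Fin (m - 1))) : (A.map f).gn g = f (A.gn g) := by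
  cases g <;> rfl

/-- The quotient map by a two-sided ideal as an algebra homomorphism. -/
def quotAlg (k : Type) [Field k] {R : Type} [Ring R] [Algebra k R] (J : TwoSidedIdeal R) :
    R →ₐ[k] J.ringCon.Quotient :=
  { RingCon.mk' J.ringCon with commutes' := fun _ => rfl }

lemma quotAlg_surjective (J : TwoSidedIdeal R) : Function.Surjective (quotAlg k J) :=
  RingCon.mk'_surjective _

lemma quotAlg_eq_zero (J : TwoSidedIdeal R) (a : R) : quotAlg k J a = 0 ↔ a ∈ J := by
  have : quotAlg k J a = 0 ↔ (a : J.ringCon.Quotient) = ((0 : R) : J.ringCon.Quotient) := Iff.rfl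
  rw [this, RingCon.eq, TwoSidedIdeal.mem_iff]

lemma exists_quot_linear {S : Type} [AddCommGroup S] [Module k S] (J : TwoSidedIdeal R)
    (f : R →ₗ[k] S) (h : ∀ a ∈ J, f a = 0) :
    ∃ f' : J.ringCon.Quotient →ₗ[k] S, ∀ a, f' (quotAlg k J a) = f a := by
  have hk : LinearMap.ker (quotAlg k J).toLinearMap ≤ LinearMap.ker f := fun a ha =>
    h a ((quotAlg_eq_zero (k := k) J a).1 ha)
  obtain ⟨s, hs⟩ := (quotAlg k J).toLinearMap.exists_rightInverse_of_surjective
    (LinearMap.range_eq_top.2 (quotAlg_surjective (k := k) J))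
  refine ⟨f ∘ₗ s, fun a => ?_⟩
  have := hk (x := s (quotAlg k J a) - a) (by
    rw [LinearMap.mem_ker, map_sub, sub_eq_zero]
    exact LinearMap.congr_fun hs _)
  rw [LinearMap.mem_ker, map_sub, sub_eq_zero] at this
  exact this

lemma Full.quot (F : Full k Wd R) {g : Fin m → ℤ}
    (hmin : ∀ w, F.A.e w ≠ 0 → rd g ≤ rd w) (J : TwoSidedIdeal R)
    (hJ : J = TwoSidedIdeal.span {F.A.e g}) :
    ∃ F' : Full k Wd J.ringCon.Quotient, (∀ a, F'.om (quotAlg k J a) = quotAlg k J (F.om a)) ∧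
      ∀ w, F'.A.e w = quotAlg k J (F.A.e w) := by
  have hgJ : F.A.e g ∈ J := hJ ▸ TwoSidedIdeal.subset_span rfl
  have homJ : ∀ a ∈ J, F.om a ∈ J := by
    let J' : TwoSidedIdeal R := .mk' {a | F.om a ∈ J} (by simp [J.zero_mem])
      (fun ha hb => by simpa using J.add_mem ha hb) (fun ha => by simpa using J.neg_mem ha)
      (fun {a b} hb => by
        change F.om (a * b) ∈ J
        rw [F.om_mul]; exact J.mul_mem_right _ _ hb)
      (fun {a b} hb => by
        change F.om (a * b) ∈ J
        rw [F.om_mul]; exact J.mul_mem_left _ _ hb)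
    have : J ≤ J' := by
      conv_lhs => rw [hJ]
      rw [TwoSidedIdeal.span_le]
      rintro _ rfl
      change _ ∈ J'
      rw [TwoSidedIdeal.mem_mk']
      change F.om _ ∈ J
      rwa [F.om_e]
    intro a ha
    have := this ha
    rwa [TwoSidedIdeal.mem_mk'] at this
  obtain ⟨om', hom'⟩ := exists_quot_linear J ((quotAlg k J).toLinearMap ∘ₗ F.om) (fun a ha =>
    (quotAlg_eq_zero (k := k) J _).2 (homJ a ha))
  replace hom' : ∀ a, om' (quotAlg k J a) = quotAlg k J (F.om a) := hom'
  refine ⟨{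
    A := F.A.map (quotAlg k J)
    gen := ?_
    om := om'
    om_mul := fun a b => ?_
    om_one := ?_
    om_om := fun a => ?_
    om_x := fun p => ?_
    om_gn := fun g' => ?_
    om_e := fun w => ?_
    univ := fun T _ _ ρ hρ => ?_ }, hom', fun w => rfl⟩
  · have h1 : (Set.range (F.A.map (quotAlg k J)).x ∪ Set.range (F.A.map (quotAlg k J)).gn ∪
        Set.range (F.A.map (quotAlg k J)).e) =
        quotAlg k J '' (Set.range F.A.x ∪ Set.range F.A.gn ∪ Set.range F.A.e) := by
      simp only [Set.image_union, ← Set.range_comp]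
      congr 3
      funext g'; exact F.A.map_gn _ g'
    rw [h1, ← AlgHom.map_adjoin, F.gen, Algebra.map_top]
    exact (AlgHom.range_eq_top _).2 (quotAlg_surjective J)
  · obtain ⟨a, rfl⟩ := quotAlg_surjective (k := k) J a
    obtain ⟨b, rfl⟩ := quotAlg_surjective (k := k) J b
    rw [← map_mul, hom', hom', hom', F.om_mul, map_mul]
  · rw [← map_one (quotAlg k J), hom', F.om_one]
  · obtain ⟨a, rfl⟩ := quotAlg_surjective (k := k) J a
    rw [hom', hom', F.om_om]
  · exact (hom' _).trans (by rw [F.om_x]; rfl)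
  · rw [F.A.map_gn, hom', F.om_gn]
  · exact (hom' _).trans (by rw [F.om_e]; rfl)
  · have hw : ∀ w', (F.A.map (quotAlg k J)).e w' ≠ 0 → F.A.e w' ≠ 0 ∧ rd g < rd w' := by
      intro w' hw'
      have h1 : F.A.e w' ≠ 0 := by
        intro h; apply hw'; change quotAlg k J _ = 0; rw [h, map_zero]
      refine ⟨h1, lt_of_le_of_ne (hmin w' h1) fun h => hw' ?_⟩
      rw [← rd_injective h]
      exact (quotAlg_eq_zero J _).2 hgJ
    obtain ⟨f, fx, fg, fe⟩ := F.univ T ρ fun w h => hρ w fun w' h' => h w' (hw w' h').1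
    have hJf : J ≤ TwoSidedIdeal.ker f := by
      conv_lhs => rw [hJ]
      rw [TwoSidedIdeal.span_le]
      rintro _ rfl
      change _ ∈ TwoSidedIdeal.ker f
      rw [TwoSidedIdeal.mem_ker, fe]
      exact hρ g fun w' h' => (hw w' h').2
    obtain ⟨f', hf'⟩ := exists_quot_linear J f.toLinearMap fun a ha =>
      (TwoSidedIdeal.mem_ker f).1 (hJf ha)
    replace hf' : ∀ a, f' (quotAlg k J a) = f a := hf'
    refine ⟨AlgHom.ofLinearMap f' ?_ fun a b => ?_, fun p => ?_, fun g' => ?_, fun w => ?_⟩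
    · rw [← map_one (quotAlg k J), hf', map_one]
    · obtain ⟨a, rfl⟩ := quotAlg_surjective (k := k) J a
      obtain ⟨b, rfl⟩ := quotAlg_surjective (k := k) J b
      rw [← map_mul, hf', hf', hf', map_mul]
    · exact (hf' _).trans (fx p)
    · rw [F.A.map_gn]; exact (hf' _).trans (fg g')
    · exact (hf' _).trans (fe w)

end

theorem Full.exists_chain {k : Type} [Field k] {m : ℕ} [NeZero m] {Wd : Finset (Fin m → ℤ)}
    (h2 : (2 : k) ≠ 0) {p : k} (hp : p ≠ 0) (hpow : ∀ n : ℕ, 0 < n → p ^ n ≠ 1)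
    (hcl : ∀ w ∈ Wd, ∀ g, gact g w ∈ Wd) (hodd : ∀ w ∈ Wd, ∀ i, w i % 2 = 1) (n : ℕ) :
    ∀ (R : Type) [Ring R] [Algebra k R] (F : Full k Wd R),
      {w | F.A.e w ≠ 0}.ncard ≤ n → ∃ n, AffineCellularChain k n R F.om := by
  induction n with
  | zero =>
    intro R _ _ F h
    have hfin : {w | F.A.e w ≠ 0}.Finite := Wd.finite_toSet.subset fun w hw => by
      by_contra hc; exact hw (F.A.e_zero w hc)
    have h0 := (Set.ncard_eq_zero hfin).1 (Nat.le_zero.1 h)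
    refine ⟨0, ?_⟩
    change Subsingleton R
    refine subsingleton_of_zero_eq_one ?_
    rw [← F.A.e_sum]
    refine (Finset.sum_eq_zero fun w _ => ?_).symm
    by_contra hc
    exact (h0.subset hc).elim
  | succ n ih =>
    intro R _ _ F h
    have hfin : {w | F.A.e w ≠ 0}.Finite := Wd.finite_toSet.subset fun w hw => by
      by_contra hc; exact hw (F.A.e_zero w hc)
    rcases Set.eq_empty_or_nonempty {w | F.A.e w ≠ 0} with h0 | h0
    · exact ih R F (by rw [h0]; simp)
    obtain ⟨g, hg, hmin⟩ := Set.exists_min_image _ rd hfin h0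
    obtain ⟨F', hF', hF'e⟩ := F.quot hmin _ rfl
    have hlt : {w | F'.A.e w ≠ 0}.ncard < {w | F.A.e w ≠ 0}.ncard := by
      refine Set.ncard_lt_ncard ⟨fun w hw h0 => hw ?_, fun h => h hg ?_⟩ hfin
      · rw [hF'e, h0, map_zero]
      · rw [hF'e]
        exact (quotAlg_eq_zero _ _).2 (TwoSidedIdeal.subset_span rfl)
    obtain ⟨N, hN⟩ := ih _ F' (by omega)
    exact ⟨N + 1, _, F.exists_cellIdeal h2 hp hpow hcl hodd hg hmin, F'.om, hF', hN⟩

end VVPaper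

namespace VVPaper

variable {k : Type} [Field k]

/-- A labelling of the letters in the support of `ν` by odd integers, compatible with the arrows
and the involution. -/
structure Labels (p q : kˣ) (ν : kˣ →₀ ℕ) where
  L : kˣ → ℤ
  odd : ∀ a, ν a ≠ 0 → L a % 2 = 1
  inj : ∀ a b, ν a ≠ 0 → ν b ≠ 0 → L a = L b → a = b
  inv : ∀ a, ν a ≠ 0 → L a⁻¹ = -L a
  arrow : ∀ a b, ν a ≠ 0 → ν b ≠ 0 → (Arrow p a b ↔ L a = L b + 2)
  ne_q : ∀ a, ν a ≠ 0 → a ≠ q ∧ a ≠ q⁻¹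

lemma exists_labels {p q : kˣ} {I : Set kˣ} (hI : ∃ lam : kˣ, I = orbit p lam)
    (hI1 : (1 : kˣ) ∉ I) (hI1' : (-1 : kˣ) ∉ I) (hp : p ∉ I) (hq : q ∉ I)
    (hroot : ∀ n : ℕ, 0 < n → p ^ n ≠ 1) {ν : kˣ →₀ ℕ} (hν : IsDimVec I ν) :
    Nonempty (Labels p q ν) := by
  obtain ⟨lam, rfl⟩ := hI
  have pinj : ∀ a b : ℤ, p ^ a = p ^ b → a = b := by
    have : ¬ IsOfFinOrder p := fun h => by
      obtain ⟨n, hn, h⟩ := isOfFinOrder_iff_pow_eq_one.1 h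
      exact hroot n hn h
    exact fun a b h => injective_zpow_iff_not_isOfFinOrder.2 this h
  have hqν : ∀ a, ν a ≠ 0 → a ≠ q ∧ a ≠ q⁻¹ := fun a ha =>
    ⟨fun h => hq (h ▸ hν.1 a ha), fun h => hq (by
      have := hν.1 a⁻¹ (by rwa [hν.2])
      rwa [h, inv_inv] at this)⟩
  by_cases hdis : ∃ n n' : ℤ, p ^ (2 * n) * lam = p ^ (2 * n') * lam⁻¹
  · obtain ⟨n, n', h⟩ := hdis
    have h1 : lam ^ 2 = (p ^ (n' - n)) ^ 2 := by
      have : p ^ (2 * n) * (lam * lam) = p ^ (2 * n') := by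
        rw [← mul_assoc, h, inv_mul_cancel_right]
      rw [sq, sq, ← zpow_add, eq_comm, ← mul_right_inj (p ^ (2 * n)), this, ← zpow_add]
      congr 1; ring
    set j := n' - n
    have h2 : lam = p ^ j ∨ lam = -p ^ j := by
      have := sq_eq_sq_iff_eq_or_eq_neg.1 (congrArg Units.val h1)
      rcases this with h | h
      · exact Or.inl (Units.ext h)
      · exact Or.inr (Units.ext (by simpa using h))
    have key : lam = -p ^ j ∧ j % 2 = 1 := by
      rcases Int.emod_two_eq_zero_or_one j with hj | hj <;> rcases h2 with h2 | h2
      · exact (hI1 ⟨-(j / 2), Or.inl (by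
          rw [h2, ← zpow_add, show 2 * -(j / 2) + j = 0 by omega, zpow_zero])⟩).elim
      · exact (hI1' ⟨-(j / 2), Or.inl (by
          rw [h2, mul_neg, ← zpow_add, show 2 * -(j / 2) + j = 0 by omega, zpow_zero])⟩).elim
      · exact (hp ⟨-(j / 2), Or.inl (by
          rw [h2, ← zpow_add, show 2 * -(j / 2) + j = 1 by omega, zpow_one])⟩).elim
      · exact ⟨h2, hj⟩
    obtain ⟨hl, hj⟩ := key
    have hex : ∀ a, ν a ≠ 0 → ∃ n : ℤ, n % 2 = 1 ∧ a = -p ^ n := by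
      intro a ha
      obtain ⟨n, h | h⟩ := hν.1 a ha
      · exact ⟨2 * n + j, by omega, by rw [h, hl, zpow_add, mul_neg]⟩
      · exact ⟨2 * n - j, by omega, by
          rw [h, hl, sub_eq_add_neg, zpow_add, zpow_neg, inv_neg, mul_neg]⟩
    choose! L hodd hL using hex
    refine ⟨⟨L, hodd, fun a b ha hb h => by rw [hL a ha, hL b hb, h], fun a ha => ?_,
      fun a b ha hb => ?_, hqν⟩⟩
    · have ha' : ν a⁻¹ ≠ 0 := by rwa [hν.2]
      have := hL a⁻¹ ha'
      conv_lhs at this => rw [hL a ha]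
      rw [inv_neg, neg_inj, ← zpow_neg] at this
      exact (pinj _ _ this).symm
    · rw [Arrow]
      conv_lhs => rw [hL a ha, hL b hb]
      rw [mul_neg, neg_inj, ← zpow_natCast, ← zpow_add]
      exact ⟨fun h => by have := pinj _ _ h; push_cast at this; omega,
        fun h => by congr 1; push_cast; omega⟩
  · push Not at hdis
    have hex : ∀ a, ∃ n : ℤ, ν a ≠ 0 → a = p ^ (2 * n) * lam ∨ a = p ^ (2 * n) * lam⁻¹ := by
      intro a
      by_cases ha : ν a ≠ 0
      · obtain ⟨n, h⟩ := hν.1 a ha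
        exact ⟨n, fun _ => h⟩
      · exact ⟨0, fun h => (ha h).elim⟩
    choose N hN using hex
    have hcan : ∀ n n' : ℤ, ∀ c : kˣ, p ^ (2 * n) * c = p ^ (2 * n') * c → n = n' := by
      intro n n' c h
      have := pinj _ _ (mul_right_cancel h)
      omega
    set B := ν.support.sup fun a => (N a).natAbs
    have hB : ∀ a, ν a ≠ 0 → |N a| ≤ B := by
      intro a ha
      have : (N a).natAbs ≤ B :=
        Finset.le_sup (f := fun a => (N a).natAbs) (Finsupp.mem_support_iff.2 ha)
      rw [Int.abs_eq_natAbs]; exact_mod_cast this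
    classical
    let L : kˣ → ℤ := fun a => if a = p ^ (2 * N a) * lam then 2 * N a - (2 * B + 3)
      else 2 * N a + (2 * B + 3)
    have hP : ∀ a, ν a ≠ 0 →
        (a = p ^ (2 * N a) * lam ∧ L a = 2 * N a - (2 * B + 3) ∧ L a ≤ -3) ∨
        (a = p ^ (2 * N a) * lam⁻¹ ∧ L a = 2 * N a + (2 * B + 3) ∧ 3 ≤ L a) := by
      intro a ha
      have hb := abs_le.1 (hB a ha)
      by_cases h : a = p ^ (2 * N a) * lam
      · have : L a = 2 * N a - (2 * B + 3) := if_pos h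
        exact Or.inl ⟨h, this, by omega⟩
      · have : L a = 2 * N a + (2 * B + 3) := if_neg h
        exact Or.inr ⟨(hN a ha).resolve_left h, this, by omega⟩
    refine ⟨⟨L, fun a ha => ?_, fun a b ha hb h => ?_, fun a ha => ?_, fun a b ha hb => ?_, hqν⟩⟩
    · rcases hP a ha with h | h <;> omega
    · rcases hP a ha with ⟨h1, h2, h3⟩ | ⟨h1, h2, h3⟩ <;>
        rcases hP b hb with ⟨h1', h2', h3'⟩ | ⟨h1', h2', h3'⟩
      · rw [h1, h1', show N a = N b by omega]
      · omega
      · omega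
      · rw [h1, h1', show N a = N b by omega]
    · have ha' : ν a⁻¹ ≠ 0 := by rwa [hν.2]
      rcases hP a ha with ⟨h1, h2, h3⟩ | ⟨h1, h2, h3⟩ <;>
        rcases hP a⁻¹ ha' with ⟨h1', h2', h3'⟩ | ⟨h1', h2', h3'⟩
      · conv_lhs at h1' => rw [h1]
        rw [mul_inv, ← zpow_neg, show -(2 * N a) = 2 * -N a by ring] at h1'
        exact (hdis _ _ h1'.symm).elim
      · conv_lhs at h1' => rw [h1]
        rw [mul_inv, ← zpow_neg, show -(2 * N a) = 2 * -N a by ring] at h1'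
        have := hcan _ _ _ h1'
        omega
      · conv_lhs at h1' => rw [h1]
        rw [mul_inv, inv_inv, ← zpow_neg, show -(2 * N a) = 2 * -N a by ring] at h1'
        have := hcan _ _ _ h1'
        omega
      · conv_lhs at h1' => rw [h1]
        rw [mul_inv, inv_inv, ← zpow_neg, show -(2 * N a) = 2 * -N a by ring] at h1'
        exact (hdis _ _ h1').elim
    · have hs : ∀ c : kˣ, ∀ n : ℤ, p ^ 2 * (p ^ (2 * n) * c) = p ^ (2 * (n + 1)) * c := by
        intro c n
        rw [← mul_assoc, ← zpow_natCast, ← zpow_add]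
        congr 2; push_cast; ring
      rw [Arrow]
      rcases hP a ha with ⟨h1, h2, h3⟩ | ⟨h1, h2, h3⟩ <;>
        rcases hP b hb with ⟨h1', h2', h3'⟩ | ⟨h1', h2', h3'⟩ <;>
        (conv_lhs => rw [h1, h1', hs])
      · exact ⟨fun h => by have := hcan _ _ _ h; omega,
          fun h => by rw [show N a = N b + 1 by omega]⟩
      · exact ⟨fun h => (hdis _ _ h).elim, fun h => by omega⟩
      · exact ⟨fun h => (hdis _ _ h.symm).elim, fun h => by omega⟩
      · exact ⟨fun h => by have := hcan _ _ _ h; omega,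
          fun h => by rw [show N a = N b + 1 by omega]⟩

end VVPaper

namespace VVPaper
open MulOpposite

section
variable {k : Type} [Field k] {m : ℕ} [NeZero m] {Wd : Finset (Fin m → ℤ)} {R : Type} [Ring R]
  [Algebra k R]

lemma swapAt_braid {V : Type} (s : Fin (m - 1)) (hs : s.1 + 1 < m - 1) (w : Fin m → V) :
    swapAt ⟨s.1 + 1, hs⟩ (swapAt s (swapAt ⟨s.1 + 1, hs⟩ w)) = w ∘ Equiv.swap (lo s) (hi2 s hs) ∧
    swapAt s (swapAt ⟨s.1 + 1, hs⟩ (swapAt s w)) = w ∘ Equiv.swap (lo s) (hi2 s hs) := by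
  have k1 : lo s ≠ hi2 s hs := by simp [hi2, lo]
  have k2 : hi s ≠ hi2 s hs := by simp [hi2, hi]
  have h1 := Equiv.swap_mul_swap_mul_swap (lo_ne_hi s) k1
  have h2 := Equiv.swap_mul_swap_mul_swap k2.symm k1.symm
  rw [Equiv.swap_comm (hi2 s hs) (lo s)] at h1
  rw [Equiv.swap_comm (hi s) (lo s), Equiv.swap_comm (hi2 s hs) (hi s)] at h2
  constructor <;> funext p
  · exact congrArg w (DFunLike.congr_fun h1 p)
  · exact congrArg w (DFunLike.congr_fun h2 p)

lemma VVAlg.e_braid (A : VVAlg k Wd R) (s : Fin (m - 1)) (hs : s.1 + 1 < m - 1) (w : Fin m → ℤ) :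
    A.e w * A.sg ⟨s.1 + 1, hs⟩ * A.sg s * A.sg ⟨s.1 + 1, hs⟩ =
      A.sg ⟨s.1 + 1, hs⟩ * A.sg s * A.sg ⟨s.1 + 1, hs⟩ * A.e (w ∘ Equiv.swap (lo s) (hi2 s hs)) ∧
    A.e w * A.sg s * A.sg ⟨s.1 + 1, hs⟩ * A.sg s =
      A.sg s * A.sg ⟨s.1 + 1, hs⟩ * A.sg s * A.e (w ∘ Equiv.swap (lo s) (hi2 s hs)) := by
  constructor
  · rw [A.e_sg, mul_assoc (A.sg _), A.e_sg, ← mul_assoc, mul_assoc _ (A.e _), A.e_sg, ← mul_assoc,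
      (swapAt_braid s hs w).1]
  · rw [A.e_sg, mul_assoc (A.sg _), A.e_sg, ← mul_assoc, mul_assoc _ (A.e _), A.e_sg, ← mul_assoc,
      (swapAt_braid s hs w).2]

lemma comp_swap_eq {V : Type} (a b : Fin m) (w : Fin m → V) (h : w a = w b) :
    w ∘ Equiv.swap a b = w := by
  funext p
  simp only [Function.comp_apply, Equiv.swap_apply_def]
  split_ifs with h1 h2
  · rw [h1, h]
  · rw [h2, h]
  · rfl

/-- The opposite of a VV algebra. -/
def VVAlg.op (A : VVAlg k Wd R) : VVAlg k Wd Rᵐᵒᵖ where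
  x p := MulOpposite.op (A.x p)
  sg s := MulOpposite.op (A.sg s)
  pi := MulOpposite.op A.pi
  e w := MulOpposite.op (A.e w)
  e_zero w h := by rw [A.e_zero w h, op_zero]
  e_mul w := by rw [← op_mul, A.e_mul]
  e_orth w w' h := by rw [← op_mul, A.e_orth w' w (Ne.symm h), op_zero]
  e_sum := by 
    have := congrArg MulOpposite.op A.e_sum
    simpa using this
  x_comm a b := by rw [← op_mul, A.x_comm, op_mul]
  x_e a w := by rw [← op_mul, ← A.x_e, op_mul]
  sg_e s w := by rw [← op_mul, A.e_sg, op_mul]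
  sq_eq s w h := by
    rw [← op_mul, ← op_mul, ← mul_assoc, A.e_sg, mul_assoc, A.e_sg, swapAt_swapAt, ← mul_assoc,
      A.sq_eq s w h, op_zero]
  sq_none s w h h1 h2 := by
    rw [← op_mul, ← op_mul, ← mul_assoc, A.e_sg, mul_assoc, A.e_sg, swapAt_swapAt, ← mul_assoc,
      A.sq_none s w h h1 h2]
  sq_up s w h := by
    rw [← MulOpposite.op_sub, ← op_mul, ← op_mul, ← op_mul, ← mul_assoc, A.e_sg, mul_assoc, A.e_sg,
      swapAt_swapAt, ← mul_assoc, A.sq_up s w h, sub_mul, mul_sub, A.x_e, A.x_e]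
  sq_dn s w h := by
    rw [← MulOpposite.op_sub, ← op_mul, ← op_mul, ← op_mul, ← mul_assoc, A.e_sg, mul_assoc, A.e_sg,
      swapAt_swapAt, ← mul_assoc, A.sq_dn s w h, sub_mul, mul_sub, A.x_e, A.x_e]
  sg_comm s t h := by rw [← op_mul, ← A.sg_comm s t h, op_mul]
  braid_triv s hs w h := by
    simp only [← op_mul, ← mul_assoc]
    have k2 : hi s ≠ hi2 s hs := by simp [hi2, hi]
    rw [MulOpposite.op_inj, (A.e_braid s hs w).1, (A.e_braid s hs w).2, A.braid_triv]
    simp only [Function.comp_apply, Equiv.swap_apply_left, Equiv.swap_apply_right,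
      Equiv.swap_apply_of_ne_of_ne (lo_ne_hi s).symm k2]
    by_cases h0 : w (lo s) = w (hi2 s hs)
    · rw [← h0]; exact Or.inr (h.resolve_left fun h => h h0)
    · exact Or.inl (Ne.symm h0)
  braid_dn s hs w h h' := by
    simp only [← op_mul, ← mul_assoc, ← MulOpposite.op_add]
    rw [MulOpposite.op_inj, (A.e_braid s hs w).1, (A.e_braid s hs w).2, comp_swap_eq _ _ _ h,
      A.braid_dn s hs w h h']
  braid_up s hs w h h' := by
    simp only [← op_mul, ← mul_assoc, ← MulOpposite.op_sub]
    rw [MulOpposite.op_inj, (A.e_braid s hs w).1, (A.e_braid s hs w).2, comp_swap_eq _ _ _ h,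
      A.braid_up s hs w h h']
  sg_x_lo s w h := by
    simp only [← op_mul, ← MulOpposite.op_sub, ← mul_assoc]
    rw [MulOpposite.op_inj, ← A.x_e, mul_assoc, A.e_sg, mul_assoc (A.sg s), swapAt_eq s w h, ← A.x_e,
      ← mul_assoc, ← mul_assoc, A.sg_x_hi s w h, add_sub_cancel_right]
  sg_x_hi s w h := by
    simp only [← op_mul, ← MulOpposite.op_add, ← mul_assoc]
    rw [MulOpposite.op_inj, ← A.x_e, mul_assoc, A.e_sg, mul_assoc (A.sg s), swapAt_eq s w h, ← A.x_e,
      ← mul_assoc, ← mul_assoc, A.sg_x_lo s w h, sub_add_cancel]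
  sg_x s l w h := by
    simp only [← op_mul, ← mul_assoc]
    rw [MulOpposite.op_inj, ← A.x_e, mul_assoc, A.e_sg, mul_assoc (A.sg s), ← A.x_e, ← mul_assoc, ← mul_assoc,
      A.sg_x s _ (swapAt s w), Equiv.swap_apply_self]
    rw [swapAt_lo, swapAt_hi]
    refine h.imp Ne.symm fun h => ?_
    rwa [Equiv.swap_apply_of_ne_of_ne h.1 h.2]
  pi_e w := by rw [← op_mul, A.e_pi, op_mul]
  pi_sq := by rw [← op_mul, A.pi_sq, op_one]
  pi_x0 := by rw [← op_mul, ← op_mul, ← MulOpposite.op_neg, A.pi_x0, neg_neg]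
  pi_x l h := by rw [← op_mul, ← A.pi_x l h, op_mul]
  pi_sg s h := by rw [← op_mul, ← A.pi_sg s h, op_mul]
  sg_pi h := by
    simp only [← op_mul]
    rw [A.sg_pi h]
end
end VVPaper

namespace VVPaper
variable {k : Type} [Field k] {m : ℕ} {p q : kˣ} {ν : kˣ →₀ ℕ}

lemma IsThetaSeq.ne {i : Fin m → kˣ} (h : IsThetaSeq ν i) (j : Fin m) : ν (i j) ≠ 0 := by
  rw [← h, Finsupp.finsetSum_apply]
  have := Finset.single_le_sum (f := fun l => (Finsupp.single (i l) 1 + Finsupp.single (i l)⁻¹ 1 :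
    kˣ →₀ ℕ) (i j)) (fun _ _ => Nat.zero_le _) (Finset.mem_univ j)
  simp only [Finsupp.add_apply, Finsupp.single_eq_same] at this
  simp only [Finsupp.add_apply]
  omega

lemma mem_thetaSeqs {i : Fin m → kˣ} : i ∈ thetaSeqs ν m ↔ IsThetaSeq ν i := by
  simp only [thetaSeqs, Finset.mem_filter, Fintype.mem_piFinset, Finsupp.mem_support_iff]
  exact ⟨fun h => h.2, fun h => ⟨h.ne, h⟩⟩

lemma isThetaSeq_swapAt {s : Fin (m - 1)} {i : Fin m → kˣ} :
    IsThetaSeq ν (swapAt s i) ↔ IsThetaSeq ν i := by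
  unfold IsThetaSeq swapAt
  rw [← Equiv.sum_comp (Equiv.swap (lo s) (hi s))
    (fun j => (Finsupp.single (i j) 1 + Finsupp.single (i j)⁻¹ 1 : kˣ →₀ ℕ))]
  rfl

lemma isThetaSeq_inv {a : Fin m} {i : Fin m → kˣ} :
    IsThetaSeq ν (Function.update i a (i a)⁻¹) ↔ IsThetaSeq ν i := by
  unfold IsThetaSeq
  have : ∀ j, (Finsupp.single (Function.update i a (i a)⁻¹ j) 1 +
      Finsupp.single (Function.update i a (i a)⁻¹ j)⁻¹ 1 : kˣ →₀ ℕ) =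
      Finsupp.single (i j) 1 + Finsupp.single (i j)⁻¹ 1 := by
    intro j
    by_cases h : j = a
    · subst h; rw [Function.update_self, inv_inv, add_comm]
    · rw [Function.update_of_ne h]
  simp only [this]

lemma vmk_rel {a b : FA k m} (h : Rel p q (IsThetaSeq ν) (thetaSeqs ν m) true a b) :
    vmk p q ν m a = vmk p q ν m b := RingQuot.mkAlgHom_rel k h

namespace Labels
variable (Λ : Labels p q ν)

/-- The word of odd integers attached to a sequence of letters. -/
def wd (i : Fin m → kˣ) : Fin m → ℤ := fun j => Λ.L (i j)

lemma wd_inj {i j : Fin m → kˣ} (hi : IsThetaSeq ν i) (hj : IsThetaSeq ν j)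
    (h : Λ.wd i = Λ.wd j) : i = j :=
  funext fun l => Λ.inj _ _ (hi.ne l) (hj.ne l) (congrFun h l)

lemma wd_swapAt (s : Fin (m - 1)) (i : Fin m → kˣ) : Λ.wd (swapAt s i) = swapAt s (Λ.wd i) := rfl

lemma wd_inv [NeZero m] (h0 : 0 < m) {i : Fin m → kˣ} (hi : IsThetaSeq ν i) :
    Λ.wd (Function.update i ⟨0, h0⟩ (i ⟨0, h0⟩)⁻¹) = flip0 (Λ.wd i) := by
  have h : (0 : Fin m) = ⟨0, h0⟩ := Fin.ext (by simp)
  funext j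
  unfold wd flip0
  rw [h]
  by_cases hj : j = ⟨0, h0⟩
  · subst hj; rw [Function.update_self, Function.update_self, Λ.inv _ (hi.ne _)]
  · rw [Function.update_of_ne hj, Function.update_of_ne hj]

open Classical in
/-- The admissible words. -/
def Wd (m : ℕ) : Finset (Fin m → ℤ) := (thetaSeqs ν m).image Λ.wd

lemma mem_Wd {w : Fin m → ℤ} : w ∈ Λ.Wd m ↔ ∃ i, IsThetaSeq ν i ∧ Λ.wd i = w := by
  simp [Wd, mem_thetaSeqs]

lemma sum_Wd {M : Type} [AddCommMonoid M] (f : (Fin m → ℤ) → M) :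
    ∑ w ∈ Λ.Wd m, f w = ∑ i ∈ thetaSeqs ν m, f (Λ.wd i) :=
  Finset.sum_image fun _ hi _ hj h => Λ.wd_inj (mem_thetaSeqs.1 hi) (mem_thetaSeqs.1 hj) h

lemma Wd_closed [NeZero m] : ∀ w ∈ Λ.Wd m, ∀ g, gact g w ∈ Λ.Wd m := by
  intro w hw g
  obtain ⟨i, hi, rfl⟩ := Λ.mem_Wd.1 hw
  cases g with
  | none => exact Λ.mem_Wd.2 ⟨_, isThetaSeq_inv.2 hi, Λ.wd_inv (NeZero.pos m) hi⟩
  | some s => exact Λ.mem_Wd.2 ⟨_, isThetaSeq_swapAt.2 hi, rfl⟩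

lemma Wd_odd : ∀ w ∈ Λ.Wd m, ∀ i, w i % 2 = 1 := by
  intro w hw j
  obtain ⟨i, hi, rfl⟩ := Λ.mem_Wd.1 hw
  exact Λ.odd _ (hi.ne j)

open Classical in
/-- The idempotent of a word. -/
def ee (w : Fin m → ℤ) : VV k p q ν m :=
  ∑ i ∈ (thetaSeqs ν m).filter fun i => Λ.wd i = w, vmk p q ν m (E i)

lemma ee_wd {i : Fin m → kˣ} (hi : IsThetaSeq ν i) : Λ.ee (Λ.wd i) = vmk p q ν m (E i) := by
  classical
  rw [ee, Finset.sum_eq_single i]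
  · intro j hj hne
    simp only [Finset.mem_filter, mem_thetaSeqs] at hj
    exact (hne (Λ.wd_inj hj.1 hi hj.2)).elim
  · intro h
    simp [mem_thetaSeqs, hi] at h

lemma ee_zero {w : Fin m → ℤ} (h : w ∉ Λ.Wd m) : Λ.ee w = 0 := by
  classical
  refine Finset.sum_eq_zero fun i hi => ?_
  simp only [Finset.mem_filter, mem_thetaSeqs] at hi
  exact (h (Λ.mem_Wd.2 ⟨i, hi.1, hi.2⟩)).elim

lemma ee_forall {P : (Fin m → ℤ) → VV k p q ν m → Prop} (h0 : ∀ w ∉ Λ.Wd m, P w 0)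
    (h1 : ∀ i, IsThetaSeq ν i → P (Λ.wd i) (vmk p q ν m (E i))) (w : Fin m → ℤ) : P w (Λ.ee w) := by
  by_cases h : w ∈ Λ.Wd m
  · obtain ⟨i, hi, rfl⟩ := Λ.mem_Wd.1 h
    rw [Λ.ee_wd hi]; exact h1 i hi
  · rw [Λ.ee_zero h]; exact h0 w h

lemma ext_E {a b : VV k p q ν m}
    (h : ∀ i, IsThetaSeq ν i → a * vmk p q ν m (E i) = b * vmk p q ν m (E i)) : a = b := by
  have h1 : ∑ i ∈ thetaSeqs ν m, vmk p q ν m (E i) = 1 := by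
    rw [← map_sum, vmk_rel .idem_sum, map_one]
  rw [← mul_one a, ← mul_one b, ← h1, Finset.mul_sum, Finset.mul_sum]
  exact Finset.sum_congr rfl fun i hi => h i (mem_thetaSeqs.1 hi)

lemma not_arrow {i : Fin m → kˣ} (hi : IsThetaSeq ν i) {a b : Fin m}
    (h : Λ.wd i a ≠ Λ.wd i b + 2) : ¬ Arrow p (i a) (i b) :=
  fun h' => h ((Λ.arrow _ _ (hi.ne _) (hi.ne _)).1 h')

lemma arrow' {i : Fin m → kˣ} (hi : IsThetaSeq ν i) {a b : Fin m}
    (h : Λ.wd i a = Λ.wd i b + 2) : Arrow p (i a) (i b) ∧ ¬ Arrow p (i b) (i a) :=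
  ⟨(Λ.arrow _ _ (hi.ne _) (hi.ne _)).2 h, Λ.not_arrow hi (by omega)⟩

lemma eq' {i : Fin m → kˣ} (hi : IsThetaSeq ν i) {a b : Fin m} (h : Λ.wd i a = Λ.wd i b) :
    i a = i b := Λ.inj _ _ (hi.ne _) (hi.ne _) h

lemma ne' {i : Fin m → kˣ} {a b : Fin m} (h : Λ.wd i a ≠ Λ.wd i b) :
    i a ≠ i b := fun h' => h (congrArg Λ.L h')

/-- The VV algebra with letters written as odd integers. -/
def alg [NeZero m] : VVAlg k (Λ.Wd m) (VV k p q ν m) where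
  x j := vmk p q ν m (X j)
  sg s := vmk p q ν m (Sg s)
  pi := vmk p q ν m Pg
  e := Λ.ee
  e_zero w h := Λ.ee_zero h
  e_mul := Λ.ee_forall (P := fun w e => e * e = e) (fun w _ => mul_zero _) fun i hi => by
    rw [← map_mul, vmk_rel (.idem_mul i)]
  e_orth w w' := Λ.ee_forall (P := fun w' e' => w ≠ w' → Λ.ee w * e' = 0)
    (fun w' _ _ => mul_zero _) (fun j hj => Λ.ee_forall (P := fun w e => w ≠ Λ.wd j → e * _ = 0)
      (fun w _ _ => zero_mul _) (fun i hi h => by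
        rw [← map_mul, vmk_rel (.idem_orth i j fun h' => h (h' ▸ rfl)), map_zero]) w) w'
  e_sum := by
    rw [Λ.sum_Wd, Finset.sum_congr rfl fun i hi => Λ.ee_wd (mem_thetaSeqs.1 hi), ← map_sum,
      vmk_rel .idem_sum, map_one]
  x_comm a b := by rw [← map_mul, vmk_rel (.x_mul_comm a b), map_mul]
  x_e a := Λ.ee_forall (P := fun w e => _ * e = e * _) (fun w _ => by rw [mul_zero, zero_mul])
    fun i hi => by rw [← map_mul, vmk_rel (.x_idem a i), map_mul]
  sg_e s := Λ.ee_forall (P := fun w e => _ * e = Λ.ee (swapAt s w) * _) (fun w hw => by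
      rw [Λ.ee_zero, mul_zero, zero_mul]
      intro h; apply hw; simpa [gact, swapAt_swapAt] using Λ.Wd_closed _ h (some s))
    fun i hi => by
      rw [← Λ.wd_swapAt, Λ.ee_wd (isThetaSeq_swapAt.2 hi), ← map_mul, vmk_rel (.sig_idem s i),
        map_mul]
  sq_eq s := Λ.ee_forall (P := fun w e => w (lo s) = w (hi s) → _ * _ * e = 0)
    (fun w hw _ => mul_zero _) fun i h0 h => by
      simp only [← map_mul]; rw [vmk_rel (.sig_sq_eq s i (Λ.eq' h0 h)), map_zero]
  sq_none s := Λ.ee_forall (P := fun w e => w (lo s) ≠ w (hi s) → w (lo s) ≠ w (hi s) + 2 →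
      w (hi s) ≠ w (lo s) + 2 → _ * _ * e = e)
    (fun w hw _ _ _ => mul_zero _) fun i h0 h h1 h2 => by
      simp only [← map_mul]
      rw [vmk_rel (.sig_sq_none s i (Λ.ne' h) (Λ.not_arrow h0 h1) (Λ.not_arrow h0 h2))]
  sq_up s := Λ.ee_forall (P := fun w e => w (hi s) = w (lo s) + 2 → _ * _ * e = _ * e)
    (fun w hw _ => by rw [mul_zero, mul_zero]) fun i h0 h => by
      simp only [← map_mul, ← map_sub]
      rw [vmk_rel (.sig_sq_from s i (Λ.arrow' h0 h).1 (Λ.arrow' h0 h).2)]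
  sq_dn s := Λ.ee_forall (P := fun w e => w (lo s) = w (hi s) + 2 → _ * _ * e = _ * e)
    (fun w hw _ => by rw [mul_zero, mul_zero]) fun i h0 h => by
      simp only [← map_mul, ← map_sub]
      rw [vmk_rel (.sig_sq_to s i (Λ.arrow' h0 h).1 (Λ.arrow' h0 h).2)]
  sg_comm s t h := by rw [← map_mul, vmk_rel (.sig_comm s t h), map_mul]
  braid_triv s hs := Λ.ee_forall (P := fun w e => (w (lo s) ≠ w (hi2 s hs) ∨
      (w (lo s) ≠ w (hi s) + 2 ∧ w (hi s) ≠ w (lo s) + 2)) → _ * e = _ * e)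
    (fun w hw _ => by rw [mul_zero, mul_zero]) fun i h0 h => by
      simp only [← map_mul]
      rw [vmk_rel (.braid_triv s hs i (h.imp (Λ.ne' (b := hi2 s hs)) fun h =>
        ⟨Λ.not_arrow h0 h.1, Λ.not_arrow h0 h.2⟩))]
  braid_dn s hs := Λ.ee_forall (P := fun w e => w (lo s) = w (hi2 s hs) →
      w (lo s) = w (hi s) + 2 → _ * e = _ * e + e)
    (fun w hw _ _ => by rw [mul_zero, mul_zero, add_zero]) fun i h0 h h' => by
      simp only [← map_mul, ← map_add]
      rw [vmk_rel (.braid_to s hs i (Λ.eq' h0 h) (Λ.arrow' h0 h').1 (Λ.arrow' h0 h').2)]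
  braid_up s hs := Λ.ee_forall (P := fun w e => w (lo s) = w (hi2 s hs) →
      w (hi s) = w (lo s) + 2 → _ * e = _ * e - e)
    (fun w hw _ _ => by rw [mul_zero, mul_zero, sub_zero]) fun i h0 h h' => by
      simp only [← map_mul, ← map_sub]
      rw [vmk_rel (.braid_from s hs i (Λ.eq' h0 h) (Λ.arrow' h0 h').1 (Λ.arrow' h0 h').2)]
  sg_x_lo s := Λ.ee_forall (P := fun w e => w (lo s) = w (hi s) → _ * e = _ * e - e)
    (fun w hw _ => by rw [mul_zero, mul_zero, sub_zero]) fun i h0 h => by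
      simp only [← map_mul, ← map_sub]; rw [vmk_rel (.sig_x_lo s i (Λ.eq' h0 h))]
  sg_x_hi s := Λ.ee_forall (P := fun w e => w (lo s) = w (hi s) → _ * e = _ * e + e)
    (fun w hw _ => by rw [mul_zero, mul_zero, add_zero]) fun i h0 h => by
      simp only [← map_mul, ← map_add]; rw [vmk_rel (.sig_x_hi s i (Λ.eq' h0 h))]
  sg_x s l := Λ.ee_forall (P := fun w e => (w (lo s) ≠ w (hi s) ∨ (l ≠ lo s ∧ l ≠ hi s)) →
      _ * e = _ * e)
    (fun w hw _ => by rw [mul_zero, mul_zero]) fun i h0 h => by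
      simp only [← map_mul]; rw [vmk_rel (.sig_x s l i (h.imp_left Λ.ne'))]
  pi_e := Λ.ee_forall (P := fun w e => _ * e = Λ.ee (flip0 w) * _) (fun w hw => by
      rw [Λ.ee_zero, mul_zero, zero_mul]
      intro h; apply hw; simpa [gact, flip0_flip0] using Λ.Wd_closed _ h none)
    fun i hi => by
      rw [← Λ.wd_inv (NeZero.pos m) hi, Λ.ee_wd (isThetaSeq_inv.2 hi), ← map_mul,
        vmk_rel (.pi_idem rfl (NeZero.pos m) i), map_mul]
  pi_sq := ext_E fun i hi => by
    have := Λ.ne_q _ (hi.ne ⟨0, NeZero.pos m⟩)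
    simp only [← map_mul]
    rw [vmk_rel (.pi_sq_one rfl (NeZero.pos m) i this.1 this.2), one_mul]
  pi_x0 := by
    rw [show (0 : Fin m) = ⟨0, NeZero.pos m⟩ from Fin.ext (by simp), ← map_mul,
      vmk_rel (.pi_x_zero rfl (NeZero.pos m)), map_neg, map_mul]
  pi_x l h := by rw [← map_mul, vmk_rel (.pi_x rfl l h), map_mul]
  pi_sg s h := by rw [← map_mul, vmk_rel (.pi_sig rfl s h), map_mul]
  sg_pi h1 := ext_E fun i hi => by
    simp only [← map_mul]
    rw [vmk_rel (.sig_pi_zero rfl h1 i (fun h => (Λ.ne_q _ (hi.ne _)).1 h.1)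
      (fun h => (Λ.ne_q _ (hi.ne _)).2 h.1))]

end Labels
end VVPaper

namespace VVPaper
variable {k : Type} [Field k] {m : ℕ} {p q : kˣ} {ν : kˣ →₀ ℕ}

lemma adjoin_vmk_range :
    Algebra.adjoin k (Set.range fun g => vmk p q ν m (FreeAlgebra.ι k g)) = ⊤ := by
  have : (Set.range fun g => vmk p q ν m (FreeAlgebra.ι k g)) =
      vmk p q ν m '' Set.range (FreeAlgebra.ι k) := by
    rw [← Set.range_comp]; rfl
  rw [this, ← AlgHom.map_adjoin, FreeAlgebra.adjoin_range_ι, Algebra.map_top]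
  exact (AlgHom.range_eq_top _).2 (RingQuot.mkAlgHom_surjective k _)

namespace Labels
variable [NeZero m] (Λ : Labels p q ν)

lemma exists_hom {T : Type} [Ring T] [Algebra k T] (ρ : VVAlg k (Λ.Wd m) T) :
    ∃ f : VV k p q ν m →ₐ[k] T, (∀ j, f (Λ.alg.x j) = ρ.x j) ∧
      (∀ g, f (Λ.alg.gn g) = ρ.gn g) ∧ ∀ w, f (Λ.alg.e w) = ρ.e w := by
  classical
  let E' : (Fin m → kˣ) → T := fun i => if IsThetaSeq ν i then ρ.e (Λ.wd i) else 0
  have E1 : ∀ i, IsThetaSeq ν i → E' i = ρ.e (Λ.wd i) := fun i h => if_pos h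
  have E0 : ∀ i, ¬ IsThetaSeq ν i → E' i = 0 := fun i h => if_neg h
  let F : FA k m →ₐ[k] T := FreeAlgebra.lift k fun g => match g with
    | .x j => ρ.x j
    | .sig s => ρ.sg s
    | .idem i => E' i
    | .pi => ρ.pi
  have FX : ∀ j, F (X j) = ρ.x j := fun j => FreeAlgebra.lift_ι_apply _ _
  have FS : ∀ s, F (Sg s) = ρ.sg s := fun s => FreeAlgebra.lift_ι_apply _ _
  have FE : ∀ i, F (E i) = E' i := fun i => FreeAlgebra.lift_ι_apply _ _
  have FP : F Pg = ρ.pi := FreeAlgebra.lift_ι_apply _ _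
  have hL : ∀ {i : Fin m → kˣ}, IsThetaSeq ν i → ∀ a b, Arrow p (i a) (i b) ↔
      Λ.wd i a = Λ.wd i b + 2 := fun hi a b => Λ.arrow _ _ (hi.ne _) (hi.ne _)
  have hEq : ∀ {i : Fin m → kˣ} (a b), i a = i b → Λ.wd i a = Λ.wd i b :=
    fun a b h => congrArg Λ.L h
  have hNe : ∀ {i : Fin m → kˣ}, IsThetaSeq ν i → ∀ a b, i a ≠ i b → Λ.wd i a ≠ Λ.wd i b :=
    fun hi a b h h' => h (Λ.eq' hi h')
  have h00 : ∀ h0 : 0 < m, (⟨0, h0⟩ : Fin m) = 0 := fun h0 => Fin.ext (by simp)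
  have hF : ∀ ⦃a b⦄, Rel p q (IsThetaSeq ν) (thetaSeqs ν m) true a b → F a = F b := by
    intro a b h
    induction h with
    | idem_mul i =>
      simp only [map_mul, FE]
      by_cases hi : IsThetaSeq ν i
      · rw [E1 i hi, ρ.e_mul]
      · rw [E0 i hi, mul_zero]
    | idem_orth i j h =>
      simp only [map_mul, FE, map_zero]
      by_cases hi : IsThetaSeq ν i
      · by_cases hj : IsThetaSeq ν j
        · rw [E1 i hi, E1 j hj, ρ.e_orth _ _ fun h' => h (Λ.wd_inj hi hj h')]
        · rw [E0 j hj, mul_zero]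
      · rw [E0 i hi, zero_mul]
    | idem_zero i h => rw [FE, E0 i h, map_zero]
    | idem_sum =>
      rw [map_sum, map_one, ← ρ.e_sum, Λ.sum_Wd]
      exact Finset.sum_congr rfl fun i hi => by rw [FE, E1 i (mem_thetaSeqs.1 hi)]
    | x_mul_comm a b => simp only [map_mul, FX]; exact ρ.x_comm a b
    | x_idem a i =>
      simp only [map_mul, FX, FE]
      by_cases hi : IsThetaSeq ν i
      · rw [E1 i hi, ρ.x_e]
      · rw [E0 i hi, mul_zero, zero_mul]
    | sig_idem s i =>
      simp only [map_mul, FS, FE]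
      by_cases hi : IsThetaSeq ν i
      · rw [E1 i hi, E1 _ (isThetaSeq_swapAt.2 hi), ρ.sg_e, Λ.wd_swapAt]
      · rw [E0 i hi, E0 _ (mt isThetaSeq_swapAt.1 hi), mul_zero, zero_mul]
    | sig_comm s t h => simp only [map_mul, FS]; exact ρ.sg_comm s t h
    | pi_idem _ h0 i =>
      simp only [map_mul, FP, FE]
      by_cases hi : IsThetaSeq ν i
      · rw [E1 i hi, E1 _ (isThetaSeq_inv.2 hi), ρ.pi_e, Λ.wd_inv h0 hi]
      · rw [E0 i hi, E0 _ (mt isThetaSeq_inv.1 hi), mul_zero, zero_mul]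
    | pi_x_zero _ h0 => simp only [map_mul, map_neg, FP, FX, h00]; exact ρ.pi_x0
    | pi_x _ l h => simp only [map_mul, FP, FX]; exact ρ.pi_x l h
    | pi_sig _ s h => simp only [map_mul, FP, FS]; exact ρ.pi_sg s h
    | pi_zero hw => cases hw
    | sig_sq_eq s i h => 
      simp only [map_mul, map_zero, FS, FE]
      by_cases hi : IsThetaSeq ν i
      · rw [E1 i hi, ρ.sq_eq s _ (hEq _ _ h)]
      · rw [E0 i hi, mul_zero]
    | sig_sq_none s i hne h1 h2 =>
      simp only [map_mul, FS, FE]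
      by_cases hi : IsThetaSeq ν i
      · rw [hL hi] at h1 h2
        rw [E1 i hi, ρ.sq_none s _ (hNe hi _ _ hne) h1 h2]
      · rw [E0 i hi, mul_zero]
    | sig_sq_from s i h1 h2 =>
      simp only [map_mul, map_sub, FS, FE, FX]
      by_cases hi : IsThetaSeq ν i
      · rw [hL hi] at h1
        rw [E1 i hi, ρ.sq_up s _ h1]
      · rw [E0 i hi, mul_zero, mul_zero]
    | sig_sq_to s i h1 h2 =>
      simp only [map_mul, map_sub, FS, FE, FX]
      by_cases hi : IsThetaSeq ν i
      · rw [hL hi] at h1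
        rw [E1 i hi, ρ.sq_dn s _ h1]
      · rw [E0 i hi, mul_zero, mul_zero]
    | sig_sq_both s i h1 h2 =>
      simp only [map_mul, map_sub, FS, FE, FX]
      by_cases hi : IsThetaSeq ν i
      · rw [hL hi] at h1 h2
        omega
      · rw [E0 i hi, mul_zero, mul_zero]
    | braid_triv s hs i h =>
      simp only [map_mul, FS, FE]
      by_cases hi : IsThetaSeq ν i
      · rw [hL hi, hL hi] at h
        rw [E1 i hi, ρ.braid_triv s hs _ (h.imp_left (hNe hi _ _))]
      · rw [E0 i hi, mul_zero, mul_zero]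
    | braid_to s hs i he h1 h2 =>
      simp only [map_mul, map_add, FS, FE]
      by_cases hi : IsThetaSeq ν i
      · rw [hL hi] at h1
        rw [E1 i hi, ρ.braid_dn s hs _ (hEq _ _ he) h1]
      · rw [E0 i hi, mul_zero, mul_zero, add_zero]
    | braid_from s hs i he h1 h2 =>
      simp only [map_mul, map_sub, FS, FE]
      by_cases hi : IsThetaSeq ν i
      · rw [hL hi] at h1
        rw [E1 i hi, ρ.braid_up s hs _ (hEq _ _ he) h1]
      · rw [E0 i hi, mul_zero, mul_zero, sub_zero]
    | braid_both s hs i he h1 h2 =>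
      simp only [map_mul, map_add, FS, FE]
      by_cases hi : IsThetaSeq ν i
      · rw [hL hi] at h1 h2
        omega
      · rw [E0 i hi, mul_zero, mul_zero, mul_zero, add_zero]
    | sig_x_lo s i h =>
      simp only [map_mul, map_sub, FS, FE, FX]
      by_cases hi : IsThetaSeq ν i
      · rw [E1 i hi, ρ.sg_x_lo s _ (hEq _ _ h)]
      · rw [E0 i hi, mul_zero, mul_zero, sub_zero]
    | sig_x_hi s i h =>
      simp only [map_mul, map_add, FS, FE, FX]
      by_cases hi : IsThetaSeq ν i
      · rw [E1 i hi, ρ.sg_x_hi s _ (hEq _ _ h)]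
      · rw [E0 i hi, mul_zero, mul_zero, add_zero]
    | sig_x s l i h =>
      simp only [map_mul, FS, FE, FX]
      by_cases hi : IsThetaSeq ν i
      · rw [E1 i hi, ρ.sg_x s l _ (h.imp_left (hNe hi _ _))]
      · rw [E0 i hi, mul_zero, mul_zero]
    | pi_sq_q _ h0 i h =>
      simp only [map_mul, FP, FE, FX]
      rw [E0 i fun hi => (Λ.ne_q _ (hi.ne _)).1 h, mul_zero, mul_zero]
    | pi_sq_qinv _ h0 i h =>
      simp only [map_mul, map_neg, FP, FE, FX]
      rw [E0 i fun hi => (Λ.ne_q _ (hi.ne _)).2 h, mul_zero, mul_zero, neg_zero]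
    | pi_sq_one _ h0 i h1 h2 => simp only [map_mul, FP, ρ.pi_sq, one_mul]
    | sig_pi_plus _ h1 i ha hb =>
      simp only [map_mul, map_add, FP, FE, FS]
      rw [E0 i fun hi => (Λ.ne_q _ (hi.ne _)).1 ha, mul_zero, mul_zero, mul_zero, zero_add]
    | sig_pi_minus _ h1 i ha hb =>
      simp only [map_mul, map_sub, FP, FE, FS]
      rw [E0 i fun hi => (Λ.ne_q _ (hi.ne _)).2 ha, mul_zero, mul_zero, mul_zero, zero_sub,
        neg_zero]
    | sig_pi_zero _ h1 i hc hc' =>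
      simp only [map_mul, FP, FE, FS]
      rw [ρ.sg_pi h1]
  have key : ∀ a, RingQuot.liftAlgHom k ⟨F, hF⟩ (vmk p q ν m a) = F a := fun a =>
    RingQuot.liftAlgHom_mkAlgHom_apply _ _ _ _
  refine ⟨RingQuot.liftAlgHom k ⟨F, hF⟩, fun j => (key _).trans (FX j), fun g => ?_,
    Λ.ee_forall (P := fun w e => _ = ρ.e w) (fun w h => by rw [map_zero, ρ.e_zero w h])
      fun i hi => (key _).trans ((FE i).trans (E1 i hi))⟩
  cases g with
  | none => exact (key _).trans FP
  | some s => exact (key _).trans (FS s)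

lemma alg_gen : Algebra.adjoin k (Set.range (Λ.alg (m := m)).x ∪ Set.range Λ.alg.gn ∪
    Set.range Λ.alg.e) = ⊤ := by
  rw [eq_top_iff, ← adjoin_vmk_range, Algebra.adjoin_le_iff]
  rintro _ ⟨g, rfl⟩
  have hs := Algebra.subset_adjoin (R := k) (s := Set.range (Λ.alg (m := m)).x ∪
    Set.range Λ.alg.gn ∪ Set.range Λ.alg.e)
  cases g with
  | x j => exact hs (Or.inl (Or.inl ⟨j, rfl⟩))
  | sig s => exact hs (Or.inl (Or.inr ⟨some s, rfl⟩))
  | pi => exact hs (Or.inl (Or.inr ⟨none, rfl⟩))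
  | idem i =>
    by_cases hi : IsThetaSeq ν i
    · exact hs (Or.inr ⟨Λ.wd i, Λ.ee_wd hi⟩)
    · change vmk p q ν m (E i) ∈ _
      rw [vmk_rel (.idem_zero i hi), map_zero]
      exact zero_mem _

lemma exists_full : ∃ F : Full k (Λ.Wd m) (VV k p q ν m), F.A = Λ.alg := by
  obtain ⟨f, fx, fg, fe⟩ := Λ.exists_hom (m := m) Λ.alg.op
  have fg' : ∀ g, f (Λ.alg.gn g) = MulOpposite.op (Λ.alg.gn g) := by
    intro g; rw [fg]; cases g <;> rfl
  have hff : (AlgHom.opComm f).comp f = AlgHom.id k _ := by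
    refine AlgHom.ext_of_adjoin_eq_top Λ.alg_gen ?_
    rintro _ ((⟨j, rfl⟩ | ⟨g, rfl⟩) | ⟨w, rfl⟩)
    · change (f (f (Λ.alg.x j)).unop).unop = _
      rw [fx]; exact congrArg MulOpposite.unop (fx j)
    · change (f (f (Λ.alg.gn g)).unop).unop = _
      rw [fg']; exact congrArg MulOpposite.unop (fg' g)
    · change (f (f (Λ.alg.e w)).unop).unop = _
      rw [fe]; exact congrArg MulOpposite.unop (fe w)
  exact ⟨{
    A := Λ.alg
    gen := Λ.alg_gen
    om := (MulOpposite.opLinearEquiv k).symm.toLinearMap ∘ₗ f.toLinearMap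
    om_mul := fun a b => congrArg MulOpposite.unop (map_mul f a b)
    om_one := congrArg MulOpposite.unop (map_one f)
    om_om := fun a => DFunLike.congr_fun hff a
    om_x := fun j => congrArg MulOpposite.unop (fx j)
    om_gn := fun g => congrArg MulOpposite.unop (fg' g)
    om_e := fun w => congrArg MulOpposite.unop (fe w)
    univ := fun T _ _ ρ _ => Λ.exists_hom ρ }, rfl⟩

end Labels
end VVPaper

namespace VVPaper
open TensorProduct

lemma exists_cell_top {k H B : Type} [Field k] [CommRing H] [Algebra k H] [CommRing B] [Algebra k B]
    (eB : B ≃ₐ[k] H) :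
    ∃ (act : H →ₐ[k] Module.End B (Fin 1 → B))
      (α : (Submodule.restrictScalars k (TwoSidedIdeal.asIdeal (⊤ : TwoSidedIdeal H))) ≃ₗ[k]
        (Fin 1 → B) ⊗[B] (Fin 1 → B)),
      (∀ (h : H) (x y : (Submodule.restrictScalars k
        (TwoSidedIdeal.asIdeal (⊤ : TwoSidedIdeal H)))), (y : H) = h * (x : H) →
          α y = LinearMap.rTensor (Fin 1 → B) (act h) (α x)) ∧
      (∀ (h : H) (x y : (Submodule.restrictScalars k
        (TwoSidedIdeal.asIdeal (⊤ : TwoSidedIdeal H)))), (y : H) = (x : H) * h →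
          α y = LinearMap.lTensor (Fin 1 → B) (act h) (α x)) ∧
      ∃ sw : (Fin 1 → B) ⊗[B] (Fin 1 → B) →ₗ[k] (Fin 1 → B) ⊗[B] (Fin 1 → B),
        (∀ d d' : Fin 1 → B, sw (d ⊗ₜ d') = d' ⊗ₜ d) ∧
        (∀ x y : (Submodule.restrictScalars k (TwoSidedIdeal.asIdeal (⊤ : TwoSidedIdeal H))),
          (y : H) = (x : H) → α y = sw (α x)) := by
  let e1 : (Submodule.restrictScalars k (TwoSidedIdeal.asIdeal (⊤ : TwoSidedIdeal H))) ≃ₗ[k] H :=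
    { toFun := fun x => x
      invFun := fun x => ⟨x, trivial⟩
      map_add' := fun _ _ => rfl
      map_smul' := fun _ _ => rfl
      left_inv := fun _ => rfl
      right_inv := fun _ => rfl }
  let e2 : B ≃ₗ[B] (Fin 1 → B) ⊗[B] (Fin 1 → B) := (TensorProduct.lid B B).symm ≪≫ₗ
    TensorProduct.congr (LinearEquiv.funUnique (Fin 1) B B).symm
      (LinearEquiv.funUnique (Fin 1) B B).symm
  have h2 : ∀ b, e2 b = (1 : Fin 1 → B) ⊗ₜ fun _ => b := fun b => rfl
  have hsm : ∀ b : B, (fun _ => b : Fin 1 → B) = b • (1 : Fin 1 → B) := fun b => by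
    funext j; simp
  let act : H →ₐ[k] Module.End B (Fin 1 → B) :=
    (Algebra.lsmul k B (Fin 1 → B)).comp eB.symm.toAlgHom
  have hact : ∀ h d, act h d = eB.symm h • d := fun h d => rfl
  let α := (e1 ≪≫ₗ eB.symm.toLinearEquiv) ≪≫ₗ e2.restrictScalars k
  have hα : ∀ x, α x = (1 : Fin 1 → B) ⊗ₜ (eB.symm (x : H) • (1 : Fin 1 → B)) := fun x => by
    rw [← hsm]; rfl
  refine ⟨act, α, fun h x y hy => ?_, fun h x y hy => ?_,
    (TensorProduct.comm B (Fin 1 → B) (Fin 1 → B)).toLinearMap.restrictScalars k,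
    fun d d' => rfl, fun x y hy => ?_⟩
  · rw [hα, hα, LinearMap.rTensor_tmul, hact, TensorProduct.smul_tmul, smul_smul, hy, map_mul]
  · rw [hα, hα, LinearMap.lTensor_tmul, hact, smul_smul, hy, map_mul, mul_comm]
  · rw [hα, hα, hy]
    exact (TensorProduct.smul_tmul _ _ _).symm

lemma isAffineCellIdeal_top {k H : Type} [Field k] [CommRing H] [Algebra k H] (t : H)
    (ht : Algebra.adjoin k {t} = ⊤) : IsAffineCellIdeal k H LinearMap.id ⊤ := by
  let f : MvPolynomial (Fin 1) k →ₐ[k] H := MvPolynomial.aeval fun _ => t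
  have hf : Function.Surjective f := by
    rw [← AlgHom.range_eq_top, eq_top_iff, ← ht, Algebra.adjoin_le_iff]
    rintro _ rfl
    exact ⟨MvPolynomial.X 0, MvPolynomial.aeval_X _ _⟩
  exact ⟨fun x => Iff.rfl, 1, 1, RingHom.ker f, AlgEquiv.refl, fun b => rfl,
    exists_cell_top (Ideal.quotientKerAlgEquivOfSurjective hf)⟩

lemma exists_chain_of_mul_comm {k H : Type} [Field k] [Ring H] [Algebra k H]
    (hc : ∀ a b : H, a * b = b * a) (t : H) (ht : Algebra.adjoin k {t} = ⊤) :
    AffineCellularChain k 1 H LinearMap.id := by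
  let _ : CommRing H := { ‹Ring H› with mul_comm := hc }
  refine ⟨⊤, isAffineCellIdeal_top t ht, LinearMap.id, fun _ => rfl, ?_⟩
  change Subsingleton _
  refine ⟨fun a b => ?_⟩
  obtain ⟨a, rfl⟩ := quotAlg_surjective (k := k) _ a
  obtain ⟨b, rfl⟩ := quotAlg_surjective (k := k) _ b
  rw [← sub_eq_zero, ← map_sub, quotAlg_eq_zero]
  trivial

section
variable {k : Type} [Field k] {p q : kˣ} {ν : kˣ →₀ ℕ}

lemma vmk_E_eq_one (i : Fin 0 → kˣ) : vmk p q ν 0 (E i) = 1 := by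
  have h := vmk_rel (k := k) (p := p) (q := q) (ν := ν) (m := 0) .idem_sum
  rw [map_sum, map_one] at h
  by_cases hi : i ∈ thetaSeqs ν 0
  · rwa [Finset.sum_eq_single i (fun j _ hj => (hj (Subsingleton.elim _ _)).elim)
      (fun h => (h hi).elim)] at h
  · rw [Finset.sum_eq_zero fun j hj => (hi (Subsingleton.elim j i ▸ hj)).elim] at h
    rw [← mul_one (vmk p q ν 0 (E i)), ← h, mul_zero]

lemma adjoin_vmk_Pg : Algebra.adjoin k {vmk p q ν 0 Pg} = ⊤ := by
  rw [eq_top_iff, ← adjoin_vmk_range, Algebra.adjoin_le_iff]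
  rintro _ ⟨g, rfl⟩
  cases g with
  | x j => exact j.elim0
  | sig s => exact s.elim0
  | pi => exact Algebra.subset_adjoin rfl
  | idem i =>
    change vmk p q ν 0 (E i) ∈ _
    rw [vmk_E_eq_one]; exact one_mem _

lemma VV_zero_mul_comm (a b : VV k p q ν 0) : a * b = b * a := by
  have := Algebra.isMulCommutative_adjoin_singleton k (vmk p q ν 0 Pg)
  have h (c : VV k p q ν 0) : c ∈ Algebra.adjoin k {vmk p q ν 0 Pg} :=
    (adjoin_vmk_Pg (k := k) (p := p) (q := q) (ν := ν)) ▸ Algebra.mem_top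
  exact setLike_mul_comm (h a) (h b)

end

/-- Corollary 2.27.  In case (A1) (`p, q ∉ I`, `p` not a root of unity),
for every `ν ∈ ᶿℕI` the VV algebra `𝔚_ν` is affine cellular with respect to the
`k`-involution fixing all the generators `x_j`, `σ_s`, `π`, `e(i)` and reversing products. -/
theorem vv_affineCellular_case_A1
    (k : Type) [Field k] (hchar : (2 : k) ≠ 0)
    (p q : kˣ) (hp1 : p ≠ 1) (hp2 : p ≠ -1)
    (hpq : ∀ n : ℤ, p ≠ q ^ n) (hqp : ∀ n : ℤ, q ≠ p ^ n)
    (I : Set kˣ) (hI : ∃ lam : kˣ, I = orbit p lam)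
    (hI1 : (1 : kˣ) ∉ I) (hI1' : (-1 : kˣ) ∉ I)
    (hp : p ∉ I) (hq : q ∉ I) (hroot : ∀ n : ℕ, 0 < n → p ^ n ≠ 1)
    (ν : kˣ →₀ ℕ) (hν : IsDimVec I ν) (m : ℕ) (hm : height ν = 2 * m) :
    ∃ ω : VV k p q ν m →ₗ[k] VV k p q ν m,
      IsKInvolution ω ∧
      (∀ j : Fin m, ω (vmk p q ν m (X j)) = vmk p q ν m (X j)) ∧
      (∀ s : Fin (m - 1), ω (vmk p q ν m (Sg s)) = vmk p q ν m (Sg s)) ∧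
      ω (vmk p q ν m Pg) = vmk p q ν m Pg ∧
      (∀ i : Fin m → kˣ, ω (vmk p q ν m (E i)) = vmk p q ν m (E i)) ∧
      IsAffineCellular k (VV k p q ν m) ω := by
  rcases m.eq_zero_or_pos with rfl | hm0
  · have hω : IsKInvolution (LinearMap.id : VV k p q ν 0 →ₗ[k] _) :=
      ⟨VV_zero_mul_comm, rfl, fun _ => rfl⟩
    exact ⟨LinearMap.id, hω, fun _ => rfl, fun _ => rfl, rfl, fun _ => rfl, hω, 1,
      exists_chain_of_mul_comm VV_zero_mul_comm _ adjoin_vmk_Pg⟩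
  · have : NeZero m := ⟨hm0.ne'⟩
    obtain ⟨Λ⟩ := exists_labels (k := k) (p := p) (q := q) hI hI1 hI1' hp hq hroot hν
    obtain ⟨F, hF⟩ := Λ.exists_full (m := m)
    have hω : IsKInvolution F.om := ⟨F.om_mul, F.om_one, F.om_om⟩
    have hx := F.om_x
    have hgn := F.om_gn
    have he := F.om_e
    rw [hF] at hx hgn he
    refine ⟨F.om, hω, hx, fun s => hgn (some s), hgn none, fun i => ?_, hω, ?_⟩
    · by_cases hi : IsThetaSeq ν i
      · rw [← Λ.ee_wd hi]; exact he _
      · rw [vmk_rel (.idem_zero i hi), map_zero, map_zero]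
    · refine Full.exists_chain hchar p.ne_zero (fun n hn h => hroot n hn (Units.ext ?_))
        Λ.Wd_closed Λ.Wd_odd _ _ F le_rfl
      rw [Units.val_pow_eq_pow_val, h, Units.val_one]

end VVPaper
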